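/- Channels of energy around the ground state in six dimensions: there exists a constant C > 0 such that every radial finite-energy solution u of the linearized wave equation ∂_t²u − Δu + Vu = 0 on ℝ × ℝ⁶, for which the outer radiated energy E_out is well defined, satisfies ‖Π⊥_{L²} u₁‖_{L²(ℝ⁶)} + ‖∇(Π⊥_{Ḣ¹} u₀)‖_{Z_{−3}} ≤ C √E_out, where (u₀,u₁) = (u(0,·), ∂_t u(0,·)). -/

import Mathlib

open MeasureTheory Real Filter Set Topology ENNReal RealInnerProductSpace

noncomputable section

abbrev E6 := EuclideanSpace ℝ (Fin 6)

/-- The ground state `W(x) = (1+|x|²/24)⁻²` on `ℝ⁶`. -/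
def W6 (x : E6) : ℝ := ((1 + ‖x‖ ^ 2 / 24) ^ 2)⁻¹

/-- The potential `V = -2W` of the linearized equation. -/
def V6 (x : E6) : ℝ := -2 * W6 x

/-- `ΛW(x) = x·∇W(x) + 2W(x)`. -/
def LW6 (x : E6) : ℝ := fderiv ℝ W6 x x + 2 * W6 x

/-- The Laplacian of `f : ℝ⁶ → ℝ`. -/
def lap6 (f : E6 → ℝ) (x : E6) : ℝ :=
  ∑ i : Fin 6, fderiv ℝ (fun y => fderiv ℝ f y (EuclideanSpace.single i 1)) x
    (EuclideanSpace.single i 1)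

/-- `∂ₜ u`. -/
def dtu (u : ℝ → E6 → ℝ) (t : ℝ) (x : E6) : ℝ := deriv (fun s => u s x) t

/-- `∂ₜ² u`. -/
def dttu (u : ℝ → E6 → ℝ) (t : ℝ) (x : E6) : ℝ := deriv (fun s => dtu u s x) t

/-- `|∇_{t,x} u|² = (∂ₜ u)² + |∇u|²`. -/
def eDensity (u : ℝ → E6 → ℝ) (t : ℝ) (x : E6) : ℝ :=
  dtu u t x ^ 2 + ‖gradient (u t) x‖ ^ 2

/-- `u` is a radial finite-energy solution of `∂ₜ²u - Δu + Vu = 0` on `ℝ × ℝ⁶`. -/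
def IsRadSol (u : ℝ → E6 → ℝ) : Prop :=
  ContDiff ℝ 2 (fun p : ℝ × E6 => u p.1 p.2) ∧
  (∀ t x y, ‖x‖ = ‖y‖ → u t x = u t y) ∧
  (∀ t x, dttu u t x - lap6 (u t) x + V6 x * u t x = 0) ∧
  Integrable (fun x => eDensity u 0 x)

/-- The annulus `{R < |x| < 2R}`. -/
def ann (R : ℝ) : Set E6 := {x | R < ‖x‖ ∧ ‖x‖ < 2 * R}

/-- The `Z₋₃` norm: `sup_{R>0} ⟨log R⟩⁻¹ (∫_{R<|x|<2R} f²)^{1/2}`. -/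
def Zm3 (f : E6 → ℝ) : ℝ≥0∞ :=
  ⨆ R : {R : ℝ // 0 < R}, ENNReal.ofReal
    ((Real.sqrt (1 + Real.log R.1 ^ 2))⁻¹ * Real.sqrt (∫ x in ann R.1, f x ^ 2))

/-- Orthogonal projection onto `(span ΛW)^⊥` in `L²(ℝ⁶)`. -/
def PiL2perp (f : E6 → ℝ) : E6 → ℝ :=
  fun x => f x - ((∫ y, f y * LW6 y) / (∫ y, LW6 y ^ 2)) * LW6 x

/-- Orthogonal projection onto `(span ΛW)^⊥` in `Ḣ¹(ℝ⁶)`. -/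
def PiH1perp (f : E6 → ℝ) : E6 → ℝ :=
  fun x => f x -
    ((∫ y, ⟪gradient f y, gradient LW6 y⟫) / (∫ y, ‖gradient LW6 y‖ ^ 2)) * LW6 x

namespace Chan

open intervalIntegral (integral_congr integral_eq_sub_of_hasDerivAt integral_of_le norm_integral_le_of_norm_le_const continuous_parametric_intervalIntegral_of_continuous abs_integral_le_integral_abs integral_add_adjacent_intervals)
notation "pos!" => (by positivity)
notation "lin!" => (by linarith)
notation "con!" => (by fun_prop)

/-- `f'` is the derivative of `f` on the positive half-line. -/
abbrev HD (f f' : ℝ → ℝ) : Prop := ∀ r, 0 < r → HasDerivAt f (f' r) r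
theorem _root_.HasDerivAt.cwa {f : ℝ → ℝ} {d x : ℝ} {s : Set ℝ} (h : HasDerivAt f d x) : ContinuousWithinAt f s x := h.continuousAt.continuousWithinAt
theorem _root_.ContinuousOn.iint {f : ℝ → ℝ} {a b : ℝ} (hab : a ≤ b) (h : ContinuousOn f (Icc a b)) : IntervalIntegrable f volume a b := h.intervalIntegrable_of_Icc hab
theorem _root_.ContinuousOn.icc {f : ℝ → ℝ} {a : ℝ} (h : ContinuousOn f (Ioi 0)) (ha : 0 < a) (b : ℝ) : ContinuousOn f (Icc a b) := h.mono fun _ hx => ha.trans_le hx.1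
theorem pow_le_l {a b : ℝ} (ha : 0 ≤ a) (h : a ≤ b) (n : ℕ) : a ^ n ≤ b ^ n := pow_le_pow_left₀ ha h n
theorem unc {f : ℝ → ℝ → ℝ} (h : Continuous fun z : ℝ × ℝ => f z.1 z.2) : Continuous (Function.uncurry f) := h
theorem ii_const_mul {a b : ℝ} (c : ℝ) (f : ℝ → ℝ) : ∫ x in a..b, c * f x = c * ∫ x in a..b, f x := intervalIntegral.integral_const_mul c f
theorem ii_const {a b : ℝ} (c : ℝ) : ∫ _ in a..b, c = (b - a) * c := intervalIntegral.integral_const c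
theorem ii_sub {a b : ℝ} {f g : ℝ → ℝ} (hf : IntervalIntegrable f volume a b) (hg : IntervalIntegrable g volume a b) :
    ∫ x in a..b, f x - g x = (∫ x in a..b, f x) - ∫ x in a..b, g x := intervalIntegral.integral_sub hf hg
theorem ii_add {a b : ℝ} {f g : ℝ → ℝ} (hf : IntervalIntegrable f volume a b) (hg : IntervalIntegrable g volume a b) :
    ∫ x in a..b, f x + g x = (∫ x in a..b, f x) + ∫ x in a..b, g x := intervalIntegral.integral_add hf hg
theorem ii_nonneg {a b : ℝ} {f : ℝ → ℝ} (h : a ≤ b) (hf : ∀ x ∈ Icc a b, 0 ≤ f x) : 0 ≤ ∫ x in a..b, f x := intervalIntegral.integral_nonneg h hf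
theorem mul_le_l {a b c : ℝ} (h : b ≤ c) (ha : 0 ≤ a) : a * b ≤ a * c := mul_le_mul_of_nonneg_left h ha
theorem mul_le_r {a b c : ℝ} (h : b ≤ c) (ha : 0 ≤ a) : b * a ≤ c * a := mul_le_mul_of_nonneg_right h ha
theorem ii_congr {a b : ℝ} (hab : a ≤ b) {f g : ℝ → ℝ} (h : ∀ r ∈ Icc a b, f r = g r) : ∫ r in a..b, f r = ∫ r in a..b, g r :=
  integral_congr fun r hr => h r (by rwa [uIcc_of_le hab] at hr)

/-- Integration order on a triangle. -/
lemma tri_swap {f : ℝ → ℝ → ℝ} (hf : Continuous (Function.uncurry f)) {a b : ℝ} (hab : a ≤ b) : ∫ x in a..b, ∫ y in a..x, f x y = ∫ y in a..b, ∫ x in y..b, f x y := by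
  let F : ℝ → ℝ → ℝ := fun x y => ({p : ℝ × ℝ | p.2 ≤ p.1}.indicator (Function.uncurry f)) (x, y)
  have hm : MeasurableSet {p : ℝ × ℝ | p.2 ≤ p.1} := measurableSet_le measurable_snd measurable_fst
  have h1 : ∀ x ∈ uIcc a b, ∫ y in a..x, f x y = ∫ y in a..b, F x y := by
    intro x hx
    rw [uIcc_of_le hab] at hx
    rw [integral_of_le hx.1, integral_of_le hab]
    rw [← integral_indicator measurableSet_Ioc, ← integral_indicator measurableSet_Ioc]
    congr 1; ext y
    simp only [F, indicator, mem_Ioc, mem_ofPred_eq, Function.uncurry]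
    split_ifs <;> first | rfl | (exfalso; grind)
  have h2 : ∀ y ∈ uIcc a b, ∫ x in y..b, f x y = ∫ x in a..b, F x y := by
    intro y hy
    rw [uIcc_of_le hab] at hy
    rw [integral_of_le hy.2, integral_of_le hab]
    rw [← integral_Icc_eq_integral_Ioc, ← integral_Icc_eq_integral_Ioc, ← integral_indicator measurableSet_Icc, ← integral_indicator measurableSet_Icc]
    congr 1; ext x
    simp only [F, indicator, mem_Icc, mem_ofPred_eq, Function.uncurry]
    split_ifs <;> first | rfl | (exfalso; grind)
  rw [integral_congr h1, integral_congr h2]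
  apply intervalIntegral_intervalIntegral_swap
  have : Function.uncurry F = {p : ℝ × ℝ | p.2 ≤ p.1}.indicator (Function.uncurry f) := by ext ⟨x, y⟩; rfl
  rw [this]
  refine IntegrableOn.indicator ?_ hm
  rw [uIoc_of_le hab]
  refine IntegrableOn.mono_set (t := Icc a b ×ˢ Icc a b) ?_ (prod_mono Ioc_subset_Icc_self Ioc_subset_Icc_self)
  exact hf.continuousOn.integrableOn_compact (isCompact_Icc.prod isCompact_Icc)

lemma rect_swap {f : ℝ → ℝ → ℝ} (hf : Continuous (Function.uncurry f)) (a b c d : ℝ) : ∫ x in a..b, ∫ y in c..d, f x y = ∫ y in c..d, ∫ x in a..b, f x y := by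
  apply intervalIntegral_intervalIntegral_swap
  refine IntegrableOn.mono_set (t := uIcc a b ×ˢ uIcc c d) ?_ (prod_mono uIoc_subset_uIcc uIoc_subset_uIcc)
  exact hf.continuousOn.integrableOn_compact (isCompact_uIcc.prod isCompact_uIcc)

/-- Integrated form of a pointwise differential inequality. -/
lemma mono_ftc {A B P P' : ℝ → ℝ} {a b : ℝ} (hab : a ≤ b) (hA : ContinuousOn A (Icc a b)) (hB : ContinuousOn B (Icc a b))
    (hP' : ContinuousOn P' (Icc a b)) (hP : ∀ r ∈ Icc a b, HasDerivAt P (P' r) r)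
    (h : ∀ r ∈ Icc a b, A r ≤ B r + P' r) :
    ∫ r in a..b, A r ≤ (∫ r in a..b, B r) + (P b - P a) := by
  have iA := hA.iint hab
  have iB := hB.iint hab
  have iP := hP'.iint hab
  rw [← integral_eq_sub_of_hasDerivAt (f' := P') (by rwa [uIcc_of_le hab]) iP, ← ii_add iB iP]
  exact intervalIntegral.integral_mono_on hab iA (iB.add iP) h

/-- Monotonicity of interval integrals of continuous functions. -/
lemma int_mono {A B : ℝ → ℝ} {a b : ℝ} (hab : a ≤ b) (hA : ContinuousOn A (Icc a b)) (hB : ContinuousOn B (Icc a b))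
    (h : ∀ r ∈ Icc a b, A r ≤ B r) : ∫ r in a..b, A r ≤ ∫ r in a..b, B r :=
  intervalIntegral.integral_mono_on hab (hA.iint hab) (hB.iint hab) h

/-- Cauchy–Schwarz for interval integrals of continuous functions. -/
lemma cs {f g : ℝ → ℝ} {a b : ℝ} (hab : a ≤ b) (hf : ContinuousOn f (Icc a b)) (hg : ContinuousOn g (Icc a b)) :
    (∫ r in a..b, f r * g r) ^ 2 ≤ (∫ r in a..b, f r ^ 2) * ∫ r in a..b, g r ^ 2 := by
  have i1 : IntervalIntegrable (fun r => f r ^ 2) volume a b := (hf.pow 2).iint hab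
  have i2 : IntervalIntegrable (fun r => g r ^ 2) volume a b := (hg.pow 2).iint hab
  have i3 : IntervalIntegrable (fun r => f r * g r) volume a b := (hf.mul hg).iint hab
  have key := discrim_le_zero (a := ∫ r in a..b, g r ^ 2) (b := -2 * ∫ r in a..b, f r * g r) (c := ∫ r in a..b, f r ^ 2) (by
      intro x
      have e : (∫ r in a..b, g r ^ 2) * (x * x) + (-2 * ∫ r in a..b, f r * g r) * x + ∫ r in a..b, f r ^ 2 = ∫ r in a..b, (f r - x * g r) ^ 2 := by
        rw [show (fun r => (f r - x * g r) ^ 2) = fun r => (g r ^ 2 * (x * x) + (f r * g r) * (-2 * x)) + f r ^ 2 by ext r; ring]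
        rw [ii_add ((i2.mul_const _).add (i3.mul_const _)) i1, ii_add (i2.mul_const _) (i3.mul_const _),
          intervalIntegral.integral_mul_const, intervalIntegral.integral_mul_const]
        ring
      rw [e]
      exact ii_nonneg hab fun r _ => sq_nonneg _)
  rw [discrim] at key
  nlinarith

lemma int_sq_nonneg {f : ℝ → ℝ} {a b : ℝ} (hab : a ≤ b) : 0 ≤ ∫ r in a..b, f r ^ 2 := ii_nonneg hab fun _ _ => sq_nonneg _

lemma int_lin {f g : ℝ → ℝ} {a b : ℝ} (hab : a ≤ b) (x y : ℝ) (hf : ContinuousOn f (Icc a b)) (hg : ContinuousOn g (Icc a b)) :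
    ∫ r in a..b, (x * f r + y * g r) = x * (∫ r in a..b, f r) + y * ∫ r in a..b, g r := by
  have i1 := hf.iint hab
  have i2 := hg.iint hab
  rw [ii_add (i1.const_mul _) (i2.const_mul _), ii_const_mul, ii_const_mul]

lemma int_le_lin {A f g : ℝ → ℝ} {a b : ℝ} (hab : a ≤ b) (x y : ℝ) (hA : ContinuousOn A (Icc a b)) (hf : ContinuousOn f (Icc a b)) (hg : ContinuousOn g (Icc a b))
    (h : ∀ r ∈ Icc a b, A r ≤ x * f r + y * g r) :
    ∫ r in a..b, A r ≤ x * (∫ r in a..b, f r) + y * ∫ r in a..b, g r := by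
  rw [← int_lin hab x y hf hg]
  exact int_mono hab hA con! h

lemma int_le_mul {A f : ℝ → ℝ} {a b : ℝ} (hab : a ≤ b) (x : ℝ) (hA : ContinuousOn A (Icc a b)) (hf : ContinuousOn f (Icc a b)) (h : ∀ r ∈ Icc a b, A r ≤ x * f r) :
    ∫ r in a..b, A r ≤ x * (∫ r in a..b, f r) := by
  rw [← ii_const_mul]
  exact int_mono hab hA con! h

/-- Cauchy–Schwarz with a pointwise bound by a product. -/
lemma cs_le {A f g : ℝ → ℝ} {a b : ℝ} (hab : a ≤ b) (hA : ContinuousOn A (Icc a b)) (hf : ContinuousOn f (Icc a b)) (hg : ContinuousOn g (Icc a b))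
    (h : ∀ r ∈ Icc a b, |A r| ≤ |f r * g r|) :
    (∫ r in a..b, |A r|) ^ 2 ≤ (∫ r in a..b, f r ^ 2) * ∫ r in a..b, g r ^ 2 := by
  have h1 := cs hab hf.abs hg.abs
  simp only [sq_abs] at h1
  refine le_trans (pow_le_l (ii_nonneg hab fun _ _ => abs_nonneg _) (int_mono hab hA.abs (hf.abs.mul hg.abs) fun r hr => ?_) 2) h1
  simpa [abs_mul] using h r hr

/-- Squared `L²` triangle inequality. -/
lemma int_sub {f : ℝ → ℝ} {a b c : ℝ} (hab : a ≤ b) (hbc : b ≤ c) (hf : ContinuousOn f (Icc a c)) : (∫ r in a..b, f r) + (∫ r in b..c, f r) = ∫ r in a..c, f r :=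
  integral_add_adjacent_intervals ((hf.mono (Icc_subset_Icc_right hbc)).iint hab) ((hf.mono (Icc_subset_Icc_left hab)).iint hbc)

lemma int_mono_set {f : ℝ → ℝ} {a b c d : ℝ} (hab : a ≤ b) (hbc : b ≤ c) (hcd : c ≤ d) (hf : ContinuousOn f (Icc a d)) (h0 : ∀ r ∈ Icc a d, 0 ≤ f r) :
    (∫ r in b..c, f r) ≤ ∫ r in a..d, f r := by
  rw [← int_sub (hab.trans hbc) hcd hf, ← int_sub hab hbc (hf.mono (Icc_subset_Icc_right hcd))]
  have h1 : 0 ≤ ∫ r in a..b, f r := ii_nonneg hab fun r hr => h0 r ⟨hr.1, hr.2.trans (hbc.trans hcd)⟩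
  have h2 : 0 ≤ ∫ r in c..d, f r := ii_nonneg hcd fun r hr => h0 r ⟨(hab.trans hbc).trans hr.1, hr.2⟩
  linarith

lemma cont_up {F : ℝ → ℝ → ℝ} (hF : Continuous (Function.uncurry F)) (X : ℝ) : Continuous fun η => ∫ ξ in η..X, F η ξ := by
  have : (fun η => ∫ ξ in η..X, F η ξ) = fun η => -∫ ξ in X..η, F η ξ := by ext η; rw [intervalIntegral.integral_symm]
  rw [this]
  exact (continuous_parametric_intervalIntegral_of_continuous hF continuous_id).neg

lemma cont_lo {F : ℝ → ℝ → ℝ} (hF : Continuous (Function.uncurry F)) (R : ℝ) : Continuous fun ξ => ∫ η in R..ξ, F η ξ :=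
  continuous_parametric_intervalIntegral_of_continuous (f := fun ξ η => F η ξ) (hF.comp continuous_swap) continuous_id

/-- A first order hyperbolic system in characteristic coordinates on a triangle. -/
structure Tri (R X : ℝ) (p q K : ℝ → ℝ → ℝ) : Prop where
  hRX : R ≤ X
  cp : Continuous (Function.uncurry p)
  cq : Continuous (Function.uncurry q)
  cK : Continuous (Function.uncurry K)
  dq : ∀ η ξ, R ≤ η → η ≤ ξ → ξ ≤ X → HasDerivAt (fun s => q η s) (K η ξ * p η ξ) ξ
  dp : ∀ η ξ, R ≤ η → η ≤ ξ → ξ ≤ X → HasDerivAt (fun s => p s ξ) (K η ξ * q η ξ) η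

variable {R X : ℝ} {p q K : ℝ → ℝ → ℝ}

lemma Tri.weighted (h : Tri R X p q K) {Θ Θξ Θη : ℝ → ℝ → ℝ} (cΘ : Continuous (Function.uncurry Θ)) (cξ : Continuous (Function.uncurry Θξ))
    (cη : Continuous (Function.uncurry Θη))
    (dξ : ∀ η ξ, R ≤ η → η ≤ ξ → ξ ≤ X → HasDerivAt (fun s => Θ η s) (Θξ η ξ) ξ)
    (dη : ∀ η ξ, R ≤ η → η ≤ ξ → ξ ≤ X → HasDerivAt (fun s => Θ s ξ) (Θη η ξ) η) :
    (∫ η in R..X, Θ η X * q η X ^ 2) + (∫ ξ in R..X, Θ R ξ * p R ξ ^ 2) = (∫ x in R..X, Θ x x * (q x x ^ 2 + p x x ^ 2)) +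
      (∫ η in R..X, ∫ ξ in η..X, Θξ η ξ * q η ξ ^ 2) -
      ∫ ξ in R..X, ∫ η in R..ξ, Θη η ξ * p η ξ ^ 2 := by
  have hRX := h.hRX
  have cp := h.cp
  have cq := h.cq
  have cK := h.cK
  have cp' : Continuous fun z : ℝ × ℝ => p z.1 z.2 := cp
  have cq' : Continuous fun z : ℝ × ℝ => q z.1 z.2 := cq
  have cK' : Continuous fun z : ℝ × ℝ => K z.1 z.2 := cK
  have cΘ' : Continuous fun z : ℝ × ℝ => Θ z.1 z.2 := cΘ
  have cξ' : Continuous fun z : ℝ × ℝ => Θξ z.1 z.2 := cξ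
  have cη' : Continuous fun z : ℝ × ℝ => Θη z.1 z.2 := cη
  let N : ℝ → ℝ → ℝ := fun η ξ => 2 * Θ η ξ * K η ξ * p η ξ * q η ξ
  let A : ℝ → ℝ → ℝ := fun η ξ => Θξ η ξ * q η ξ ^ 2
  let B : ℝ → ℝ → ℝ := fun η ξ => Θη η ξ * p η ξ ^ 2
  have cN : Continuous (Function.uncurry N) := by simp only [Function.uncurry_def, N]; fun_prop
  have cA : Continuous (Function.uncurry A) := by simp only [Function.uncurry_def, A]; fun_prop
  have cB : Continuous (Function.uncurry B) := by simp only [Function.uncurry_def, B]; fun_prop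
  have e1 : ∀ η ∈ uIcc R X, Θ η X * q η X ^ 2 - Θ η η * q η η ^ 2 = (∫ ξ in η..X, A η ξ) + ∫ ξ in η..X, N η ξ := by
    intro η hη
    rw [uIcc_of_le hRX] at hη
    have c1 : Continuous fun ξ => A η ξ := cA.comp (Continuous.prodMk_right η)
    have c2 : Continuous fun ξ => N η ξ := cN.comp (Continuous.prodMk_right η)
    rw [← ii_add (c1.intervalIntegrable _ _) (c2.intervalIntegrable _ _)]
    symm
    apply integral_eq_sub_of_hasDerivAt (f := fun ξ => Θ η ξ * q η ξ ^ 2)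
    · intro ξ hξ
      rw [uIcc_of_le hη.2] at hξ
      refine ((dξ η ξ hη.1 hξ.1 hξ.2).fun_mul ((h.dq η ξ hη.1 hξ.1 hξ.2).fun_pow 2)).congr_deriv ?_
      simp only [A, N, Nat.cast_ofNat]; ring
    · exact (c1.add c2).intervalIntegrable _ _
  have e2 : ∀ ξ ∈ uIcc R X, Θ ξ ξ * p ξ ξ ^ 2 - Θ R ξ * p R ξ ^ 2 = (∫ η in R..ξ, B η ξ) + ∫ η in R..ξ, N η ξ := by
    intro ξ hξ
    rw [uIcc_of_le hRX] at hξ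
    have c1 : Continuous fun η => B η ξ := cB.comp (Continuous.prodMk_left ξ)
    have c2 : Continuous fun η => N η ξ := cN.comp (Continuous.prodMk_left ξ)
    rw [← ii_add (c1.intervalIntegrable _ _) (c2.intervalIntegrable _ _)]
    symm
    apply integral_eq_sub_of_hasDerivAt (f := fun η => Θ η ξ * p η ξ ^ 2)
    · intro η hη
      rw [uIcc_of_le hξ.1] at hη
      refine ((dη η ξ hη.1 hη.2 hξ.2).fun_mul ((h.dp η ξ hη.1 hη.2 hξ.2).fun_pow 2)).congr_deriv ?_
      simp only [B, N, Nat.cast_ofNat]; ring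
    · exact (c1.add c2).intervalIntegrable _ _
  have ii : ∀ {g : ℝ → ℝ}, Continuous g → IntervalIntegrable g volume R X := fun hg => hg.intervalIntegrable _ _
  have I1 := integral_congr (μ := volume) e1
  have I2 := integral_congr (μ := volume) e2
  rw [ii_add (ii (cont_up cA X)) (ii (cont_up cN X)), ii_sub (ii con!) (ii con!)] at I1
  rw [ii_add (ii (cont_lo cB R)) (ii (cont_lo cN R)), ii_sub (ii con!) (ii con!)] at I2
  have sw := tri_swap (f := fun ξ η => N η ξ) (cN.comp continuous_swap) hRX
  simp only [mul_add]
  rw [ii_add (ii con!) (ii con!)]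
  simp only [A, B] at I1 I2
  linarith

lemma Tri.energy (h : Tri R X p q K) : (∫ η in R..X, q η X ^ 2) + (∫ ξ in R..X, p R ξ ^ 2) = ∫ x in R..X, (q x x ^ 2 + p x x ^ 2) := by
  have := h.weighted (Θ := fun _ _ => 1) (Θξ := fun _ _ => 0) (Θη := fun _ _ => 0) continuous_const continuous_const continuous_const
    (fun _ _ _ _ _ => hasDerivAt_const _ _) (fun _ _ _ _ _ => hasDerivAt_const _ _)
  simpa using this

/-- Carleman kernel positivity. -/
lemma carleman_nonneg {f : ℝ → ℝ} (hf : Continuous f) {R X : ℝ} (hR : 0 < R) (hRX : R ≤ X) : 0 ≤ ∫ x in R..X, ∫ y in R..X, f x * f y / (x + y) := by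
  have key : ∀ N : ℝ, 0 ≤ N → -(exp (-(2 * R * N)) * (∫ x in R..X, ∫ y in R..X, |f x| * |f y| / (2 * R))) ≤ ∫ x in R..X, ∫ y in R..X, f x * f y / (x + y) := by
    intro N hN
    have h1 : 0 ≤ ∫ s in (0:ℝ)..N, (∫ x in R..X, f x * exp (-(s * x))) ^ 2 := int_sq_nonneg hN
    have h2 : ∫ s in (0:ℝ)..N, (∫ x in R..X, f x * exp (-(s * x))) ^ 2 = ∫ x in R..X, ∫ y in R..X, ∫ s in (0:ℝ)..N, f x * f y * exp (-(s * (x + y))) := by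
      have a1 : ∀ s, (∫ x in R..X, f x * exp (-(s * x))) ^ 2 = ∫ x in R..X, ∫ y in R..X, f x * f y * exp (-(s * (x + y))) := by
        intro s
        rw [sq, ← intervalIntegral.integral_mul_const]
        congr 1; ext x
        rw [← ii_const_mul]
        congr 1; ext y
        rw [mul_add, neg_add, exp_add]; ring
      simp_rw [a1]
      rw [rect_swap (f := fun s x => ∫ y in R..X, f x * f y * exp (-(s * (x + y))))]
      · congr 1; ext x
        rw [rect_swap]
        simp only [Function.uncurry_def]; fun_prop
      · simp only [Function.uncurry_def]
        refine continuous_parametric_intervalIntegral_of_continuous (f := fun (z : ℝ × ℝ) y => f z.2 * f y * exp (-(z.1 * (z.2 + y)))) ?_ continuous_const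
        simp only [Function.uncurry_def]; fun_prop
    have h3 : ∀ x ∈ Icc R X, ∀ y ∈ Icc R X, ∫ s in (0:ℝ)..N, f x * f y * exp (-(s * (x + y))) = f x * f y / (x + y) - f x * f y * exp (-(N * (x + y))) / (x + y) := by
      intro x hx y hy
      have hxy : x + y ≠ 0 := by linarith [hx.1, hy.1]
      rw [integral_eq_sub_of_hasDerivAt (f := fun s => -(f x * f y * exp (-(s * (x + y))) / (x + y)))]
      · simp; ring
      · intro s _
        refine (((((hasDerivAt_id' s).mul_const (x + y)).fun_neg.exp.const_mul (f x * f y)).div_const (x + y)).fun_neg).congr_deriv ?_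
        field_simp
      · exact (con! : Continuous _).intervalIntegrable _ _
    rw [h2] at h1
    rw [← sub_nonneg, sub_neg_eq_add]
    refine h1.trans ?_
    have cI : ∀ g : ℝ → ℝ → ℝ, Continuous (Function.uncurry g) →
      Continuous fun x => ∫ y in R..X, g x y := fun g hg => continuous_parametric_intervalIntegral_of_continuous hg continuous_const
    let k : ℝ → ℝ → ℝ := fun x y => f x * f y / (max x R + max y R)
    have ck : Continuous (Function.uncurry k) := by
      simp only [Function.uncurry_def, k]
      refine Continuous.div con! con! fun z => ?_
      have := le_max_right z.1 R
      have := le_max_right z.2 R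
      linarith
    have hk : ∫ x in R..X, ∫ y in R..X, f x * f y / (x + y) = ∫ x in R..X, ∫ y in R..X, k x y := by
      refine integral_congr fun x hx => integral_congr fun y hy => ?_
      rw [uIcc_of_le hRX] at hx hy
      simp only [k, max_eq_left hx.1, max_eq_left hy.1]
    have cm : Continuous fun x => exp (-(2 * R * N)) * ∫ y in R..X, |f x| * |f y| / (2 * R) := continuous_const.mul (cI (fun x y => |f x| * |f y| / (2 * R)) (unc con!))
    rw [hk, ← ii_const_mul, ← ii_add ((cI _ ck).intervalIntegrable _ _) (cm.intervalIntegrable _ _)]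
    refine intervalIntegral.integral_mono_on hRX ?_ ?_ ?_
    · refine (cI (fun x y => ∫ s in (0:ℝ)..N, f x * f y * exp (-(s * (x + y)))) ?_).intervalIntegrable _ _
      simp only [Function.uncurry_def]
      refine continuous_parametric_intervalIntegral_of_continuous (f := fun (z : ℝ × ℝ) s => f z.1 * f z.2 * exp (-(s * (z.1 + z.2)))) ?_ continuous_const
      simp only [Function.uncurry_def]; fun_prop
    · exact ((cI _ ck).add cm).intervalIntegrable _ _
    intro x hx
    have ckx : Continuous fun y => k x y := ck.comp (Continuous.prodMk_right x)
    have cmx : Continuous fun y => exp (-(2 * R * N)) * (|f x| * |f y| / (2 * R)) := con!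
    rw [← ii_const_mul, ← ii_add (ckx.intervalIntegrable _ _) (cmx.intervalIntegrable _ _)]
    refine intervalIntegral.integral_mono_on hRX ?_ ?_ ?_
    · refine Continuous.intervalIntegrable ?_ _ _
      refine continuous_parametric_intervalIntegral_of_continuous (f := fun y s => f x * f y * exp (-(s * (x + y)))) ?_ continuous_const
      simp only [Function.uncurry_def]; fun_prop
    · exact (ckx.add cmx).intervalIntegrable _ _
    intro y hy
    rw [h3 x hx y hy]
    simp only [k, max_eq_left hx.1, max_eq_left hy.1]
    have hx1 := hx.1
    have hy1 := hy.1
    have b1 : -(f x * f y * exp (-(N * (x + y))) / (x + y)) ≤ |f x * f y| * exp (-(N * (x + y))) / (x + y) := by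
      rw [← neg_div, ← neg_mul]
      gcongr
      · linarith
      · exact neg_le_abs _
    have b2 : |f x * f y| * exp (-(N * (x + y))) / (x + y) ≤ |f x * f y| * exp (-(2 * R * N)) / (2 * R) := by
      have hexp : 2 * R * N ≤ N * (x + y) := by nlinarith
      gcongr ?_ * exp (-?_) / ?_
      · linarith
    rw [abs_mul] at b1 b2
    have : |f x| * |f y| * exp (-(2 * R * N)) / (2 * R) = exp (-(2 * R * N)) * (|f x| * |f y| / (2 * R)) := by ring
    linarith
  have lim : Tendsto (fun N : ℝ =>
      -(exp (-(2 * R * N)) * (∫ x in R..X, ∫ y in R..X, |f x| * |f y| / (2 * R)))) atTop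
      (𝓝 (-(0 * (∫ x in R..X, ∫ y in R..X, |f x| * |f y| / (2 * R))))) := by
    refine ((Real.tendsto_exp_neg_atTop_nhds_zero.comp ?_).mul_const _).neg
    exact tendsto_id.const_mul_atTop pos!
  have := le_of_tendsto lim ((eventually_ge_atTop 0).mono key)
  simpa using this

lemma hardy_zero {f : ℝ → ℝ} (hf : Continuous f) {R X : ℝ} (hR : 0 < R) (hRX : R ≤ X) : ∫ x in R..X, (∫ y in R..x, f y) ^ 2 / x ^ 2 ≤ 4 * ∫ x in R..X, f x ^ 2 := by
  set G : ℝ → ℝ := fun x => ∫ y in R..x, f y with hG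
  have dG : ∀ x, HasDerivAt G (f x) x := fun x => hf.integral_hasStrictDerivAt R x |>.hasDerivAt
  have cG : Continuous G := continuous_iff_continuousAt.2 fun x => (dG x).continuousAt
  have pos : ∀ r ∈ Icc R X, r ≠ 0 := fun r hr => by linarith [hr.1]
  have c1 : ContinuousOn (fun r => G r ^ 2 / r ^ 2) (Icc R X) := ContinuousOn.div con! con! fun r hr => pow_ne_zero 2 (pos r hr)
  have key := mono_ftc (A := fun r => G r ^ 2 / r ^ 2) (B := fun r => 4 * f r ^ 2) (P := fun r => -(2 * (G r ^ 2 / r)))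
    (P' := fun r => -(4 * (G r * f r / r) - 2 * (G r ^ 2 / r ^ 2))) hRX c1 con!
    con! (fun r hr => by
      have h0 := pos r hr
      refine ((((dG r).fun_pow 2).fun_div (hasDerivAt_id' r) h0).const_mul 2).fun_neg.congr_deriv ?_
      simp only [Nat.cast_ofNat]
      field_simp
      ring) (fun r hr => by
      have h0 := pos r hr
      have : 4 * f r ^ 2 - 4 * (G r * f r / r) + G r ^ 2 / r ^ 2 = (2 * f r - G r / r) ^ 2 := by field_simp; ring
      nlinarith [sq_nonneg (2 * f r - G r / r)])
  have hGR : G R = 0 := by simp [hG]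
  rw [ii_const_mul] at key
  refine key.trans ?_
  have : 0 ≤ G X ^ 2 / X := div_nonneg (sq_nonneg _) lin!
  simp only [hGR]
  have e : (0:ℝ) ^ 2 / R = 0 := by simp
  rw [e]
  linarith

lemma Tri.weighted_bound (h : Tri R X p q K) (hR : 0 < R) (hd : ∀ x, p x x ^ 2 = q x x ^ 2) :
    ∫ ξ in R..X, ∫ η in R..ξ, η * (max ξ (R / 2))⁻¹ ^ 2 * q η ξ ^ 2 ≤ 2 * ∫ x in R..X, q x x ^ 2 := by
  have cp' : Continuous fun z : ℝ × ℝ => p z.1 z.2 := h.cp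
  have cq' : Continuous fun z : ℝ × ℝ => q z.1 z.2 := h.cq
  have hp : ∀ x : ℝ, max x (R / 2) ≠ 0 := fun x => by have := le_max_right x (R / 2); linarith
  have cw : Continuous fun x : ℝ => (max x (R / 2))⁻¹ := by refine Continuous.inv₀ con! hp
  have dw : ∀ ξ, R ≤ ξ → HasDerivAt (fun x : ℝ => (max x (R / 2))⁻¹) (-(max ξ (R / 2))⁻¹ ^ 2) ξ := by
    intro ξ hξ
    have e : (fun x : ℝ => (max x (R / 2))⁻¹) =ᶠ[𝓝 ξ] fun x => x⁻¹ := by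
      filter_upwards [lt_mem_nhds (show R / 2 < ξ by linarith)] with x hx
      rw [max_eq_left hx.le]
    refine (HasDerivAt.congr_of_eventuallyEq ?_ e)
    rw [max_eq_left lin!]
    refine (hasDerivAt_inv lin!).congr_deriv (by rw [inv_pow])
  have cw1 : Continuous fun z : ℝ × ℝ => (max z.1 (R / 2))⁻¹ := cw.comp continuous_fst
  have cw2 : Continuous fun z : ℝ × ℝ => (max z.2 (R / 2))⁻¹ := cw.comp continuous_snd
  have key := h.weighted (Θ := fun η ξ => η * (max ξ (R / 2))⁻¹) (Θξ := fun η ξ => -(η * (max ξ (R / 2))⁻¹ ^ 2)) (Θη := fun η ξ => (max ξ (R / 2))⁻¹)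
    (unc con!) (unc con!)
    (unc con!)
    (fun η ξ h1 h2 _ => ((dw ξ (h1.trans h2)).const_mul η).congr_deriv (by ring))
    (fun η ξ h1 h2 _ => ((hasDerivAt_id' η).mul_const _).congr_deriv (by ring))
  have hRX := h.hRX
  have wp : ∀ x : ℝ, 0 < (max x (R / 2))⁻¹ := fun x => inv_pos.2 (lt_of_lt_of_le lin! (le_max_right x (R / 2)))
  have n1 : 0 ≤ ∫ η in R..X, η * (max X (R / 2))⁻¹ * q η X ^ 2 := ii_nonneg hRX fun η hη => by
      have : 0 ≤ η := by linarith [hη.1]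
      positivity
  have n2 : 0 ≤ ∫ ξ in R..X, R * (max ξ (R / 2))⁻¹ * p R ξ ^ 2 := ii_nonneg hRX fun ξ hξ => by positivity
  have n3 : 0 ≤ ∫ ξ in R..X, ∫ η in R..ξ, (max ξ (R / 2))⁻¹ * p η ξ ^ 2 := ii_nonneg hRX fun ξ hξ =>
      ii_nonneg hξ.1 fun η hη => by
      positivity
  have e1 : ∫ x in R..X, x * (max x (R / 2))⁻¹ * (q x x ^ 2 + p x x ^ 2) = 2 * ∫ x in R..X, q x x ^ 2 := by
    rw [← ii_const_mul]
    refine ii_congr hRX fun x hx => ?_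
    have hx0 : x ≠ 0 := by linarith [hx.1]
    simp only [hd, max_eq_left (show R / 2 ≤ x by linarith [hx.1])]
    field_simp; ring
  rw [e1] at key
  have sw := tri_swap (f := fun ξ η => η * (max ξ (R / 2))⁻¹ ^ 2 * q η ξ ^ 2) (by
    simp only [Function.uncurry_def]
    have : Continuous fun z : ℝ × ℝ => q z.2 z.1 := cq'.comp continuous_swap
    fun_prop) hRX
  rw [sw]
  have e2 : ∫ η in R..X, ∫ ξ in η..X, -(η * (max ξ (R / 2))⁻¹ ^ 2) * q η ξ ^ 2 = -∫ η in R..X, ∫ ξ in η..X, η * (max ξ (R / 2))⁻¹ ^ 2 * q η ξ ^ 2 := by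
    rw [← intervalIntegral.integral_neg]
    congr 1; ext η
    rw [← intervalIntegral.integral_neg]
    congr 1; ext ξ
    ring
  rw [e2] at key
  linarith

lemma half_square {k : ℝ → ℝ → ℝ} (hk : Continuous (Function.uncurry k)) (hs : ∀ x y, k x y = k y x) {R X : ℝ} (hRX : R ≤ X) :
    2 * ∫ x in R..X, ∫ y in R..x, k x y = ∫ x in R..X, ∫ y in R..X, k x y := by
  have h1 := tri_swap hk hRX
  have h2 : ∫ y in R..X, ∫ x in y..X, k x y = ∫ x in R..X, ∫ y in x..X, k x y := by simp_rw [hs]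
  have ii : ∀ {g : ℝ → ℝ}, Continuous g → IntervalIntegrable g volume R X := fun hg => hg.intervalIntegrable _ _
  have h3 : (∫ x in R..X, ∫ y in R..x, k x y) + (∫ x in R..X, ∫ y in x..X, k x y) = ∫ x in R..X, ∫ y in R..X, k x y := by
    rw [← ii_add (ii (cont_lo (F := fun y x => k x y) (hk.comp continuous_swap) R)) (ii (cont_up hk X))]
    congr 1; ext x
    have c1 : Continuous fun y => k x y := hk.comp (Continuous.prodMk_right x)
    exact integral_add_adjacent_intervals (c1.intervalIntegrable _ _) (c1.intervalIntegrable _ _)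
  linarith

set_option maxHeartbeats 1000000 in
/-- For odd solutions the outgoing component controls the data. -/
lemma Tri.odd_bound (h : Tri R X p q K) (hR : 0 < R) (hd : ∀ x, p x x = q x x) (hK : ∀ η ξ, R ≤ η → η ≤ ξ → ξ ≤ X → |2 * (ξ + η) * K η ξ - 1| ≤ 1 / 100) :
    ∫ x in R..X, q x x ^ 2 ≤ 16 * ∫ η in R..X, q η X ^ 2 := by
  have hRX := h.hRX
  have cp' : Continuous fun z : ℝ × ℝ => p z.1 z.2 := h.cp
  have cq' : Continuous fun z : ℝ × ℝ => q z.1 z.2 := h.cq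
  have cK' : Continuous fun z : ℝ × ℝ => K z.1 z.2 := h.cK
  have ii : ∀ {g : ℝ → ℝ}, Continuous g → ∀ a b, IntervalIntegrable g volume a b := fun hg _ _ => hg.intervalIntegrable _ _
  set f : ℝ → ℝ := fun x => q x x with hf
  have cf : Continuous f := cq'.comp (continuous_id.prodMk continuous_id)
  set G : ℝ → ℝ := fun s => ∫ y in R..s, |f y| with hG
  have cG : Continuous G := continuous_iff_continuousAt.2 fun x => (cf.abs.integral_hasStrictDerivAt R x).hasDerivAt.continuousAt
  have G0 : ∀ s, R ≤ s → 0 ≤ G s := fun s hs => ii_nonneg hs fun _ _ => abs_nonneg _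
  obtain ⟨w, hw⟩ : ∃ w : ℝ → ℝ, w = fun x => (max x (R / 2))⁻¹ := ⟨_, rfl⟩
  have cw : Continuous w := by
    rw [hw]
    refine Continuous.inv₀ con! fun x => ?_
    have := le_max_right x (R / 2); linarith
  have we : ∀ x, R ≤ x → w x = x⁻¹ := fun x hx => by rw [hw]; simp only [max_eq_left (show R / 2 ≤ x by linarith)]
  have wp : ∀ x, 0 < w x := fun x => by rw [hw]; exact inv_pos.2 (lt_of_lt_of_le lin! (le_max_right x (R / 2)))
  have hwb : ∫ ξ in R..X, ∫ s in R..ξ, s * w ξ ^ 2 * q s ξ ^ 2 ≤ 2 * ∫ x in R..X, f x ^ 2 := by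
    have := h.weighted_bound hR (fun x => by rw [hd])
    rw [hw]; exact this
  set F := ∫ x in R..X, f x ^ 2 with hF
  have hH : ∫ x in R..X, G x ^ 2 * w x ^ 2 ≤ 4 * F := by
    have := hardy_zero cf.abs hR hRX
    simp only [sq_abs] at this
    refine le_trans (le_of_eq (ii_congr hRX fun x hx => ?_)) this
    simp only [we x hx.1, hG]; field_simp
  have hKp : ∀ η ξ, R ≤ η → η ≤ ξ → ξ ≤ X → |K η ξ| ≤ 101 / 200 * w ξ ∧ |K η ξ - (w η ^ (-1 : ℤ) + w ξ ^ (-1 : ℤ))⁻¹ / 2| ≤ 1 / 200 * w ξ := by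
    intro η ξ h1 h2 h3
    have h4 := hK η ξ h1 h2 h3
    have hη : 0 < η := lin!
    have hξ : 0 < ξ := lin!
    rw [we ξ lin!, we η h1]
    simp only [zpow_neg, zpow_one, inv_inv]
    have e : K η ξ - (η + ξ)⁻¹ / 2 = (2 * (ξ + η) * K η ξ - 1) / (2 * (ξ + η)) := by field_simp; ring
    have b : |K η ξ - (η + ξ)⁻¹ / 2| ≤ 1 / 200 * ξ⁻¹ := by
      rw [e, abs_div, abs_of_pos (show 0 < 2 * (ξ + η) by positivity)]
      calc _ ≤ (1 / 100) / (2 * (ξ + 0)) := by gcongr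
        _ = _ := by rw [add_zero]; field_simp; norm_num
    refine ⟨?_, b⟩
    have b2 : (η + ξ)⁻¹ / 2 ≤ 1 / 2 * ξ⁻¹ := by
      have : (η + ξ)⁻¹ ≤ ξ⁻¹ := by gcongr; linarith
      linarith
    have b3 : 0 ≤ (η + ξ)⁻¹ / 2 := pos!
    rw [abs_le] at b ⊢
    constructor <;> linarith [inv_pos.2 hξ]
  obtain ⟨k, hk⟩ : ∃ k : ℝ → ℝ → ℝ, k = fun y x => (w y ^ (-1 : ℤ) + w x ^ (-1 : ℤ))⁻¹ / 2 := ⟨_, rfl⟩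
  have ck : Continuous fun z : ℝ × ℝ => k z.1 z.2 := by
    simp only [hk, zpow_neg, zpow_one]
    have c1 : Continuous fun z => (w z)⁻¹ := cw.inv₀ fun x => (wp x).ne'
    refine Continuous.div_const (Continuous.inv₀ ((c1.comp continuous_fst).add (c1.comp continuous_snd)) fun z => ?_) _
    exact (add_pos (inv_pos.2 (wp z.1)) (inv_pos.2 (wp z.2))).ne'
  have ks : ∀ x y, k x y = k y x := fun x y => by simp only [hk, add_comm]
  have hcar : 0 ≤ ∫ x in R..X, ∫ y in R..x, f x * f y * k y x := by
    have h1 := carleman_nonneg cf hR hRX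
    have h2 : ∫ x in R..X, ∫ y in R..X, f x * f y / (x + y) = 2 * ∫ x in R..X, ∫ y in R..X, f x * f y * k y x := by
      rw [← ii_const_mul]
      refine integral_congr fun x hx => ?_
      rw [← ii_const_mul]
      refine integral_congr fun y hy => ?_
      rw [uIcc_of_le hRX] at hx hy
      simp only [hk, we x hx.1, we y hy.1, zpow_neg, zpow_one, inv_inv, add_comm x y]
      ring
    have h3 := half_square (k := fun x y => f x * f y * k y x) (unc con!) (fun x y => by rw [ks]; ring) hRX
    linarith
  set J : ℝ → ℝ := fun ξ => ∫ η in R..ξ, f η * (K η ξ * p η ξ) with hJ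
  have cJ : Continuous J := cont_lo (F := fun η ξ => f η * (K η ξ * p η ξ)) (unc con!) R
  have E1 : ∫ η in R..X, f η * q η X = F + ∫ ξ in R..X, J ξ := by
    have e : ∀ η ∈ uIcc R X, f η * q η X = f η ^ 2 + ∫ ξ in η..X, f η * (K η ξ * p η ξ) := by
      intro η hη
      rw [uIcc_of_le hRX] at hη
      have := integral_eq_sub_of_hasDerivAt (a := η) (b := X)
        (f := fun ξ => q η ξ) (f' := fun ξ => K η ξ * p η ξ) (fun ξ hξ => by rw [uIcc_of_le hη.2] at hξ; exact h.dq η ξ hη.1 hξ.1 hξ.2)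
        (ii con! _ _)
      rw [ii_const_mul, this]
      simp only [hf]; ring
    rw [integral_congr e, ii_add (ii con! _ _) (ii (cont_up (F := fun η ξ => f η * (K η ξ * p η ξ)) (unc con!) X) _ _)]
    congr 1
    exact (tri_swap (f := fun ξ η => f η * (K η ξ * p η ξ)) (unc con!) hRX).symm
  set A : ℝ → ℝ := fun ξ => ∫ s in R..ξ, s * w ξ ^ 2 * q s ξ ^ 2 with hA
  have cA : Continuous A := cont_lo (F := fun s ξ => s * w ξ ^ 2 * q s ξ ^ 2) (unc con!) R
  set B : ℝ → ℝ := fun ξ => ∫ s in R..ξ, G s ^ 2 * w s * w ξ ^ 2 with hB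
  have cB : Continuous B := cont_lo (F := fun s ξ => G s ^ 2 * w s * w ξ ^ 2) (unc con!) R
  set D : ℝ → ℝ := fun ξ => ∫ y in R..ξ, f ξ * f y * k y ξ with hD
  have cD : Continuous D := cont_lo (F := fun y ξ => f ξ * f y * k y ξ) (unc con!) R
  have hBF : ∫ ξ in R..X, B ξ ≤ 4 * F := by
    refine le_trans ?_ hH
    rw [hB, tri_swap (f := fun ξ s => G s ^ 2 * w s * w ξ ^ 2) (unc con!) hRX]
    refine intervalIntegral.integral_mono_on hRX (ii (cont_up (F := fun s ξ => G s ^ 2 * w s * w ξ ^ 2) (unc con!) X) _ _) (ii con! _ _) fun s hs => ?_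
    rw [ii_const_mul]
    have h0 : ∫ ξ in s..X, w ξ ^ 2 = s⁻¹ - X⁻¹ := by
      rw [integral_eq_sub_of_hasDerivAt (f := fun x => -x⁻¹)]
      · ring
      · intro x hx
        rw [uIcc_of_le hs.2] at hx
        have : R ≤ x := hs.1.trans hx.1
        rw [we x this]
        exact (hasDerivAt_inv lin!).fun_neg.congr_deriv (by rw [inv_pow]; ring)
      · exact ii con! _ _
    rw [h0, we s hs.1]
    have : 0 ≤ X⁻¹ := inv_nonneg.2 lin!
    have : 0 ≤ s⁻¹ := inv_nonneg.2 (by linarith [hs.1])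
    calc G s ^ 2 * s⁻¹ * (s⁻¹ - X⁻¹) ≤ G s ^ 2 * s⁻¹ * s⁻¹ := by gcongr; linarith
      _ = _ := by ring
  have E3 : ∀ ξ ∈ Icc R X, D ξ - 1 / 200 * (|f ξ| * G ξ * w ξ) - 13 / 100 * (7 / 5 * A ξ + 5 / 7 * B ξ) ≤ J ξ := by
    intro ξ hξ
    have e1 : ∀ η ∈ uIcc R ξ, f η * (K η ξ * p η ξ) = f ξ * (f η * K η ξ) - ∫ s in η..ξ, f η * K η ξ * (K s ξ * q s ξ) := by
      intro η hη
      rw [uIcc_of_le hξ.1] at hη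
      have := integral_eq_sub_of_hasDerivAt (a := η) (b := ξ)
        (f := fun s => p s ξ) (f' := fun s => K s ξ * q s ξ) (fun s hs => by rw [uIcc_of_le hη.2] at hs; exact h.dp s ξ (hη.1.trans hs.1) hs.2 hξ.2)
        (ii con! _ _)
      rw [ii_const_mul, this, hd]
      simp only [hf]; ring
    have e2 : J ξ = (∫ η in R..ξ, f ξ * (f η * K η ξ)) - ∫ s in R..ξ, ∫ η in R..s, f η * K η ξ * (K s ξ * q s ξ) := by
      rw [hJ]
      simp only []
      rw [integral_congr e1, ii_sub (ii con! _ _) (ii (cont_up (F := fun η s => f η * K η ξ * (K s ξ * q s ξ)) (unc con!) ξ) _ _)]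
      congr 1
      exact (tri_swap (f := fun s η => f η * K η ξ * (K s ξ * q s ξ)) (unc con!) hξ.1).symm
    have e3 : D ξ - 1 / 200 * (|f ξ| * G ξ * w ξ) ≤ ∫ η in R..ξ, f ξ * (f η * K η ξ) := by
      have : 1 / 200 * (|f ξ| * G ξ * w ξ) = ∫ η in R..ξ, 1 / 200 * (|f ξ| * |f η| * w ξ) := by rw [ii_const_mul, intervalIntegral.integral_mul_const, ii_const_mul]
      rw [this, hD]
      simp only []
      rw [← ii_sub (ii con! _ _) (ii con! _ _)]
      refine intervalIntegral.integral_mono_on hξ.1 (ii con! _ _) (ii con! _ _) fun η hη => ?_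
      have b := (hKp η ξ hη.1 hη.2 hξ.2).2
      have hkk : (w η ^ (-1 : ℤ) + w ξ ^ (-1 : ℤ))⁻¹ / 2 = k η ξ := by rw [hk]
      rw [hkk] at b
      have b2 : |f ξ * f η * (K η ξ - k η ξ)| ≤ |f ξ| * |f η| * (1 / 200 * w ξ) := by rw [abs_mul, abs_mul]; gcongr
      have := neg_abs_le (f ξ * f η * (K η ξ - k η ξ))
      linarith
    have e4 : ∫ s in R..ξ, ∫ η in R..s, f η * K η ξ * (K s ξ * q s ξ) ≤ 13 / 100 * (7 / 5 * A ξ + 5 / 7 * B ξ) := by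
      have : 13 / 100 * (7 / 5 * A ξ + 5 / 7 * B ξ) = ∫ s in R..ξ, 13 / 100 * (7 / 5 * (s * w ξ ^ 2 * q s ξ ^ 2) + 5 / 7 * (G s ^ 2 * w s * w ξ ^ 2)) := by
        rw [ii_const_mul, ii_add (ii con! _ _) (ii con! _ _), ii_const_mul, ii_const_mul]
      rw [this]
      refine intervalIntegral.integral_mono_on hξ.1 (ii (cont_lo (F := fun η s => f η * K η ξ * (K s ξ * q s ξ)) (unc con!) R) _ _) (ii con! _ _) fun s hs => ?_
      rw [intervalIntegral.integral_mul_const]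
      have g1 : |∫ η in R..s, f η * K η ξ| ≤ 101 / 200 * w ξ * G s := by
        refine (abs_integral_le_integral_abs hs.1).trans ?_
        rw [hG]
        simp only []
        rw [← ii_const_mul]
        refine intervalIntegral.integral_mono_on hs.1 (ii con! _ _) (ii con! _ _) fun η hη => ?_
        rw [abs_mul, mul_comm]
        have := (hKp η ξ hη.1 (hη.2.trans hs.2) hξ.2).1
        gcongr
      have g2 := (hKp s ξ hs.1 hs.2 hξ.2).1
      have hG0 := G0 s hs.1
      have hw0 := wp ξ
      refine (le_abs_self _).trans ?_
      rw [abs_mul, abs_mul]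
      calc _ ≤ 101 / 200 * w ξ * G s * (101 / 200 * w ξ * |q s ξ|) := by gcongr
        _ ≤ 13 / 50 * w ξ ^ 2 * (G s * |q s ξ|) := by
          have : 0 ≤ w ξ ^ 2 * (G s * |q s ξ|) := pos!
          nlinarith
        _ ≤ 13 / 50 * w ξ ^ 2 * ((7 / 5 * (s * q s ξ ^ 2) + 5 / 7 * (G s ^ 2 * w s)) / 2) := by
          gcongr
          rw [we s hs.1, ← sq_abs (q s ξ)]
          have hs0 : 0 < s := by linarith [hs.1]
          have : 7 / 5 * (s * |q s ξ| ^ 2) + 5 / 7 * (G s ^ 2 * s⁻¹) - 2 * (G s * |q s ξ|) = (7 / 5 * s * |q s ξ| - G s) ^ 2 * (5 / 7 * s⁻¹) := by field_simp; ring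
          have : 0 ≤ (7 / 5 * s * |q s ξ| - G s) ^ 2 * (5 / 7 * s⁻¹) := pos!
          linarith
        _ = _ := by ring
    linarith
  have E4 : -(3 / 4 : ℝ) * F ≤ ∫ ξ in R..X, J ξ := by
    have h1 : ∫ ξ in R..X, (D ξ - 1 / 200 * (|f ξ| * G ξ * w ξ) - 13 / 100 * (7 / 5 * A ξ + 5 / 7 * B ξ)) ≤ ∫ ξ in R..X, J ξ := int_mono hRX con! con! E3
    have h2 : ∫ ξ in R..X, |f ξ| * G ξ * w ξ ≤ 1 * F + 1 / 4 * ∫ x in R..X, G x ^ 2 * w x ^ 2 := by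
      refine int_le_lin hRX 1 (1/4) con! con! con! fun x hx => ?_
      rw [← sq_abs (f x)]
      nlinarith [sq_nonneg (|f x| - G x * w x / 2)]
    rw [ii_sub (ii con! _ _) (ii con! _ _), ii_sub (ii con! _ _) (ii con! _ _), ii_const_mul, ii_const_mul, int_lin hRX _ _ cA.continuousOn cB.continuousOn] at h1
    have hF0 : 0 ≤ F := int_sq_nonneg hRX
    simp only [hA, hD] at h1
    linarith
  have E5 : ∫ η in R..X, f η * q η X ≤ 1 / 8 * F + 2 * ∫ η in R..X, q η X ^ 2 := by
    refine int_le_lin hRX _ _ con! con! con! fun x hx => ?_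
    nlinarith [sq_nonneg (f x - 4 * q x X)]
  linarith [int_sq_nonneg (f := fun η => q η X) hRX]

/-- `f` has partial derivatives `ft`, `fr` (in the Fréchet sense) on `ℝ × J`. -/
def HasGrad (J : Set ℝ) (f ft fr : ℝ → ℝ → ℝ) : Prop :=
  ∀ t, ∀ r ∈ J, HasFDerivAt (fun z : ℝ × ℝ => f z.1 z.2) (ft t r • ContinuousLinearMap.fst ℝ ℝ ℝ + fr t r • ContinuousLinearMap.snd ℝ ℝ ℝ) (t, r)

/-- Joint continuity on `ℝ × J`. -/
def CP (J : Set ℝ) (f : ℝ → ℝ → ℝ) : Prop := ContinuousOn (fun z : ℝ × ℝ => f z.1 z.2) (univ ×ˢ J)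

section grad
variable {J : Set ℝ} {f ft fr g gt gr : ℝ → ℝ → ℝ}

lemma HasGrad.mono {J' : Set ℝ} (h : HasGrad J f ft fr) (hJ : J' ⊆ J) : HasGrad J' f ft fr := fun t r hr => h t r (hJ hr)

lemma HasGrad.cp (h : HasGrad J f ft fr) : CP J f := fun z hz => (h z.1 z.2 hz.2).continuousAt.continuousWithinAt

lemma CP.comp (h : CP J f) {τ σ : ℝ → ℝ} {s : Set ℝ} (hτ : ContinuousOn τ s) (hσ : ContinuousOn σ s) (hJ : ∀ x ∈ s, σ x ∈ J) : ContinuousOn (fun x => f (τ x) (σ x)) s :=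
  ContinuousOn.comp (g := fun z : ℝ × ℝ => f z.1 z.2) h (hτ.prodMk hσ) fun x hx => ⟨mem_univ _, hJ x hx⟩

lemma CP.slice (h : CP J f) (t : ℝ) : ContinuousOn (fun r => f t r) J := h.comp continuousOn_const continuousOn_id fun _ hx => hx

lemma CP.ofR {k : ℝ → ℝ} (h : ContinuousOn k J) : CP J (fun _ r => k r) := h.comp continuousOn_snd fun _ hz => hz.2

lemma CP.add (h : CP J f) (h' : CP J g) : CP J (fun t r => f t r + g t r) := ContinuousOn.add h h'
lemma CP.sub (h : CP J f) (h' : CP J g) : CP J (fun t r => f t r - g t r) := ContinuousOn.sub h h'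
lemma CP.mul (h : CP J f) (h' : CP J g) : CP J (fun t r => f t r * g t r) := ContinuousOn.mul h h'

lemma HasGrad.congr (h : HasGrad J f ft fr) (h1 : ∀ t, ∀ r ∈ J, gt t r = ft t r) (h2 : ∀ t, ∀ r ∈ J, gr t r = fr t r) : HasGrad J f gt gr := fun t r hr => by
  rw [h1 t r hr, h2 t r hr]; exact h t r hr

lemma HasGrad.congr_fun (h : HasGrad J f ft fr) (hJ : IsOpen J) (h1 : ∀ t, ∀ r ∈ J, g t r = f t r) : HasGrad J g ft fr := fun t r hr => by
  refine (h t r hr).congr_of_eventuallyEq ?_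
  filter_upwards [(isOpen_univ.prod hJ).mem_nhds (show (t, r) ∈ univ ×ˢ J from ⟨mem_univ _, hr⟩)] with z hz
  exact h1 z.1 z.2 hz.2

lemma HasGrad.add (h : HasGrad J f ft fr) (h' : HasGrad J g gt gr) :
    HasGrad J (fun t r => f t r + g t r) (fun t r => ft t r + gt t r) (fun t r => fr t r + gr t r) := fun t r hr => by
  refine ((h t r hr).add (h' t r hr)).congr_fderiv ?_
  ext <;> simp

lemma HasGrad.sub (h : HasGrad J f ft fr) (h' : HasGrad J g gt gr) :
    HasGrad J (fun t r => f t r - g t r) (fun t r => ft t r - gt t r) (fun t r => fr t r - gr t r) := fun t r hr => by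
  refine ((h t r hr).sub (h' t r hr)).congr_fderiv ?_
  ext <;> simp

lemma HasGrad.mul (h : HasGrad J f ft fr) (h' : HasGrad J g gt gr) :
    HasGrad J (fun t r => f t r * g t r) (fun t r => ft t r * g t r + f t r * gt t r) (fun t r => fr t r * g t r + f t r * gr t r) := fun t r hr => by
  refine ((h t r hr).mul (h' t r hr)).congr_fderiv ?_
  ext <;> simp <;> ring

lemma HasGrad.ofR {k k1 : ℝ → ℝ} (h : ∀ r ∈ J, HasDerivAt k (k1 r) r) : HasGrad J (fun _ r => k r) (fun _ _ => 0) (fun _ r => k1 r) := fun t r hr => by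
  refine ((h r hr).hasFDerivAt.comp (t, r) hasFDerivAt_snd).congr_fderiv ?_
  ext <;> simp

lemma HasGrad.const (c : ℝ) : HasGrad J (fun _ _ => c) (fun _ _ => 0) (fun _ _ => 0) := HasGrad.ofR fun r _ => hasDerivAt_const r c

lemma HasGrad.time : HasGrad J (fun t _ => t) (fun _ _ => 1) (fun _ _ => 0) := fun t r _ => by
  refine (hasFDerivAt_fst (p := (t, r))).congr_fderiv ?_
  ext <;> simp

lemma HasGrad.smul (x : ℝ) (h : HasGrad J f ft fr) : HasGrad J (fun t r => x * f t r) (fun t r => x * ft t r) (fun t r => x * fr t r) :=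
  ((HasGrad.const x).mul h).congr (fun _ _ _ => by ring) (fun _ _ _ => by ring)

lemma HasGrad.line (h : HasGrad J f ft fr) {τ σ : ℝ → ℝ} {τ' σ' x : ℝ} (hτ : HasDerivAt τ τ' x) (hσ : HasDerivAt σ σ' x) (hx : σ x ∈ J) :
    HasDerivAt (fun x => f (τ x) (σ x)) (ft (τ x) (σ x) * τ' + fr (τ x) (σ x) * σ') x := by
  have := (h (τ x) (σ x) hx).comp_hasDerivAt x (f := fun x => (τ x, σ x)) (hτ.prodMk hσ)
  refine this.congr_deriv ?_
  simp

lemma HasGrad.dr (h : HasGrad J f ft fr) (t : ℝ) {r : ℝ} (hr : r ∈ J) : HasDerivAt (fun r => f t r) (fr t r) r := by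
  refine (h.line (hasDerivAt_const r t) (hasDerivAt_id' r) hr).congr_deriv ?_
  ring

lemma HasGrad.dt (h : HasGrad J f ft fr) (t : ℝ) {r : ℝ} (hr : r ∈ J) : HasDerivAt (fun t => f t r) (ft t r) t := by
  refine (h.line (hasDerivAt_id' t) (hasDerivAt_const t r) hr).congr_deriv ?_
  ring

lemma HasGrad.shift (h : HasGrad J f ft fr) (c d : ℝ) :
    HasGrad J (fun t r => f (c * t + d) r) (fun t r => c * ft (c * t + d) r) (fun t r => fr (c * t + d) r) := fun t r hr => by
  have e : HasFDerivAt (fun z : ℝ × ℝ => (c * z.1 + d, z.2)) ((c • ContinuousLinearMap.fst ℝ ℝ ℝ).prod (ContinuousLinearMap.snd ℝ ℝ ℝ)) (t, r) :=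
    ((hasFDerivAt_fst.const_mul c).add_const d).prodMk hasFDerivAt_snd
  refine ((h (c * t + d) r hr).comp (t, r) e).congr_fderiv ?_
  ext <;> simp <;> ring

lemma CP.shift (h : CP J f) (c d : ℝ) : CP J (fun t r => f (c * t + d) r) := by
  refine ContinuousOn.comp (g := fun z : ℝ × ℝ => f z.1 z.2) (f := fun z : ℝ × ℝ => (c * z.1 + d, z.2)) h ?_ fun z hz => ⟨mem_univ _, hz.2⟩
  exact Continuous.continuousOn con!

end grad

/-- The radial potential. -/
def Vp (r : ℝ) : ℝ := -1152 / (24 + r ^ 2) ^ 2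

lemma cont_Vp : Continuous Vp := by
  unfold Vp
  exact Continuous.div con! con! fun r => pos!

/-- Solutions of the radial equation on `r > 0`, with their derivatives up to order two. -/
structure Sol where
  u : ℝ → ℝ → ℝ
  a : ℝ → ℝ → ℝ
  b : ℝ → ℝ → ℝ
  aT : ℝ → ℝ → ℝ
  aR : ℝ → ℝ → ℝ
  bR : ℝ → ℝ → ℝ
  gu : HasGrad (Ioi 0) u a b
  ga : HasGrad (Ioi 0) a aT aR
  gb : HasGrad (Ioi 0) b aR bR
  cT : CP (Ioi 0) aT
  cR : CP (Ioi 0) aR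
  cB : CP (Ioi 0) bR
  pde : ∀ t r, 0 < r → aT t r = bR t r + 5 / r * b t r - Vp r * u t r

/-- Linear combinations of solutions. -/
def Sol.lin (x : ℝ) (s : Sol) (y : ℝ) (s' : Sol) : Sol where
  u t r := x * s.u t r + y * s'.u t r
  a t r := x * s.a t r + y * s'.a t r
  b t r := x * s.b t r + y * s'.b t r
  aT t r := x * s.aT t r + y * s'.aT t r
  aR t r := x * s.aR t r + y * s'.aR t r
  bR t r := x * s.bR t r + y * s'.bR t r
  gu := (s.gu.smul x).add (s'.gu.smul y)
  ga := (s.ga.smul x).add (s'.ga.smul y)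
  gb := (s.gb.smul x).add (s'.gb.smul y)
  cT := ((CP.ofR continuousOn_const).mul s.cT).add ((CP.ofR continuousOn_const).mul s'.cT)
  cR := ((CP.ofR continuousOn_const).mul s.cR).add ((CP.ofR continuousOn_const).mul s'.cR)
  cB := ((CP.ofR continuousOn_const).mul s.cB).add ((CP.ofR continuousOn_const).mul s'.cB)
  pde t r hr := by rw [s.pde t r hr, s'.pde t r hr]; ring

/-- Affine change of time `t ↦ c t + d`, where `c² = 1`. -/
def Sol.shift (s : Sol) (c d : ℝ) (hc : c * c = 1) : Sol where
  u t r := s.u (c * t + d) r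
  a t r := c * s.a (c * t + d) r
  b t r := s.b (c * t + d) r
  aT t r := s.aT (c * t + d) r
  aR t r := c * s.aR (c * t + d) r
  bR t r := s.bR (c * t + d) r
  gu := s.gu.shift c d
  ga := ((s.ga.shift c d).smul c).congr (fun t r _ => by rw [← mul_assoc, hc, one_mul]) (fun _ _ _ => rfl)
  gb := s.gb.shift c d
  cT := s.cT.shift c d
  cR := (CP.ofR continuousOn_const).mul (s.cR.shift c d)
  cB := s.cB.shift c d
  pde t r hr := s.pde _ r hr

/-- `S(r) = r^{5/2}`. -/
def S (r : ℝ) : ℝ := r ^ 2 * √r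

lemma S_sq {r : ℝ} (hr : 0 < r) : S r ^ 2 = r ^ 5 := by rw [S, mul_pow, Real.sq_sqrt hr.le]; ring

lemma S_pos {r : ℝ} (hr : 0 < r) : 0 < S r := by unfold S; positivity

lemma cont_S : Continuous S := by unfold S; fun_prop

lemma dS {r : ℝ} (hr : 0 < r) : HasDerivAt S (5 / (2 * r) * S r) r := by
  have h := (hasDerivAt_pow 2 r).fun_mul (Real.hasDerivAt_sqrt hr.ne')
  refine h.congr_deriv ?_
  have h0 := Real.sqrt_pos.2 hr
  have : r = √r ^ 2 := (Real.sq_sqrt hr.le).symm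
  unfold S
  generalize √r = y at *
  subst this
  field_simp
  norm_num
  ring

abbrev ODE (g g1 : ℝ → ℝ) : Prop := ∀ r, 0 < r → HasDerivAt g1 (-5 / r * g1 r + Vp r * g r) r

/-- A static solution `g` with a primitive `I` of `-r⁵ g²`, and asymptotics on `J`. -/
structure Pair (J : Set ℝ) (g g1 I : ℝ → ℝ) (M : ℝ) : Prop where
  hJ : J ⊆ Ioi 0
  oJ : IsOpen J
  hM : 1 ≤ M
  dg : HD g g1
  dg1 : ODE g g1
  dI : ∀ r, 0 < r → HasDerivAt I (-(r ^ 5 * g r ^ 2)) r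
  g0 : ∀ r ∈ J, 0 < g r
  I0 : ∀ r ∈ J, 0 < I r
  gl : ∀ r ∈ J, 1 ≤ M * (r ^ 4 * g r)
  gu : ∀ r ∈ J, r ^ 4 * g r ≤ M
  g1u : ∀ r ∈ J, r ^ 5 * |g1 r| ≤ M
  Il : ∀ r ∈ J, 1 ≤ M * (r ^ 2 * I r)
  Iu : ∀ r ∈ J, r ^ 2 * I r ≤ M
  hκ : ∀ r ∈ J, |2 * r * (r ^ 5 * g r ^ 2 / I r + 5 / (2 * r) + g1 r / g r) - 1| ≤ 1 / 100

section system
variable {J : Set ℝ} {g g1 I : ℝ → ℝ} {M : ℝ}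

/-- The Wronskian flux `r⁵ (g ∂ᵣu - g' u)`. -/
def wr (g g1 : ℝ → ℝ) (s : Sol) (t r : ℝ) : ℝ := r ^ 5 * (g r * s.b t r - g1 r * s.u t r)

/-- `Ψ` is a potential of the closed form `(ℓ - wr) dt - r⁵ g u_t dr`. -/
def Pot (g g1 : ℝ → ℝ) (s : Sol) (l : ℝ) (Ψ : ℝ → ℝ → ℝ) : Prop := HasGrad (Ioi 0) Ψ (fun t r => l - wr g g1 s t r) (fun t r => -(r ^ 5 * g r * s.a t r))

lemma wr_grad (hg : HD g g1) (hg1 : ODE g g1) (s : Sol) :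
    HasGrad (Ioi 0) (wr g g1 s) (fun t r => r ^ 5 * (g r * s.aR t r - g1 r * s.a t r)) (fun t r => r ^ 5 * g r * s.aT t r) := by
  have h5 : HasGrad (Ioi 0) (fun _ r => r ^ 5) (fun _ _ => 0) (fun _ r => 5 * r ^ 4) := HasGrad.ofR fun r _ => by simpa using hasDerivAt_pow 5 r
  have hG : HasGrad (Ioi 0) (fun _ r => g r) (fun _ _ => 0) (fun _ r => g1 r) := HasGrad.ofR hg
  have hG1 := HasGrad.ofR (J := Ioi 0) hg1
  refine (h5.mul ((hG.mul s.gb).sub (hG1.mul s.gu))).congr (fun t r hr => ?_) (fun t r hr => ?_)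
  · ring
  · have : r ≠ 0 := ne_of_gt hr
    rw [s.pde t r hr]
    field_simp
    ring

lemma Pot.exists (hg : HD g g1) (hg1 : ODE g g1) (s : Sol) (l : ℝ) (t0 r0 v : ℝ) : ∃ Ψ, Pot g g1 s l Ψ ∧ Ψ t0 r0 = v := by
  have hW := wr_grad hg hg1 s
  have h5 : HasGrad (Ioi 0) (fun _ r => r ^ 5) (fun _ _ => 0) (fun _ r => 5 * r ^ 4) := HasGrad.ofR fun r _ => by simpa using hasDerivAt_pow 5 r
  have hG : HasGrad (Ioi 0) (fun _ r => g r) (fun _ _ => 0) (fun _ r => g1 r) := HasGrad.ofR hg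
  have hA := ((h5.mul hG).mul s.ga).smul (-1)
  have hB := (HasGrad.const l).sub hW
  let ω : ℝ × ℝ → (ℝ × ℝ →L[ℝ] ℝ) := fun z =>
    (l - wr g g1 s z.1 z.2) • ContinuousLinearMap.fst ℝ ℝ ℝ +
    (-1 * (z.2 ^ 5 * g z.2 * s.a z.1 z.2)) • ContinuousLinearMap.snd ℝ ℝ ℝ
  have dω : ∀ z : ℝ × ℝ, 0 < z.2 → HasFDerivAt ω _ z := fun z hz =>
    ((hB z.1 z.2 hz).smul_const (ContinuousLinearMap.fst ℝ ℝ ℝ)).add ((hA z.1 z.2 hz).smul_const (ContinuousLinearMap.snd ℝ ℝ ℝ))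
  obtain ⟨F, hF⟩ := Convex.exists_forall_hasFDerivAt_of_fderiv_symmetric (ω := ω)
    (s := univ ×ˢ Ioi (0 : ℝ)) (convex_univ.prod (convex_Ioi 0)) (isOpen_univ.prod isOpen_Ioi)
    (fun z hz => (dω z hz.2).differentiableAt.differentiableWithinAt) (fun z hz x y => by
      rw [(dω z hz.2).fderiv]
      simp
      ring)
  refine ⟨fun t r => F (t, r) + (v - F (t0, r0)), fun t r hr => ?_, by simp⟩
  refine ((hF (t, r) ⟨mem_univ _, hr⟩).add_const _).congr_fderiv ?_
  simp [ω]

/-- Coefficient of the first order system. -/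
def kap (g g1 I : ℝ → ℝ) (r : ℝ) : ℝ := r ^ 5 * g r ^ 2 / I r + 5 / (2 * r) + g1 r / g r

def a2 (g I : ℝ → ℝ) (s : Sol) (Ψ : ℝ → ℝ → ℝ) (t r : ℝ) : ℝ := S r * g r / I r * Ψ t r - S r * s.a t r

def b2 (g g1 : ℝ → ℝ) (s : Sol) (l : ℝ) (t r : ℝ) : ℝ := (l - wr g g1 s t r) / (S r * g r)

namespace Pair
variable (P : Pair J g g1 I M)
include P

lemma cg : ContinuousOn g (Ioi 0) := fun r hr => (P.dg r hr).cwa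
lemma cg1 : ContinuousOn g1 (Ioi 0) := fun r hr => (P.dg1 r hr).cwa
lemma cI : ContinuousOn I (Ioi 0) := fun r hr => (P.dI r hr).cwa

lemma ckap : ContinuousOn (kap g g1 I) J := by
  have h1 := P.cg.mono P.hJ
  have h2 := P.cg1.mono P.hJ
  have h3 := P.cI.mono P.hJ
  unfold kap
  refine ((ContinuousOn.div con! h3 fun r hr => (P.I0 r hr).ne').add (ContinuousOn.div con! con! fun r hr => ?_)).add (h2.div h1 fun r hr => (P.g0 r hr).ne')
  have := P.hJ hr
  simp only [mem_Ioi] at this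
  positivity

lemma dSgI {r : ℝ} (hr : r ∈ J) : HasDerivAt (fun r => S r * g r / I r) (kap g g1 I r * (S r * g r / I r)) r := by
  have h0 := P.hJ hr
  have hI := P.I0 r hr
  have hg := P.g0 r hr
  have h0' : 0 < r := h0
  refine (((dS h0).fun_mul (P.dg r h0)).fun_div (P.dI r h0) hI.ne').congr_deriv ?_
  unfold kap
  field_simp
  ring

lemma dSg {r : ℝ} (hr : r ∈ J) : HasDerivAt (fun r => (S r * g r)⁻¹) (-(5 / (2 * r) + g1 r / g r) * (S r * g r)⁻¹) r := by
  have h0 := P.hJ hr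
  have hg := P.g0 r hr
  have h0' : 0 < r := h0
  have hS := S_pos h0'
  refine (((dS h0).fun_mul (P.dg r h0)).fun_inv pos!).congr_deriv ?_
  field_simp

lemma grad_b2 (s : Sol) (l : ℝ) : HasGrad J (b2 g g1 s l) (fun t r => -(S r * (s.aR t r - g1 r / g r * s.a t r)))
    (fun t r => -(S r * s.aT t r) - (5 / (2 * r) + g1 r / g r) * b2 g g1 s l t r) := by
  have hW := ((HasGrad.const l).sub (wr_grad P.dg P.dg1 s)).mono P.hJ
  refine ((hW.mul (HasGrad.ofR fun r hr => P.dSg hr)).congr ?_ ?_).congr_fun P.oJ ?_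
  · intro t r hr
    have h0 : 0 < r := P.hJ hr
    have hg := P.g0 r hr
    have hS := S_pos h0
    rw [← S_sq h0]
    field_simp
    ring
  · intro t r hr
    have h0 : 0 < r := P.hJ hr
    have hg := P.g0 r hr
    have hS := S_pos h0
    rw [← S_sq h0]
    unfold b2
    field_simp
    ring
  · intro t r hr
    rw [b2, div_eq_mul_inv]

variable {s : Sol} {l : ℝ} {Ψ : ℝ → ℝ → ℝ} (hΨ : Pot g g1 s l Ψ)
include hΨ

lemma grad_a2 : HasGrad J (a2 g I s Ψ) (fun t r => kap g g1 I r * b2 g g1 s l t r + (-(S r * s.aT t r) - (5 / (2 * r) + g1 r / g r) * b2 g g1 s l t r))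
    (fun t r => kap g g1 I r * a2 g I s Ψ t r + -(S r * (s.aR t r - g1 r / g r * s.a t r))) := by
  refine (((HasGrad.ofR fun r hr => P.dSgI hr).mul (HasGrad.mono hΨ P.hJ)).sub ((HasGrad.ofR fun r hr => dS (P.hJ hr)).mul (s.ga.mono P.hJ))).congr ?_ ?_
  · intro t r hr
    have h0 : 0 < r := P.hJ hr
    have hg := P.g0 r hr
    have hI := P.I0 r hr
    have hS := S_pos h0
    unfold b2 kap
    rw [← S_sq h0]
    field_simp
    ring
  · intro t r hr
    have h0 : 0 < r := P.hJ hr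
    have hg := P.g0 r hr
    have hI := P.I0 r hr
    have hS := S_pos h0
    unfold a2 kap
    rw [← S_sq h0]
    field_simp
    ring

/-- The quotient `Ψ / I` and its gradient. -/
lemma grad_Y : HasGrad J (fun t r => Ψ t r / I r) (fun t r => S r * g r / I r * b2 g g1 s l t r) (fun t r => S r * g r / I r * a2 g I s Ψ t r) := by
  have hi : ∀ r ∈ J, HasDerivAt (fun r => (I r)⁻¹) (r ^ 5 * g r ^ 2 / I r ^ 2) r := fun r hr => ((P.dI r (P.hJ hr)).fun_inv (P.I0 r hr).ne').congr_deriv (by ring)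
  refine (((HasGrad.mono hΨ P.hJ).mul (HasGrad.ofR hi)).congr ?_ ?_).congr_fun P.oJ fun t r hr => div_eq_mul_inv _ _
  · intro t r hr
    have h0 : 0 < r := P.hJ hr
    have hg := P.g0 r hr
    have hI := P.I0 r hr
    have hS := S_pos h0
    unfold b2
    field_simp
    ring
  · intro t r hr
    have h0 : 0 < r := P.hJ hr
    have hg := P.g0 r hr
    have hI := P.I0 r hr
    unfold a2
    rw [← S_sq h0]
    field_simp
    ring

/-- Exact identity `(Ψ²/I)_r = a2² - (S a)²`. -/
lemma d_exact (t : ℝ) {r : ℝ} (hr : r ∈ J) : HasDerivAt (fun r => Ψ t r ^ 2 / I r) (a2 g I s Ψ t r ^ 2 - r ^ 5 * s.a t r ^ 2) r := by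
  have h0 : 0 < r := P.hJ hr
  have hI := P.I0 r hr
  refine (((HasGrad.dr hΨ t h0).fun_pow 2).fun_div (P.dI r h0) hI.ne').congr_deriv ?_
  unfold a2
  rw [← S_sq h0]
  simp only [Nat.cast_ofNat]
  field_simp
  ring

end Pair
end system

lemma exists_Icc_enlarge {J : Set ℝ} (hJ : IsOpen J) {R X : ℝ} (hRX : R ≤ X) (h : Icc R X ⊆ J) : ∃ m M, m < R ∧ X < M ∧ Icc m M ⊆ J := by
  obtain ⟨e, he, h1⟩ := Metric.isOpen_iff.1 hJ R (h ⟨le_rfl, hRX⟩)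
  obtain ⟨e', he', h2⟩ := Metric.isOpen_iff.1 hJ X (h ⟨hRX, le_rfl⟩)
  refine ⟨R - e / 2, X + e' / 2, lin!, lin!, fun x hx => ?_⟩
  by_cases hx1 : x < R
  · apply h1
    rw [Metric.mem_ball, Real.dist_eq, abs_lt]
    constructor <;> linarith [hx.1]
  by_cases hx2 : X < x
  · apply h2
    rw [Metric.mem_ball, Real.dist_eq, abs_lt]
    constructor <;> linarith [hx.2]
  exact h ⟨not_lt.1 hx1, not_lt.1 hx2⟩

namespace Pair
variable {J : Set ℝ} {g g1 I : ℝ → ℝ} {M : ℝ} (P : Pair J g g1 I M) {s : Sol} {l : ℝ} {Ψ : ℝ → ℝ → ℝ} (hΨ : Pot g g1 s l Ψ)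
include P hΨ

lemma tri (t0 : ℝ) {R X m N : ℝ} (hRX : R ≤ X) (hm : m < R) (hN : X < N) (hJ : Icc m N ⊆ J) :
    Tri R X (fun η ξ => a2 g I s Ψ (t0 + (ξ - η) / 2) (max m (min N ((ξ + η) / 2))) + b2 g g1 s l (t0 + (ξ - η) / 2) (max m (min N ((ξ + η) / 2))))
      (fun η ξ => a2 g I s Ψ (t0 + (ξ - η) / 2) (max m (min N ((ξ + η) / 2))) - b2 g g1 s l (t0 + (ξ - η) / 2) (max m (min N ((ξ + η) / 2))))
      (fun η ξ => kap g g1 I (max m (min N ((ξ + η) / 2))) / 2) := by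
  have hcl : ∀ x, max m (min N x) ∈ J := fun x => hJ ⟨le_max_left _ _, max_le lin! (min_le_left _ _)⟩
  have hA := P.grad_a2 hΨ
  have hB := P.grad_b2 s l
  have cA : Continuous fun z : ℝ × ℝ => a2 g I s Ψ (t0 + (z.2 - z.1) / 2) (max m (min N ((z.2 + z.1) / 2))) := by
    rw [← continuousOn_univ]
    refine ContinuousOn.comp (g := fun z : ℝ × ℝ => a2 g I s Ψ z.1 z.2) (f := fun z : ℝ × ℝ =>
      (t0 + (z.2 - z.1) / 2, max m (min N ((z.2 + z.1) / 2)))) hA.cp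
      (Continuous.continuousOn con!) fun z _ => ⟨mem_univ _, hcl _⟩
  have cB : Continuous fun z : ℝ × ℝ => b2 g g1 s l (t0 + (z.2 - z.1) / 2) (max m (min N ((z.2 + z.1) / 2))) := by
    rw [← continuousOn_univ]
    refine ContinuousOn.comp (g := fun z : ℝ × ℝ => b2 g g1 s l z.1 z.2) (f := fun z : ℝ × ℝ =>
      (t0 + (z.2 - z.1) / 2, max m (min N ((z.2 + z.1) / 2)))) hB.cp
      (Continuous.continuousOn con!) fun z _ => ⟨mem_univ _, hcl _⟩
  have cl : ∀ {y : ℝ}, m ≤ y → y ≤ N → max m (min N y) = y := fun h1 h2 => by rw [min_eq_right h2, max_eq_right h1]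
  have near : ∀ {f : ℝ → ℝ} {x : ℝ}, ContinuousAt f x → R ≤ f x → f x ≤ X → (fun s => max m (min N (f s))) =ᶠ[𝓝 x] f := by
    intro f x hf h1 h2
    have := hf.eventually (Ioo_mem_nhds (show m < f x by linarith) (show f x < N by linarith))
    filter_upwards [this] with y hy
    exact cl hy.1.le hy.2.le
  refine ⟨hRX, cA.add cB, cA.sub cB, ?_, ?_, ?_⟩
  · refine Continuous.div_const ?_ _
    refine ContinuousOn.comp_continuous P.ckap (f := fun z : ℝ × ℝ => max m (min N ((z.2 + z.1) / 2))) con! fun z => hcl _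
  · intro η ξ h1 h2 h3
    have r1 : R ≤ (ξ + η) / 2 := lin!
    have r2 : (ξ + η) / 2 ≤ X := lin!
    have rJ : (ξ + η) / 2 ∈ J := hJ ⟨lin!, lin!⟩
    have dσ : HasDerivAt (fun x : ℝ => (x + η) / 2) (1 / 2) ξ := ((hasDerivAt_id' ξ).add_const η).div_const 2
    have dτ : HasDerivAt (fun x : ℝ => t0 + (x - η) / 2) (1 / 2) ξ := (((hasDerivAt_id' ξ).sub_const η).div_const 2).const_add t0
    rw [cl (show m ≤ (ξ + η) / 2 by linarith) lin!]
    refine (((hA.line dτ dσ rJ).fun_sub (hB.line dτ dσ rJ)).congr_deriv ?_).congr_of_eventuallyEq ((near dσ.continuousAt r1 r2).mono fun x hx => ?_)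
    · ring
    · simp only [] at hx
      simp only [hx]
  · intro η ξ h1 h2 h3
    have r1 : R ≤ (ξ + η) / 2 := lin!
    have r2 : (ξ + η) / 2 ≤ X := lin!
    have rJ : (ξ + η) / 2 ∈ J := hJ ⟨lin!, lin!⟩
    have dσ : HasDerivAt (fun x : ℝ => (ξ + x) / 2) (1 / 2) η := ((hasDerivAt_id' η).const_add ξ).div_const 2
    have dτ : HasDerivAt (fun x : ℝ => t0 + (ξ - x) / 2) (-1 / 2) η := (((hasDerivAt_id' η).const_sub ξ).div_const 2).const_add t0
    rw [cl (show m ≤ (ξ + η) / 2 by linarith) lin!]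
    refine (((hA.line dτ dσ rJ).fun_add (hB.line dτ dσ rJ)).congr_deriv ?_).congr_of_eventuallyEq ((near dσ.continuousAt r1 r2).mono fun x hx => ?_)
    · ring
    · simp only [] at hx
      simp only [hx]

/-- Energy identity on a characteristic triangle with base at time `t0`. -/
lemma tri_energy (t0 : ℝ) {R X : ℝ} (hRX : R ≤ X) (hJ : Icc R X ⊆ J) :
    (∫ η in R..X, (a2 g I s Ψ (t0 + (X - η) / 2) ((X + η) / 2) - b2 g g1 s l (t0 + (X - η) / 2) ((X + η) / 2)) ^ 2) +
      (∫ ξ in R..X, (a2 g I s Ψ (t0 + (ξ - R) / 2) ((ξ + R) / 2) + b2 g g1 s l (t0 + (ξ - R) / 2) ((ξ + R) / 2)) ^ 2) =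
      ∫ x in R..X, (2 * a2 g I s Ψ t0 x ^ 2 + 2 * b2 g g1 s l t0 x ^ 2) := by
  obtain ⟨m, N, hm, hN, hJ'⟩ := exists_Icc_enlarge P.oJ hRX hJ
  have key := (P.tri hΨ t0 hRX hm hN hJ').energy
  have cl : ∀ {y : ℝ}, R ≤ y → y ≤ X → max m (min N y) = y := fun h1 h2 => by rw [min_eq_right lin!, max_eq_right lin!]
  refine Eq.trans (Eq.trans ?_ key) ?_
  · congr 1 <;> refine integral_congr fun x hx => ?_ <;> rw [uIcc_of_le hRX] at hx <;> rw [cl (by linarith [hx.1]) (by linarith [hx.2])]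
  · refine ii_congr hRX fun x hx => ?_
    rw [cl (by linarith [hx.1]) (by linarith [hx.2])]
    simp only [sub_self, zero_div, add_zero, add_self_div_two]
    ring

lemma tri_out (t0 : ℝ) {R X : ℝ} (hRX : R ≤ X) (hJ : Icc R X ⊆ J) :
    ∫ η in R..X, (a2 g I s Ψ (t0 + (X - η) / 2) ((X + η) / 2) - b2 g g1 s l (t0 + (X - η) / 2) ((X + η) / 2)) ^ 2 ≤
      ∫ x in R..X, (2 * a2 g I s Ψ t0 x ^ 2 + 2 * b2 g g1 s l t0 x ^ 2) := by
  rw [← P.tri_energy hΨ t0 hRX hJ]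
  have := int_sq_nonneg (f := fun ξ => (a2 g I s Ψ (t0 + (ξ - R) / 2) ((ξ + R) / 2) + b2 g g1 s l (t0 + (ξ - R) / 2) ((ξ + R) / 2))) hRX
  linarith

lemma tri_in (t0 : ℝ) {R X : ℝ} (hRX : R ≤ X) (hJ : Icc R X ⊆ J) :
    ∫ ξ in R..X, (a2 g I s Ψ (t0 + (ξ - R) / 2) ((ξ + R) / 2) + b2 g g1 s l (t0 + (ξ - R) / 2) ((ξ + R) / 2)) ^ 2 ≤
      ∫ x in R..X, (2 * a2 g I s Ψ t0 x ^ 2 + 2 * b2 g g1 s l t0 x ^ 2) := by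
  rw [← P.tri_energy hΨ t0 hRX hJ]
  have := int_sq_nonneg (f := fun η => (a2 g I s Ψ (t0 + (X - η) / 2) ((X + η) / 2) - b2 g g1 s l (t0 + (X - η) / 2) ((X + η) / 2))) hRX
  linarith

lemma tri_odd (t0 : ℝ) {R X : ℝ} (hRX : R ≤ X) (hJ : Icc R X ⊆ J) (hb : ∀ r ∈ J, b2 g g1 s l t0 r = 0) :
    ∫ x in R..X, a2 g I s Ψ t0 x ^ 2 ≤ 16 * ∫ η in R..X, (a2 g I s Ψ (t0 + (X - η) / 2) ((X + η) / 2) - b2 g g1 s l (t0 + (X - η) / 2) ((X + η) / 2)) ^ 2 := by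
  obtain ⟨m, N, hm, hN, hJ'⟩ := exists_Icc_enlarge P.oJ hRX hJ
  have hcl : ∀ x, max m (min N x) ∈ J := fun x => hJ' ⟨le_max_left _ _, max_le lin! (min_le_left _ _)⟩
  have cl : ∀ {y : ℝ}, R ≤ y → y ≤ X → max m (min N y) = y := fun h1 h2 => by rw [min_eq_right lin!, max_eq_right lin!]
  have hR : 0 < R := P.hJ (hJ ⟨le_rfl, hRX⟩)
  have key := (P.tri hΨ t0 hRX hm hN hJ').odd_bound hR (fun x => by
    simp only [sub_self, zero_div, add_zero, add_self_div_two]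
    rw [hb _ (hcl _)]; ring) (fun η ξ h1 h2 h3 => by
    rw [cl (show R ≤ (ξ + η) / 2 by linarith) lin!]
    have := P.hκ ((ξ + η) / 2) (hJ ⟨lin!, lin!⟩)
    rw [show 2 * ((ξ + η) / 2) * (((ξ + η) / 2) ^ 5 * g ((ξ + η) / 2) ^ 2 / I ((ξ + η) / 2) + 5 / (2 * ((ξ + η) / 2)) + g1 ((ξ + η) / 2) / g ((ξ + η) / 2)) =
      2 * (ξ + η) * (kap g g1 I ((ξ + η) / 2) / 2) from by unfold kap; ring] at this
    exact this)
  refine Eq.trans_le ?_ (key.trans (le_of_eq ?_))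
  · refine ii_congr hRX fun x hx => ?_
    simp only [sub_self, zero_div, add_zero, add_self_div_two]
    rw [cl hx.1 hx.2, hb x (hJ hx), sub_zero]
  · congr 1
    refine ii_congr hRX fun x hx => ?_
    rw [cl (by linarith [hx.1]) (by linarith [hx.2])]

end Pair

/-- The energy of `s` at time `t` outside radius `ρ` is at most `M`. -/
def EB (s : Sol) (ρ t M : ℝ) : Prop := ∀ Y, ρ ≤ Y → ∫ r in ρ..Y, r ^ 5 * (s.a t r ^ 2 + s.b t r ^ 2) ≤ M

/-- Eventually the energy outside the cone `r > ρ + t` is at most `E`. -/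
def Late (s : Sol) (ρ E : ℝ) : Prop := ∃ T0, ∀ t, T0 ≤ t → EB s (ρ + t) t E

/-- Locally uniform finiteness of the energy away from the origin. -/
def FE (s : Sol) : Prop := ∀ ρ, 0 < ρ → ∀ T, ∃ M, ∀ t, |t| ≤ T → EB s ρ t M

lemma tail_small {F : ℝ → ℝ} {ρ M : ℝ} (bdd : ∀ x, ρ ≤ x → F x ≤ M) {e : ℝ} (he : 0 < e) : ∃ N, ρ ≤ N ∧ ∀ y, N ≤ y → F y - F N ≤ e := by
  have hb : BddAbove (F '' Ici ρ) := ⟨M, by rintro _ ⟨x, hx, rfl⟩; exact bdd x hx⟩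
  have hne : (F '' Ici ρ).Nonempty := ⟨F ρ, ρ, (le_refl ρ), rfl⟩
  obtain ⟨_, ⟨N, hN, rfl⟩, h1⟩ := exists_lt_of_lt_csSup hne (show sSup (F '' Ici ρ) - e < sSup (F '' Ici ρ) by linarith)
  refine ⟨N, hN, fun y hy => ?_⟩
  have := le_csSup hb ⟨y, (show ρ ≤ y from le_trans hN hy), rfl⟩
  linarith

section
variable {s : Sol}

lemma Sol.ca (s : Sol) (t : ℝ) : ContinuousOn (fun r => s.a t r) (Ioi 0) := s.ga.cp.slice t
lemma Sol.cb (s : Sol) (t : ℝ) : ContinuousOn (fun r => s.b t r) (Ioi 0) := s.gb.cp.slice t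
lemma Sol.cu (s : Sol) (t : ℝ) : ContinuousOn (fun r => s.u t r) (Ioi 0) := s.gu.cp.slice t

lemma Icc_pos {a b : ℝ} (ha : 0 < a) : Icc a b ⊆ Ioi 0 := fun _ hx => lt_of_lt_of_le ha hx.1

lemma EB.mono {ρ t M M' : ℝ} (h : EB s ρ t M) (hM : M ≤ M') : EB s ρ t M' := fun Y hY => (h Y hY).trans hM

lemma EB.nonneg {ρ t M : ℝ} (h : EB s ρ t M) : 0 ≤ M := by
  have := h ρ le_rfl
  simpa using this

lemma Sol.ce (s : Sol) {ρ Y : ℝ} (t : ℝ) (hρ : 0 < ρ) : ContinuousOn (fun r => r ^ 5 * (s.a t r ^ 2 + s.b t r ^ 2)) (Icc ρ Y) := by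
  have h1 := (s.ca t).icc hρ Y
  have h2 := (s.cb t).icc hρ Y
  fun_prop

lemma EB.sub {ρ ρ' t M : ℝ} (h : EB s ρ t M) (hρ : 0 < ρ) (hr : ρ ≤ ρ') : EB s ρ' t M := by
  intro Y hY
  refine le_trans (int_mono_set hr hY le_rfl (s.ce t hρ) fun r hr => ?_) (h Y (hr.trans hY))
  have : 0 < r := lt_of_lt_of_le hρ hr.1
  positivity

lemma EB.a_le {ρ t M : ℝ} (h : EB s ρ t M) (hρ : 0 < ρ) {Y : ℝ} (hY : ρ ≤ Y) : ∫ r in ρ..Y, r ^ 5 * s.a t r ^ 2 ≤ M := by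
  have h1 := (s.ca t).icc hρ Y
  refine (int_mono hY con! (s.ce t hρ) fun r hr => ?_).trans (h Y hY)
  have : 0 < r := lt_of_lt_of_le hρ hr.1
  gcongr
  nlinarith [sq_nonneg (s.b t r)]

lemma EB.b_le {ρ t M : ℝ} (h : EB s ρ t M) (hρ : 0 < ρ) {Y : ℝ} (hY : ρ ≤ Y) : ∫ r in ρ..Y, r ^ 5 * s.b t r ^ 2 ≤ M := by
  have h1 := (s.cb t).icc hρ Y
  refine (int_mono hY con! (s.ce t hρ) fun r hr => ?_).trans (h Y hY)
  have : 0 < r := lt_of_lt_of_le hρ hr.1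
  gcongr
  nlinarith [sq_nonneg (s.a t r)]

lemma ftc {f f' : ℝ → ℝ} {a b : ℝ} (hab : a ≤ b) (h : ∀ x ∈ Icc a b, HasDerivAt f (f' x) x) (hc : ContinuousOn f' (Icc a b)) : ∫ x in a..b, f' x = f b - f a :=
  integral_eq_sub_of_hasDerivAt (by rwa [uIcc_of_le hab]) (hc.iint hab)

lemma diff_sq_le {ρ t M : ℝ} (h : EB s ρ t M) (hρ : 0 < ρ) {x y : ℝ} (hx : ρ ≤ x) (hxy : x ≤ y) : (s.u t y - s.u t x) ^ 2 ≤ M / (4 * x ^ 4) := by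
  have hx0 : 0 < x := lt_of_lt_of_le hρ hx
  have h1 := (s.cb t).icc hx0 y
  rw [← ftc hxy (fun r hr => s.gu.dr t (Icc_pos hx0 hr)) h1]
  have hS : ∀ r ∈ Icc x y, 0 < S r := fun r hr => S_pos (Icc_pos hx0 hr)
  have cS : ContinuousOn (fun r => S r) (Icc x y) := cont_S.continuousOn
  have cI : ContinuousOn (fun r => (S r)⁻¹) (Icc x y) := cS.inv₀ fun r hr => (hS r hr).ne'
  have e : ∫ r in x..y, s.b t r = ∫ r in x..y, (S r)⁻¹ * (S r * s.b t r) := by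
    refine ii_congr hxy fun r hr => ?_
    have := hS r hr
    field_simp
  rw [e]
  refine (cs hxy cI (cS.mul h1)).trans ?_
  have e1 : ∫ r in x..y, (S r)⁻¹ ^ 2 = 1 / (4 * x ^ 4) - 1 / (4 * y ^ 4) := by
    rw [ftc hxy (f := fun r => -(r ^ 4)⁻¹ / 4) (fun r hr => ?_) (cI.fun_pow 2)]
    · have : y ≠ 0 := lin!
      field_simp; ring
    · have hr0 : 0 < r := Icc_pos hx0 hr
      refine (((hasDerivAt_pow 4 r).fun_inv pos!).fun_neg.div_const 4).congr_deriv ?_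
      rw [inv_pow, S_sq hr0]
      simp only [Nat.cast_ofNat]
      field_simp
  have e2 : ∫ r in x..y, (S r * s.b t r) ^ 2 ≤ M := by
    refine le_trans (le_of_eq (integral_congr fun r hr => ?_)) ((h.sub hρ hx).b_le hx0 hxy)
    rw [uIcc_of_le hxy] at hr
    simp only [mul_pow, S_sq (Icc_pos hx0 hr : 0 < r)]
  have e0 : 0 ≤ ∫ r in x..y, (S r * s.b t r) ^ 2 := int_sq_nonneg hxy
  rw [e1]
  have : 0 ≤ 1 / (4 * y ^ 4) := pos!
  have h4 : 0 ≤ 1 / (4 * x ^ 4) := pos!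
  calc _ ≤ (1 / (4 * x ^ 4)) * M :=
        mul_le_mul lin! e2 e0 h4
    _ = _ := by ring

lemma u_bound {ρ t M c : ℝ} (h : EB s ρ t M) (hρ : 0 < ρ) (hu : Tendsto (fun r => s.u t r) atTop (𝓝 c)) {x : ℝ} (hx : ρ ≤ x) : (s.u t x - c) ^ 2 ≤ M / (4 * x ^ 4) := by
  have h1 : Tendsto (fun y => (s.u t y - s.u t x) ^ 2) atTop (𝓝 ((c - s.u t x) ^ 2)) := (hu.sub_const _).pow 2
  have := le_of_tendsto h1 ((eventually_ge_atTop x).mono fun y hy => diff_sq_le h hρ hx hy)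
  calc _ = (c - s.u t x) ^ 2 := by ring
    _ ≤ _ := this

lemma hardy_u {ρ t M : ℝ} (h : EB s ρ t M) (hρ : 0 < ρ) (hu : Tendsto (fun r => s.u t r) atTop (𝓝 0)) {Y : ℝ} (hY : ρ ≤ Y) : ∫ r in ρ..Y, r ^ 3 * s.u t r ^ 2 ≤ M := by
  have hY0 : 0 < Y := lt_of_lt_of_le hρ hY
  have h1 := (s.cb t).icc hρ Y
  have h2 := (s.cu t).icc hρ Y
  have key := mono_ftc (A := fun r => r ^ 3 * s.u t r ^ 2) (B := fun r => 1 / 4 * (r ^ 5 * s.b t r ^ 2)) (P := fun r => r ^ 4 * s.u t r ^ 2 / 2)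
    (P' := fun r => 2 * r ^ 3 * s.u t r ^ 2 + r ^ 4 * (s.u t r * s.b t r)) hY con!
    con! con! (fun r hr => by
      refine (((hasDerivAt_pow 4 r).fun_mul ((s.gu.dr t (Icc_pos hρ hr)).fun_pow 2)).div_const 2).congr_deriv ?_
      simp only [Nat.cast_ofNat]; ring) (fun r hr => by
      have hr0 : 0 < r := Icc_pos hρ hr
      have : 0 ≤ r ^ 3 * (s.u t r + r * s.b t r / 2) ^ 2 := pos!
      nlinarith)
  rw [ii_const_mul] at key
  have k1 := h.b_le hρ hY
  have k2 := u_bound h hρ hu hY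
  rw [sub_zero, le_div_iff₀ pos!] at k2
  have k3 : 0 ≤ ρ ^ 4 * s.u t ρ ^ 2 / 2 := pos!
  have := h.nonneg
  linarith

end

namespace Pair
variable {J : Set ℝ} {g g1 I : ℝ → ℝ} {M : ℝ} (P : Pair J g g1 I M) {s : Sol} {l : ℝ} {Ψ : ℝ → ℝ → ℝ}
include P

lemma g1g {r : ℝ} (hr : r ∈ J) : |g1 r / g r| ≤ M ^ 2 / r := by
  have h0 : 0 < r := P.hJ hr
  have hg := P.g0 r hr
  have h1 := P.g1u r hr
  have h2 := P.gl r hr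
  have hM := P.hM
  rw [abs_div, abs_of_pos hg, div_le_div_iff₀ hg h0]
  have h3 : r ^ 5 * |g1 r| * 1 ≤ M * (M * (r ^ 4 * g r)) := by gcongr
  have h4 : 0 < r ^ 4 := pos!
  refine le_of_mul_le_mul_left (a := r ^ 4) ?_ h4
  linarith

lemma b2_eq {t r : ℝ} (hr : r ∈ J) : b2 g g1 s l t r = l / (S r * g r) - S r * (s.b t r - g1 r / g r * s.u t r) := by
  have h0 : 0 < r := P.hJ hr
  have hg := P.g0 r hr
  have hS := S_pos h0
  rw [b2, wr, ← S_sq h0]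
  field_simp

lemma c_a2 (hΨ : Pot g g1 s l Ψ) (t : ℝ) : ContinuousOn (fun r => a2 g I s Ψ t r) J := (P.grad_a2 hΨ).cp.slice t

lemma c_b2 (s : Sol) (l : ℝ) (t : ℝ) : ContinuousOn (fun r => b2 g g1 s l t r) J := (P.grad_b2 s l).cp.slice t

lemma a2_le (hΨ : Pot g g1 s l Ψ) {ρ t E : ℝ} (hJ : Ici ρ ⊆ J) (hE : EB s ρ t E) (hl : Tendsto (fun r => Ψ t r) atTop (𝓝 0)) {Y : ℝ} (hY : ρ ≤ Y) :
    ∫ r in ρ..Y, a2 g I s Ψ t r ^ 2 ≤ E := by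
  have hρ : 0 < ρ := P.hJ (hJ (show ρ ∈ Ici ρ from le_refl ρ))
  have cc : ∀ x y, ρ ≤ x → ContinuousOn (fun r => r ^ 5 * s.a t r ^ 2) (Icc x y) := fun x y hx => by
    have := (s.ca t).mono (Icc_pos (b := y) (lt_of_lt_of_le hρ hx))
    fun_prop
  have ca : ContinuousOn (fun r => a2 g I s Ψ t r) (Icc ρ Y) := (P.c_a2 hΨ t).mono fun x hx => hJ hx.1
  have key : ∀ Y', Y ≤ Y' → (Ψ t Y' - Ψ t Y) ^ 2 ≤ I Y * (E - ∫ r in ρ..Y, r ^ 5 * s.a t r ^ 2) := by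
    intro Y' hY'
    have hY0 : 0 < Y := lt_of_lt_of_le hρ hY
    have cg := P.cg.icc hY0 (Y')
    have ca := (s.ca t).icc hY0 (Y')
    have cS : ContinuousOn (fun r => S r) (Icc Y Y') := cont_S.continuousOn
    rw [← ftc hY' (fun r hr => HasGrad.dr hΨ t (Icc_pos hY0 hr)) con!]
    have e : ∫ r in Y..Y', -(r ^ 5 * g r * s.a t r) = ∫ r in Y..Y', (-(S r * g r)) * (S r * s.a t r) := by
      refine ii_congr hY' fun r hr => ?_
      simp only [← S_sq (Icc_pos hY0 hr : 0 < r)]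
      ring
    rw [e]
    refine (cs hY' con! con!).trans ?_
    have e1 : ∫ r in Y..Y', (-(S r * g r)) ^ 2 = I Y - I Y' := by
      have := ftc hY' (f := fun r => -I r) (f' := fun r => (-(S r * g r)) ^ 2) (fun r hr => by
        have h0 : 0 < r := Icc_pos hY0 hr
        refine (P.dI r h0).fun_neg.congr_deriv ?_
        rw [neg_sq, mul_pow, S_sq h0]; ring) con!
      rw [this]; ring
    have e2 : ∫ r in Y..Y', (S r * s.a t r) ^ 2 = ∫ r in Y..Y', r ^ 5 * s.a t r ^ 2 := by
      refine ii_congr hY' fun r hr => ?_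
      simp only [mul_pow, S_sq (Icc_pos hY0 hr : 0 < r)]
    have e3 := int_sub hY hY' (cc ρ Y' le_rfl)
    have e4 := hE.a_le hρ (hY.trans hY')
    have e5 : 0 ≤ ∫ r in Y..Y', (S r * s.a t r) ^ 2 := int_sq_nonneg hY'
    have i1 := P.I0 Y (hJ hY)
    have i2 := P.I0 Y' (hJ (hY.trans hY'))
    rw [e1, ← e2] at *
    calc _ ≤ I Y * ∫ r in Y..Y', (S r * s.a t r) ^ 2 := by gcongr; linarith
      _ ≤ _ := by gcongr; linarith
  have lim : Tendsto (fun Y' => (Ψ t Y' - Ψ t Y) ^ 2) atTop (𝓝 ((0 - Ψ t Y) ^ 2)) := (hl.sub_const _).pow 2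
  have k1 := le_of_tendsto lim ((eventually_ge_atTop Y).mono key)
  have k2 := ftc hY (fun r hr => P.d_exact hΨ t (hJ hr.1)) ((ca.fun_pow 2).fun_sub (cc ρ Y le_rfl))
  rw [ii_sub ((ca.fun_pow 2).iint hY) ((cc ρ Y le_rfl).iint hY)] at k2
  have i1 := P.I0 Y (hJ hY)
  have i2 := P.I0 ρ (hJ (show ρ ∈ Ici ρ from le_refl ρ))
  have k3 : Ψ t Y ^ 2 / I Y ≤ E - ∫ r in ρ..Y, r ^ 5 * s.a t r ^ 2 := by
    rw [div_le_iff₀ i1]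
    calc _ = (0 - Ψ t Y) ^ 2 := by ring
      _ ≤ _ := k1
      _ = _ := by ring
  have k4 : 0 ≤ Ψ t ρ ^ 2 / I ρ := pos!
  linarith

lemma b2_le {ρ t E : ℝ} (hJ : Ici ρ ⊆ J) (hE : EB s ρ t E) (hu : Tendsto (fun r => s.u t r) atTop (𝓝 0)) {Y : ℝ} (hY : ρ ≤ Y) :
    ∫ r in ρ..Y, b2 g g1 s 0 t r ^ 2 ≤ (2 + 2 * M ^ 4) * E := by
  have hρ : 0 < ρ := P.hJ (hJ (show ρ ∈ Ici ρ from le_refl ρ))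
  have cb := (P.c_b2 s 0 t).mono (show Icc ρ Y ⊆ J from fun x hx => hJ hx.1)
  have h1 := (s.cb t).icc hρ Y
  have h2 := (s.cu t).icc hρ Y
  refine (int_le_lin hY 2 (2 * M ^ 4) (f := fun r => r ^ 5 * s.b t r ^ 2) (g := fun r => r ^ 3 * s.u t r ^ 2) con! con! con! fun r hr => ?_).trans ?_
  · have hr0 : 0 < r := Icc_pos hρ hr
    have hrJ : r ∈ J := hJ hr.1
    rw [P.b2_eq hrJ, zero_div, zero_sub, neg_sq, mul_pow, S_sq hr0]
    have h3 := P.g1g hrJ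
    have h4 : (g1 r / g r * s.u t r) ^ 2 ≤ (M ^ 2 / r) ^ 2 * s.u t r ^ 2 := by
      rw [mul_pow]
      exact mul_le_r (sq_le_sq.2 (h3.trans (le_abs_self _))) (sq_nonneg _)
    have h5 : (s.b t r - g1 r / g r * s.u t r) ^ 2 ≤ 2 * s.b t r ^ 2 + 2 * ((M ^ 2 / r) ^ 2 * s.u t r ^ 2) := by nlinarith [sq_nonneg (s.b t r + g1 r / g r * s.u t r)]
    calc _ ≤ r ^ 5 * (2 * s.b t r ^ 2 + 2 * ((M ^ 2 / r) ^ 2 * s.u t r ^ 2)) := by gcongr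
      _ = _ := by field_simp
  · have k1 := hE.b_le hρ hY
    have k2 := hardy_u hE hρ hu hY
    have : 0 ≤ 2 * M ^ 4 := pos!
    nlinarith

/-- Exterior estimate for solutions vanishing at time `0`. -/
lemma outer_odd (hΨ : Pot g g1 s 0 Ψ) {ρ E N : ℝ} (hJ : Ici ρ ⊆ J) (h0 : ∀ r, 0 < r → s.u 0 r = 0 ∧ s.b 0 r = 0) (hu : ∀ t, Tendsto (fun r => s.u t r) atTop (𝓝 0))
    (hl : ∀ t, Tendsto (fun r => Ψ t r) atTop (𝓝 0)) (hE : Late s ρ E) (hN : EB s ρ 0 N)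
    {Y : ℝ} (hY : ρ ≤ Y) :
    ∫ r in ρ..Y, a2 g I s Ψ 0 r ^ 2 ≤ (96 + 64 * M ^ 4) * E := by
  have hρ : 0 < ρ := P.hJ (hJ (show ρ ∈ Ici ρ from le_refl ρ))
  have hb : ∀ r ∈ J, b2 g g1 s 0 0 r = 0 := fun r hr => by
    obtain ⟨e1, e2⟩ := h0 r (P.hJ hr)
    rw [b2, wr, e1, e2]; simp
  obtain ⟨T0, hT⟩ := hE
  set F : ℝ → ℝ := fun y => ∫ r in ρ..y, a2 g I s Ψ 0 r ^ 2 with hF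
  have ca : ∀ x y, ρ ≤ x → ContinuousOn (fun r => a2 g I s Ψ 0 r ^ 2) (Icc x y) := fun x y hx => ((P.c_a2 hΨ 0).mono fun z hz => hJ (hx.trans hz.1)).pow 2
  have mono : ∀ x y, ρ ≤ x → x ≤ y → F x ≤ F y := fun x y hx hxy => int_mono_set le_rfl hx hxy (ca ρ y le_rfl) fun _ _ => sq_nonneg _
  have bdd : ∀ x, ρ ≤ x → F x ≤ N := fun x hx => P.a2_le hΨ hJ hN (hl 0) hx
  refine le_of_forall_pos_le_add fun e he => ?_
  obtain ⟨η1, hη1, htail⟩ := tail_small bdd (show 0 < e / 32 by linarith)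
  set t0 := max (max T0 0) (Y - η1) with ht0
  have t00 : 0 ≤ t0 := (le_max_right _ _).trans (le_max_left _ _)
  have t01 : T0 ≤ t0 := (le_max_left _ _).trans (le_max_left _ _)
  have t02 : Y - η1 ≤ t0 := le_max_right _ _
  set X := η1 + 2 * t0 with hX
  have hρX : ρ ≤ X := lin!
  have hηX : η1 ≤ X := lin!
  have hE := hT t0 t01
  have hJ' : ∀ {x y}, ρ ≤ x → Icc x y ⊆ J := fun h z hz => hJ (le_trans h hz.1)
  have k1 := P.tri_odd hΨ 0 hρX (hJ' le_rfl) hb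
  have cq : ContinuousOn (fun η => (a2 g I s Ψ (0 + (X - η) / 2) ((X + η) / 2) - b2 g g1 s 0 (0 + (X - η) / 2) ((X + η) / 2)) ^ 2) (Icc ρ X) := by
    refine ContinuousOn.pow (ContinuousOn.sub ?_ ?_) 2
    · exact (P.grad_a2 hΨ).cp.comp con! con! fun x hx => hJ (by simp only [mem_Ici]; linarith [hx.1])
    · exact (P.grad_b2 s 0).cp.comp con! con! fun x hx => hJ (by simp only [mem_Ici]; linarith [hx.1])
  rw [← int_sub hη1 hηX cq] at k1
  have k2 := P.tri_out hΨ 0 hηX (hJ' hη1)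
  have e2 : ∫ x in η1..X, (2 * a2 g I s Ψ 0 x ^ 2 + 2 * b2 g g1 s 0 0 x ^ 2) = 2 * ∫ x in η1..X, a2 g I s Ψ 0 x ^ 2 := by
    rw [← ii_const_mul]
    refine ii_congr hηX fun x hx => ?_
    simp only [hb x (hJ' hη1 hx)]
    ring
  have e3 : (∫ x in ρ..η1, a2 g I s Ψ 0 x ^ 2) + ∫ x in η1..X, a2 g I s Ψ 0 x ^ 2 = F X := int_sub hη1 hηX (ca ρ X le_rfl)
  have e4 : F η1 = ∫ x in ρ..η1, a2 g I s Ψ 0 x ^ 2 := rfl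
  have k3 := P.tri_out hΨ t0 (show ρ + t0 ≤ η1 + t0 by linarith) (hJ' lin!)
  have e5 : ∫ η in (ρ + t0)..(η1 + t0), (a2 g I s Ψ (t0 + (η1 + t0 - η) / 2) ((η1 + t0 + η) / 2) - b2 g g1 s 0 (t0 + (η1 + t0 - η) / 2) ((η1 + t0 + η) / 2)) ^ 2 =
      ∫ η in ρ..η1, (a2 g I s Ψ (0 + (X - η) / 2) ((X + η) / 2) - b2 g g1 s 0 (0 + (X - η) / 2) ((X + η) / 2)) ^ 2 := by
    rw [← intervalIntegral.integral_comp_add_right (a := ρ) (b := η1) (d := t0)]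
    refine integral_congr fun x hx => ?_
    simp only [hX, show t0 + (η1 + t0 - (x + t0)) / 2 = 0 + (η1 + 2 * t0 - x) / 2 by ring, show (η1 + t0 + (x + t0)) / 2 = (η1 + 2 * t0 + x) / 2 by ring]
  have hJt : Ici (ρ + t0) ⊆ J := fun x hx => hJ (by simp only [mem_Ici] at hx ⊢; linarith)
  have hle : ρ + t0 ≤ η1 + t0 := lin!
  rw [e5, int_lin hle 2 2 (((P.c_a2 hΨ t0).mono (hJ' lin!)).fun_pow 2) (((P.c_b2 s 0 t0).mono (hJ' lin!)).fun_pow 2)] at k3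
  have k4 := P.a2_le hΨ hJt hE (hl t0) hle
  have k5 := P.b2_le (g := g) hJt hE (hu t0) hle
  have k6 := htail X hηX
  have k7 : F Y ≤ F X := mono Y X hY lin!
  have k8 : F X = ∫ x in ρ..X, a2 g I s Ψ 0 x ^ 2 := rfl
  have k9 : F Y = ∫ x in ρ..Y, a2 g I s Ψ 0 x ^ 2 := rfl
  have hEn := hE.nonneg
  linarith

end Pair

lemma abs_int_le {A f g : ℝ → ℝ} {a b x y : ℝ} (hab : a ≤ b) (hA : ContinuousOn A (Icc a b)) (hf : ContinuousOn f (Icc a b)) (hg : ContinuousOn g (Icc a b))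
    (h : ∀ r ∈ Icc a b, |A r| ≤ |f r * g r|) (hx : 0 ≤ x) (hy : 0 ≤ y)
    (h1 : ∫ r in a..b, f r ^ 2 ≤ x ^ 2) (h2 : ∫ r in a..b, g r ^ 2 ≤ y ^ 2) :
    |∫ r in a..b, A r| ≤ x * y := by
  refine (abs_integral_le_integral_abs hab).trans ?_
  refine abs_le_of_sq_le_sq' ?_ pos! |>.2
  refine (cs_le hab hA hf hg h).trans ?_
  rw [mul_pow]
  exact mul_le_mul h1 h2 (int_sq_nonneg hab) (sq_nonneg _)

namespace Pair
variable {J : Set ℝ} {g g1 I : ℝ → ℝ} {M : ℝ} (P : Pair J g g1 I M) {s : Sol} {l : ℝ} {Ψ : ℝ → ℝ → ℝ}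
include P

lemma recover (hΨ : Pot g g1 s l Ψ) (t : ℝ) {R Y A : ℝ} (hRY : R ≤ Y) (hJ : Icc R Y ⊆ J) (h0 : Ψ t R = 0) (h : ∫ r in R..Y, a2 g I s Ψ t r ^ 2 ≤ A) :
    ∫ r in R..Y, r ^ 5 * s.a t r ^ 2 ≤ A := by
  have ca : ContinuousOn (fun r => a2 g I s Ψ t r) (Icc R Y) := (P.c_a2 hΨ t).mono hJ
  have h1 := (s.ca t).mono (hJ.trans P.hJ)
  have cc : ContinuousOn (fun r => r ^ 5 * s.a t r ^ 2) (Icc R Y) := con!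
  have k2 := ftc hRY (fun r hr => P.d_exact hΨ t (hJ hr)) ((ca.fun_pow 2).fun_sub cc)
  rw [ii_sub ((ca.fun_pow 2).iint hRY) (cc.iint hRY), h0] at k2
  have i1 := P.I0 Y (hJ ⟨hRY, le_rfl⟩)
  have : 0 ≤ Ψ t Y ^ 2 / I Y := pos!
  simp only [ne_eq, OfNat.ofNat_ne_zero, not_false_eq_true, zero_pow, zero_div, sub_zero] at k2
  linarith

/-- Bound for a solution on the characteristic `r - t = R`. -/
lemma line_bound (hΨ : Pot g g1 s 0 Ψ) {R A : ℝ} (hJ : Ici R ⊆ J) (hA : 0 ≤ A) (h0 : ∀ r, 0 < r → s.u 0 r = 0 ∧ s.b 0 r = 0) (hΨ0 : Ψ 0 R = 0)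
    (h : ∀ Y, R ≤ Y → ∫ r in R..Y, a2 g I s Ψ 0 r ^ 2 ≤ A ^ 2) {X : ℝ} (hX : R ≤ X) :
    X ^ 2 * |s.u ((X - R) / 2) ((X + R) / 2)| ≤ 48 * M ^ 3 * A := by
  have hR : 0 < R := P.hJ (hJ (le_refl R))
  have hM := P.hM
  have hb : ∀ r ∈ J, b2 g g1 s 0 0 r = 0 := fun r hr => by
    obtain ⟨e1, e2⟩ := h0 r (P.hJ hr)
    rw [b2, wr, e1, e2]; simp
  have hr : ∀ ξ, R ≤ ξ → (ξ + R) / 2 ∈ J := fun ξ h => hJ (by simp only [mem_Ici]; linarith)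
  have key := fun Y (hY : R ≤ Y) => P.tri_in hΨ 0 hY (fun x hx => hJ hx.1)
  set p : ℝ → ℝ := fun ξ => a2 g I s Ψ ((ξ - R) / 2) ((ξ + R) / 2) + b2 g g1 s 0 ((ξ - R) / 2) ((ξ + R) / 2) with hp
  have cp : ∀ Y, ContinuousOn p (Icc R Y) := fun Y => by
    refine ContinuousOn.add ?_ ?_
    · exact (P.grad_a2 hΨ).cp.comp con! con! fun x hx => hr x hx.1
    · exact (P.grad_b2 s 0).cp.comp con! con! fun x hx => hr x hx.1
  have kp : ∀ Y, R ≤ Y → ∫ ξ in R..Y, p ξ ^ 2 ≤ (2 * A) ^ 2 := fun Y hY => by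
    have := key Y hY
    simp only [zero_add] at this
    refine this.trans ?_
    have e2 : ∫ x in R..Y, (2 * a2 g I s Ψ 0 x ^ 2 + 2 * b2 g g1 s 0 0 x ^ 2) = 2 * ∫ x in R..Y, a2 g I s Ψ 0 x ^ 2 := by
      rw [← ii_const_mul]
      refine ii_congr hY fun x hx => ?_
      simp only [hb x (hJ hx.1)]
      ring
    rw [e2]
    nlinarith [h Y hY]
  have dτ : ∀ ξ, HasDerivAt (fun x : ℝ => (x - R) / 2) (1 / 2) ξ := fun ξ => ((hasDerivAt_id' ξ).sub_const R).div_const 2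
  have dσ : ∀ ξ, HasDerivAt (fun x : ℝ => (x + R) / 2) (1 / 2) ξ := fun ξ => ((hasDerivAt_id' ξ).add_const R).div_const 2
  -- the coefficient functions
  have cS : ∀ Y, ContinuousOn (fun ξ : ℝ => S ((ξ + R) / 2)) (Icc R Y) := fun Y => (cont_S.comp (con! : Continuous fun ξ : ℝ => (ξ + R) / 2)).continuousOn
  have cmp : ∀ {f : ℝ → ℝ}, ContinuousOn f (Ioi 0) → ∀ Y, ContinuousOn (fun ξ : ℝ => f ((ξ + R) / 2)) (Icc R Y) := fun hf Y => hf.comp con! fun x hx => P.hJ (hr x hx.1)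
  have cg := cmp P.cg
  have cI := cmp P.cI
  have cY : ∀ Y, ContinuousOn (fun ξ => Ψ ((ξ - R) / 2) ((ξ + R) / 2) / I ((ξ + R) / 2)) (Icc R Y) := fun Y =>
    ((HasGrad.cp hΨ).comp con! con! fun x hx => P.hJ (hr x hx.1)).div (cI Y) fun x hx => (P.I0 _ (hr x hx.1)).ne'
  have kY : ∀ ξ, R ≤ ξ → |Ψ ((ξ - R) / 2) ((ξ + R) / 2) / I ((ξ + R) / 2)| ≤ 2 * A * (M ^ 2 * ξ) := by
    intro Y hY
    have c1 : ContinuousOn (fun ξ => S ((ξ + R) / 2) * g ((ξ + R) / 2) / (2 * I ((ξ + R) / 2))) (Icc R Y) := ((cS Y).mul (cg Y)).div ((cI Y).const_mul 2) fun x hx => by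
      have := P.I0 _ (hr x hx.1)
      positivity
    have k1 := ftc hY (f := fun ξ => Ψ ((ξ - R) / 2) ((ξ + R) / 2) / I ((ξ + R) / 2)) (f' := fun ξ => p ξ * (S ((ξ + R) / 2) * g ((ξ + R) / 2) / (2 * I ((ξ + R) / 2))))
      (fun ξ hξ => by
        refine ((P.grad_Y hΨ).line (dτ ξ) (dσ ξ) (hr ξ hξ.1)).congr_deriv ?_
        have := P.I0 _ (hr ξ hξ.1)
        simp only [hp]
        field_simp
        ring) ((cp Y).fun_mul c1)
    simp only [sub_self, zero_div, add_self_div_two, hΨ0, sub_zero] at k1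
    rw [← k1]
    have hY0 : 0 ≤ Y := hR.le.trans hY
    refine abs_int_le hY ((cp Y).fun_mul c1) (cp Y) c1 (fun _ _ => le_rfl) pos! pos! (kp Y hY) ?_
    have : ∫ r in R..Y, (M ^ 4 * Y) = (Y - R) * (M ^ 4 * Y) := by rw [ii_const]
    refine (int_mono hY (c1.fun_pow 2) continuousOn_const fun ξ hξ => ?_).trans (this.trans_le ?_)
    · set r := (ξ + R) / 2 with hrdef
      have hrJ : r ∈ J := hr ξ hξ.1
      have r0 : 0 < r := P.hJ hrJ
      have g0 := P.g0 r hrJ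
      have I0 := P.I0 r hrJ
      have h1 := P.gu r hrJ
      have h2 := P.Il r hrJ
      have h3 : r ≤ Y := by rw [hrdef]; linarith [hξ.1, hξ.2]
      rw [div_pow, mul_pow, S_sq r0, div_le_iff₀ pos!]
      have h4 : (r ^ 4 * g r) ^ 2 * 1 ≤ M ^ 2 * (M * (r ^ 2 * I r)) ^ 2 := by
        gcongr
        exact one_le_pow₀ h2
      have h5 : 0 < r ^ 3 := pos!
      refine le_of_mul_le_mul_left (a := r ^ 3) ?_ h5
      calc r ^ 3 * (r ^ 5 * g r ^ 2) = (r ^ 4 * g r) ^ 2 * 1 := by ring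
        _ ≤ M ^ 2 * (M * (r ^ 2 * I r)) ^ 2 := h4
        _ = (M ^ 4 * r ^ 4 * I r ^ 2) * 1 := by ring
        _ ≤ (M ^ 4 * r ^ 4 * I r ^ 2) * 4 := by gcongr; norm_num
        _ = r ^ 3 * (M ^ 4 * r * (2 * I r) ^ 2) := by ring
        _ ≤ _ := by gcongr
    · have : 0 ≤ M ^ 4 * Y * R := pos!
      nlinarith
  have hX0 : 0 < X := hR.trans_le hX
  have c1 : ContinuousOn (fun ξ => 1 / (2 * (S ((ξ + R) / 2) * g ((ξ + R) / 2)))) (Icc R X) := continuousOn_const.div (((cS X).mul (cg X)).const_mul 2) fun x hx => by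
      have h1 := P.g0 _ (hr x hx.1)
      have h2 := S_pos (P.hJ (hr x hx.1))
      positivity
  have hG : HasGrad J (fun _ r => g r) (fun _ _ => 0) (fun _ r => g1 r) :=
    (HasGrad.ofR P.dg : HasGrad (Ioi 0) (fun _ r => g r) (fun _ _ => 0) (fun _ r => g1 r)).mono P.hJ
  have k1 := ftc hX (f := fun ξ => s.u ((ξ - R) / 2) ((ξ + R) / 2) / g ((ξ + R) / 2))
      (f' := fun ξ => 1 / 2 * (Ψ ((ξ - R) / 2) ((ξ + R) / 2) / I ((ξ + R) / 2)) - p ξ * (1 / (2 * (S ((ξ + R) / 2) * g ((ξ + R) / 2)))))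
      (fun ξ hξ => by
        have hrJ := hr ξ hξ.1
        have g0 := P.g0 _ hrJ
        have I0 := P.I0 _ hrJ
        have r0 := P.hJ hrJ
        have S0 := S_pos r0
        refine ((s.gu.line (dτ ξ) (dσ ξ) r0).fun_div (hG.line (dτ ξ) (dσ ξ) hrJ) g0.ne').congr_deriv ?_
        simp only [hp, P.b2_eq hrJ, a2, zero_div]
        field_simp
        ring) ((continuousOn_const.fun_mul (cY X)).fun_sub ((cp X).fun_mul c1))
  simp only [sub_self, zero_div, add_self_div_two, (h0 R hR).1, sub_zero] at k1
  rw [ii_sub ((continuousOn_const.fun_mul (cY X)).iint hX) (((cp X).fun_mul c1).iint hX)] at k1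
  have k2 : |∫ ξ in R..X, 1 / 2 * (Ψ ((ξ - R) / 2) ((ξ + R) / 2) / I ((ξ + R) / 2))| ≤ M ^ 2 * A * X ^ 2 := by
    have := norm_integral_le_of_norm_le_const (a := R) (b := X) (C := M ^ 2 * A * X)
      (f := fun ξ => 1 / 2 * (Ψ ((ξ - R) / 2) ((ξ + R) / 2) / I ((ξ + R) / 2))) (fun ξ hξ => by
        rw [uIoc_of_le hX] at hξ
        rw [norm_mul, norm_eq_abs, norm_eq_abs, abs_of_pos (by norm_num : (0:ℝ) < 1 / 2)]
        have h1 := kY ξ hξ.1.le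
        have h2 : 2 * A * (M ^ 2 * ξ) ≤ 2 * A * (M ^ 2 * X) := by gcongr; exact hξ.2
        linarith)
    rw [norm_eq_abs, abs_of_nonneg (sub_nonneg.2 hX)] at this
    refine this.trans ?_
    have : 0 ≤ M ^ 2 * A * X * R := pos!
    nlinarith
  have k3 : |∫ ξ in R..X, p ξ * (1 / (2 * (S ((ξ + R) / 2) * g ((ξ + R) / 2))))| ≤ 2 * A * (M * X ^ 2) := by
    refine abs_int_le hX ((cp X).fun_mul c1) (cp X) c1 (fun _ _ => le_rfl) pos! pos! (kp X hX) ?_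
    have : ∫ r in R..X, (M ^ 2 * X ^ 3) = (X - R) * (M ^ 2 * X ^ 3) := by rw [ii_const]
    refine (int_mono hX (c1.fun_pow 2) continuousOn_const fun ξ hξ => ?_).trans (this.trans_le ?_)
    · set r := (ξ + R) / 2 with hrdef
      have hrJ : r ∈ J := hr ξ hξ.1
      have r0 : 0 < r := P.hJ hrJ
      have g0 := P.g0 r hrJ
      have h1 := P.gl r hrJ
      have h3 : r ≤ X := by rw [hrdef]; linarith [hξ.1, hξ.2]
      have S0 := S_pos r0
      rw [div_pow, mul_pow, mul_pow, S_sq r0, div_le_iff₀ pos!]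
      have h4 : 1 ≤ (M * (r ^ 4 * g r)) ^ 2 := one_le_pow₀ h1
      calc (1:ℝ) ^ 2 = 1 := by norm_num
        _ ≤ (M * (r ^ 4 * g r)) ^ 2 := h4
        _ = M ^ 2 * r ^ 3 * (r ^ 5 * g r ^ 2) * 1 := by ring
        _ ≤ M ^ 2 * r ^ 3 * (r ^ 5 * g r ^ 2) * 4 := by gcongr; norm_num
        _ ≤ M ^ 2 * X ^ 3 * (r ^ 5 * g r ^ 2) * 4 := by gcongr
        _ = _ := by ring
    · have : 0 ≤ M ^ 2 * X ^ 3 * R := pos!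
      nlinarith
  set r := (X + R) / 2 with hrdef
  have hrJ : r ∈ J := hr X hX
  have r0 : 0 < r := P.hJ hrJ
  have g0 := P.g0 r hrJ
  have h1 := P.gu r hrJ
  have k4 : |s.u ((X - R) / 2) r| ≤ (M ^ 2 * A * X ^ 2 + 2 * A * (M * X ^ 2)) * g r := by
    have e : |s.u ((X - R) / 2) r| / g r = |s.u ((X - R) / 2) r / g r| := by rw [abs_div, abs_of_pos g0]
    rw [← div_le_iff₀ g0, e, ← k1]
    exact (abs_sub _ _).trans (add_le_add k2 k3)
  have k5 : M ^ 2 * A * X ^ 2 + 2 * A * (M * X ^ 2) ≤ 3 * M ^ 2 * A * X ^ 2 := by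
    have : M ≤ M ^ 2 := by nlinarith
    have : A * X ^ 2 * M ≤ A * X ^ 2 * M ^ 2 := by gcongr
    linarith
  have hXr : X ≤ 2 * r := by rw [hrdef]; linarith
  have h5 : X ^ 4 * g r ≤ 16 * M := by
    calc X ^ 4 * g r ≤ (2 * r) ^ 4 * g r := by gcongr
      _ = 16 * (r ^ 4 * g r) := by ring
      _ ≤ _ := by gcongr
  calc X ^ 2 * |s.u ((X - R) / 2) r| ≤ X ^ 2 * (3 * M ^ 2 * A * X ^ 2 * g r) := by
        gcongr
        exact k4.trans (by gcongr)
    _ = 3 * M ^ 2 * A * (X ^ 4 * g r) := by ring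
    _ ≤ 3 * M ^ 2 * A * (16 * M) := by gcongr
    _ = _ := by ring

end Pair

lemma int_inv_sqrt {x y B : ℝ} (hx : 0 < x) (hxy : x ≤ y) {W : ℝ → ℝ} (hB : 0 ≤ B) (hW : ContinuousOn W (Icc x y)) (h : ∀ ξ ∈ Icc x y, |W ξ| ≤ 16 / ξ ^ 2 * (B * √ξ)) :
    |∫ ξ in x..y, W ξ| ≤ 32 * B / √x := by
  refine (abs_integral_le_integral_abs hxy).trans ?_
  have hp : ∀ ξ ∈ Icc x y, 0 < ξ := fun ξ h => hx.trans_le h.1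
  have c1 : ContinuousOn (fun ξ : ℝ => 16 / ξ ^ 2 * (B * √ξ)) (Icc x y) := by
    refine ContinuousOn.mul ?_ con!
    exact continuousOn_const.div con! fun ξ hξ => by have := hp ξ hξ; positivity
  refine (int_mono hxy hW.abs c1 h).trans ?_
  rw [ftc hxy (f := fun ξ => -(32 * B / √ξ)) (fun ξ hξ => ?_) c1]
  · have : 0 ≤ 32 * B / √y := pos!
    linarith
  · have h0 := hp ξ hξ
    have h1 := Real.sqrt_pos.2 h0
    refine (((hasDerivAt_const ξ (32 * B)).fun_div (Real.hasDerivAt_sqrt h0.ne') h1.ne').fun_neg).congr_deriv ?_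
    have : ξ = √ξ ^ 2 := (Real.sq_sqrt h0.le).symm
    generalize √ξ = y at *
    subst this
    field_simp
    ring

/-- A priori bounds for a function with `∂_η F = D`, `|∂_ξ D| ≤ 16 ξ⁻² |F|` in a characteristic
strip, given `F` on two sides and `D` on the opposite one. -/
lemma strip_aux {F D W : ℝ → ℝ → ℝ} {X0 ρ R1 T A : ℝ} (hX0 : 0 < X0) (hρ : 0 < ρ) (hρ1 : ρ ≤ R1) (hX1 : X0 ≤ R1) (hA : 0 ≤ A) (hT : R1 ≤ T)
    (cF : ContinuousOn (fun z : ℝ × ℝ => F z.1 z.2) (Ioi 0 ×ˢ Ioi 0))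
    (cD : ContinuousOn (fun z : ℝ × ℝ => D z.1 z.2) (Ioi 0 ×ˢ Ioi 0))
    (cW : ContinuousOn (fun z : ℝ × ℝ => W z.1 z.2) (Ioi 0 ×ˢ Ioi 0))
    (dF : ∀ η ξ, 0 < η → 0 < ξ → HasDerivAt (fun η => F η ξ) (D η ξ) η)
    (dD : ∀ η ξ, 0 < η → 0 < ξ → HasDerivAt (fun ξ => D η ξ) (W η ξ) ξ)
    (hW : ∀ η ξ, 0 < η → 0 < ξ → |W η ξ| ≤ 16 / ξ ^ 2 * |F η ξ|)
    (h0 : ∀ ξ, 0 < ξ → F ξ ξ = 0) (h1 : ∀ ξ, R1 ≤ ξ → |F R1 ξ| ≤ A * √ξ)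
    (h2 : ∫ η in ρ..R1, D η (η + 2 * T) ^ 2 ≤ A ^ 2) :
    ∀ η ξ, ρ ≤ η → η ≤ R1 → η ≤ ξ → X0 ≤ ξ → ξ ≤ η + 2 * T → |F η ξ| ≤ 2 * (1 + √(R1 / X0)) * exp (64 / X0 * R1) * A * √ξ ∧
      |D η ξ| ≤ |D η (η + 2 * T)| + 64 * (1 + √(R1 / X0)) * exp (64 / X0 * R1) / √X0 * A := by
  set l := 64 / X0 with hl
  have hl0 : 0 < l := pos!
  have hR1 : 0 < R1 := hρ.trans_le hρ1
  set K : Set (ℝ × ℝ) := (Icc ρ R1 ×ˢ Icc X0 (R1 + 2 * T)) ∩ {z | z.1 ≤ z.2 ∧ z.2 ≤ z.1 + 2 * T} with hK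
  have kK : IsCompact K := by
    refine (isCompact_Icc.prod isCompact_Icc).inter_right ?_
    exact (isClosed_le continuous_fst continuous_snd).inter (isClosed_le continuous_snd (continuous_fst.add continuous_const))
  have memK : ∀ η ξ, ρ ≤ η → η ≤ R1 → η ≤ ξ → X0 ≤ ξ → ξ ≤ η + 2 * T → (η, ξ) ∈ K := fun η ξ a b c d e => ⟨⟨⟨a, b⟩, d, by show ξ ≤ _; linarith⟩, c, e⟩
  have neK : K.Nonempty := ⟨(R1, R1), memK _ _ hρ1 le_rfl le_rfl hX1 lin!⟩
  have posK : ∀ z ∈ K, 0 < z.1 ∧ 0 < z.2 := fun z hz => ⟨hρ.trans_le hz.1.1.1, hX0.trans_le hz.1.2.1⟩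
  have cf : ContinuousOn (fun z : ℝ × ℝ => |F z.1 z.2| / (√z.2 * exp (l * (R1 - z.1)))) K := by
    refine ContinuousOn.div (cF.mono fun z hz => posK z hz).abs con! fun z hz => ?_
    have := Real.sqrt_pos.2 (posK z hz).2
    positivity
  obtain ⟨z0, hz0, hmax⟩ := kK.exists_isMaxOn neK cf
  set B := |F z0.1 z0.2| / (√z0.2 * exp (l * (R1 - z0.1))) with hB
  have bF : ∀ η ξ, ρ ≤ η → η ≤ R1 → η ≤ ξ → X0 ≤ ξ → ξ ≤ η + 2 * T → |F η ξ| ≤ B * exp (l * (R1 - η)) * √ξ := fun η ξ a b c d e => by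
    have := hmax (memK η ξ a b c d e)
    simp only [Set.mem_ofPred_eq] at this
    have h3 := Real.sqrt_pos.2 (hX0.trans_le d)
    rw [div_le_iff₀ pos!] at this
    linarith
  have bD : ∀ η ξ, ρ ≤ η → η ≤ R1 → η ≤ ξ → X0 ≤ ξ → ξ ≤ η + 2 * T → |D η ξ| ≤ |D η (η + 2 * T)| + 32 * (B * exp (l * (R1 - η))) / √ξ := fun η ξ a b c d e => by
    have η0 : 0 < η := hρ.trans_le a
    have ξ0 : 0 < ξ := hX0.trans_le d
    have cw : ContinuousOn (fun x => W η x) (Icc ξ (η + 2 * T)) := ContinuousOn.comp cW (f := fun x => (η, x)) con! fun x hx => ⟨η0, ξ0.trans_le hx.1⟩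
    have k1 := ftc e (fun x hx => dD η x η0 (ξ0.trans_le hx.1)) cw
    have k2 := int_inv_sqrt ξ0 e (B := B * exp (l * (R1 - η))) pos! cw fun x hx => by
      refine (hW η x η0 (ξ0.trans_le hx.1)).trans ?_
      gcongr
      exact bF η x a b (c.trans hx.1) (d.trans hx.1) hx.2
    rw [k1] at k2
    have : D η ξ = D η (η + 2 * T) - (D η (η + 2 * T) - D η ξ) := by ring
    rw [this]
    exact (abs_sub _ _).trans (by gcongr)
  have B1 : B ≤ 2 * (1 + √(R1 / X0)) * A := by
    obtain ⟨⟨⟨a, b⟩, d, -⟩, c, e⟩ := hz0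
    set η := z0.1
    set ξ := z0.2
    have ξ0 : 0 < ξ := hX0.trans_le d
    have η0 : 0 < η := hρ.trans_le a
    have sξ := Real.sqrt_pos.2 ξ0
    set m := min R1 ξ with hm
    have hηm : η ≤ m := le_min b c
    have cd : ContinuousOn (fun x => D x ξ) (Icc η m) := ContinuousOn.comp cD (f := fun x => (x, ξ)) con! fun x hx => ⟨η0.trans_le hx.1, ξ0⟩
    have k1 := ftc hηm (fun x hx => dF x ξ (η0.trans_le hx.1) ξ0) cd
    have k2 : |F m ξ| ≤ A * √ξ := by
      rcases le_total R1 ξ with h | h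
      · rw [hm, min_eq_left h]; exact h1 ξ h
      · rw [hm, min_eq_right h, h0 ξ ξ0, abs_zero]; positivity
    have cq : ContinuousOn (fun x => D x (x + 2 * T)) (Icc ρ R1) :=
      ContinuousOn.comp cD (f := fun x => (x, x + 2 * T)) con! fun x hx => ⟨hρ.trans_le hx.1, show (0:ℝ) < _ by linarith [hx.1]⟩
    have sub : Icc η m ⊆ Icc ρ R1 := Icc_subset_Icc a (min_le_left _ _)
    have k3 : |∫ x in η..m, D x ξ| ≤ √R1 * A + 32 / √ξ * B * (exp (l * (R1 - η)) / l) := by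
      refine (abs_integral_le_integral_abs hηm).trans ?_
      have ce : ContinuousOn (fun x => 32 / √ξ * B * exp (l * (R1 - x))) (Icc η m) := con!
      have cq' := (cq.mono sub).abs
      refine (int_mono hηm cd.abs (cq'.fun_add ce) fun x hx => ?_).trans ?_
      · refine (bD x ξ (sub hx).1 (sub hx).2 (hx.2.trans (min_le_right _ _)) d (by linarith [hx.1])).trans (le_of_eq ?_)
        ring
      rw [ii_add (cq'.iint hηm) (ce.iint hηm)]
      refine add_le_add ?_ ?_
      · have := abs_int_le hηm cq' (continuousOn_const (c := (1:ℝ))) (cq.mono sub) (x := √R1) (y := A) (fun x _ => by simp) pos! hA (by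
            simp only [one_pow, ii_const, mul_one]
            rw [Real.sq_sqrt hR1.le]
            have : m ≤ R1 := min_le_left _ _
            linarith) ((int_mono_set a hηm (min_le_left _ _) (cq.fun_pow 2) (fun _ _ => sq_nonneg _)).trans h2)
        exact (le_abs_self _).trans this
      · rw [ftc hηm (f := fun x => 32 / √ξ * B * (-(exp (l * (R1 - x)) / l))) (fun x _ => ?_) ce]
        · have : 0 ≤ 32 / √ξ * B * (exp (l * (R1 - m)) / l) := pos!
          linarith
        · refine ((((((hasDerivAt_id' x).const_sub R1).const_mul l).exp).div_const l).fun_neg.const_mul _).congr_deriv ?_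
          field_simp
    have k4 : |F η ξ| ≤ A * √ξ + (√R1 * A + 32 / √ξ * B * (exp (l * (R1 - η)) / l)) := by
      have : F η ξ = F m ξ - (F m ξ - F η ξ) := by ring
      rw [this, ← k1]
      exact (abs_sub _ _).trans (add_le_add k2 k3)
    have k5 : B * (√ξ * exp (l * (R1 - η))) = |F η ξ| := by rw [hB]; field_simp
    have k6 : 32 / √ξ * B * (exp (l * (R1 - η)) / l) ≤ B * (√ξ * exp (l * (R1 - η))) / 2 := by
      rw [hl]
      have : √ξ ^ 2 = ξ := Real.sq_sqrt ξ0.le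
      have h5 : 32 / √ξ * B * (exp (64 / X0 * (R1 - η)) / (64 / X0)) = B * exp (64 / X0 * (R1 - η)) * (X0 / √ξ) / 2 := by field_simp; ring
      rw [h5]
      have h6 : X0 / √ξ ≤ √ξ := by rw [div_le_iff₀ sξ]; nlinarith
      have : B * exp (64 / X0 * (R1 - η)) * (X0 / √ξ) ≤ B * exp (64 / X0 * (R1 - η)) * √ξ := by gcongr
      linarith
    have k7 : √R1 ≤ √(R1 / X0) * √ξ := by
      rw [← Real.sqrt_mul pos!]
      apply Real.sqrt_le_sqrt
      rw [div_mul_eq_mul_div, le_div_iff₀ hX0]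
      gcongr
    have k8 : √R1 * A ≤ √(R1 / X0) * √ξ * A := by gcongr
    have k9 : B * √ξ ≤ B * (√ξ * exp (l * (R1 - η))) := by
      have : 1 ≤ exp (l * (R1 - η)) := by apply one_le_exp; have := sub_nonneg.2 b; positivity
      gcongr
      nlinarith
    have k10 : B * √ξ ≤ 2 * (1 + √(R1 / X0)) * A * √ξ := lin!
    exact le_of_mul_le_mul_right k10 sξ
  intro η ξ a b c d e
  constructor
  · refine (bF η ξ a b c d e).trans ?_
    calc B * exp (l * (R1 - η)) * √ξ ≤ (2 * (1 + √(R1 / X0)) * A) * exp (l * R1) * √ξ := by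
          gcongr; linarith
      _ = _ := by ring
  · refine (bD η ξ a b c d e).trans ?_
    have : 32 * (B * exp (l * (R1 - η))) / √ξ ≤ 32 * ((2 * (1 + √(R1 / X0)) * A) * exp (l * R1)) / √X0 := by
      have := Real.sqrt_pos.2 hX0
      gcongr
      linarith
    refine add_le_add le_rfl (this.trans (le_of_eq ?_))
    ring

/-- `∂_η (r^{5/2} u)` in the characteristic coordinates `η = r - t`, `ξ = r + t`. -/
def Dm (s : Sol) (t r : ℝ) : ℝ := (5 / (2 * r) * S r * s.u t r + S r * s.b t r - S r * s.a t r) / 2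

/-- `∂_ξ ∂_η (r^{5/2} u)`. -/
def Wm (s : Sol) (t r : ℝ) : ℝ := (15 / (4 * r ^ 2) + Vp r) / 4 * (S r * s.u t r)

lemma dS1 {r : ℝ} (hr : 0 < r) : HasDerivAt (fun r => 5 / (2 * r) * S r) (15 / (4 * r ^ 2) * S r) r := by
  refine (((hasDerivAt_const r (5:ℝ)).fun_div ((hasDerivAt_id' r).const_mul 2) pos!).fun_mul (dS hr)).congr_deriv ?_
  field_simp
  ring

lemma abs_Vp {r : ℝ} (hr : 0 < r) : |Vp r| ≤ 12 / r ^ 2 := by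
  rw [Vp, abs_div, abs_of_neg (by norm_num : (-1152:ℝ) < 0), abs_of_pos pos!, div_le_div_iff₀ pos! pos!]
  nlinarith [sq_nonneg (r ^ 2 - 24)]

lemma Sol.grad_Su (s : Sol) : HasGrad (Ioi 0) (fun t r => S r * s.u t r) (fun t r => S r * s.a t r) (fun t r => 5 / (2 * r) * S r * s.u t r + S r * s.b t r) :=
  ((HasGrad.ofR (fun r hr => dS hr)).mul s.gu).congr (fun t r hr => by ring) fun t r hr => by ring

lemma Sol.grad_Dm (s : Sol) : HasGrad (Ioi 0) (Dm s) (fun t r => (5 / (2 * r) * S r * s.a t r + S r * s.aR t r - S r * s.aT t r) / 2)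
    (fun t r => (15 / (4 * r ^ 2) * S r * s.u t r + 5 / r * S r * s.b t r + S r * s.bR t r - 5 / (2 * r) * S r * s.a t r - S r * s.aR t r) / 2) := by
  have h1 := (HasGrad.ofR (fun r (hr : r ∈ Ioi (0:ℝ)) => dS1 hr)).mul s.gu
  have h2 := (HasGrad.ofR (fun r (hr : r ∈ Ioi (0:ℝ)) => dS hr)).mul s.gb
  have h3 := (HasGrad.ofR (fun r (hr : r ∈ Ioi (0:ℝ)) => dS hr)).mul s.ga
  refine (((((h1.add h2).sub h3).smul (1/2)).congr_fun isOpen_Ioi (fun t r hr => ?_))).congr (fun t r hr => ?_) (fun t r hr => ?_)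
  · simp only [Dm]; ring
  · ring
  · have : (0:ℝ) < r := hr
    field_simp; ring

lemma Sol.strip (s : Sol) {X0 ρ R1 T A : ℝ} (hX0 : 0 < X0) (hρ : 0 < ρ) (hρ1 : ρ ≤ R1) (hX1 : X0 ≤ R1) (hA : 0 ≤ A) (hT : R1 ≤ T) (h0 : ∀ r, 0 < r → s.u 0 r = 0)
    (h1 : ∀ ξ, R1 ≤ ξ → ξ ^ 2 * |s.u ((ξ - R1) / 2) ((ξ + R1) / 2)| ≤ A)
    (hE : EB s (ρ + T) T (A ^ 2 / 6)) (hu : Tendsto (fun r => s.u T r) atTop (𝓝 0)) :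
    ∃ q : ℝ → ℝ, ContinuousOn q (Icc ρ R1) ∧ ∫ η in ρ..R1, q η ^ 2 ≤ A ^ 2 ∧
    ∀ η ξ, ρ ≤ η → η ≤ R1 → η ≤ ξ → X0 ≤ ξ → ξ ≤ 2 * T → |S ((ξ + η) / 2) * s.u ((ξ - η) / 2) ((ξ + η) / 2)| ≤ 2 * (1 + √(R1 / X0)) * exp (64 / X0 * R1) * A * √ξ ∧
      |Dm s ((ξ - η) / 2) ((ξ + η) / 2)| ≤ |q η| + 64 * (1 + √(R1 / X0)) * exp (64 / X0 * R1) / √X0 * A := by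
  have hT0 : 0 < T := lin!
  have cc : ∀ {f : ℝ → ℝ → ℝ}, CP (Ioi 0) f → ContinuousOn (fun z : ℝ × ℝ => f ((z.2 - z.1) / 2) ((z.2 + z.1) / 2)) (Ioi 0 ×ˢ Ioi 0) := fun hf =>
    ContinuousOn.comp hf (f := fun z : ℝ × ℝ => ((z.2 - z.1) / 2, (z.2 + z.1) / 2)) con! fun z hz => ⟨mem_univ _, by
        have h1 : 0 < z.1 := hz.1
        have h2 : 0 < z.2 := hz.2
        exact (show 0 < (z.2 + z.1) / 2 by positivity)⟩
  have cWm : CP (Ioi 0) (Wm s) := by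
    refine CP.mul (CP.ofR ?_) s.grad_Su.cp
    refine ContinuousOn.div_const (ContinuousOn.add ?_ cont_Vp.continuousOn) _
    exact continuousOn_const.div con! fun r hr => by
      have : (0:ℝ) < r := hr
      positivity
  have rp : ∀ {η ξ : ℝ}, 0 < η → 0 < ξ → (ξ + η) / 2 ∈ Ioi (0:ℝ) := fun h h' => show (0:ℝ) < _ by positivity
  have cq := cc s.grad_Dm.cp
  have hq : ∫ η in ρ..R1, Dm s ((η + 2 * T - η) / 2) ((η + 2 * T + η) / 2) ^ 2 ≤ A ^ 2 := by
    have e1 : ∫ η in ρ..R1, Dm s ((η + 2 * T - η) / 2) ((η + 2 * T + η) / 2) ^ 2 = ∫ r in (ρ + T)..(R1 + T), Dm s T r ^ 2 := by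
      rw [← intervalIntegral.integral_comp_add_right (fun r => Dm s T r ^ 2)]
      congr 1; ext η; congr 2 <;> ring
    rw [e1]
    have h3 : 0 < ρ + T := pos!
    have h4 : ρ + T ≤ R1 + T := lin!
    have k1 := hardy_u hE h3 hu h4
    have k2 := hE _ h4
    have ci := s.cu T |>.icc h3 (R1 + T)
    have cd : ContinuousOn (fun r => Dm s T r) (Icc (ρ + T) (R1 + T)) := (s.grad_Dm.cp.slice T).icc h3 _
    refine (int_le_lin h4 5 1 (cd.fun_pow 2) (f := fun r => r ^ 3 * s.u T r ^ 2) (g := fun r => r ^ 5 * (s.a T r ^ 2 + s.b T r ^ 2)) con!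
      (s.ce T h3) fun r hr => ?_).trans lin!
    have r0 : 0 < r := h3.trans_le hr.1
    have e2 : Dm s T r ^ 2 = S r ^ 2 * (5 / (2 * r) * s.u T r + s.b T r - s.a T r) ^ 2 / 4 := by simp only [Dm]; ring
    have e3 : r ^ 3 * s.u T r ^ 2 = r ^ 5 * (s.u T r / r) ^ 2 := by field_simp
    have e4 : 5 / (2 * r) * s.u T r = 5 / 2 * (s.u T r / r) := by field_simp
    rw [e2, S_sq r0, e3, e4]
    generalize s.u T r / r = y
    generalize s.a T r = a
    generalize s.b T r = b
    have : (5 / 2 * y + b - a) ^ 2 / 4 ≤ 5 * y ^ 2 + (a ^ 2 + b ^ 2) := by nlinarith [sq_nonneg (a + b), sq_nonneg (5 / 2 * y - b), sq_nonneg (5 / 2 * y + a)]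
    have := mul_le_l this (pos! : 0 ≤ r ^ 5)
    linarith
  have key := strip_aux (F := fun η ξ => S ((ξ + η) / 2) * s.u ((ξ - η) / 2) ((ξ + η) / 2)) (D := fun η ξ => Dm s ((ξ - η) / 2) ((ξ + η) / 2))
    (W := fun η ξ => Wm s ((ξ - η) / 2) ((ξ + η) / 2)) hX0 hρ hρ1 hX1 hA hT
    (cc s.grad_Su.cp) (cc s.grad_Dm.cp) (cc cWm)
    (fun η ξ hη hξ => by
      refine (s.grad_Su.line (((hasDerivAt_id' η).const_sub ξ).div_const 2) (((hasDerivAt_id' η).const_add ξ).div_const 2) (rp hη hξ)).congr_deriv ?_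
      simp only [Dm]; ring)
    (fun η ξ hη hξ => by
      have h := rp hη hξ
      refine (s.grad_Dm.line (((hasDerivAt_id' ξ).sub_const η).div_const 2) (((hasDerivAt_id' ξ).add_const η).div_const 2) h).congr_deriv ?_
      rw [s.pde _ _ h]
      simp only [Wm]; ring)
    (fun η ξ hη hξ => by
      rw [Wm, abs_mul]
      gcongr
      have h : 0 < (ξ + η) / 2 := rp hη hξ
      have h3 : ξ / 2 ≤ (ξ + η) / 2 := lin!
      set r := (ξ + η) / 2
      have h4 := abs_Vp h
      rw [abs_div, abs_of_pos (by norm_num : (0:ℝ) < 4)]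
      have h5 : |15 / (4 * r ^ 2) + Vp r| ≤ 16 / r ^ 2 := by
        refine (abs_add_le _ _).trans ?_
        rw [abs_of_pos pos!]
        have : 16 / r ^ 2 = 15 / (4 * r ^ 2) + 12 / r ^ 2 + 1 / (4 * r ^ 2) := by field_simp; norm_num
        have : 0 < 1 / (4 * r ^ 2) := pos!
        linarith
      have h6 : 16 / r ^ 2 ≤ 64 / ξ ^ 2 := by
        rw [div_le_div_iff₀ pos! pos!]
        nlinarith
      calc _ ≤ 64 / ξ ^ 2 / 4 := lin!
        _ = _ := by ring)
    (fun ξ hξ => by simp only [sub_self, zero_div, add_self_div_two, h0 ξ hξ, mul_zero])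
    (fun ξ hξ => by
      have hR : 0 < R1 := hX0.trans_le hX1
      have x0 : 0 < ξ := hR.trans_le hξ
      rw [abs_mul]
      set r := (ξ + R1) / 2 with hr
      have r0 : 0 < r := pos!
      have hrξ : r ≤ ξ := by rw [hr]; linarith
      rw [abs_of_pos (S_pos r0)]
      have := h1 ξ hξ
      calc S r * |s.u ((ξ - R1) / 2) r| ≤ ξ ^ 2 * √ξ * |s.u ((ξ - R1) / 2) r| := by
            unfold S; gcongr
        _ = (ξ ^ 2 * |s.u ((ξ - R1) / 2) r|) * √ξ := by ring
        _ ≤ _ := by gcongr) hq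
  refine ⟨_, ?_, ?_, fun η ξ a b c d e => key η ξ a b c d (e.trans lin!)⟩
  · exact ContinuousOn.comp cq (f := fun x => (x, x + 2 * T)) con! fun x hx => ⟨hρ.trans_le hx.1, show (0:ℝ) < _ by linarith [hx.1]⟩
  · exact hq

lemma exists_bound {f : ℝ → ℝ} {a b : ℝ} (hf : ContinuousOn f (Icc a b)) : ∃ C, 0 ≤ C ∧ ∀ x ∈ Icc a b, |f x| ≤ C := by
  obtain ⟨C, hC⟩ := isCompact_Icc.exists_bound_of_continuousOn hf
  exact ⟨max C 0, le_max_right _ _, fun x hx => (hC x hx).trans (le_max_left _ _)⟩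

lemma hardy_inner {Z Z' : ℝ → ℝ} {ρ X : ℝ} (hρ : 0 < ρ) (hX : ρ ≤ X) (hZ : Z ρ = 0) (dZ : ∀ r ∈ Icc ρ X, HasDerivAt Z (Z' r) r) (cZ : ContinuousOn Z' (Icc ρ X)) :
    ∫ r in ρ..X, (r ^ 3)⁻¹ * Z r ^ 2 ≤ ∫ r in ρ..X, r⁻¹ * Z' r ^ 2 := by
  have hp : ∀ r ∈ Icc ρ X, 0 < r := fun r h => hρ.trans_le h.1
  have cZ0 : ContinuousOn Z (Icc ρ X) := fun r hr => (dZ r hr).cwa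
  have ci : ∀ n : ℕ, ContinuousOn (fun r : ℝ => (r ^ n)⁻¹) (Icc ρ X) := fun n => ContinuousOn.inv₀ con! fun r hr => by have := hp r hr; positivity
  have ci1 : ContinuousOn (fun r : ℝ => r⁻¹) (Icc ρ X) := by simpa using ci 1
  have h3 := ci 3
  have := mono_ftc hX (A := fun r => (r ^ 3)⁻¹ * Z r ^ 2) (B := fun r => r⁻¹ * Z' r ^ 2) (P := fun r => -((r ^ 2)⁻¹ * Z r ^ 2))
    (P' := fun r => 2 * ((r ^ 3)⁻¹ * Z r ^ 2) - 2 * ((r ^ 2)⁻¹ * (Z r * Z' r)))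
    con! con! con! (fun r hr => by
      have := hp r hr
      refine ((((hasDerivAt_pow 2 r).fun_inv pos!).fun_mul ((dZ r hr).fun_pow 2)).fun_neg).congr_deriv ?_
      simp only [Nat.cast_ofNat]
      field_simp
      ring) (fun r hr => by
      have h0 := hp r hr
      have e : r⁻¹ * Z' r ^ 2 + (2 * ((r ^ 3)⁻¹ * Z r ^ 2) - 2 * ((r ^ 2)⁻¹ * (Z r * Z' r))) - (r ^ 3)⁻¹ * Z r ^ 2 = r⁻¹ * (Z' r - Z r / r) ^ 2 := by field_simp; ring
      have : 0 ≤ r⁻¹ * (Z' r - Z r / r) ^ 2 := pos!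
      linarith)
  rw [hZ] at this
  have h0 : 0 < X := hp X ⟨hX, le_rfl⟩
  have : 0 ≤ (X ^ 2)⁻¹ * Z X ^ 2 := pos!
  simp only [ne_eq, OfNat.ofNat_ne_zero, not_false_eq_true, zero_pow, mul_zero, neg_zero, sub_zero] at *
  linarith

namespace Pair
variable {J : Set ℝ} {g g1 I : ℝ → ℝ} {M : ℝ} (P : Pair J g g1 I M)
include P

/-- From `L²` control of `a2` to `L²` control of `a - γ g` on `[ρ, X]` (inner region). -/
lemma inner_recover {s : Sol} {l : ℝ} {Ψ : ℝ → ℝ → ℝ} (hΨ : Pot g g1 s l Ψ) {ρ X A : ℝ} (hρ : 0 < ρ) (hX : ρ ≤ X) (hJ : Icc ρ X ⊆ J) (hA : 0 ≤ A) (h0 : Ψ 0 X = 0)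
    (h : ∫ r in ρ..X, a2 g I s Ψ 0 r ^ 2 ≤ A ^ 2) :
    ∃ γ, |γ| ≤ A * (M ^ 2 * X) ∧ ∫ r in ρ..X, r ^ 5 * (s.a 0 r - γ * g r) ^ 2 ≤ (2 + 2 * M ^ 6) * A ^ 2 := by
  have hM := P.hM
  have hp : ∀ r ∈ Icc ρ X, 0 < r := fun r h => hρ.trans_le h.1
  set Y : ℝ → ℝ := fun r => Ψ 0 r / I r with hY
  have ca : ContinuousOn (fun r => a2 g I s Ψ 0 r) (Icc ρ X) := (P.c_a2 hΨ 0).mono hJ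
  have cg : ContinuousOn g (Icc ρ X) := P.cg.mono fun r hr => hp r hr
  have cI : ContinuousOn I (Icc ρ X) := P.cI.mono fun r hr => hp r hr
  have cs : ContinuousOn (fun r => s.a 0 r) (Icc ρ X) := (s.ca 0).mono fun r hr => hp r hr
  have cS' : ContinuousOn S (Icc ρ X) := cont_S.continuousOn
  have ck : ContinuousOn (fun r => S r * g r / I r) (Icc ρ X) := (cS'.mul cg).div cI fun r hr => (P.I0 r (hJ hr)).ne'
  have dY : ∀ r ∈ Icc ρ X, HasDerivAt Y (a2 g I s Ψ 0 r * (S r * g r / I r)) r := fun r hr => ((P.grad_Y hΨ).dr 0 (hJ hr)).congr_deriv (by ring)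
  have cY' := ca.fun_mul ck
  have cYY : ContinuousOn Y (Icc ρ X) := fun r hr => (dY r hr).cwa
  have bk : ∀ r ∈ Icc ρ X, (S r * g r / I r) ^ 2 ≤ M ^ 4 * r := fun r hr => by
    have r0 := hp r hr
    have I0 := P.I0 r (hJ hr)
    have g0 := P.g0 r (hJ hr)
    have h1 := P.gu r (hJ hr)
    have h2 := P.Il r (hJ hr)
    rw [div_pow, mul_pow, S_sq r0, div_le_iff₀ pos!]
    refine le_of_mul_le_mul_left (a := r ^ 3) ?_ pos!
    calc r ^ 3 * (r ^ 5 * g r ^ 2) = (r ^ 4 * g r) ^ 2 * 1 := by ring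
      _ ≤ M ^ 2 * (M * (r ^ 2 * I r)) ^ 2 := by gcongr; exact one_le_pow₀ h2
      _ = _ := by ring
  have hYX : Y X = 0 := by simp [hY, h0]
  refine ⟨Y ρ, ?_, ?_⟩
  · have k1 := ftc hX dY cY'
    rw [hYX, zero_sub] at k1
    have hX0 : 0 < X := hp X ⟨hX, le_rfl⟩
    have k2 := abs_int_le hX cY' ca ck (fun _ _ => le_rfl) hA (pos! : 0 ≤ M ^ 2 * X) h (by
      refine (int_mono hX (ck.fun_pow 2) (continuousOn_const (c := M ^ 4 * X)) fun r hr => ?_).trans ?_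
      · refine (bk r hr).trans ?_
        gcongr
        exact hr.2
      · rw [ii_const]
        have : 0 ≤ M ^ 4 * X * ρ := pos!
        nlinarith)
    rwa [k1, abs_neg] at k2
  · have hh := hardy_inner (Z := fun r => Y r - Y ρ) hρ hX (sub_self _) (fun r hr => (dY r hr).sub_const _) cY'
    have ci : ContinuousOn (fun r : ℝ => (r ^ 3)⁻¹) (Icc ρ X) := ContinuousOn.inv₀ con! fun r hr => by have := hp r hr; positivity
    have ci1 : ContinuousOn (fun r : ℝ => r⁻¹) (Icc ρ X) := ContinuousOn.inv₀ con! fun r hr => by have := hp r hr; positivity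
    have h3 : ∫ r in ρ..X, r⁻¹ * (a2 g I s Ψ 0 r * (S r * g r / I r)) ^ 2 ≤ M ^ 4 * A ^ 2 := by
      refine (int_le_mul hX (M ^ 4) con! (ca.fun_pow 2) fun r hr => ?_).trans (mul_le_l h pos!)
      have r0 := hp r hr
      calc r⁻¹ * (a2 g I s Ψ 0 r * (S r * g r / I r)) ^ 2
          = r⁻¹ * a2 g I s Ψ 0 r ^ 2 * (S r * g r / I r) ^ 2 := by ring
        _ ≤ r⁻¹ * a2 g I s Ψ 0 r ^ 2 * (M ^ 4 * r) := by gcongr; exact bk r hr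
        _ = _ := by field_simp
    refine (int_le_lin hX 2 (2 * M ^ 2) con! (ca.fun_pow 2) (ci.fun_mul ((cYY.fun_sub continuousOn_const).fun_pow 2)) fun r hr => ?_).trans
      ((add_le_add (mul_le_l h (by norm_num)) (mul_le_l (hh.trans h3) pos!)).trans (le_of_eq (by ring)))
    have r0 := hp r hr
    have S0 := S_pos r0
    have I0 := P.I0 r (hJ hr)
    have g0 := P.g0 r (hJ hr)
    have h1 := P.gu r (hJ hr)
    have e1 : r ^ 5 * (s.a 0 r - Y ρ * g r) ^ 2 = (S r * g r * (Y r - Y ρ) - a2 g I s Ψ 0 r) ^ 2 := by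
      rw [← S_sq r0]
      simp only [a2, hY]
      field_simp
      ring
    have e2 : (S r * g r * (Y r - Y ρ)) ^ 2 ≤ M ^ 2 * ((r ^ 3)⁻¹ * (Y r - Y ρ) ^ 2) := by
      rw [mul_pow, mul_pow, S_sq r0]
      have : r ^ 5 * g r ^ 2 = (r ^ 4 * g r) ^ 2 * (r ^ 3)⁻¹ := by field_simp
      rw [this]
      calc _ ≤ M ^ 2 * (r ^ 3)⁻¹ * (Y r - Y ρ) ^ 2 := by gcongr
        _ = _ := by ring
    rw [e1]
    nlinarith [sq_nonneg (S r * g r * (Y r - Y ρ) + a2 g I s Ψ 0 r)]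

set_option maxHeartbeats 1000000 in
/-- Inner channel estimate: control of the solution on the characteristic `r + t = X` gives control
of `∂ₜu(0)` modulo `g` on `[ρ, X]`. -/
lemma inner_odd {X Cs : ℝ} (hX : 0 < X) (hJ : Ioc 0 X ⊆ J) (hCs : 0 ≤ Cs) : ∃ C, 0 ≤ C ∧ ∀ (s : Sol) (ρ A : ℝ) (q : ℝ → ℝ), (∀ r, 0 < r → s.u 0 r = 0 ∧ s.b 0 r = 0) →
      0 < ρ → ρ ≤ X → 0 ≤ A → ContinuousOn q (Icc ρ X) → ∫ η in ρ..X, q η ^ 2 ≤ A ^ 2 →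
      (∀ η, ρ ≤ η → η ≤ X → |S ((X + η) / 2) * s.u ((X - η) / 2) ((X + η) / 2)| ≤ Cs * A ∧ |Dm s ((X - η) / 2) ((X + η) / 2)| ≤ |q η| + Cs * A) →
      ∃ γ, |γ| ≤ C * A ∧ ∫ r in ρ..X, r ^ 5 * (s.a 0 r - γ * g r) ^ 2 ≤ C * A ^ 2 := by
  have hM := P.hM
  have hK : Icc (X / 2) X ⊆ Ioi (0:ℝ) := Icc_pos pos!
  have hKJ : Icc (X / 2) X ⊆ J := fun r hr => hJ ⟨hK hr, hr.2⟩
  have cS' : ContinuousOn S (Icc (X / 2) X) := cont_S.continuousOn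
  have cg := P.cg.mono hK
  have cg1 := P.cg1.mono hK
  have cI := P.cI.mono hK
  have cr : ContinuousOn (fun r : ℝ => r⁻¹) (Icc (X / 2) X) := ContinuousOn.inv₀ con! fun r hr => (hK hr : (0:ℝ) < r).ne'
  obtain ⟨K1, K10, hK1⟩ := exists_bound (cS'.fun_mul cg)
  obtain ⟨K2, K20, hK2⟩ := exists_bound
    (((cS'.fun_mul cg).fun_mul cr).fun_mul (continuousOn_const (c := 5 / 4)) |>.fun_add ((cS'.fun_mul cg1).fun_mul (continuousOn_const (c := 1 / 2))))
  obtain ⟨K3, K30, hK3⟩ := exists_bound (f := fun r => S r * g r / I r) ((cS'.fun_mul cg).div cI fun r hr => (P.I0 r (hKJ hr)).ne')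
  obtain ⟨K4, K40, hK4⟩ := exists_bound (f := fun r => r⁻¹ * (5 / 2) + g1 r / g r) ((cr.fun_mul (continuousOn_const (c := 5 / 2))).fun_add
    (cg1.div cg fun r hr => (P.g0 r (hKJ hr)).ne'))
  -- bound for the potential on the edge
  set KΨ := K1 * (√X + Cs * X) + K2 * Cs * X with hKΨ
  set K5 := K4 * Cs + K3 * KΨ + 2 * Cs with hK5
  set B := 4 * √(8 + 2 * K5 ^ 2 * X) with hB
  refine ⟨max (B * (M ^ 2 * X)) ((2 + 2 * M ^ 6) * B ^ 2), le_max_of_le_left pos!, ?_⟩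
  intro s ρ A q h0 hρ hρX hA cq hq hst
  obtain ⟨Ψ, hΨ, hΨ0⟩ := Pot.exists P.dg P.dg1 s 0 0 X 0
  have hρ0 : ∀ η ∈ Icc ρ X, 0 < η := fun η h => hρ.trans_le h.1
  have hr : ∀ η ∈ Icc ρ X, (X + η) / 2 ∈ Icc (X / 2) X := fun η h => ⟨by linarith [hρ0 η h], by linarith [h.2]⟩
  have hrp : ∀ η ∈ Icc ρ X, 0 < (X + η) / 2 := fun η h => hK (hr η h)
  have hrJ : ∀ η ∈ Icc ρ X, (X + η) / 2 ∈ J := fun η h => hKJ (hr η h)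
  have dτ : ∀ η, HasDerivAt (fun η : ℝ => (X - η) / 2) (-1 / 2) η := fun η => ((hasDerivAt_id' η).const_sub X).div_const 2
  have dσ : ∀ η, HasDerivAt (fun η : ℝ => (X + η) / 2) (1 / 2) η := fun η => ((hasDerivAt_id' η).const_add X).div_const 2
  have cc : ∀ {f : ℝ → ℝ → ℝ}, CP (Ioi 0) f → ContinuousOn (fun η => f ((X - η) / 2) ((X + η) / 2)) (Icc ρ X) := fun hf => hf.comp con! con! hrp
  have bΨ : ∀ η ∈ Icc ρ X, |Ψ ((X - η) / 2) ((X + η) / 2)| ≤ KΨ * A := by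
    intro η hη
    have hsub : Icc η X ⊆ Icc ρ X := Icc_subset_Icc_left hη.1
    have cd : ContinuousOn (fun η => (0 - wr g g1 s ((X - η) / 2) ((X + η) / 2)) * (-1 / 2) +
        -(((X + η) / 2) ^ 5 * g ((X + η) / 2) * s.a ((X - η) / 2) ((X + η) / 2)) * (1 / 2))
        (Icc η X) := by
      have e1 := (cc (wr_grad P.dg P.dg1 s).cp).mono hsub
      have e2 := (cc s.ga.cp).mono hsub
      have e3 := (cc (CP.ofR P.cg)).mono hsub
      have e4 : ContinuousOn (fun η : ℝ => ((X + η) / 2) ^ 5) (Icc η X) := con!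
      exact ((continuousOn_const.fun_sub e1).fun_mul continuousOn_const).fun_add (((e4.fun_mul e3).fun_mul e2).fun_neg.fun_mul continuousOn_const)
    have k1 := ftc hη.2 (f := fun η => Ψ ((X - η) / 2) ((X + η) / 2)) (fun x hx => HasGrad.line hΨ (dτ x) (dσ x) (hrp x (hsub hx))) cd
    simp only [sub_self, zero_div, add_self_div_two, hΨ0] at k1
    rw [zero_sub] at k1
    rw [← abs_neg, ← k1]
    refine (abs_integral_le_integral_abs hη.2).trans ?_
    have cq' := (cq.mono hsub).abs
    refine (int_le_lin hη.2 K1 1 cd.abs cq' (continuousOn_const (c := K1 * (Cs * A) + K2 * (Cs * A))) fun x hx => ?_).trans ?_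
    · have h1 := hK1 _ (hr x (hsub hx))
      have h2 := hK2 _ (hr x (hsub hx))
      obtain ⟨h3, h4⟩ := hst x (hsub hx).1 hx.2
      have r0 := hrp x (hsub hx)
      set r := (X + x) / 2
      set t := (X - x) / 2
      have S0 := S_pos r0
      have e : (0 - wr g g1 s t r) * (-1 / 2) + -(r ^ 5 * g r * s.a t r) * (1 / 2) =
          S r * g r * Dm s t r - (S r * g r * r⁻¹ * (5 / 4) + S r * g1 r * (1 / 2)) * (S r * s.u t r) := by
        rw [wr, ← S_sq r0, Dm]; field_simp; ring
      rw [e]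
      refine (abs_sub _ _).trans ?_
      rw [abs_mul (S r * g r), abs_mul (S r * g r * r⁻¹ * (5 / 4) + S r * g1 r * (1 / 2))]
      calc _ ≤ K1 * (|q x| + Cs * A) + K2 * (Cs * A) := by gcongr
        _ = _ := by ring
    · have k2 : ∫ x in η..X, |q x| ≤ √X * A := by
        have := abs_int_le hη.2 cq' (continuousOn_const (c := (1:ℝ))) (cq.mono hsub) (x := √X) (y := A) (fun x _ => by simp) pos! hA (by
            simp only [one_pow, ii_const, mul_one]
            rw [Real.sq_sqrt hX.le]
            linarith [hρ0 η hη]) ((int_mono_set hη.1 hη.2 le_rfl (cq.fun_pow 2) (fun _ _ => sq_nonneg _)).trans hq)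
        exact (le_abs_self _).trans this
      rw [ii_const]
      have k3 : (X - η) * (K1 * (Cs * A) + K2 * (Cs * A)) ≤ X * (K1 * (Cs * A) + K2 * (Cs * A)) := by
        gcongr
        linarith [hρ0 η hη]
      have k4 := mul_le_l k2 K10
      rw [hKΨ]
      linarith
  have hJ' : Icc ρ X ⊆ J := fun r hr => hJ ⟨hρ0 r hr, hr.2⟩
  have hb : ∀ r ∈ J, b2 g g1 s 0 0 r = 0 := fun r hr => by
    obtain ⟨e1, e2⟩ := h0 r (P.hJ hr)
    rw [b2, wr, e1, e2]; simp
  have k5 := P.tri_odd hΨ 0 hρX hJ' hb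
  simp only [zero_add] at k5
  have cp : ContinuousOn (fun η => a2 g I s Ψ ((X - η) / 2) ((X + η) / 2) - b2 g g1 s 0 ((X - η) / 2) ((X + η) / 2)) (Icc ρ X) :=
    ((P.grad_a2 hΨ).cp.comp con! con! hrJ).sub ((P.grad_b2 s 0).cp.comp con! con! hrJ)
  have k6 : ∫ η in ρ..X, (a2 g I s Ψ ((X - η) / 2) ((X + η) / 2) - b2 g g1 s 0 ((X - η) / 2) ((X + η) / 2)) ^ 2 ≤ (8 + 2 * K5 ^ 2 * X) * A ^ 2 := by
    refine (int_le_lin hρX 8 1 (cp.fun_pow 2) (cq.fun_pow 2) (continuousOn_const (c := 2 * (K5 * A) ^ 2)) fun x hx => ?_).trans ?_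
    · have h1 := hK3 _ (hr x hx)
      have h2 := hK4 _ (hr x hx)
      obtain ⟨h3, h4⟩ := hst x hx.1 hx.2
      have h5 := bΨ x hx
      have r0 := hrp x hx
      have g0 := P.g0 _ (hrJ x hx)
      have I0 := P.I0 _ (hrJ x hx)
      have rJ := hrJ x hx
      set r := (X + x) / 2
      set t := (X - x) / 2
      have S0 := S_pos r0
      have e : a2 g I s Ψ t r - b2 g g1 s 0 t r = 2 * Dm s t r - (r⁻¹ * (5 / 2) + g1 r / g r) * (S r * s.u t r) + S r * g r / I r * Ψ t r := by
        rw [P.b2_eq rJ, Dm]; simp only [a2]; field_simp; ring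
      have e2 : |a2 g I s Ψ t r - b2 g g1 s 0 t r| ≤ 2 * |q x| + K5 * A := by
        rw [e]
        refine (abs_add_le _ _).trans ((add_le_add (abs_sub _ _) le_rfl).trans ?_)
        rw [abs_mul (2:ℝ), abs_mul (r⁻¹ * (5 / 2) + g1 r / g r), abs_mul (S r * g r / I r)]
        rw [abs_of_pos (by norm_num : (0:ℝ) < 2)]
        calc _ ≤ 2 * (|q x| + Cs * A) + K4 * (Cs * A) + K3 * (KΨ * A) :=
              add_le_add (add_le_add (mul_le_l h4 (by norm_num)) (mul_le_mul h2 h3 (abs_nonneg _) K40)) (mul_le_mul h1 h5 (abs_nonneg _) K30)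
          _ = 2 * |q x| + K5 * A := by rw [hK5]; ring
      have e3 := sq_abs (a2 g I s Ψ t r - b2 g g1 s 0 t r)
      have e4 := pow_le_l (abs_nonneg _) e2 2
      have e5 := sq_abs (q x)
      rw [e3] at e4
      have e6 := sq_nonneg (2 * |q x| - K5 * A)
      have e7 : (2 * |q x| + K5 * A) ^ 2 = 8 * |q x| ^ 2 + 2 * (K5 * A) ^ 2 - (2 * |q x| - K5 * A) ^ 2 := by ring
      rw [← e5]
      linarith
    · rw [ii_const]
      have : (X - ρ) * (2 * (K5 * A) ^ 2) ≤ X * (2 * (K5 * A) ^ 2) := by gcongr; linarith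
      linarith
  obtain ⟨γ, h1, h2⟩ := P.inner_recover hΨ hρ hρX hJ' (A := B * A) pos! hΨ0 (by
    refine k5.trans ?_
    rw [hB, mul_pow, mul_pow, Real.sq_sqrt pos!]
    linarith)
  refine ⟨γ, h1.trans ?_, h2.trans ?_⟩
  · calc B * A * (M ^ 2 * X) = B * (M ^ 2 * X) * A := by ring
      _ ≤ _ := by gcongr; exact le_max_left _ _
  · calc (2 + 2 * M ^ 6) * (B * A) ^ 2 = (2 + 2 * M ^ 6) * B ^ 2 * A ^ 2 := by ring
      _ ≤ _ := by gcongr; exact le_max_right _ _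

end Pair

/-- A multiple of `ΛW`, as a radial profile. -/
def phi (r : ℝ) : ℝ := (r ^ 2 - 24) / (r ^ 2 + 24) ^ 3
/-- The derivative of `phi`. -/
def phi1 (r : ℝ) : ℝ := 4 * r * (48 - r ^ 2) / (r ^ 2 + 24) ^ 4
/-- `∫_r^∞ ρ⁵ phi²`. -/
def Iout (r : ℝ) : ℝ := (1 / (r ^ 2 + 24) - 72 / (r ^ 2 + 24) ^ 2 + 2496 / (r ^ 2 + 24) ^ 3 - 41472 / (r ^ 2 + 24) ^ 4 + 1327104 / (5 * (r ^ 2 + 24) ^ 5)) / 2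
/-- The logarithm occurring in the second static solution. -/
def Lg (r : ℝ) : ℝ := 2 * Real.log r - Real.log 24
/-- The second radial static solution. -/
def Gam (r : ℝ) : ℝ := (r ^ 10 / 4 + 90 * r ^ 8 - 2304 * r ^ 6 - 497664 * r ^ 4 + 1244160 * r ^ 2
  + 1990656) / (r ^ 4 * (r ^ 2 + 24) ^ 3) + 8640 * (r ^ 2 - 24) / (r ^ 2 + 24) ^ 3 * Lg r
/-- The derivative of `Gam`. -/
def Gam1 (r : ℝ) : ℝ := (-144 * r ^ 10 + 35136 * r ^ 8 + 2875392 * r ^ 6 - 19906560 * r ^ 4 - 79626240 * r ^ 2 - 191102976) / (r ^ 5 * (r ^ 2 + 24) ^ 4)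
  + 34560 * r * (48 - r ^ 2) / (r ^ 2 + 24) ^ 4 * Lg r

lemma dLg {r : ℝ} (hr : 0 < r) : HasDerivAt Lg (2 / r) r := by
  have := ((hasDerivAt_log hr.ne').const_mul 2).sub_const (Real.log 24)
  exact this.congr_deriv (by field_simp)

lemma dquad (r : ℝ) : HasDerivAt (fun r : ℝ => r ^ 2 + 24) (2 * r) r := by simpa using (hasDerivAt_pow 2 r).add_const 24

lemma quad_ne (r : ℝ) : r ^ 2 + 24 ≠ 0 := pos!

lemma dphi (r : ℝ) : HasDerivAt phi (phi1 r) r := by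
  have h := quad_ne r
  have h1 := ((hasDerivAt_pow 2 r).sub_const 24).fun_div ((dquad r).fun_pow 3) (pow_ne_zero 3 h)
  refine h1.congr_deriv ?_
  simp only [Nat.cast_ofNat, phi1]
  field_simp
  ring

lemma dphi1 {r : ℝ} (hr : 0 < r) : HasDerivAt phi1 (-5 / r * phi1 r + Vp r * phi r) r := by
  have h := quad_ne r
  have h1 := (((hasDerivAt_id' r).const_mul 4).fun_mul ((hasDerivAt_pow 2 r).const_sub 48)).fun_div ((dquad r).fun_pow 4) (pow_ne_zero 4 h)
  refine h1.congr_deriv ?_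
  simp only [Nat.cast_ofNat, phi1, phi, Vp, add_comm (24 : ℝ)]
  field_simp
  ring

lemma dIout (r : ℝ) : HasDerivAt Iout (-(r ^ 5 * phi r ^ 2)) r := by
  have h := quad_ne r
  have d := dquad r
  have e (n : ℕ) (c : ℝ) := (hasDerivAt_const r c).fun_div (d.fun_pow n) (pow_ne_zero n h)
  have h1 := (((((hasDerivAt_const r (1 : ℝ)).fun_div d h).fun_sub (e 2 72)).fun_add (e 3 2496)).fun_sub
    (e 4 41472)).fun_add ((hasDerivAt_const r (1327104 : ℝ)).fun_div ((d.fun_pow 5).const_mul 5) pos!)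
  refine (h1.div_const 2).congr_deriv ?_
  simp only [Nat.cast_ofNat, phi]
  field_simp
  ring

lemma dGam {r : ℝ} (hr : 0 < r) : HasDerivAt Gam (Gam1 r) r := by
  have h := quad_ne r
  have p (n : ℕ) := hasDerivAt_pow n r
  have h1 := ((((((((p 10).div_const 4).fun_add ((p 8).const_mul 90)).fun_sub ((p 6).const_mul 2304)).fun_sub
    ((p 4).const_mul 497664)).fun_add ((p 2).const_mul 1244160)).add_const 1990656).fun_div
    ((p 4).fun_mul ((dquad r).fun_pow 3)) pos!).fun_add
    (((((p 2).sub_const 24).const_mul 8640).fun_div ((dquad r).fun_pow 3) (pow_ne_zero 3 h)).fun_mul (dLg hr))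
  refine h1.congr_deriv ?_
  simp only [Nat.cast_ofNat, Gam1]
  generalize Lg r = l
  field_simp
  ring

lemma dGam1 {r : ℝ} (hr : 0 < r) : HasDerivAt Gam1 (-5 / r * Gam1 r + Vp r * Gam r) r := by
  have h := quad_ne r
  have p (n : ℕ) := hasDerivAt_pow n r
  have h1 := ((((((((p 10).const_mul (-144)).fun_add ((p 8).const_mul 35136)).fun_add ((p 6).const_mul 2875392)).fun_sub
    ((p 4).const_mul 19906560)).fun_sub ((p 2).const_mul 79626240)).sub_const 191102976).fun_div
    ((p 5).fun_mul ((dquad r).fun_pow 4)) pos!).fun_add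
    (((((hasDerivAt_id' r).const_mul 34560).fun_mul ((p 2).const_sub 48)).fun_div ((dquad r).fun_pow 4) (pow_ne_zero 4 h)).fun_mul (dLg hr))
  refine h1.congr_deriv ?_
  simp only [Nat.cast_ofNat, Gam1, Gam, Vp, add_comm (24 : ℝ)]
  generalize Lg r = l
  field_simp
  ring

lemma wronsk {r : ℝ} (hr : 0 < r) : r ^ 5 * (phi r * Gam1 r - phi1 r * Gam r) = 1 := by
  have h := quad_ne r
  simp only [phi, phi1, Gam1, Gam]
  generalize Lg r = l
  field_simp
  ring

lemma pair_eventually {F : Filter ℝ} {g g1 I : ℝ → ℝ} {c : ℝ} (hc : 0 < c) (h0 : ∀ᶠ r in F, 0 < r)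
    (h1 : Tendsto (fun r => r ^ 4 * g r) F (𝓝 c)) (h2 : Tendsto (fun r => r ^ 5 * g1 r) F (𝓝 (-4 * c)))
    (h3 : Tendsto (fun r => r ^ 2 * I r) F (𝓝 (c ^ 2 / 2))) :
    ∃ M, 1 ≤ M ∧ ∀ᶠ r in F, 0 < r ∧ 0 < g r ∧ 0 < I r ∧ 1 ≤ M * (r ^ 4 * g r) ∧ r ^ 4 * g r ≤ M ∧ r ^ 5 * |g1 r| ≤ M ∧ 1 ≤ M * (r ^ 2 * I r) ∧ r ^ 2 * I r ≤ M ∧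
      |2 * r * (r ^ 5 * g r ^ 2 / I r + 5 / (2 * r) + g1 r / g r) - 1| ≤ 1 / 100 := by
  have hκ : Tendsto (fun r => 2 * ((r ^ 4 * g r) ^ 2 / (r ^ 2 * I r) + 5 / 2 + (r ^ 5 * g1 r) / (r ^ 4 * g r)) - 1) F (𝓝 0) := by
    have := ((((h1.pow 2).div h3 pos!).add_const (5 / 2)).add (h2.div h1 hc.ne')).const_mul 2 |>.sub_const 1
    have e : 2 * (c ^ 2 / (c ^ 2 / 2) + 5 / 2 + -4 * c / c) - 1 = 0 := by field_simp; norm_num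
    rw [e] at this
    exact this
  refine ⟨1 + 2 * c + 2 / c + 5 * c + c ^ 2 + 4 / c ^ 2, ?_, ?_⟩
  · have : 0 < 2 / c := pos!
    have : 0 < 4 / c ^ 2 := pos!
    nlinarith [sq_nonneg c]
  have ev1 := h1.eventually (Ioo_mem_nhds (show c / 2 < c by linarith) (show c < 2 * c by linarith))
  have ev2 := h2.eventually (Ioo_mem_nhds (show -5 * c < -4 * c by linarith) (show -4 * c < 5 * c by linarith))
  have hc2 : 0 < c ^ 2 := pos!
  have ev3 := h3.eventually (Ioo_mem_nhds (show c ^ 2 / 4 < c ^ 2 / 2 by linarith) (show c ^ 2 / 2 < c ^ 2 by linarith))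
  have ev4 := hκ.eventually (Ioo_mem_nhds (show (-(1 / 100) : ℝ) < 0 by norm_num) (show (0 : ℝ) < 1 / 100 by norm_num))
  filter_upwards [h0, ev1, ev2, ev3, ev4] with r hr ⟨e1, e1'⟩ ⟨e2, e2'⟩ ⟨e3, e3'⟩ ⟨e4, e4'⟩
  have hg : 0 < g r := by
    by_contra hn
    have : r ^ 4 * g r ≤ 0 := mul_nonpos_of_nonneg_of_nonpos pos! (not_lt.1 hn)
    linarith
  have hI : 0 < I r := by
    by_contra hn
    have : r ^ 2 * I r ≤ 0 := mul_nonpos_of_nonneg_of_nonpos pos! (not_lt.1 hn)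
    linarith
  have k1 : 0 < 2 / c := pos!
  have k2 : 0 < 4 / c ^ 2 := pos!
  have k3 : 2 / c * (c / 2) = 1 := by field_simp
  have k4 : 4 / c ^ 2 * (c ^ 2 / 4) = 1 := by field_simp
  refine ⟨hr, hg, hI, ?_, lin!, ?_, ?_, lin!, ?_⟩
  · calc 1 = 2 / c * (c / 2) := k3.symm
      _ ≤ _ := mul_le_mul lin! e1.le pos! pos!
  · have : r ^ 5 * |g1 r| = |r ^ 5 * g1 r| := by rw [abs_mul, abs_of_pos (pos! : 0 < r ^ 5)]
    rw [this, abs_le]; constructor <;> linarith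
  · calc 1 = 4 / c ^ 2 * (c ^ 2 / 4) := k4.symm
      _ ≤ _ := mul_le_mul lin! e3.le pos! pos!
  · have : 2 * r * (r ^ 5 * g r ^ 2 / I r + 5 / (2 * r) + g1 r / g r) - 1 = 2 * ((r ^ 4 * g r) ^ 2 / (r ^ 2 * I r) + 5 / 2 + (r ^ 5 * g1 r) / (r ^ 4 * g r)) - 1 := by
      field_simp
    rw [this, abs_le]; exact ⟨e4.le, e4'.le⟩

lemma tendsto_of_inv {f k : ℝ → ℝ} (hk : Continuous k) (h : ∀ r, 0 < r → f r = k r⁻¹) : Tendsto f atTop (𝓝 (k 0)) := by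
  refine ((hk.tendsto 0).comp tendsto_inv_atTop_zero).congr' ?_
  filter_upwards [eventually_gt_atTop 0] with r hr using (h r hr).symm

lemma phi_lim : Tendsto (fun r => r ^ 4 * phi r) atTop (𝓝 1) := by
  have := tendsto_of_inv (f := fun r => r ^ 4 * phi r) (k := fun y => (1 - 24 * y ^ 2) / (1 + 24 * y ^ 2) ^ 3) (Continuous.div con! con! fun y => pos!)
    (fun r hr => by simp only [phi]; field_simp)
  simpa using this

lemma phi1_lim : Tendsto (fun r => r ^ 5 * phi1 r) atTop (𝓝 (-4 * 1)) := by
  have := tendsto_of_inv (f := fun r => r ^ 5 * phi1 r) (k := fun y => 4 * (48 * y ^ 2 - 1) / (1 + 24 * y ^ 2) ^ 4) (Continuous.div con! con! fun y => pos!)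
    (fun r hr => by simp only [phi1]; field_simp)
  convert this using 2
  norm_num

lemma Iout_lim : Tendsto (fun r => r ^ 2 * Iout r) atTop (𝓝 (1 ^ 2 / 2)) := by
  have := tendsto_of_inv (f := fun r => r ^ 2 * Iout r)
    (k := fun y => (1 / (1 + 24 * y ^ 2) - 72 * y ^ 2 / (1 + 24 * y ^ 2) ^ 2 + 2496 * y ^ 4 / (1 + 24 * y ^ 2) ^ 3 - 41472 * y ^ 6 / (1 + 24 * y ^ 2) ^ 4 +
      1327104 * y ^ 8 / (5 * (1 + 24 * y ^ 2) ^ 5)) / 2)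
    (by
      refine Continuous.div_const ?_ _
      refine Continuous.add (Continuous.sub (Continuous.add (Continuous.sub ?_ ?_) ?_) ?_) ?_ <;>
      exact Continuous.div con! con! fun y => pos!)
    (fun r hr => by simp only [Iout]; field_simp)
  simpa using this

lemma phi_pair : ∃ R M, 10 ≤ R ∧ Pair (Ioi R) phi phi1 Iout M := by
  obtain ⟨M, hM, h⟩ := pair_eventually one_pos (eventually_gt_atTop 0) phi_lim phi1_lim Iout_lim
  obtain ⟨R, hR⟩ := eventually_atTop.1 h
  refine ⟨max R 10, M, le_max_right _ _, ?_⟩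
  have key (r : ℝ) (hr : r ∈ Ioi (max R 10)) := hR r ((le_max_left _ _).trans (le_of_lt hr))
  exact ⟨fun r hr => (key r hr).1, isOpen_Ioi, hM, fun r _ => dphi r, fun r hr => dphi1 hr, fun r _ => dIout r, fun r hr => (key r hr).2.1, fun r hr => (key r hr).2.2.1,
    fun r hr => (key r hr).2.2.2.1, fun r hr => (key r hr).2.2.2.2.1,
    fun r hr => (key r hr).2.2.2.2.2.1, fun r hr => (key r hr).2.2.2.2.2.2.1,
    fun r hr => (key r hr).2.2.2.2.2.2.2.1, fun r hr => (key r hr).2.2.2.2.2.2.2.2⟩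

/-- `r² Lg r`, extended continuously by zero. -/
def rrL (r : ℝ) : ℝ := 2 * r * (r * Real.log r) - Real.log 24 * r ^ 2

lemma cont_rrL : Continuous rrL := by
  unfold rrL
  exact ((continuous_const.mul continuous_id).mul Real.continuous_mul_log).sub con!

lemma rrL_eq (r : ℝ) : rrL r = r ^ 2 * Lg r := by unfold rrL Lg; ring

/-- The continuous function with `r⁴ Gam = 144 + r kGam`. -/
def kGam (r : ℝ) : ℝ := r * (r ^ 8 / 4 + 90 * r ^ 6 - 2448 * r ^ 4 - 508032 * r ^ 2 + 995328) / (r ^ 2 + 24) ^ 3 + 8640 * r * (r ^ 2 - 24) / (r ^ 2 + 24) ^ 3 * rrL r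

lemma cont_kGam : Continuous kGam := by
  unfold kGam
  refine Continuous.add ?_ (Continuous.mul ?_ cont_rrL) <;>
  exact Continuous.div con! con! fun y => pos!

/-- The continuous extension of `r⁴ Gam`. -/
def Gm (r : ℝ) : ℝ := 144 + r * kGam r

lemma cont_Gm : Continuous Gm := continuous_const.add (continuous_id.mul cont_kGam)

lemma Gm_eq {r : ℝ} (hr : 0 < r) : r ^ 4 * Gam r = Gm r := by
  have h := quad_ne r
  simp only [Gam, Gm, kGam, rrL_eq]
  generalize Lg r = l
  field_simp
  ring

/-- The continuous extension of `r⁵ Gam1`. -/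
def Gm1 (r : ℝ) : ℝ := (-144 * r ^ 10 + 35136 * r ^ 8 + 2875392 * r ^ 6 - 19906560 * r ^ 4 - 79626240 * r ^ 2 - 191102976) / (r ^ 2 + 24) ^ 4
  + 34560 * r ^ 4 * (48 - r ^ 2) / (r ^ 2 + 24) ^ 4 * rrL r

lemma cont_Gm1 : Continuous Gm1 := by
  unfold Gm1
  refine Continuous.add ?_ (Continuous.mul ?_ cont_rrL) <;>
  exact Continuous.div con! con! fun y => pos!

lemma Gm1_eq {r : ℝ} (hr : 0 < r) : r ^ 5 * Gam1 r = Gm1 r := by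
  have h := quad_ne r
  simp only [Gam1, Gm1, rrL_eq]
  generalize Lg r = l
  field_simp

/-- `∫_r^1 ρ⁵ Gam²`. -/
def Iin (r : ℝ) : ℝ := ∫ x in r..1, x ^ 5 * Gam x ^ 2

lemma cGam : ContinuousOn Gam (Ioi 0) := fun _ hr => (dGam hr).cwa
lemma cGam1 : ContinuousOn Gam1 (Ioi 0) := fun _ hr => (dGam1 hr).cwa
lemma cphi : Continuous phi := continuous_iff_continuousAt.2 fun r => (dphi r).continuousAt
lemma cphi1 : Continuous phi1 := by
  unfold phi1
  exact Continuous.div con! con! fun y => pos!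

lemma dIin {r : ℝ} (hr : 0 < r) : HasDerivAt Iin (-(r ^ 5 * Gam r ^ 2)) r := by
  have hc : ContinuousOn (fun x => x ^ 5 * Gam x ^ 2) (Ioi 0) := (continuous_pow 5).continuousOn.mul (cGam.pow 2)
  exact intervalIntegral.integral_hasDerivAt_left ((hc.mono fun x hx => lt_of_lt_of_le (lt_min hr one_pos) hx.1).intervalIntegrable)
    (hc.stronglyMeasurableAtFilter isOpen_Ioi r hr) (hc.continuousAt (Ioi_mem_nhds hr))

lemma Iin_lim : Tendsto (fun r => r ^ 2 * Iin r) (𝓝[>] 0) (𝓝 (144 ^ 2 / 2)) := by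
  have hm : Continuous fun r => 288 * kGam r + r * kGam r ^ 2 := (continuous_const.mul cont_kGam).add (continuous_id.mul (cont_kGam.pow 2))
  obtain ⟨B, hB0, hB⟩ := exists_bound (a := 0) (b := 1) hm.continuousOn
  have key : ∀ r ∈ Ioo (0 : ℝ) 1, |r ^ 2 * Iin r - 144 ^ 2 / 2 * (1 - r ^ 2)| ≤ B * r := by
    rintro r ⟨h0, h1⟩
    have hpos : ∀ x ∈ Icc r 1, 0 < x := fun x hx => h0.trans_le hx.1
    have e1 : Iin r = (∫ x in r..1, 144 ^ 2 / x ^ 3) + ∫ x in r..1, (288 * kGam x + x * kGam x ^ 2) / x ^ 2 := by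
      unfold Iin
      rw [← ii_add]
      · refine ii_congr h1.le fun x hx => ?_
        have hx0 := hpos x hx
        have : Gam x = Gm x / x ^ 4 := by rw [← Gm_eq hx0]; field_simp
        simp only [this, Gm]
        field_simp
        ring
      · refine ContinuousOn.iint h1.le (ContinuousOn.div con! con! ?_)
        intro x hx; have := hpos x hx; positivity
      · refine ContinuousOn.iint h1.le (ContinuousOn.div hm.continuousOn con! ?_)
        intro x hx; have := hpos x hx; positivity
    have e2 : ∫ x in r..1, (144 : ℝ) ^ 2 / x ^ 3 = 144 ^ 2 / 2 * (1 / r ^ 2 - 1) := by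
      have hd : ∀ x ∈ Icc r 1, HasDerivAt (fun x : ℝ => -(144 ^ 2 / 2) / x ^ 2) (144 ^ 2 / x ^ 3) x := by
        intro x hx
        have hx0 := hpos x hx
        refine ((hasDerivAt_const x (-(144 ^ 2 / 2 : ℝ))).fun_div (hasDerivAt_pow 2 x) pos!).congr_deriv ?_
        simp only [Nat.cast_ofNat]
        field_simp
        ring
      rw [integral_eq_sub_of_hasDerivAt (fun x hx => hd x (by rwa [uIcc_of_le h1.le] at hx))]
      · field_simp; ring
      · refine ContinuousOn.iint h1.le (ContinuousOn.div con! con! ?_)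
        intro x hx; have := hpos x hx; positivity
    have e3 : |∫ x in r..1, (288 * kGam x + x * kGam x ^ 2) / x ^ 2| ≤ B * (1 / r - 1) := by
      have hd : ∀ x ∈ Icc r 1, HasDerivAt (fun x : ℝ => -B / x) (B / x ^ 2) x := by
        intro x hx
        have hx0 := hpos x hx
        refine ((hasDerivAt_const x (-B)).fun_div (hasDerivAt_id' x) pos!).congr_deriv ?_
        field_simp
        ring
      have hi : IntervalIntegrable (fun x : ℝ => B / x ^ 2) volume r 1 := by
        refine ContinuousOn.iint h1.le (ContinuousOn.div con! con! ?_)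
        intro x hx; have := hpos x hx; positivity
      have e4 : ∫ x in r..1, B / x ^ 2 = B * (1 / r - 1) := by
        rw [integral_eq_sub_of_hasDerivAt (fun x hx => hd x (by rwa [uIcc_of_le h1.le] at hx)) hi]
        field_simp; ring
      rw [← e4]
      have := intervalIntegral.norm_integral_le_of_norm_le (μ := volume) h1.le (f := fun x => (288 * kGam x + x * kGam x ^ 2) / x ^ 2) (ae_of_all _ fun x hx => ?_) hi
      · exact this
      have hx0 := h0.trans hx.1
      rw [norm_eq_abs, abs_div, abs_of_pos (pos! : 0 < x ^ 2)]
      gcongr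
      exact hB x ⟨hx0.le, hx.2⟩
    rw [e1, e2]
    have : r ^ 2 * (144 ^ 2 / 2 * (1 / r ^ 2 - 1) + ∫ x in r..1, (288 * kGam x + x * kGam x ^ 2) / x ^ 2) -
        144 ^ 2 / 2 * (1 - r ^ 2) = r ^ 2 * ∫ x in r..1, (288 * kGam x + x * kGam x ^ 2) / x ^ 2 := by
      field_simp; ring
    rw [this, abs_mul, abs_of_pos (pos! : 0 < r ^ 2)]
    calc _ ≤ r ^ 2 * (B * (1 / r - 1)) := mul_le_l e3 pos!
      _ = B * r - B * r ^ 2 := by field_simp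
      _ ≤ _ := by nlinarith [mul_nonneg hB0 (sq_nonneg r)]
  have l1 : Tendsto (fun r : ℝ => 144 ^ 2 / 2 * (1 - r ^ 2)) (𝓝[>] 0) (𝓝 (144 ^ 2 / 2)) := by
    have : Continuous fun r : ℝ => (144 : ℝ) ^ 2 / 2 * (1 - r ^ 2) := con!
    have := (this.tendsto 0).mono_left (nhdsWithin_le_nhds (s := Ioi 0))
    simpa using this
  have l2 : Tendsto (fun r => r ^ 2 * Iin r - 144 ^ 2 / 2 * (1 - r ^ 2)) (𝓝[>] 0) (𝓝 0) := by
    refine squeeze_zero_norm' (a := fun r => B * r) ?_ ?_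
    · filter_upwards [Ioo_mem_nhdsGT one_pos] with r hr using key r hr
    · have : Continuous fun r : ℝ => B * r := con!
      have := (this.tendsto 0).mono_left (nhdsWithin_le_nhds (s := Ioi 0))
      simpa using this
  simpa using l2.add l1

lemma Gam_pair : ∃ X M, 0 < X ∧ X ≤ 1 ∧ Pair (Ioo 0 X) Gam Gam1 Iin M := by
  have g1 : Tendsto (fun r => r ^ 4 * Gam r) (𝓝[>] 0) (𝓝 144) := by
    have := (cont_Gm.tendsto 0).mono_left (nhdsWithin_le_nhds (s := Ioi 0))
    rw [show Gm 0 = 144 by simp [Gm]] at this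
    refine this.congr' ?_
    filter_upwards [self_mem_nhdsWithin] with r hr using (Gm_eq hr).symm
  have g2 : Tendsto (fun r => r ^ 5 * Gam1 r) (𝓝[>] 0) (𝓝 (-4 * 144)) := by
    have := (cont_Gm1.tendsto 0).mono_left (nhdsWithin_le_nhds (s := Ioi 0))
    rw [show Gm1 0 = -4 * 144 by norm_num [Gm1]] at this
    refine this.congr' ?_
    filter_upwards [self_mem_nhdsWithin] with r hr using (Gm1_eq hr).symm
  obtain ⟨M, hM, h⟩ := pair_eventually (by norm_num) self_mem_nhdsWithin g1 g2 Iin_lim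
  obtain ⟨X, hX0, hX⟩ := mem_nhdsGT_iff_exists_Ioo_subset.1 h
  refine ⟨min X 1, M, lt_min hX0 one_pos, min_le_right _ _, ?_⟩
  have key (r : ℝ) (hr : r ∈ Ioo 0 (min X 1)) := hX ⟨hr.1, hr.2.trans_le (min_le_left _ _)⟩
  exact ⟨fun r hr => (key r hr).1, isOpen_Ioo, hM, fun r hr => dGam hr, fun r hr => dGam1 hr,
    fun r hr => dIin hr, fun r hr => (key r hr).2.1, fun r hr => (key r hr).2.2.1,
    fun r hr => (key r hr).2.2.2.1, fun r hr => (key r hr).2.2.2.2.1,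
    fun r hr => (key r hr).2.2.2.2.2.1, fun r hr => (key r hr).2.2.2.2.2.2.1,
    fun r hr => (key r hr).2.2.2.2.2.2.2.1, fun r hr => (key r hr).2.2.2.2.2.2.2.2⟩

lemma Lg_abs {r : ℝ} (hr : 1 ≤ r) : |Lg r| ≤ 24 * r := by
  have h1 := Real.log_le_sub_one_of_pos (show 0 < r by linarith)
  have h2 := Real.log_nonneg hr
  have h3 := Real.log_le_sub_one_of_pos (show (0 : ℝ) < 24 by norm_num)
  have h4 := Real.log_nonneg (show (1 : ℝ) ≤ 24 by norm_num)
  unfold Lg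
  rw [abs_le]
  constructor <;> linarith

lemma phi_bound {r : ℝ} (hr : 0 < r) : r ^ 4 * |phi r| ≤ 1 := by
  unfold phi
  have h := quad_ne r
  rw [abs_div, abs_of_pos (pos! : 0 < (r ^ 2 + 24) ^ 3), ← mul_div_assoc, div_le_one pos!]
  have : |r ^ 2 - 24| ≤ r ^ 2 + 24 := by rw [abs_le]; constructor <;> nlinarith [sq_nonneg r]
  calc r ^ 4 * |r ^ 2 - 24| ≤ r ^ 4 * (r ^ 2 + 24) := by gcongr
    _ ≤ (r ^ 2 + 24) ^ 2 * (r ^ 2 + 24) := by gcongr; nlinarith [sq_nonneg r]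
    _ = _ := by ring

lemma phi1_bound {r : ℝ} (hr : 0 < r) : r ^ 5 * |phi1 r| ≤ 8 := by
  unfold phi1
  rw [abs_div, abs_of_pos (pos! : 0 < (r ^ 2 + 24) ^ 4), ← mul_div_assoc, div_le_iff₀ pos!, abs_mul, abs_of_pos (pos! : 0 < 4 * r)]
  have : |48 - r ^ 2| ≤ 2 * (r ^ 2 + 24) := by rw [abs_le]; constructor <;> nlinarith [sq_nonneg r]
  calc r ^ 5 * (4 * r * |48 - r ^ 2|) ≤ r ^ 5 * (4 * r * (2 * (r ^ 2 + 24))) := by gcongr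
    _ = 8 * ((r ^ 2) ^ 3 * (r ^ 2 + 24)) := by ring
    _ ≤ 8 * ((r ^ 2 + 24) ^ 3 * (r ^ 2 + 24)) := by gcongr; linarith
    _ = _ := by ring

lemma phi_small {r : ℝ} : |phi r| ≤ 1 := by
  unfold phi
  rw [abs_div, abs_of_pos (pos! : 0 < (r ^ 2 + 24) ^ 3), div_le_one pos!]
  have : |r ^ 2 - 24| ≤ r ^ 2 + 24 := by rw [abs_le]; constructor <;> nlinarith [sq_nonneg r]
  nlinarith [sq_nonneg r, pow_le_l (by norm_num) (show 1 ≤ r ^ 2 + 24 by nlinarith [sq_nonneg r]) 2]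

lemma phi1_small {r : ℝ} (hr : 0 < r) : |phi1 r| ≤ r := by
  unfold phi1
  rw [abs_div, abs_of_pos (pos! : 0 < (r ^ 2 + 24) ^ 4), div_le_iff₀ pos!, abs_mul, abs_of_pos (pos! : 0 < 4 * r)]
  have h2 : |48 - r ^ 2| ≤ 2 * (r ^ 2 + 24) := by rw [abs_le]; constructor <;> nlinarith [sq_nonneg r]
  have h1 : 24 ≤ r ^ 2 + 24 := by nlinarith [sq_nonneg r]
  have h3 := pow_le_l (by norm_num) h1 3
  calc 4 * r * |48 - r ^ 2| ≤ 4 * r * (2 * (r ^ 2 + 24)) := by gcongr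
    _ = r * (8 * (r ^ 2 + 24)) := by ring
    _ ≤ r * ((r ^ 2 + 24) ^ 3 * (r ^ 2 + 24)) := by gcongr; linarith
    _ = _ := by ring

lemma cont_inv_num : Continuous fun y : ℝ => (1 / 4 + 90 * y ^ 2 - 2304 * y ^ 4 - 497664 * y ^ 6 + 1244160 * y ^ 8 + 1990656 * y ^ 10) / (1 + 24 * y ^ 2) ^ 3 :=
  Continuous.div con! con! fun y => pos!

lemma cont_inv_num1 : Continuous fun y : ℝ => (-144 + 35136 * y ^ 2 + 2875392 * y ^ 4 - 19906560 * y ^ 6 -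
    79626240 * y ^ 8 - 191102976 * y ^ 10) / (1 + 24 * y ^ 2) ^ 4 :=
  Continuous.div con! con! fun y => pos!

lemma Gam_bound_out : ∃ C, 0 ≤ C ∧ ∀ r, 1 ≤ r → |Gam r| ≤ C ∧ r ^ 3 * |Gam1 r| ≤ C := by
  obtain ⟨B, hB0, hB⟩ := exists_bound (a := 0) (b := 1) cont_inv_num.continuousOn
  obtain ⟨B1, hB10, hB1⟩ := exists_bound (a := 0) (b := 1) cont_inv_num1.continuousOn
  refine ⟨B + B1 + 8640 * 8 * 24, pos!, fun r hr => ?_⟩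
  have hr0 : 0 < r := lin!
  have hy : r⁻¹ ∈ Icc (0 : ℝ) 1 := ⟨pos!, inv_le_one_of_one_le₀ hr⟩
  have h := quad_ne r
  have b := hB _ hy
  have b1 := hB1 _ hy
  have e : Gam r = (1 / 4 + 90 * r⁻¹ ^ 2 - 2304 * r⁻¹ ^ 4 - 497664 * r⁻¹ ^ 6 +
      1244160 * r⁻¹ ^ 8 + 1990656 * r⁻¹ ^ 10) / (1 + 24 * r⁻¹ ^ 2) ^ 3 + 8640 * (phi r * Lg r) := by
    simp only [Gam, phi]
    generalize Lg r = l
    field_simp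
  have e1 : r ^ 3 * Gam1 r = (-144 + 35136 * r⁻¹ ^ 2 + 2875392 * r⁻¹ ^ 4 - 19906560 * r⁻¹ ^ 6 - 79626240 * r⁻¹ ^ 8 - 191102976 * r⁻¹ ^ 10) / (1 + 24 * r⁻¹ ^ 2) ^ 4 +
      8640 * (r ^ 3 * phi1 r * Lg r) := by
    simp only [Gam1, phi1]
    generalize Lg r = l
    field_simp
    ring
  have hL := Lg_abs hr
  have p := phi_bound hr0
  have p1 := phi1_bound hr0
  have q : |phi r * Lg r| ≤ 24 := by
    rw [abs_mul]
    calc |phi r| * |Lg r| ≤ |phi r| * (24 * r) := by gcongr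
      _ ≤ |phi r| * (24 * r ^ 4) := by gcongr; exact le_self_pow₀ hr (by norm_num)
      _ = 24 * (r ^ 4 * |phi r|) := by ring
      _ ≤ 24 := lin!
  have q1 : |r ^ 3 * phi1 r * Lg r| ≤ 8 * 24 := by
    rw [abs_mul, abs_mul, abs_of_pos (pos! : 0 < r ^ 3)]
    calc r ^ 3 * |phi1 r| * |Lg r| ≤ r ^ 3 * |phi1 r| * (24 * r) := by gcongr
      _ ≤ r ^ 3 * |phi1 r| * (24 * r ^ 2) := by gcongr; exact le_self_pow₀ hr (by norm_num)
      _ = 24 * (r ^ 5 * |phi1 r|) := by ring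
      _ ≤ _ := lin!
  constructor
  · rw [e]
    refine (abs_add_le _ _).trans ?_
    rw [abs_mul, abs_of_pos (by norm_num : (0 : ℝ) < 8640)]
    linarith
  · rw [← abs_of_pos (pos! : 0 < r ^ 3), ← abs_mul, e1]
    refine (abs_add_le _ _).trans ?_
    rw [abs_mul 8640, abs_of_pos (by norm_num : (0 : ℝ) < 8640)]
    linarith

lemma Gam_bound_in : ∃ C, 0 ≤ C ∧ ∀ r, 0 < r → r ≤ 1 → r ^ 4 * |Gam r| ≤ C ∧ r ^ 5 * |Gam1 r| ≤ C := by
  obtain ⟨B, hB0, hB⟩ := exists_bound (a := 0) (b := 1) cont_Gm.continuousOn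
  obtain ⟨B1, hB10, hB1⟩ := exists_bound (a := 0) (b := 1) cont_Gm1.continuousOn
  refine ⟨B + B1, pos!, fun r h0 h1 => ?_⟩
  have b := hB r ⟨h0.le, h1⟩
  have b1 := hB1 r ⟨h0.le, h1⟩
  rw [← Gm_eq h0, abs_mul, abs_of_pos (pos! : 0 < r ^ 4)] at b
  rw [← Gm1_eq h0, abs_mul, abs_of_pos (pos! : 0 < r ^ 5)] at b1
  constructor <;> linarith

lemma Iin_bound : ∃ C, 0 ≤ C ∧ ∀ r, 0 < r → r ≤ 1 → |Iin r| ≤ C / r ^ 2 := by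
  obtain ⟨C, hC0, hC⟩ := Gam_bound_in
  refine ⟨C ^ 2, pos!, fun r h0 h1 => ?_⟩
  have hd : ∀ x ∈ Icc r 1, HasDerivAt (fun x : ℝ => -(C ^ 2 / 2) / x ^ 2) (C ^ 2 / x ^ 3) x := by
    intro x hx
    have hx0 := h0.trans_le hx.1
    refine ((hasDerivAt_const x (-(C ^ 2 / 2 : ℝ))).fun_div (hasDerivAt_pow 2 x) pos!).congr_deriv ?_
    simp only [Nat.cast_ofNat]
    field_simp
    ring
  have hi : IntervalIntegrable (fun x : ℝ => C ^ 2 / x ^ 3) volume r 1 := by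
    refine ContinuousOn.iint h1 (ContinuousOn.div con! con! ?_)
    intro x hx; have := h0.trans_le hx.1; positivity
  have e := integral_eq_sub_of_hasDerivAt (fun x hx => hd x (by rwa [uIcc_of_le h1] at hx)) hi
  have := intervalIntegral.norm_integral_le_of_norm_le (μ := volume) h1 (f := fun x => x ^ 5 * Gam x ^ 2) (ae_of_all _ fun x hx => ?_) hi
  · unfold Iin
    rw [norm_eq_abs, e] at this
    refine this.trans ?_
    have : 0 ≤ C ^ 2 / 2 := pos!
    calc -(C ^ 2 / 2) / 1 ^ 2 - -(C ^ 2 / 2) / r ^ 2 = C ^ 2 / r ^ 2 / 2 - C ^ 2 / 2 := by ring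
      _ ≤ C ^ 2 / r ^ 2 := by
        have : 0 ≤ C ^ 2 / r ^ 2 := pos!
        linarith
  · have hx0 := h0.trans hx.1
    have h2 := (hC x hx0 hx.2).1
    rw [norm_eq_abs, abs_of_nonneg pos!, le_div_iff₀ pos!]
    calc x ^ 5 * Gam x ^ 2 * x ^ 3 = (x ^ 4 * |Gam x|) ^ 2 := by rw [mul_pow, sq_abs]; ring
      _ ≤ C ^ 2 := pow_le_l pos! h2 2

lemma Iout_bound : ∃ C, 0 ≤ C ∧ ∀ r, 0 < r → |Iout r| ≤ C ∧ r ^ 2 * |Iout r| ≤ C := by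
  refine ⟨10 ^ 6, by norm_num, fun r hr => ?_⟩
  have hs : 24 ≤ r ^ 2 + 24 := by nlinarith
  have key : |Iout r| ≤ 300000 / (r ^ 2 + 24) := by
    unfold Iout
    have hsp : 0 < r ^ 2 + 24 := pos!
    generalize r ^ 2 + 24 = s at hs hsp
    have b (n : ℕ) : 1 / s ^ (n + 1) ≤ 1 / s := by
      apply one_div_le_one_div_of_le hsp
      exact le_self_pow₀ lin! (by omega)
    have p (n : ℕ) : 0 ≤ 1 / s ^ n := pos!
    have e : (1 / s - 72 / s ^ 2 + 2496 / s ^ 3 - 41472 / s ^ 4 + 1327104 / (5 * s ^ 5)) / 2 =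
      (1 / s - 72 * (1 / s ^ 2) + 2496 * (1 / s ^ 3) - 41472 * (1 / s ^ 4) + 1327104 / 5 * (1 / s ^ 5)) / 2 := by
      field_simp
    rw [e, show 300000 / s = 300000 * (1 / s) by ring, abs_le]
    have h1 := b 1
    have h2 := b 2
    have h3 := b 3
    have h4 := b 4
    have p2 := p 2
    have p3 := p 3
    have p4 := p 4
    have p5 := p 5
    simp only [Nat.reduceAdd] at h1 h2 h3 h4
    constructor <;> linarith
  constructor
  · refine key.trans ((div_le_iff₀ pos!).2 ?_); linarith
  · calc r ^ 2 * |Iout r| ≤ r ^ 2 * (300000 / (r ^ 2 + 24)) := by gcongr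
      _ ≤ 10 ^ 6 := by rw [← mul_div_assoc, div_le_iff₀ pos!]; nlinarith

/-- `∫_0^r ρ⁵ phi Gam`. -/
def Kz (r : ℝ) : ℝ := ∫ x in (0:ℝ)..r, x * (phi x * Gm x)

lemma cKz : Continuous fun x => x * (phi x * Gm x) := continuous_id.mul (cphi.mul cont_Gm)

lemma dKz {r : ℝ} (hr : 0 < r) : HasDerivAt Kz (r ^ 5 * phi r * Gam r) r := by
  have := intervalIntegral.integral_hasDerivAt_right (cKz.intervalIntegrable 0 r) (cKz.stronglyMeasurableAtFilter volume (𝓝 r)) cKz.continuousAt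
  refine this.congr_deriv ?_
  rw [← Gm_eq hr]; ring

lemma Kz_bound : ∃ C, 0 ≤ C ∧ ∀ r, 0 < r → |Kz r| ≤ C * r ^ 2 := by
  obtain ⟨B, hB0, hB⟩ := exists_bound (a := 0) (b := 1) (cphi.mul cont_Gm).continuousOn
  obtain ⟨C, hC0, hC⟩ := Gam_bound_out
  refine ⟨B + C, pos!, fun r hr => ?_⟩
  have key : ∀ x, 0 < x → |x * (phi x * Gm x)| ≤ (B + C) * x := by
    intro x hx
    rw [abs_mul, abs_of_pos hx, mul_comm]
    refine mul_le_r ?_ hx.le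
    rcases le_total x 1 with h1 | h1
    · have : |phi x * Gm x| ≤ B := hB x ⟨hx.le, h1⟩
      linarith
    · have := (hC x h1).1
      rw [← Gm_eq hx, show phi x * (x ^ 4 * Gam x) = x ^ 4 * phi x * Gam x by ring, abs_mul, abs_mul, abs_of_pos (pos! : 0 < x ^ 4)]
      have p := phi_bound hx
      calc x ^ 4 * |phi x| * |Gam x| ≤ 1 * C := mul_le_mul p this (abs_nonneg _) (by norm_num)
        _ ≤ _ := lin!
  have := intervalIntegral.norm_integral_le_of_norm_le (μ := volume) hr.le (f := fun x => x * (phi x * Gm x)) (g := fun x => (B + C) * x)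
    (ae_of_all _ fun x hx => key x hx.1) (Continuous.intervalIntegrable con! _ _)
  rw [ii_const_mul, integral_id] at this
  refine this.trans ?_
  have : 0 ≤ (B + C) * r ^ 2 := pos!
  linarith

/-- A solution of `Φ'' + 5/r Φ' - V Φ = phi`, decaying at infinity. -/
def PhS (r : ℝ) : ℝ := -(Iout r * Gam r) - phi r * Kz r
/-- The derivative of `PhS`. -/
def PhS1 (r : ℝ) : ℝ := -(Iout r * Gam1 r) - phi1 r * Kz r
/-- A solution of `Θ'' + 5/r Θ' - V Θ = Gam`. -/
def ThS (r : ℝ) : ℝ := Gam r * Kz r + phi r * Iin r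
/-- The derivative of `ThS`. -/
def ThS1 (r : ℝ) : ℝ := Gam1 r * Kz r + phi1 r * Iin r

lemma dPhS {r : ℝ} (hr : 0 < r) : HasDerivAt PhS (PhS1 r) r := by
  refine ((((dIout r).fun_mul (dGam hr)).fun_neg).fun_sub ((dphi r).fun_mul (dKz hr))).congr_deriv ?_
  unfold PhS1; ring

lemma dPhS1 {r : ℝ} (hr : 0 < r) : HasDerivAt PhS1 (phi r - 5 / r * PhS1 r + Vp r * PhS r) r := by
  refine ((((dIout r).fun_mul (dGam1 hr)).fun_neg).fun_sub ((dphi1 hr).fun_mul (dKz hr))).congr_deriv ?_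
  have w := wronsk hr
  unfold PhS1 PhS
  linear_combination phi r * w

lemma dThS {r : ℝ} (hr : 0 < r) : HasDerivAt ThS (ThS1 r) r := by
  refine (((dGam hr).fun_mul (dKz hr)).fun_add ((dphi r).fun_mul (dIin hr))).congr_deriv ?_
  unfold ThS1; ring

lemma dThS1 {r : ℝ} (hr : 0 < r) : HasDerivAt ThS1 (Gam r - 5 / r * ThS1 r + Vp r * ThS r) r := by
  refine (((dGam1 hr).fun_mul (dKz hr)).fun_add ((dphi1 hr).fun_mul (dIin hr))).congr_deriv ?_
  have w := wronsk hr
  unfold ThS1 ThS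
  linear_combination Gam r * w

lemma PhS_bound : ∃ C, 0 ≤ C ∧ ∀ r, 1 ≤ r → r ^ 2 * |PhS r| ≤ C ∧ r ^ 3 * |PhS1 r| ≤ C := by
  obtain ⟨A, hA0, hA⟩ := Gam_bound_out
  obtain ⟨B, hB0, hB⟩ := Iout_bound
  obtain ⟨K, hK0, hK⟩ := Kz_bound
  refine ⟨B * A + 8 * K, pos!, fun r hr => ?_⟩
  have hr0 : 0 < r := lin!
  obtain ⟨a, a1⟩ := hA r hr
  obtain ⟨b, b1⟩ := hB r hr0
  have k := hK r hr0
  have p := phi_bound hr0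
  have p1 := phi1_bound hr0
  constructor
  · unfold PhS
    have := abs_sub (-(Iout r * Gam r)) (phi r * Kz r)
    rw [abs_neg, abs_mul, abs_mul] at this
    calc _ ≤ r ^ 2 * (|Iout r| * |Gam r| + |phi r| * |Kz r|) := by gcongr
      _ = (r ^ 2 * |Iout r|) * |Gam r| + r ^ 2 * |phi r| * |Kz r| := by ring
      _ ≤ B * A + r ^ 2 * |phi r| * (K * r ^ 2) := add_le_add (mul_le_mul b1 a (abs_nonneg _) hB0) (by gcongr)
      _ = B * A + K * (r ^ 4 * |phi r|) := by ring
      _ ≤ _ := by nlinarith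
  · unfold PhS1
    have := abs_sub (-(Iout r * Gam1 r)) (phi1 r * Kz r)
    rw [abs_neg, abs_mul, abs_mul] at this
    calc _ ≤ r ^ 3 * (|Iout r| * |Gam1 r| + |phi1 r| * |Kz r|) := by gcongr
      _ = |Iout r| * (r ^ 3 * |Gam1 r|) + r ^ 3 * |phi1 r| * |Kz r| := by ring
      _ ≤ B * A + r ^ 3 * |phi1 r| * (K * r ^ 2) := add_le_add (mul_le_mul b a1 pos! hB0) (by gcongr)
      _ = B * A + K * (r ^ 5 * |phi1 r|) := by ring
      _ ≤ _ := by nlinarith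

lemma ThS_bound : ∃ C, 0 ≤ C ∧ ∀ r, 0 < r → r ≤ 1 → r ^ 2 * |ThS r| ≤ C ∧ r ^ 3 * |ThS1 r| ≤ C := by
  obtain ⟨A, hA0, hA⟩ := Gam_bound_in
  obtain ⟨B, hB0, hB⟩ := Iin_bound
  obtain ⟨K, hK0, hK⟩ := Kz_bound
  refine ⟨A * K + B, pos!, fun r hr0 hr => ?_⟩
  obtain ⟨a, a1⟩ := hA r hr0 hr
  have b := hB r hr0 hr
  rw [le_div_iff₀ pos!] at b
  have k := hK r hr0
  have p := phi_small (r := r)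
  have p1 := phi1_small hr0
  have r1 : r ^ 2 ≤ 1 := pow_le_one₀ hr0.le hr
  constructor
  · unfold ThS
    have := abs_add_le (Gam r * Kz r) (phi r * Iin r)
    rw [abs_mul, abs_mul] at this
    calc _ ≤ r ^ 2 * (|Gam r| * |Kz r| + |phi r| * |Iin r|) := by gcongr
      _ = r ^ 2 * |Gam r| * |Kz r| + |phi r| * (|Iin r| * r ^ 2) := by ring
      _ ≤ r ^ 2 * |Gam r| * (K * r ^ 2) + 1 * B := add_le_add (by gcongr) (mul_le_mul p b pos! zero_le_one)
      _ = (r ^ 4 * |Gam r|) * K + B := by ring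
      _ ≤ _ := by nlinarith
  · unfold ThS1
    have := abs_add_le (Gam1 r * Kz r) (phi1 r * Iin r)
    rw [abs_mul, abs_mul] at this
    calc _ ≤ r ^ 3 * (|Gam1 r| * |Kz r| + |phi1 r| * |Iin r|) := by gcongr
      _ = r ^ 3 * |Gam1 r| * |Kz r| + r * |phi1 r| * (|Iin r| * r ^ 2) := by ring
      _ ≤ r ^ 3 * |Gam1 r| * (K * r ^ 2) + 1 * B := add_le_add (by gcongr) (mul_le_mul (by nlinarith) b pos! zero_le_one)
      _ = (r ^ 5 * |Gam1 r|) * K + B := by ring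
      _ ≤ _ := by nlinarith

/-- `Φ + I(0) Γ` and its derivative are bounded near the origin. -/
lemma PhS_bound_in : ∃ C, 0 ≤ C ∧ ∀ r, 0 < r → r ≤ 1 → |PhS r + Iout 0 * Gam r| ≤ C ∧ |PhS1 r + Iout 0 * Gam1 r| ≤ C := by
  obtain ⟨A, hA0, hA⟩ := Gam_bound_in
  obtain ⟨K, hK0, hK⟩ := Kz_bound
  refine ⟨A + K, pos!, fun r hr0 hr => ?_⟩
  obtain ⟨a, a1⟩ := hA r hr0 hr
  have k := hK r hr0
  have p := phi_small (r := r)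
  have p1 := phi1_small hr0
  have r1 : r ^ 2 ≤ 1 := pow_le_one₀ hr0.le hr
  have hk : |Kz r| ≤ K := k.trans (by nlinarith)
  have hI : |Iout 0 - Iout r| ≤ r ^ 5 := by
    have hd : ∀ x ∈ Icc 0 r, HasDerivWithinAt Iout (-(x ^ 5 * phi x ^ 2)) (Icc 0 r) x := fun x _ => (dIout x).hasDerivWithinAt
    have := (convex_Icc 0 r).norm_image_sub_le_of_norm_hasDerivWithin_le (C := r ^ 5) hd (fun x hx => ?_) (right_mem_Icc.2 hr0.le) (left_mem_Icc.2 hr0.le)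
    · refine this.trans ?_
      rw [zero_sub, norm_neg, norm_eq_abs, abs_of_pos hr0]
      exact mul_le_of_le_one_right pos! hr
    · have hp := (phi_small (r := x))
      rw [norm_neg, norm_eq_abs, abs_of_nonneg (mul_nonneg (pow_nonneg hx.1 _) (sq_nonneg _))]
      have : phi x ^ 2 ≤ 1 := by rw [← sq_abs]; exact pow_le_one₀ (abs_nonneg _) hp
      calc x ^ 5 * phi x ^ 2 ≤ r ^ 5 * 1 :=
          mul_le_mul (pow_le_l hx.1 hx.2 5) this (sq_nonneg _) pos!
        _ = r ^ 5 := mul_one _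
  constructor
  · have e : PhS r + Iout 0 * Gam r = (Iout 0 - Iout r) * Gam r - phi r * Kz r := by unfold PhS; ring
    have := abs_sub ((Iout 0 - Iout r) * Gam r) (phi r * Kz r)
    rw [abs_mul, abs_mul] at this
    rw [e]
    calc _ ≤ _ := this
      _ ≤ r ^ 5 * |Gam r| + 1 * K := add_le_add (by gcongr) (mul_le_mul p hk (abs_nonneg _) zero_le_one)
      _ = r * (r ^ 4 * |Gam r|) + K := by ring
      _ ≤ 1 * A + K := by gcongr
      _ = _ := by ring
  · have e : PhS1 r + Iout 0 * Gam1 r = (Iout 0 - Iout r) * Gam1 r - phi1 r * Kz r := by unfold PhS1; ring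
    have := abs_sub ((Iout 0 - Iout r) * Gam1 r) (phi1 r * Kz r)
    rw [abs_mul, abs_mul] at this
    rw [e]
    calc _ ≤ _ := this
      _ ≤ r ^ 5 * |Gam1 r| + 1 * K := add_le_add (by gcongr) (mul_le_mul (p1.trans hr) hk (abs_nonneg _) zero_le_one)
      _ ≤ _ := lin!

lemma abs_int_lin {A f g : ℝ → ℝ} {a b : ℝ} (hab : a ≤ b) (x y : ℝ) (hA : ContinuousOn A (Icc a b)) (hf : ContinuousOn f (Icc a b)) (hg : ContinuousOn g (Icc a b))
    (h : ∀ r ∈ Icc a b, |A r| ≤ x * f r + y * g r) :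
    |∫ r in a..b, A r| ≤ x * (∫ r in a..b, f r) + y * ∫ r in a..b, g r :=
  (abs_integral_le_integral_abs hab).trans (int_le_lin hab x y hA.abs hf hg h)

lemma lim_of_cauchy {f : ℝ → ℝ} {C : ℝ} (h : ∀ x, 1 ≤ x → ∀ y, x ≤ y → |f y - f x| ≤ C / x) : ∃ L, Tendsto f atTop (𝓝 L) := by
  have hC : 0 ≤ C := by
    have := h 1 le_rfl 1 le_rfl
    simpa using this
  refine cauchySeq_tendsto_of_complete (Metric.cauchySeq_iff'.2 fun ε hε => ?_)
  refine ⟨C / ε + 1, fun n hn => ?_⟩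
  have h0 : 0 ≤ C / ε := pos!
  have := h (C / ε + 1) lin! n hn
  rw [Real.dist_eq]
  refine lt_of_le_of_lt this ((div_lt_iff₀ lin!).2 ?_)
  have : ε * (C / ε + 1) = C + ε := by field_simp
  linarith

lemma avg_lim {f : ℝ → ℝ} {L : ℝ} (hc : ContinuousOn f (Ioi 0)) (h : Tendsto f atTop (𝓝 L)) : Tendsto (fun n => n⁻¹ * ∫ r in n..2 * n, f r) atTop (𝓝 L) := by
  rw [Metric.tendsto_atTop] at h ⊢
  intro ε hε
  obtain ⟨N, hN⟩ := h (ε / 2) pos!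
  refine ⟨max N 1, fun n hn => ?_⟩
  have hn1 : 0 < n := lt_of_lt_of_le one_pos ((le_max_right _ _).trans hn)
  have hcn : ContinuousOn f (Icc n (2 * n)) := hc.icc hn1 _
  have e : n⁻¹ * (∫ r in n..2 * n, f r) - L = n⁻¹ * ∫ r in n..2 * n, (f r - L) := by
    rw [ii_sub (hcn.iint lin!) (by simp), ii_const]
    field_simp
    ring
  rw [Real.dist_eq, e, abs_mul, abs_of_pos (pos! : 0 < n⁻¹)]
  have := abs_int_lin (A := fun r => f r - L) (f := fun _ => 1) (g := fun _ => 0) (show n ≤ 2 * n by linarith) (ε / 2) 0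
    con! continuousOn_const continuousOn_const (fun r hr => by
      have := (hN r (((le_max_left _ _).trans hn).trans hr.1)).le
      rw [Real.dist_eq] at this
      linarith)
  rw [intervalIntegral.integral_const, ii_const, smul_eq_mul] at this
  calc _ ≤ n⁻¹ * (ε / 2 * ((2 * n - n) * 1) + 0 * ((2 * n - n) * 0)) := by gcongr
    _ = ε / 2 := by field_simp; ring
    _ < ε := lin!

lemma CP.cont_max {f : ℝ → ℝ → ℝ} (h : CP (Ioi 0) f) {a : ℝ} (ha : 0 < a) : Continuous (Function.uncurry fun t r => f t (max r a)) :=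
  continuousOn_univ.1 (ContinuousOn.comp h (f := fun z : ℝ × ℝ => (z.1, max z.2 a)) con! fun z _ => ⟨mem_univ _, lt_of_lt_of_le ha (le_max_right _ _)⟩)

lemma CP.swap {f : ℝ → ℝ → ℝ} (h : CP (Ioi 0) f) (a b : ℝ) {c d : ℝ} (hc : 0 < c) (hcd : c ≤ d) : ∫ r in c..d, ∫ t in a..b, f t r = ∫ t in a..b, ∫ r in c..d, f t r := by
  have e := rect_swap (h.cont_max hc) a b c d
  have h1 : ∀ r ∈ uIcc c d, max r c = r := fun r hr => by rw [uIcc_of_le hcd] at hr; exact max_eq_left hr.1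
  calc _ = ∫ r in c..d, ∫ t in a..b, f t (max r c) :=
        integral_congr fun r hr => by simp only [h1 r hr]
    _ = ∫ t in a..b, ∫ r in c..d, f t (max r c) := e.symm
    _ = _ := integral_congr fun t _ => integral_congr fun r hr => by simp only [h1 r hr]

lemma CP.int_cont {f : ℝ → ℝ → ℝ} (h : CP (Ioi 0) f) {c d : ℝ} (hc : 0 < c) (hcd : c ≤ d) : Continuous fun t => ∫ r in c..d, f t r := by
  have := intervalIntegral.continuous_parametric_intervalIntegral_of_continuous' (μ := volume) (h.cont_max hc) c d
  refine this.congr fun t => ii_congr hcd fun r hr => ?_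
  simp only [max_eq_left hr.1]

lemma CP.int_cont_t {f : ℝ → ℝ → ℝ} (h : CP (Ioi 0) f) (a b : ℝ) {c : ℝ} (hc : 0 < c) : ContinuousOn (fun r => ∫ t in a..b, f t r) (Ici c) := by
  have h2 : Continuous (Function.uncurry fun r t => f t (max r c)) := (h.cont_max hc).comp continuous_swap
  have := intervalIntegral.continuous_parametric_intervalIntegral_of_continuous' (μ := volume) h2 a b
  refine this.continuousOn.congr fun r hr => integral_congr fun t _ => ?_
  have hr : c ≤ r := hr
  simp only [max_eq_left hr]

lemma CP.time {f : ℝ → ℝ → ℝ} (h : CP (Ioi 0) f) {r : ℝ} (hr : 0 < r) : Continuous fun t => f t r :=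
  continuousOn_univ.1 (ContinuousOn.comp h (f := fun t : ℝ => (t, r)) con! fun _ _ => ⟨mem_univ _, hr⟩)

lemma HasGrad.time_ftc {f ft fr : ℝ → ℝ → ℝ} (h : HasGrad (Ioi 0) f ft fr) (hc : CP (Ioi 0) ft) (a b : ℝ) {r : ℝ} (hr : 0 < r) : ∫ t in a..b, ft t r = f b r - f a r :=
  integral_eq_sub_of_hasDerivAt (fun t _ => h.dt t hr) ((hc.time hr).intervalIntegrable _ _)

/-- If the time derivative averages to zero at infinity, the spatial limit is constant in time. -/
lemma lim_const {f ft fr : ℝ → ℝ → ℝ} {L : ℝ → ℝ} (h : HasGrad (Ioi 0) f ft fr) (hc : CP (Ioi 0) ft) (hL : ∀ t, Tendsto (f t) atTop (𝓝 (L t)))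
    (hb : ∀ T, ∃ C, ∀ t, |t| ≤ T → ∀ n, 1 ≤ n → |∫ r in n..2 * n, ft t r| ≤ C) (t : ℝ) :
    L t = L 0 := by
  obtain ⟨C, hC⟩ := hb |t|
  have l1 := (avg_lim (h.cp.slice t) (hL t)).sub (avg_lim (h.cp.slice 0) (hL 0))
  have l2 : Tendsto (fun n : ℝ => n⁻¹ * (C * |t - 0|)) atTop (𝓝 0) := by simpa using tendsto_inv_atTop_zero.mul_const (C * |t - 0|)
  have l3 : Tendsto (fun n => n⁻¹ * (∫ r in n..2 * n, f t r) - n⁻¹ * ∫ r in n..2 * n, f 0 r) atTop (𝓝 0) := by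
    refine squeeze_zero_norm' ?_ l2
    filter_upwards [eventually_ge_atTop 1] with n hn
    have hn0 : 0 < n := lin!
    have e : (∫ r in n..2 * n, f t r) - (∫ r in n..2 * n, f 0 r) = ∫ τ in (0:ℝ)..t, ∫ r in n..2 * n, ft τ r := by
      rw [← hc.swap 0 t hn0 lin!, ← ii_sub]
      · refine integral_congr fun r hr => ?_
        rw [uIcc_of_le lin!] at hr
        exact (h.time_ftc hc 0 t (hn0.trans_le hr.1)).symm
      · exact ((h.cp.slice t).icc hn0 _).iint lin!
      · exact ((h.cp.slice 0).icc hn0 _).iint lin!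
    rw [← mul_sub, e, norm_mul, norm_eq_abs, abs_of_pos (pos! : 0 < n⁻¹)]
    refine mul_le_l ?_ pos!
    refine norm_integral_le_of_norm_le_const fun τ hτ => hC τ ?_ n hn
    have := abs_sub_left_of_mem_uIcc (uIoc_subset_uIcc hτ)
    simpa using this
  have := tendsto_nhds_unique l1 l3
  linarith

variable {s : Sol}

lemma int_inv5_le {n m : ℝ} (hn : 1 ≤ n) (hm : n ≤ m) : ∫ r in n..m, (r ^ 3)⁻¹ ≤ 1 / n ^ 2 := by
  have hd : ∀ x ∈ Icc n m, HasDerivAt (fun x : ℝ => -(1 / 2) / x ^ 2) ((x ^ 3)⁻¹) x := by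
    intro x hx
    have hx0 : 0 < x := by linarith [hx.1]
    refine ((hasDerivAt_const x (-(1 / 2) : ℝ)).fun_div (hasDerivAt_pow 2 x) pos!).congr_deriv ?_
    simp only [Nat.cast_ofNat]
    field_simp
    ring
  rw [ftc hm hd]
  · have : 0 < 1 / m ^ 2 := by have : 0 < m := lin!
                               positivity
    have : 0 < 1 / n ^ 2 := pos!
    calc _ = 1 / n ^ 2 / 2 - 1 / m ^ 2 / 2 := by ring
      _ ≤ _ := lin!
  · exact ContinuousOn.inv₀ con! fun x hx => by
      have : 0 < x := by linarith [hx.1]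
      positivity

lemma FE.lim_u (hF : FE s) : ∃ c, ∀ t, Tendsto (s.u t) atTop (𝓝 c) := by
  have h1 : ∀ t, ∃ c, Tendsto (s.u t) atTop (𝓝 c) := by
    intro t
    obtain ⟨M, hM⟩ := hF 1 one_pos |t|
    have hM := hM t le_rfl
    have hM0 := hM.nonneg
    refine lim_of_cauchy (C := M + 1) fun x hx y hy => ?_
    have := diff_sq_le hM one_pos hx hy
    refine abs_le_of_sq_le_sq ?_ pos!
    refine this.trans ?_
    rw [div_pow, div_le_div_iff₀ pos! pos!]
    have : x ^ 2 ≤ x ^ 4 := pow_le_pow_right₀ hx (by norm_num)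
    nlinarith [sq_nonneg x, mul_nonneg hM0 (sq_nonneg x), mul_nonneg (mul_nonneg hM0 hM0) (pow_nonneg (zero_le_one.trans hx) 4), mul_le_l this hM0]
  choose L hL using h1
  refine ⟨L 0, fun t => ?_⟩
  rw [← lim_const s.gu s.ga.cp hL ?_ t]
  · exact hL t
  · intro T
    obtain ⟨M, hM⟩ := hF 1 one_pos T
    refine ⟨1 * M + 1 * 1, fun t ht n hn => ?_⟩
    have hn0 : 0 < n := lin!
    have ca := (s.ca t).icc hn0 (2 * n)
    have h3 : ContinuousOn (fun r : ℝ => (r ^ 3)⁻¹) (Icc n (2 * n)) := ContinuousOn.inv₀ con! fun x hx => by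
        have : 0 < x := by linarith [hx.1]
        positivity
    refine (abs_int_lin (f := fun r => r ^ 5 * s.a t r ^ 2) (g := fun r => (r ^ 3)⁻¹) lin! 1 1 ca con! h3 fun r hr => ?_).trans ?_
    · have hr1 : 1 ≤ r := hn.trans hr.1
      have hi : 0 ≤ (r ^ 3)⁻¹ := pos!
      have h5 : r ^ 3 * s.a t r ^ 2 ≤ r ^ 5 * s.a t r ^ 2 := by gcongr; norm_num
      have : 2 * |s.a t r| ≤ r ^ 3 * s.a t r ^ 2 + (r ^ 3)⁻¹ := by
        rw [← sq_abs]
        have := sq_nonneg (r ^ 3 * |s.a t r| - 1)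
        have k : (r ^ 3)⁻¹ * (r ^ 3 * |s.a t r| - 1) ^ 2 = r ^ 3 * |s.a t r| ^ 2 + (r ^ 3)⁻¹ - 2 * |s.a t r| := by field_simp; ring
        have := mul_nonneg hi this
        linarith
      have := abs_nonneg (s.a t r)
      linarith
    · have k1 := ((hM t ht).sub one_pos hn).a_le hn0 (show n ≤ 2 * n by linarith)
      have k2 := int_inv5_le hn (show n ≤ 2 * n by linarith)
      have k3 : 1 / n ^ 2 ≤ 1 := (div_le_one pos!).2 (one_le_pow₀ hn)
      linarith

lemma wr_bound {t M : ℝ} (hM : EB s 1 t M) (hu : Tendsto (s.u t) atTop (𝓝 0)) {n : ℝ} (hn : 1 ≤ n) : |∫ r in n..2 * n, -wr phi phi1 s t r| ≤ 10 * (M + 1) := by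
  have hn0 : 0 < n := lin!
  have hM0 := hM.nonneg
  have ca := (s.cb t).icc hn0 (2 * n)
  have cu := (s.cu t).icc hn0 (2 * n)
  have h3 : ContinuousOn (fun _ : ℝ => (1 : ℝ) / n) (Icc n (2 * n)) := continuousOn_const
  have cp := cphi.continuousOn (s := Icc n (2 * n))
  have cp1 := cphi1.continuousOn (s := Icc n (2 * n))
  have hw : ContinuousOn (fun r => -wr phi phi1 s t r) (Icc n (2 * n)) := by unfold wr; fun_prop
  refine (abs_int_lin (f := fun r => r ^ 5 * s.b t r ^ 2) (g := fun r => 1 / n) lin! 1 (9 + 8 * M) hw con! h3 fun r hr => ?_).trans ?_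
  · have hr1 : 1 ≤ r := hn.trans hr.1
    have hr0 : 0 < r := lin!
    have p := phi_bound hr0
    have p1 := phi1_bound hr0
    have hu1 := u_bound hM one_pos hu hr1
    have e0 : |s.u t r| ≤ (M + 1) / n := by
      refine abs_le_of_sq_le_sq ?_ pos!
      rw [sub_zero] at hu1
      refine hu1.trans ?_
      have : n ^ 2 ≤ r ^ 4 := (pow_le_l hn0.le hr.1 2).trans (pow_le_pow_right₀ hr1 (by norm_num))
      rw [div_pow, div_le_div_iff₀ pos! pos!]
      have h1 : 0 < r ^ 4 := pos!
      calc M * n ^ 2 ≤ M * r ^ 4 := by gcongr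
        _ ≤ (M + 1) ^ 2 * (4 * r ^ 4) := by nlinarith [mul_nonneg hM0 hM0]
    have e1 : |wr phi phi1 s t r| ≤ r * |s.b t r| + 8 * |s.u t r| := by
      unfold wr
      rw [mul_sub]
      refine (abs_sub _ _).trans (add_le_add ?_ ?_)
      · rw [abs_mul, abs_mul, abs_of_pos (pos! : 0 < r ^ 5)]
        calc _ = r ^ 4 * |phi r| * (r * |s.b t r|) := by ring
          _ ≤ 1 * (r * |s.b t r|) := by gcongr
          _ = _ := one_mul _
      · rw [abs_mul, abs_mul, abs_of_pos (pos! : 0 < r ^ 5), ← mul_assoc]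
        gcongr
    have e2 : r * |s.b t r| ≤ r ^ 5 * s.b t r ^ 2 + 1 / n := by
      have h2 : r * |s.b t r| ≤ r ^ 3 * s.b t r ^ 2 + 1 / r := by
        have := sq_nonneg (r ^ 2 * |s.b t r| - 1)
        have k : 1 / r * (r ^ 2 * |s.b t r| - 1) ^ 2 = r ^ 3 * |s.b t r| ^ 2 + 1 / r - 2 * (r * |s.b t r|) := by field_simp; ring
        have h1 : 0 ≤ 1 / r := pos!
        have := mul_nonneg h1 this
        have h4 : 0 ≤ r * |s.b t r| := pos!
        rw [sq_abs] at k
        linarith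
      have h5 : r ^ 3 * s.b t r ^ 2 ≤ r ^ 5 * s.b t r ^ 2 := by gcongr; norm_num
      have h6 : 1 / r ≤ 1 / n := one_div_le_one_div_of_le hn0 hr.1
      linarith
    rw [abs_neg]
    calc _ ≤ _ := e1
      _ ≤ r ^ 5 * s.b t r ^ 2 + 1 / n + 8 * ((M + 1) / n) := by gcongr
      _ = _ := by ring
  · have k1 := (hM.sub one_pos hn).b_le hn0 (show n ≤ 2 * n by linarith)
    rw [ii_const, show (2 * n - n) * (1 / n) = 1 by field_simp; ring]
    linarith

lemma FE.exists_pot (hF : FE s) (hu : ∀ t, Tendsto (s.u t) atTop (𝓝 0)) : ∃ Ψ, Pot phi phi1 s 0 Ψ ∧ ∀ t, Tendsto (Ψ t) atTop (𝓝 0) := by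
  obtain ⟨Ψ, hΨ, -⟩ := Pot.exists (fun r _ => dphi r) (fun r hr => dphi1 hr) s 0 0 1 0
  have h1 : ∀ t, ∃ c, Tendsto (Ψ t) atTop (𝓝 c) := by
    intro t
    obtain ⟨M, hM⟩ := hF 1 one_pos |t|
    have hM := hM t le_rfl
    refine lim_of_cauchy (C := M + 1) fun x hx y hy => ?_
    have hx0 : 0 < x := lin!
    have ca := (s.ca t).icc hx0 y
    have cp := cphi.continuousOn (s := Icc x y)
    have hc : ContinuousOn (fun r => -(r ^ 5 * phi r * s.a t r)) (Icc x y) := con!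
    rw [← ftc hy (fun r hr => hΨ.dr t (Icc_pos hx0 hr)) hc]
    have h3 : ContinuousOn (fun r : ℝ => (r ^ 3)⁻¹) (Icc x y) := ContinuousOn.inv₀ con! fun x hx => by
        have : 0 < x := by linarith [hx.1]
        positivity
    refine (abs_int_lin (f := fun r => r ^ 5 * s.a t r ^ 2) (g := fun r => (r ^ 3)⁻¹) hy (1 / x) x hc con! h3 fun r hr => ?_).trans ?_
    · have hr0 : 0 < r := by linarith [hr.1]
      have p := phi_bound hr0
      rw [abs_neg, abs_mul, abs_mul, abs_of_pos (pos! : 0 < r ^ 5)]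
      calc r ^ 5 * |phi r| * |s.a t r| = r ^ 4 * |phi r| * (r * |s.a t r|) := by ring
        _ ≤ 1 * (r * |s.a t r|) := by gcongr
        _ ≤ 1 / x * (r ^ 5 * s.a t r ^ 2) + x * (r ^ 3)⁻¹ := by
          have k : x * (r ^ 3)⁻¹ * (r ^ 4 * |s.a t r| / x - 1) ^ 2 = 1 / x * (r ^ 5 * |s.a t r| ^ 2) + x * (r ^ 3)⁻¹ - 2 * (r * |s.a t r|) := by field_simp; ring
          have h4 : 0 ≤ r * |s.a t r| := pos!
          have h5 : 0 ≤ x * (r ^ 3)⁻¹ * (r ^ 4 * |s.a t r| / x - 1) ^ 2 := pos!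
          rw [sq_abs] at k
          linarith
    · have k1 := (hM.sub one_pos hx).a_le hx0 hy
      have k2 := int_inv5_le hx hy
      calc _ ≤ 1 / x * M + x * (1 / x ^ 2) := by gcongr
        _ = _ := by field_simp
  choose L hL using h1
  have hc := lim_const hΨ (CP.sub (HasGrad.const 0).cp (wr_grad (fun r _ => dphi r) (fun r hr => dphi1 hr) s).cp) hL (fun T => by
      obtain ⟨M, hM⟩ := hF 1 one_pos T
      refine ⟨10 * (M + 1), fun t ht n hn => ?_⟩
      simpa only [zero_sub] using wr_bound (hM t ht) (hu t) hn)
  refine ⟨fun t r => Ψ t r - L 0, ?_, fun t => ?_⟩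
  · exact (hΨ.sub (HasGrad.const (L 0))).congr (fun _ _ _ => (sub_zero _).symm) (fun _ _ _ => (sub_zero _).symm)
  · have := (hL t).sub_const (L 0)
    rwa [hc t, sub_self] at this

lemma exists_scales : ∃ R1 X0 M Mi : ℝ, ∃ N : ℕ, 10 ≤ R1 ∧ 0 < X0 ∧ 16 * X0 < 1 ∧ X0 * 2 ^ N = R1 ∧
    (∃ R < R1, Pair (Ioi R) phi phi1 Iout M) ∧ ∃ J, Ioc 0 (16 * X0) ⊆ J ∧ Pair J Gam Gam1 Iin Mi := by
  obtain ⟨R, M, hR, hP⟩ := phi_pair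
  obtain ⟨X, Mi, hX0, hX1, hQ⟩ := Gam_pair
  obtain ⟨N, hN⟩ := pow_unbounded_of_one_lt (16 * (R + 1) / X) (one_lt_two (α := ℝ))
  rw [div_lt_iff₀ hX0] at hN
  have h2 : (0 : ℝ) < 2 ^ N := pos!
  have hlt : 16 * ((R + 1) / 2 ^ N) < X := by rw [← mul_div_assoc, div_lt_iff₀ h2]; linarith
  refine ⟨R + 1, (R + 1) / 2 ^ N, M, Mi, N, lin!, pos!, lin!, by field_simp, ⟨R, lin!, hP⟩, Ioo 0 X, fun r hr => ⟨hr.1, hr.2.trans_lt hlt⟩, hQ⟩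

/-- A radius beyond which the static solution `phi` is well behaved. -/
def R1 : ℝ := exists_scales.choose
/-- A radius below which the static solution `Gam` is well behaved. -/
def X0 : ℝ := exists_scales.choose_spec.choose
/-- The number of dyadic steps from `X0` to `R1`. -/
def Nst : ℕ := exists_scales.choose_spec.choose_spec.choose_spec.choose_spec.choose

lemma scales : ∃ M Mi : ℝ, 10 ≤ R1 ∧ 0 < X0 ∧ 16 * X0 < 1 ∧ X0 * 2 ^ Nst = R1 ∧
    (∃ R < R1, Pair (Ioi R) phi phi1 Iout M) ∧ ∃ J, Ioc 0 (16 * X0) ⊆ J ∧ Pair J Gam Gam1 Iin Mi :=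
  ⟨_, _, exists_scales.choose_spec.choose_spec.choose_spec.choose_spec.choose_spec⟩

lemma R1_ge : 10 ≤ R1 := by obtain ⟨_, _, h, _⟩ := scales; exact h
lemma X0_pos : 0 < X0 := by obtain ⟨_, _, _, h, _⟩ := scales; exact h
lemma X0_lt : 16 * X0 < 1 := by obtain ⟨_, _, _, _, h, _⟩ := scales; exact h
/-- The solution `t phi(r)`. -/
def tphi : Sol where
  u t r := t * phi r
  a _ r := phi r
  b t r := t * phi1 r
  aT _ _ := 0
  aR _ r := phi1 r
  bR t r := t * (-5 / r * phi1 r + Vp r * phi r)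
  gu := (HasGrad.time.mul (HasGrad.ofR fun r _ => dphi r)).congr (fun t r _ => by ring) (fun t r _ => by ring)
  ga := HasGrad.ofR fun r _ => dphi r
  gb := (HasGrad.time.mul (HasGrad.ofR fun r hr => dphi1 hr)).congr (fun t r _ => by ring) (fun t r _ => by ring)
  cT := (HasGrad.const 0).cp
  cR := CP.ofR cphi1.continuousOn
  cB := HasGrad.time.cp.mul (CP.ofR (ContinuousOn.add (ContinuousOn.mul (continuousOn_const.div continuousOn_id fun r hr => ne_of_gt hr) cphi1.continuousOn)
    (cont_Vp.mul cphi).continuousOn))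
  pde t r hr := by ring

lemma tphi_EB {ρ : ℝ} (hρ : 0 < ρ) (t : ℝ) : EB tphi ρ t ((1 + 64 * t ^ 2 / ρ ^ 2) / ρ ^ 2) := by
  intro Y hY
  have hd : ∀ x ∈ Icc ρ Y, HasDerivAt (fun x : ℝ => -(1 + 64 * t ^ 2 / ρ ^ 2) / 2 / x ^ 2) ((1 + 64 * t ^ 2 / ρ ^ 2) / x ^ 3) x := by
    intro x hx
    have hx0 : 0 < x := by linarith [hx.1]
    refine ((hasDerivAt_const x (-(1 + 64 * t ^ 2 / ρ ^ 2) / 2)).fun_div (hasDerivAt_pow 2 x) pos!).congr_deriv ?_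
    simp only [Nat.cast_ofNat]
    field_simp
    ring
  have hc : ContinuousOn (fun x : ℝ => (1 + 64 * t ^ 2 / ρ ^ 2) / x ^ 3) (Icc ρ Y) := ContinuousOn.div con! con! fun x hx => by
      have : 0 < x := by linarith [hx.1]
      positivity
  have hY0 : 0 < Y := lin!
  calc _ ≤ ∫ x in ρ..Y, (1 + 64 * t ^ 2 / ρ ^ 2) / x ^ 3 := by
        refine int_mono hY (tphi.ce t hρ) hc fun r hr => ?_
        have hr0 : 0 < r := by linarith [hr.1]
        have p := phi_bound hr0
        have p1 := phi1_bound hr0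
        change r ^ 5 * (phi r ^ 2 + (t * phi1 r) ^ 2) ≤ _
        rw [le_div_iff₀ pos!]
        have q := pow_le_l pos! p 2
        have q1 := pow_le_l pos! p1 2
        rw [mul_pow, sq_abs] at q q1
        have hr2 : ρ ^ 2 ≤ r ^ 2 := pow_le_l hρ.le hr.1 2
        calc _ = (r ^ 4) ^ 2 * phi r ^ 2 + t ^ 2 / r ^ 2 * ((r ^ 5) ^ 2 * phi1 r ^ 2) := by
              field_simp
          _ ≤ 1 ^ 2 + t ^ 2 / ρ ^ 2 * 8 ^ 2 := by gcongr
          _ = _ := by ring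
    _ = (1 + 64 * t ^ 2 / ρ ^ 2) / (2 * ρ ^ 2) - (1 + 64 * t ^ 2 / ρ ^ 2) / (2 * Y ^ 2) := by
        rw [ftc hY hd hc]
        field_simp
        ring
    _ ≤ (1 + 64 * t ^ 2 / ρ ^ 2) / (2 * ρ ^ 2) := by
        have : 0 ≤ (1 + 64 * t ^ 2 / ρ ^ 2) / (2 * Y ^ 2) := pos!
        linarith
    _ ≤ _ := by
        apply div_le_div_of_nonneg_left pos! pos!
        nlinarith

lemma tphi_FE : FE tphi := by
  intro ρ hρ T
  refine ⟨(1 + 64 * T ^ 2 / ρ ^ 2) / ρ ^ 2, fun t ht => (tphi_EB hρ t).mono ?_⟩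
  have : t ^ 2 ≤ T ^ 2 := sq_le_sq' (by linarith [neg_abs_le t]) ((le_abs_self t).trans ht)
  gcongr

lemma tphi_late {ρ E : ℝ} (hρ : 0 < ρ) (hE : 0 < E) : Late tphi ρ E := by
  refine ⟨65 / E + 1, fun t ht => ?_⟩
  have h0 : 0 < 65 / E := pos!
  have ht1 : 1 ≤ t := lin!
  refine (tphi_EB (show 0 < ρ + t by linarith) t).mono ?_
  have h1 : t ^ 2 / (ρ + t) ^ 2 ≤ 1 := by
    rw [div_le_one pos!]
    exact pow_le_l lin! lin! 2
  have h2 : 65 ≤ E * t := by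
    have : E * (65 / E + 1) ≤ E * t := by gcongr
    have e : E * (65 / E + 1) = 65 + E := by field_simp
    linarith
  rw [div_le_iff₀ pos!, mul_div_assoc]
  nlinarith

variable {s s' : Sol}

lemma EB.lin {ρ t M M' : ℝ} (hρ : 0 < ρ) (h : EB s ρ t M) (h' : EB s' ρ t M') (x y : ℝ) : EB (Sol.lin x s y s') ρ t (2 * x ^ 2 * M + 2 * y ^ 2 * M') := by
  intro Y hY
  refine (int_le_lin hY (2 * x ^ 2) (2 * y ^ 2) (Sol.ce _ t hρ) (s.ce t hρ) (s'.ce t hρ) fun r hr => ?_).trans ?_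
  · have hr0 : 0 < r := by linarith [hr.1]
    change r ^ 5 * ((x * s.a t r + y * s'.a t r) ^ 2 + (x * s.b t r + y * s'.b t r) ^ 2) ≤ _
    have := mul_nonneg (pow_nonneg hr0.le 5) (sq_nonneg (x * s.a t r - y * s'.a t r))
    have := mul_nonneg (pow_nonneg hr0.le 5) (sq_nonneg (x * s.b t r - y * s'.b t r))
    linarith
  · have := h Y hY
    have := h' Y hY
    gcongr

lemma FE.lin (h : FE s) (h' : FE s') (x y : ℝ) : FE (Sol.lin x s y s') := by
  intro ρ hρ T
  obtain ⟨M, hM⟩ := h ρ hρ T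
  obtain ⟨M', hM'⟩ := h' ρ hρ T
  exact ⟨_, fun t ht => (hM t ht).lin hρ (hM' t ht) x y⟩

lemma Late.lin {ρ E E' : ℝ} (hρ : 0 < ρ) (h : Late s ρ E) (h' : Late s' ρ E') (x y : ℝ) : Late (Sol.lin x s y s') ρ (2 * x ^ 2 * E + 2 * y ^ 2 * E') := by
  obtain ⟨T, hT⟩ := h
  obtain ⟨T', hT'⟩ := h'
  refine ⟨max (max T T') 0, fun t ht => ?_⟩
  have := (le_max_right _ _).trans ht
  exact (hT t ((le_max_left _ _).trans ((le_max_left _ _).trans ht))).lin lin! (hT' t ((le_max_right _ _).trans ((le_max_left _ _).trans ht))) x y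

lemma FE.lim_odd (h : FE s) (h0 : ∀ r, 0 < r → s.u 0 r = 0 ∧ s.b 0 r = 0) (t : ℝ) : Tendsto (s.u t) atTop (𝓝 0) := by
  obtain ⟨c, hc⟩ := h.lim_u
  have : c = 0 := by
    refine tendsto_nhds_unique (hc 0) (tendsto_const_nhds.congr' ?_)
    filter_upwards [eventually_gt_atTop 0] with r hr using (h0 r hr).1.symm
  exact this ▸ hc t

set_option maxHeartbeats 2000000 in
/-- Odd solutions: outside `X0` the velocity is close to a multiple of `phi`, inside to a
combination of `phi` and `Gam`. -/
theorem odd_main : ∃ C, 0 ≤ C ∧ ∀ s : Sol, (∀ r, 0 < r → s.u 0 r = 0 ∧ s.b 0 r = 0) → FE s →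
    ∃ β : ℝ → ℝ, ∀ ρ E, 0 < ρ → 0 < E → Late s ρ E → (∀ Y, max ρ R1 ≤ Y → ∫ r in (max ρ X0)..Y, r ^ 5 * (s.a 0 r - β (max ρ R1) * phi r) ^ 2 ≤ C * E) ∧
      (ρ ≤ X0 → ∃ γ, |γ| ≤ C * √E ∧ ∫ r in ρ..16 * X0, r ^ 5 * (s.a 0 r - β R1 * phi r - γ * Gam r) ^ 2 ≤ C * E) := by
  obtain ⟨M, Mi, hR1, hX0, hX1, hN, ⟨R0, hR0, P⟩, J, hJ, Q⟩ := scales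
  have hXR : 16 * X0 ≤ R1 := lin!
  have hM := P.hM
  set C1 := 96 + 64 * M ^ 4 with hC1
  set K := 48 * M ^ 3 * √C1 + 5 with hK
  have hK0 : 0 < K := pos!
  set Bs := 2 * (1 + √(R1 / X0)) * exp (64 / X0 * R1) with hBs
  set Bd := 64 * (1 + √(R1 / X0)) * exp (64 / X0 * R1) / √X0 with hBd
  obtain ⟨Ci, hCi0, hCi⟩ := Q.inner_odd (X := 16 * X0) (Cs := Bs * √(16 * X0) + Bd) pos! hJ pos!
  set C2 := 8 * K ^ 2 + 8 * Bd ^ 2 * K ^ 2 * R1 with hC2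
  refine ⟨C1 + C2 + Ci * K + Ci * K ^ 2, pos!, fun s h0 hF => ?_⟩
  obtain ⟨Ψ, hΨ, hΨl⟩ := hF.exists_pot (hF.lim_odd h0)
  refine ⟨fun R => Ψ 0 R / Iout R, fun ρ E hρ hE hL => ?_⟩
  set R := max ρ R1 with hR
  have hRR : R1 ≤ R := le_max_right _ _
  have hRρ : ρ ≤ R := le_max_left _ _
  have hRp : 0 < R := lin!
  have hJR : Ici R ⊆ Ioi R0 := fun r hr => lt_of_lt_of_le hR0 (hRR.trans hr)
  have hLR : Late s R E := by
    obtain ⟨T0, hT⟩ := hL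
    refine ⟨max T0 0, fun t ht => ?_⟩
    have := (le_max_right _ _).trans ht
    exact (hT t ((le_max_left _ _).trans ht)).sub lin! lin!
  obtain ⟨N, hNE⟩ := hF R hRp 0
  have hout : ∀ Y, R ≤ Y → ∫ r in R..Y, a2 phi Iout s Ψ 0 r ^ 2 ≤ C1 * E := fun Y hY => P.outer_odd hΨ hJR h0 (hF.lim_odd h0) hΨl hLR (hNE 0 (by simp)) hY
  set b := Ψ 0 R / Iout R with hb
  have hI : 0 < Iout R := P.I0 R (hJR (show R ∈ Ici R from le_refl R))
  set s' := Sol.lin 1 s (-b) tphi with hs'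
  have h0' : ∀ r, 0 < r → s'.u 0 r = 0 ∧ s'.b 0 r = 0 := fun r hr => by
    obtain ⟨e1, e2⟩ := h0 r hr
    constructor
    · change 1 * s.u 0 r + -b * (0 * phi r) = 0
      rw [e1]; ring
    · change 1 * s.b 0 r + -b * (0 * phi1 r) = 0
      rw [e2]; ring
  have ha' : ∀ t r, s'.a t r = s.a t r - b * phi r := fun t r => by
    change 1 * s.a t r + -b * phi r = _
    ring
  have hab : ∀ r, s.a 0 r - Ψ 0 R / Iout R * phi r = s'.a 0 r := fun r => (ha' 0 r).symm
  have hF' : FE s' := hF.lin tphi_FE 1 (-b)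
  have hL' : Late s' ρ (3 * E) := by
    have := Late.lin hρ hL (tphi_late hρ (show 0 < E / (2 * (b ^ 2 + 1)) by positivity)) 1 (-b)
    obtain ⟨T, hT⟩ := this
    refine ⟨T, fun t ht => (hT t ht).mono ?_⟩
    have : 2 * (-b) ^ 2 * (E / (2 * (b ^ 2 + 1))) ≤ E := by
      rw [← mul_div_assoc, div_le_iff₀ pos!]
      nlinarith
    linarith
  have hΨ' : Pot phi phi1 s' 0 (fun t r => Ψ t r - b * Iout r) := by
    refine (hΨ.sub ((HasGrad.ofR fun r _ => dIout r).smul b)).congr (fun t r hr => ?_) (fun t r hr => ?_)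
    · change 0 - r ^ 5 * (phi r * (1 * s.b t r + -b * (t * phi1 r)) - phi1 r * (1 * s.u t r + -b * (t * phi r))) =
        0 - r ^ 5 * (phi r * s.b t r - phi1 r * s.u t r) - b * 0
      ring
    · rw [ha']; ring
  have ha2 : ∀ Y, R ≤ Y → ∫ r in R..Y, a2 phi Iout s' (fun t r => Ψ t r - b * Iout r) 0 r ^ 2 ≤ C1 * E := by
    intro Y hY
    refine le_of_eq_of_le (ii_congr hY fun r hr => ?_) (hout Y hY)
    have : 0 < Iout r := P.I0 r (hJR hr.1)
    simp only [a2, ha']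
    congr 1
    field_simp
    ring
  have hΨ0 : Ψ 0 R - b * Iout R = 0 := by rw [hb]; field_simp; ring
  have hrec : ∀ Y, R ≤ Y → ∫ r in R..Y, r ^ 5 * s'.a 0 r ^ 2 ≤ C1 * E := fun Y hY => P.recover hΨ' 0 hY (fun r hr => hJR hr.1) hΨ0 (ha2 Y hY)
  have hE2 : √E ^ 2 = E := Real.sq_sqrt hE.le
  have cae : ∀ x y, 0 < x → ContinuousOn (fun r => r ^ 5 * s'.a 0 r ^ 2) (Icc x y) := fun x y hx => by
    have := (s'.ca 0).icc hx y
    fun_prop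
  have hC2' : 0 ≤ C2 := pos!
  have hCK : 0 ≤ Ci * K := pos!
  have hCK2 : 0 ≤ Ci * K ^ 2 := pos!
  rcases le_total R1 ρ with hc | hc
  · have eR : R = ρ := max_eq_left hc
    have eX : max ρ X0 = ρ := max_eq_left lin!
    refine ⟨fun Y hY => ?_, fun hX => lin!⟩
    simp only [hab, eX]
    have := hrec Y hY
    rw [eR] at this
    nlinarith
  have eR : R = R1 := max_eq_right hc
  simp only [eR] at *
  set A := K * √E with hA
  have hA0 : 0 ≤ A := pos!
  have hA2 : A ^ 2 = K ^ 2 * E := by rw [hA, mul_pow, hE2]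
  have hline : ∀ ξ, R1 ≤ ξ → ξ ^ 2 * |s'.u ((ξ - R1) / 2) ((ξ + R1) / 2)| ≤ A := fun ξ hξ => by
    have := P.line_bound hΨ' (A := √C1 * √E) hJR pos! h0' hΨ0 (fun Y hY => by rw [mul_pow, hE2, Real.sq_sqrt pos!]; exact ha2 Y hY) hξ
    refine this.trans ?_
    rw [hA, hK, ← mul_assoc]
    gcongr
    linarith
  obtain ⟨T0, hT0⟩ := hL'
  set T := max T0 R1 with hT
  have hTR : R1 ≤ T := le_max_right _ _
  have hET : EB s' (ρ + T) T (A ^ 2 / 6) := (hT0 T (le_max_left _ _)).mono (by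
    rw [hA2]
    have : 5 ≤ K := by rw [hK]; have : 0 ≤ 48 * M ^ 3 * √C1 := pos!
                       linarith
    have : 25 ≤ K ^ 2 := by nlinarith
    have := mul_le_r this hE.le
    linarith)
  obtain ⟨q, hq, hq2, hst⟩ := s'.strip hX0 hρ hc lin! hA0 hTR (fun r hr => (h0' r hr).1) hline hET (hF'.lim_odd h0' T)
  have hpart : ∫ r in (max ρ X0)..R1, r ^ 5 * s'.a 0 r ^ 2 ≤ C2 * E := by
    have hm : max ρ X0 ≤ R1 := max_le hc lin!
    have hmp : 0 < max ρ X0 := lt_of_lt_of_le hρ (le_max_left _ _)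
    have hq' : ContinuousOn q (Icc (max ρ X0) R1) := hq.mono (Icc_subset_Icc_left (le_max_left _ _))
    refine (int_le_lin hm 8 (8 * Bd ^ 2 * A ^ 2) (cae _ _ hmp) (f := fun r => q r ^ 2) (g := fun _ => 1) (hq'.pow 2) continuousOn_const fun r hr => ?_).trans ?_
    · have hr0 : 0 < r := hmp.trans_le hr.1
      have h1 := (hst r r ((le_max_left _ _).trans hr.1) hr.2 le_rfl ((le_max_right _ _).trans hr.1) (by linarith [hr.2])).2
      rw [← hBd, show (r - r) / 2 = 0 by ring, show (r + r) / 2 = r by ring, Dm, (h0' r hr0).1,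
        (h0' r hr0).2, show (5 / (2 * r) * S r * 0 + S r * 0 - S r * s'.a 0 r) / 2 = -(S r * s'.a 0 r) / 2 by ring] at h1
      have h2 := pow_le_l (abs_nonneg _) h1 2
      rw [sq_abs, div_pow, neg_sq, mul_pow, S_sq hr0] at h2
      have h3 : (|q r| + Bd * A) ^ 2 ≤ 2 * q r ^ 2 + 2 * (Bd * A) ^ 2 := by nlinarith [sq_nonneg (|q r| - Bd * A), sq_abs (q r)]
      nlinarith
    · have i1 : ∫ r in (max ρ X0)..R1, q r ^ 2 ≤ A ^ 2 := (int_mono_set (le_max_left _ _) hm le_rfl (hq.pow 2) fun _ _ => sq_nonneg _).trans hq2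
      rw [ii_const]
      calc _ ≤ 8 * A ^ 2 + 8 * Bd ^ 2 * A ^ 2 * ((R1 - 0) * 1) := by gcongr
        _ = _ := by rw [hC2, hA2]; ring
  refine ⟨fun Y hY => ?_, fun hX => ?_⟩
  · simp only [hab]
    have hm : max ρ X0 ≤ R1 := max_le hc lin!
    have hmp : 0 < max ρ X0 := lt_of_lt_of_le hρ (le_max_left _ _)
    rw [← int_sub hm hY (cae _ _ hmp)]
    have := hrec Y hY
    nlinarith
  · obtain ⟨γ, hγ, hγ2⟩ := hCi s' ρ A q h0' hρ lin! hA0 (hq.mono (Icc_subset_Icc_right hXR)) ((int_mono_set le_rfl lin! hXR (hq.pow 2) fun _ _ => sq_nonneg _).trans hq2)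
      (fun η h1 h2 => by
        obtain ⟨k1, k2⟩ := hst η (16 * X0) h1 (h2.trans hXR) h2 lin! lin!
        have i1 : 0 ≤ Bs * √(16 * X0) * A := pos!
        have i2 : 0 ≤ Bd * A := pos!
        constructor
        · refine k1.trans ?_
          linarith
        · refine k2.trans ?_
          linarith)
    refine ⟨γ, ?_, ?_⟩
    · refine hγ.trans ?_
      rw [hA, ← mul_assoc]
      gcongr
      have : 0 ≤ C1 := pos!
      linarith
    · simp only [hab]
      refine hγ2.trans ?_
      rw [hA2, ← mul_assoc]
      gcongr
      have : 0 ≤ C1 := pos!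
      linarith

lemma cont_S' (J : Set ℝ) : ContinuousOn S J := cont_S.continuousOn

lemma Ioi_of_Icc {p q r : ℝ} (hp : 0 < p) (hr : r ∈ Icc p q) : 0 < r := hp.trans_le hr.1

/-- Weighted Cauchy-Schwarz against a bounded function. -/
lemma weighted_cs {f e : ℝ → ℝ} {p q A D : ℝ} (hp : 0 < p) (hpq : p ≤ q) (hf : ContinuousOn f (Icc p q)) (he : ContinuousOn e (Icc p q)) (hA : ∀ r ∈ Icc p q, |f r| ≤ A)
    (hD : ∫ r in p..q, r ^ 5 * e r ^ 2 ≤ D) : |∫ r in p..q, r ^ 5 * (f r * e r)| ≤ A * q ^ 3 * √D := by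
  have hA0 : 0 ≤ A := (abs_nonneg _).trans (hA p (left_mem_Icc.2 hpq))
  have hq : 0 < q := lin!
  have h := cs (f := fun r => S r * f r) (g := fun r => S r * e r) hpq ((cont_S' _).mul hf) ((cont_S' _).mul he)
  have e1 : ∫ r in p..q, S r * f r * (S r * e r) = ∫ r in p..q, r ^ 5 * (f r * e r) := integral_congr fun r hr => by
      rw [uIcc_of_le hpq] at hr
      rw [← S_sq (Ioi_of_Icc hp hr)]; ring
  have e2 : ∫ r in p..q, (S r * e r) ^ 2 ≤ D := by
    refine (ii_congr hpq fun r hr => ?_).trans_le hD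
    rw [← S_sq (Ioi_of_Icc hp hr)]; ring
  have e3 : ∫ r in p..q, (S r * f r) ^ 2 ≤ A ^ 2 * q ^ 6 := by
    calc _ ≤ ∫ r in p..q, A ^ 2 * q ^ 5 := by
          refine int_mono hpq (((cont_S' _).mul hf).pow 2) continuousOn_const fun r hr => ?_
          have hr0 := Ioi_of_Icc hp hr
          rw [mul_pow, S_sq hr0, mul_comm, ← sq_abs (f r)]
          have := hA r hr
          have := hr.2
          gcongr
      _ = A ^ 2 * q ^ 5 * (q - p) := by rw [ii_const]; ring
      _ ≤ A ^ 2 * q ^ 5 * q := by gcongr; linarith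
      _ = _ := by ring
  rw [e1] at h
  have hD0 : 0 ≤ D := (int_sq_nonneg hpq).trans e2
  refine abs_le_of_sq_le_sq ?_ pos!
  calc _ ≤ _ := h
    _ ≤ A ^ 2 * q ^ 6 * D := mul_le_mul e3 e2 (int_sq_nonneg hpq) pos!
    _ = _ := by rw [mul_pow, Real.sq_sqrt hD0]; ring

/-- A bump on `[p, 2p]` and its derivatives. -/
def zet (p r : ℝ) : ℝ := ((r - p) * (2 * p - r)) ^ 2
def zet1 (p r : ℝ) : ℝ := 2 * ((r - p) * (2 * p - r)) * (3 * p - 2 * r)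
def zet2 (p r : ℝ) : ℝ := 2 * (3 * p - 2 * r) ^ 2 - 4 * ((r - p) * (2 * p - r))
/-- The elliptic operator applied to the bump. -/
def Lq (p r : ℝ) : ℝ := zet2 p r + 5 / r * zet1 p r - Vp r * zet p r

lemma dzet (p r : ℝ) : HasDerivAt (zet p) (zet1 p r) r := by
  refine ((((hasDerivAt_id' r).sub_const p).fun_mul ((hasDerivAt_id' r).const_sub (2 * p))).fun_pow 2).congr_deriv ?_
  simp only [zet1, Nat.cast_ofNat]
  ring

lemma dzet1 (p r : ℝ) : HasDerivAt (zet1 p) (zet2 p r) r := by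
  refine (((((hasDerivAt_id' r).sub_const p).fun_mul ((hasDerivAt_id' r).const_sub (2 * p))).const_mul 2).fun_mul
    (((hasDerivAt_id' r).const_mul 2).const_sub (3 * p))).congr_deriv ?_
  simp only [zet2]
  ring

lemma czet (p : ℝ) : Continuous (zet p) := by unfold zet; fun_prop

lemma cLq {p q x : ℝ} (hx : 0 < x) : ContinuousOn (Lq p) (Icc x q) := by
  have := cont_Vp
  have h2 : Continuous (zet2 p) := by unfold zet2; fun_prop
  have h1 : Continuous (zet1 p) := by unfold zet1; fun_prop
  have := czet p
  unfold Lq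
  have : ContinuousOn (fun r : ℝ => 5 / r) (Icc x q) := continuousOn_const.div continuousOn_id fun r hr => (Ioi_of_Icc hx hr).ne'
  fun_prop

lemma zet_bound {p r : ℝ} (hp : 0 < p) (hr : r ∈ Icc p (2 * p)) : |zet p r| ≤ p ^ 4 := by
  have h1 : 0 ≤ r - p := by linarith [hr.1]
  have h2 : 0 ≤ 2 * p - r := by linarith [hr.2]
  have h3 : (r - p) * (2 * p - r) ≤ p * p := mul_le_mul (by linarith [hr.2]) (by linarith [hr.1]) h2 hp.le
  rw [zet, abs_of_nonneg pos!]
  calc _ ≤ (p * p) ^ 2 := by gcongr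
    _ = _ := by ring

lemma Lq_bound {p r : ℝ} (hp : 0 < p) (hr : r ∈ Icc p (2 * p)) : |Lq p r| ≤ 28 * p ^ 2 := by
  have hr0 := Ioi_of_Icc hp hr
  have h1 : 0 ≤ r - p := by linarith [hr.1]
  have h2 : 0 ≤ 2 * p - r := by linarith [hr.2]
  have h3 : (r - p) * (2 * p - r) ≤ p * p := mul_le_mul (by linarith [hr.2]) (by linarith [hr.1]) h2 hp.le
  have h30 : 0 ≤ (r - p) * (2 * p - r) := mul_nonneg h1 h2
  have h4 : |3 * p - 2 * r| ≤ p := abs_le.2 ⟨by linarith [hr.2], by linarith [hr.1]⟩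
  have b2 : |zet2 p r| ≤ 6 * p ^ 2 := by
    have : (3 * p - 2 * r) ^ 2 ≤ p ^ 2 := sq_le_sq' (abs_le.1 h4).1 (abs_le.1 h4).2
    rw [zet2, abs_le]
    constructor <;> nlinarith [sq_nonneg (3 * p - 2 * r)]
  have b1 : |5 / r * zet1 p r| ≤ 10 * p ^ 2 := by
    rw [zet1, abs_mul, abs_mul, abs_mul, abs_of_nonneg h30, abs_of_pos (show 0 < 5 / r by positivity), abs_two]
    calc _ ≤ 5 / p * (2 * (p * p) * p) := by gcongr; exact hr.1
      _ = _ := by field_simp; ring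
  have b0 : |Vp r * zet p r| ≤ 12 * p ^ 2 := by
    rw [abs_mul]
    calc _ ≤ 12 / p ^ 2 * p ^ 4 := by
          have := zet_bound hp hr
          have := (abs_Vp hr0).trans (show 12 / r ^ 2 ≤ 12 / p ^ 2 by gcongr; exact hr.1)
          gcongr
      _ = _ := by field_simp
  rw [abs_le] at b0 b1 b2 ⊢
  unfold Lq
  constructor <;> linarith

lemma zet_int {p : ℝ} (hp : 0 < p) : p ^ 10 / 30 ≤ ∫ r in p..2 * p, r ^ 5 * zet p r := by
  have hpp : p ≤ 2 * p := lin!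
  have h := ftc (f := fun r => p ^ 2 * (r - p) ^ 3 / 3 - p * (r - p) ^ 4 / 2 + (r - p) ^ 5 / 5) (f' := zet p) hpp (fun r _ => by
      have hd := (hasDerivAt_id' r).sub_const p
      refine (((((hd.fun_pow 3).const_mul (p ^ 2)).div_const 3).sub (((hd.fun_pow 4).const_mul p).div_const 2)).add ((hd.fun_pow 5).div_const 5)).congr_deriv ?_
      simp only [Nat.cast_ofNat, zet]
      ring) (czet p).continuousOn
  calc _ = p ^ 5 * ∫ r in p..2 * p, zet p r := by rw [h]; ring
    _ = ∫ r in p..2 * p, p ^ 5 * zet p r := by rw [ii_const_mul]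
    _ ≤ _ := by
      have := czet p
      refine int_mono hpp con! con! fun r hr => ?_
      have : 0 ≤ zet p r := sq_nonneg _
      have := hr.1
      gcongr

lemma bump_ibp {f f1 F : ℝ → ℝ} {p : ℝ} (hp : 0 < p) (hf : HD f f1) (hf1 : ∀ r, 0 < r → HasDerivAt f1 (F r - 5 / r * f1 r + Vp r * f r) r) (hF : ContinuousOn F (Ioi 0)) :
    ∫ r in p..2 * p, r ^ 5 * (zet p r * F r) = ∫ r in p..2 * p, r ^ 5 * (Lq p r * f r) := by
  have hpp : p ≤ 2 * p := lin!
  have cF := hF.icc hp (2 * p)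
  have cf : ContinuousOn f (Icc p (2 * p)) := fun r hr => (hf r (Ioi_of_Icc hp hr)).cwa
  have := czet p
  have cL := cLq (p := p) (q := 2 * p) hp
  have h := ftc (f := fun r => r ^ 5 * (zet p r * f1 r - zet1 p r * f r)) (f' := fun r => r ^ 5 * (zet p r * F r) - r ^ 5 * (Lq p r * f r)) hpp (fun r hr => by
      have hr0 := Ioi_of_Icc hp hr
      refine ((hasDerivAt_pow 5 r).fun_mul (((dzet p r).fun_mul (hf1 r hr0)).fun_sub ((dzet1 p r).fun_mul (hf r hr0)))).congr_deriv ?_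
      simp only [Nat.cast_ofNat, Lq]
      field_simp
      ring) con!
  rw [ii_sub ((show ContinuousOn _ (Icc p (2 * p)) by fun_prop).iint hpp) ((show ContinuousOn _ (Icc p (2 * p)) by fun_prop).iint hpp)] at h
  have e : (fun r => r ^ 5 * (zet p r * f1 r - zet1 p r * f r)) (2 * p) - (fun r => r ^ 5 * (zet p r * f1 r - zet1 p r * f r)) p = 0 := by simp [zet, zet1]
  linarith

/-- The bump moment of the velocity. -/
def mom (s : Sol) (p t : ℝ) : ℝ := ∫ r in p..2 * p, r ^ 5 * (zet p r * s.a t r)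

variable {s : Sol}

lemma CP.int_time {f ft fr : ℝ → ℝ → ℝ} (h : HasGrad (Ioi 0) f ft fr) (hc : CP (Ioi 0) ft) {k : ℝ → ℝ} {p : ℝ} (hp : 0 < p) (hk : ContinuousOn k (Ioi 0)) (t1 t2 : ℝ) :
    (∫ r in p..2 * p, r ^ 5 * (k r * f t2 r)) - ∫ r in p..2 * p, r ^ 5 * (k r * f t1 r) = ∫ t in t1..t2, ∫ r in p..2 * p, r ^ 5 * (k r * ft t r) := by
  have hpp : p ≤ 2 * p := lin!
  have ck := hk.icc hp (2 * p)
  have cf : ∀ t, ContinuousOn (fun r => f t r) (Icc p (2 * p)) := fun t => (h.cp.slice t).icc hp _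
  have hC : CP (Ioi 0) fun t r => r ^ 5 * (k r * ft t r) := (CP.ofR con!).mul ((CP.ofR hk).mul hc)
  rw [← ii_sub ((show ContinuousOn _ (Icc p (2 * p)) by fun_prop).iint hpp) ((show ContinuousOn _ (Icc p (2 * p)) by fun_prop).iint hpp), ← hC.swap t1 t2 hp hpp]
  refine ii_congr hpp fun r hr => ?_
  rw [ii_const_mul, ii_const_mul, h.time_ftc hc t1 t2 (Ioi_of_Icc hp hr)]
  ring

lemma cLq' (p : ℝ) : ContinuousOn (Lq p) (Ioi 0) := fun r hr =>
  ((cLq (p := p) (q := r + 1) (show 0 < r / 2 from half_pos hr)).continuousAt (Icc_mem_nhds (half_lt_self hr) lin!)).continuousWithinAt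

lemma mom_diff {p : ℝ} (hp : 0 < p) (t1 t2 : ℝ) : mom s p t2 - mom s p t1 = ∫ t in t1..t2, ∫ r in p..2 * p, r ^ 5 * (Lq p r * s.u t r) := by
  rw [mom, mom, CP.int_time s.ga s.cT hp (czet p).continuousOn]
  refine integral_congr fun t _ => ?_
  exact bump_ibp hp (fun r hr => s.gu.dr t hr) (fun r hr => (s.gb.dr t hr).congr_deriv (by rw [s.pde t r hr]; ring)) (s.cT.slice t)

lemma static_mom {g g1 : ℝ → ℝ} {p : ℝ} (hp : 0 < p) (hg : HD g g1) (hg1 : ODE g g1) : ∫ r in p..2 * p, r ^ 5 * (Lq p r * g r) = 0 := by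
  rw [← bump_ibp hp (F := fun _ => 0) hg (fun r hr => (hg1 r hr).congr_deriv (by ring)) continuousOn_const]
  simp

/-- If the velocity is close to `β_t g` with a static `g`, then `β` is nearly linear. -/
lemma near_linear {g g1 : ℝ → ℝ} {p c0 y D : ℝ} {β : ℝ → ℝ} (hp : 0 < p) (hc0 : 0 < c0) (hg : HD g g1) (hg1 : ODE g g1)
    (hl : ∀ r ∈ Icc p (2 * p), c0 ≤ p ^ 4 * g r) (h0 : ∀ r, 0 < r → s.a 0 r = 0) (hy : 0 < y) (hyp : y ≤ p)
    (h : ∀ t ∈ Icc 0 y, ∫ r in p..2 * p, r ^ 5 * (s.a t r - β t * g r) ^ 2 ≤ D) {t : ℝ} (ht : t ∈ Icc 0 y) :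
    |β t - t / y * β y| ≤ 13920 / c0 * p * √D := by
  have hpp : p ≤ 2 * p := lin!
  have cg : ContinuousOn g (Icc p (2 * p)) := fun r hr => (hg r (Ioi_of_Icc hp hr)).cwa
  have ca : ∀ t, ContinuousOn (fun r => s.a t r) (Icc p (2 * p)) := fun t => (s.ca t).icc hp _
  have cL := cLq (p := p) (q := 2 * p) hp
  have cz := czet p
  set N := ∫ r in p..2 * p, r ^ 5 * (zet p r * g r) with hN
  have ce : ∀ t, ContinuousOn (fun r => s.a t r - β t * g r) (Icc p (2 * p)) := fun t => by
    have := ca t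
    fun_prop
  have split : ∀ k : ℝ → ℝ, ContinuousOn k (Icc p (2 * p)) → ∀ t, (∫ r in p..2 * p, r ^ 5 * (k r * s.a t r)) - β t * (∫ r in p..2 * p, r ^ 5 * (k r * g r)) =
        ∫ r in p..2 * p, r ^ 5 * (k r * (s.a t r - β t * g r)) := fun k hk t => by
    have := ca t
    have := int_lin (f := fun r => r ^ 5 * (k r * s.a t r)) (g := fun r => r ^ 5 * (k r * g r)) hpp 1 (-β t) con! con!
    rw [one_mul] at this
    rw [sub_eq_add_neg, ← neg_mul, ← this]
    refine integral_congr fun r _ => ?_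
    ring
  have hm : ∀ t ∈ Icc 0 y, |mom s p t - β t * N| ≤ 8 * p ^ 7 * √D := fun t ht => by
    rw [mom, hN, split _ cz.continuousOn]
    refine (weighted_cs hp hpp cz.continuousOn (ce t) (fun r hr => zet_bound hp hr) (h t ht)).trans_eq ?_
    ring
  have hB : ∀ t ∈ Icc 0 y, |∫ r in p..2 * p, r ^ 5 * (Lq p r * s.a t r)| ≤ 224 * p ^ 5 * √D := fun t ht => by
    have := split _ cL t
    rw [static_mom hp hg hg1, mul_zero, sub_zero] at this
    rw [this]
    refine (weighted_cs hp hpp cL (ce t) (fun r hr => Lq_bound hp hr) (h t ht)).trans_eq ?_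
    ring
  set B := fun t => ∫ r in p..2 * p, r ^ 5 * (Lq p r * s.u t r) with hBd
  have cB : Continuous B := CP.int_cont ((CP.ofR con!).mul ((CP.ofR (cLq' p)).mul s.gu.cp)) hp hpp
  have hB0 : ∀ t ∈ Icc 0 y, |B t - B 0| ≤ 224 * p ^ 5 * √D * y := fun t ht => by
    rw [hBd]
    simp only
    rw [CP.int_time s.gu s.ga.cp hp (cLq' p)]
    have := norm_integral_le_of_norm_le_const (a := 0) (b := t) (f := fun t => ∫ r in p..2 * p, r ^ 5 * (Lq p r * s.a t r)) (C := 224 * p ^ 5 * √D) fun x hx => by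
        rw [uIoc_of_le ht.1] at hx
        exact hB x ⟨hx.1.le, hx.2.trans ht.2⟩
    rw [sub_zero, abs_of_nonneg ht.1, Real.norm_eq_abs] at this
    refine this.trans ?_
    have := ht.2
    gcongr
  have m0 : mom s p 0 = 0 := by
    rw [mom, integral_congr (g := fun _ => 0)]
    · simp
    · intro r hr
      rw [uIcc_of_le hpp] at hr
      simp [h0 r (Ioi_of_Icc hp hr)]
  have hM : ∀ t ∈ Icc 0 y, |mom s p t - t * B 0| ≤ 224 * p ^ 5 * √D * y * t := fun t ht => by
    have e : mom s p t - t * B 0 = ∫ x in (0:ℝ)..t, (B x - B 0) := by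
      rw [ii_sub (cB.intervalIntegrable _ _) (by simp), hBd, ← mom_diff hp, m0]
      simp
    rw [e]
    have := norm_integral_le_of_norm_le_const (a := 0) (b := t) (f := fun x => B x - B 0) (C := 224 * p ^ 5 * √D * y) fun x hx => by
        rw [uIoc_of_le ht.1] at hx
        exact hB0 x ⟨hx.1.le, hx.2.trans ht.2⟩
    rwa [sub_zero, abs_of_nonneg ht.1, Real.norm_eq_abs] at this
  have hNl : c0 * p ^ 6 / 30 ≤ N := by
    calc _ = c0 / p ^ 4 * (p ^ 10 / 30) := by field_simp
      _ ≤ c0 / p ^ 4 * ∫ r in p..2 * p, r ^ 5 * zet p r := by gcongr; exact zet_int hp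
      _ = ∫ r in p..2 * p, c0 / p ^ 4 * (r ^ 5 * zet p r) := by rw [ii_const_mul]
      _ ≤ N := by
        refine int_mono hpp con! con! fun r hr => ?_
        have hr0 := Ioi_of_Icc hp hr
        have h1 : c0 / p ^ 4 ≤ g r := by rw [div_le_iff₀ pos!, mul_comm]; exact hl r hr
        have : 0 ≤ zet p r := sq_nonneg _
        calc _ ≤ g r * (r ^ 5 * zet p r) := by gcongr
          _ = _ := by ring
  have hty : 0 ≤ t / y := div_nonneg ht.1 hy.le
  have hty1 : t / y ≤ 1 := (div_le_one hy).2 ht.2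
  have key : |(β t - t / y * β y) * N| ≤ 464 * p ^ 7 * √D := by
    have a1 := hm t ht
    have a2 := hm y ⟨hy.le, le_rfl⟩
    have a3 := hM t ht
    have a4 := hM y ⟨hy.le, le_rfl⟩
    have e : (β t - t / y * β y) * N = -(mom s p t - β t * N) + t / y * (mom s p y - β y * N) + (mom s p t - t * B 0) - t / y * (mom s p y - y * B 0) := by
      field_simp
      ring
    have t1 : |t / y * (mom s p y - β y * N)| ≤ 8 * p ^ 7 * √D := by
      rw [abs_mul, abs_of_nonneg hty]
      exact (mul_le_mul hty1 a2 (abs_nonneg _) zero_le_one).trans_eq (one_mul _)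
    have hyy : 224 * p ^ 5 * √D * y * y ≤ 224 * p ^ 7 * √D := by
      calc _ ≤ 224 * p ^ 5 * √D * p * p := by gcongr
        _ = _ := by ring
    have t2 : |t / y * (mom s p y - y * B 0)| ≤ 224 * p ^ 7 * √D := by
      rw [abs_mul, abs_of_nonneg hty]
      exact (mul_le_mul hty1 (a4.trans hyy) (abs_nonneg _) zero_le_one).trans_eq (one_mul _)
    have t3 : |mom s p t - t * B 0| ≤ 224 * p ^ 7 * √D := by
      refine (a3.trans ?_).trans hyy
      have := ht.2
      gcongr
    rw [e]
    rw [abs_le] at a1 t1 t2 t3 ⊢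
    constructor <;> linarith
  have hN0 : 0 < N := lt_of_lt_of_le pos! hNl
  rw [abs_mul, abs_of_pos hN0] at key
  calc _ ≤ 464 * p ^ 7 * √D / N := by rwa [le_div_iff₀ hN0]
    _ ≤ 464 * p ^ 7 * √D / (c0 * p ^ 6 / 30) := by gcongr
    _ = _ := by field_simp; ring

lemma coef_le {g : ℝ → ℝ} {p q c0 D θ : ℝ} (hp : 0 < p) (hc0 : 0 < c0) (hq : 2 * p ≤ q) (cg : ContinuousOn g (Icc p q)) (hl : ∀ r ∈ Icc p (2 * p), c0 ≤ p ^ 4 * g r)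
    (h : ∫ r in p..q, r ^ 5 * (θ * g r) ^ 2 ≤ D) : |θ| ≤ p / c0 * √D := by
  have hpp : p ≤ 2 * p := lin!
  have h1 : θ ^ 2 * (c0 ^ 2 / p ^ 2) ≤ D := by
    calc _ = ∫ r in p..2 * p, θ ^ 2 * (c0 ^ 2 / p ^ 3) := by
          rw [ii_const]
          field_simp
          ring
      _ ≤ ∫ r in p..2 * p, r ^ 5 * (θ * g r) ^ 2 := by
          have := cg.mono (Icc_subset_Icc_right hq)
          refine int_mono hpp continuousOn_const con! fun r hr => ?_
          have hr0 := Ioi_of_Icc hp hr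
          have h1 : c0 / p ^ 4 ≤ g r := by rw [div_le_iff₀ pos!, mul_comm]; exact hl r hr
          calc _ = p ^ 5 * (θ ^ 2 * (c0 / p ^ 4) ^ 2) := by field_simp
            _ ≤ r ^ 5 * (θ ^ 2 * g r ^ 2) := by have := hr.1; gcongr
            _ = _ := by ring
      _ ≤ ∫ r in p..q, r ^ 5 * (θ * g r) ^ 2 := int_mono_set le_rfl hpp hq con! fun r hr => by
          have := Ioi_of_Icc hp hr
          positivity
      _ ≤ D := h
  have hD : 0 ≤ D := le_trans pos! h1
  refine abs_le_of_sq_le_sq ?_ pos!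
  rw [mul_pow, Real.sq_sqrt hD]
  calc θ ^ 2 = (p / c0) ^ 2 * (θ ^ 2 * (c0 ^ 2 / p ^ 2)) := by field_simp
    _ ≤ _ := by gcongr

/-- A static solution. -/
def Sol.static (g g1 : ℝ → ℝ) (hg : HD g g1) (hg1 : ODE g g1) : Sol where
  u _ r := g r
  a _ _ := 0
  b _ r := g1 r
  aT _ _ := 0
  aR _ _ := 0
  bR _ r := -5 / r * g1 r + Vp r * g r
  gu := HasGrad.ofR hg
  ga := HasGrad.const 0
  gb := HasGrad.ofR hg1
  cT := (HasGrad.const 0).cp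
  cR := (HasGrad.const 0).cp
  cB := CP.ofR (ContinuousOn.add (ContinuousOn.mul (continuousOn_const.div continuousOn_id fun r hr => ne_of_gt hr) fun r hr => (hg1 r hr).cwa)
    (cont_Vp.continuousOn.mul fun r hr => (hg r hr).cwa))
  pde t r hr := by ring

lemma level_density {y r a b u m p V χ χ1 : ℝ} (hy : 0 < y) (hr : 0 < r) (hχ : 0 ≤ χ) (hχ2 : χ ≤ 57 * y ^ 2)
    (hχ1 : |χ1| ≤ 15 * y) (hp : 0 ≤ p) (hp1 : p ≤ 1) (hV : |V| ≤ 12 / y ^ 2) (hm : m = p * a - u / y) :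
    -(50000 * y ^ 3 * (r ^ 5 * a ^ 2) + 60000 * y * (r ^ 5 * u ^ 2)) ≤
      χ ^ 2 * r ^ 5 * (b ^ 2 / (2 * y) - 3 / 2 * a ^ 2 / y) - 2 * χ * χ1 * r ^ 5 * b * m - χ ^ 2 * r ^ 5 * V * u * m := by
  have m2 : m ^ 2 ≤ 2 * a ^ 2 + 2 * (u / y) ^ 2 := by
    have : (p * a) ^ 2 ≤ a ^ 2 := by
      rw [mul_pow]
      exact mul_le_of_le_one_left (sq_nonneg _) (pow_le_one₀ hp hp1)
    rw [hm]
    nlinarith [sq_nonneg (p * a + u / y)]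
  have h1 : -(2 * y * χ1 ^ 2 * m ^ 2) ≤ χ ^ 2 * (b ^ 2 / (2 * y)) - 2 * χ * χ1 * b * m := by
    have : 0 ≤ (χ * b - 2 * y * χ1 * m) ^ 2 / (2 * y) := pos!
    have e : (χ * b - 2 * y * χ1 * m) ^ 2 / (2 * y) = χ ^ 2 * (b ^ 2 / (2 * y)) - 2 * χ * χ1 * b * m + 2 * y * χ1 ^ 2 * m ^ 2 := by
      field_simp
      ring
    linarith
  have hc1 : χ1 ^ 2 ≤ 225 * y ^ 2 := by
    rw [← sq_abs]
    calc _ ≤ (15 * y) ^ 2 := by gcongr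
      _ = _ := by ring
  have hc : χ ^ 2 ≤ 3249 * y ^ 4 := by
    calc _ ≤ (57 * y ^ 2) ^ 2 := by gcongr
      _ = _ := by ring
  have h2 : 2 * y * χ1 ^ 2 * m ^ 2 ≤ 900 * y ^ 3 * a ^ 2 + 900 * y * u ^ 2 := by
    calc _ ≤ 2 * y * (225 * y ^ 2) * (2 * a ^ 2 + 2 * (u / y) ^ 2) := by gcongr
      _ = _ := by field_simp; ring
  have h3 : χ ^ 2 * (3 / 2 * a ^ 2 / y) ≤ 5000 * y ^ 3 * a ^ 2 := by
    calc _ ≤ 3249 * y ^ 4 * (3 / 2 * a ^ 2 / y) := by gcongr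
      _ = 3249 * 3 / 2 * y ^ 3 * a ^ 2 := by field_simp
      _ ≤ _ := by gcongr; norm_num
  have h4 : |u * m| ≤ 3 / 2 * u ^ 2 / y + y * a ^ 2 := by
    have i1 : |u * m| ≤ u ^ 2 / (2 * y) + y * m ^ 2 / 2 := by
      have : 0 ≤ (|u| - y * |m|) ^ 2 / (2 * y) := pos!
      have e : (|u| - y * |m|) ^ 2 / (2 * y) = |u| ^ 2 / (2 * y) + y * |m| ^ 2 / 2 - |u| * |m| := by
        field_simp
        ring
      rw [sq_abs, sq_abs] at e
      rw [abs_mul]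
      linarith
    have i2 : y * m ^ 2 / 2 ≤ y * (2 * a ^ 2 + 2 * (u / y) ^ 2) / 2 := by gcongr
    have e : u ^ 2 / (2 * y) + y * (2 * a ^ 2 + 2 * (u / y) ^ 2) / 2 = 3 / 2 * u ^ 2 / y + y * a ^ 2 := by
      field_simp
      ring
    linarith
  have h5 : χ ^ 2 * V * u * m ≤ 39000 * y ^ 3 * a ^ 2 + 59000 * y * u ^ 2 := by
    refine (le_abs_self _).trans ?_
    rw [mul_assoc, abs_mul, abs_mul, abs_of_nonneg (sq_nonneg χ)]
    calc _ ≤ 3249 * y ^ 4 * (12 / y ^ 2) * (3 / 2 * u ^ 2 / y + y * a ^ 2) := by gcongr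
      _ = 38988 * y ^ 3 * a ^ 2 + 58482 * y * u ^ 2 := by field_simp; ring
      _ ≤ _ := by gcongr <;> norm_num
  have h6 : 0 ≤ y ^ 3 * a ^ 2 := pos!
  have h7 : 0 ≤ y * u ^ 2 := pos!
  have := mul_le_l (show -(50000 * y ^ 3 * a ^ 2 + 60000 * y * u ^ 2) ≤
    χ ^ 2 * (b ^ 2 / (2 * y) - 3 / 2 * a ^ 2 / y) - 2 * χ * χ1 * b * m - χ ^ 2 * V * u * m by linarith) (pow_nonneg hr.le 5)
  linarith

lemma level_energy {s : Sol} {y D : ℝ} (hy : 0 < y) (h0 : ∀ r, 0 < r → s.a 0 r = 0) (ha : ∀ t ∈ Icc 0 y, ∫ r in y..16 * y, r ^ 5 * s.a t r ^ 2 ≤ D)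
    (hu : ∀ t ∈ Icc 0 y, ∫ r in y..16 * y, r ^ 5 * s.u t r ^ 2 ≤ y ^ 2 * D) :
    ∫ r in 2 * y..(8 * y), r ^ 5 * s.b 0 r ^ 2 ≤ 1200 * D := by
  have hyy : y ≤ 16 * y := lin!
  obtain ⟨χ, hχ⟩ : ∃ χ : ℝ → ℝ, χ = fun r => (r - y) * (16 * y - r) := ⟨_, rfl⟩
  have dχ : ∀ r, HasDerivAt χ (17 * y - 2 * r) r := fun r => by
    rw [hχ]
    refine (((hasDerivAt_id' r).sub_const y).fun_mul ((hasDerivAt_id' r).const_sub (16 * y))).congr_deriv ?_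
    ring
  have cχ : Continuous χ := by rw [hχ]; fun_prop
  set A : ℝ → ℝ → ℝ := fun t r => χ r ^ 2 * r ^ 5 * ((1 - t / y) * (s.a t r ^ 2 + s.b t r ^ 2) / 2 - s.u t r * s.a t r / y) with hA
  set At : ℝ → ℝ → ℝ := fun t r => χ r ^ 2 * r ^ 5 *
    (-(s.a t r * s.a t r + s.b t r * s.b t r) / (2 * y) + (1 - t / y) * (s.a t r * s.aT t r + s.b t r * s.aR t r) - (s.a t r * s.a t r + s.u t r * s.aT t r) / y) with hAt
  set m : ℝ → ℝ → ℝ := fun t r => (1 - t / y) * s.a t r - s.u t r / y with hm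
  set Br : ℝ → ℝ → ℝ := fun t r => -((2 * χ r * (17 * y - 2 * r) * r ^ 5 + 5 * χ r ^ 2 * r ^ 4) * (s.b t r * m t r) +
    χ r ^ 2 * r ^ 5 * (s.bR t r * m t r) + χ r ^ 2 * r ^ 5 * (s.b t r * ((1 - t / y) * s.aR t r - s.b t r / y))) with hBr
  have cc : ∀ {k : ℝ → ℝ}, Continuous k → CP (Ioi 0) fun _ r => k r := fun h => CP.ofR h.continuousOn
  have ct : CP (Ioi 0) fun t _ => 1 - t / y := by unfold CP; fun_prop
  have cy : CP (Ioi 0) fun _ _ => y⁻¹ := cc continuous_const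
  have cA : CP (Ioi 0) At := by
    have c2 : CP (Ioi 0) fun _ _ => -(2 * y)⁻¹ := cc continuous_const
    have := (cc (k := fun r => χ r ^ 2 * r ^ 5) con!).mul
      ((((s.ga.cp.mul s.ga.cp).add (s.gb.cp.mul s.gb.cp)).mul c2 |>.add (ct.mul ((s.ga.cp.mul s.cT).add (s.gb.cp.mul s.cR)))).sub
        (((s.ga.cp.mul s.ga.cp).add (s.gu.cp.mul s.cT)).mul cy))
    refine ContinuousOn.congr this fun z hz => ?_
    simp only [hAt]
    ring
  have cm : CP (Ioi 0) m := by
    refine ContinuousOn.congr ((ct.mul s.ga.cp).sub (s.gu.cp.mul cy)) fun z hz => ?_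
    simp only [hm]
    ring
  have cB : CP (Ioi 0) Br := by
    have c1 : CP (Ioi 0) fun _ _ => (-1 : ℝ) := cc continuous_const
    have := ((((cc (k := fun r => 2 * χ r * (17 * y - 2 * r) * r ^ 5 + 5 * χ r ^ 2 * r ^ 4) con!).mul
      (s.gb.cp.mul cm)).add ((cc (k := fun r => χ r ^ 2 * r ^ 5) con!).mul (s.cB.mul cm))).add
      ((cc (k := fun r => χ r ^ 2 * r ^ 5) con!).mul (s.gb.cp.mul ((ct.mul s.cR).sub (s.gb.cp.mul cy))))).mul c1
    refine ContinuousOn.congr this fun z hz => ?_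
    simp only [hBr]
    ring
  have hAd : ∀ r, 0 < r → ∫ t in (0:ℝ)..y, At t r = A y r - A 0 r := fun r hr => by
    refine integral_eq_sub_of_hasDerivAt (f := fun t => A t r) (f' := fun t => At t r) (fun t _ => ?_) ((cA.time hr).intervalIntegrable _ _)
    have h1 := (((hasDerivAt_id' t).div_const y).const_sub 1).fun_mul (((s.ga.dt t hr).fun_pow 2).fun_add ((s.gb.dt t hr).fun_pow 2))
    refine (((h1.div_const 2).fun_sub (((s.gu.dt t hr).fun_mul (s.ga.dt t hr)).div_const y)).const_mul (χ r ^ 2 * r ^ 5)).congr_deriv ?_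
    simp only [hAt, Nat.cast_ofNat]
    field_simp
    ring
  have hBd : ∀ t, ∫ r in y..16 * y, Br t r = 0 := fun t => by
    have := ftc (f := fun r => -(χ r ^ 2 * r ^ 5 * (s.b t r * m t r))) (f' := Br t) hyy (fun r hr => by
      have hr0 := Ioi_of_Icc hy hr
      refine (((((dχ r).fun_pow 2).fun_mul (hasDerivAt_pow 5 r)).fun_mul ((s.gb.dr t hr0).fun_mul
        (((s.ga.dr t hr0).const_mul (1 - t / y)).fun_sub ((s.gu.dr t hr0).div_const y)))).fun_neg).congr_deriv ?_
      simp only [hBr, Nat.cast_ofNat, hm]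
      ring) ((cB.slice t).icc hy _)
    rw [this]
    simp [hχ]
  have hsum : ∀ t, ∀ r ∈ Icc y (16 * y), At t r + Br t r = χ r ^ 2 * r ^ 5 * (s.b t r ^ 2 / (2 * y) - 3 / 2 * s.a t r ^ 2 / y) -
      2 * χ r * (17 * y - 2 * r) * r ^ 5 * s.b t r * m t r - χ r ^ 2 * r ^ 5 * Vp r * s.u t r * m t r := fun t r hr => by
    have hr0 := Ioi_of_Icc hy hr
    simp only [hAt, hBr, hm]
    rw [s.pde t r hr0]
    field_simp
    ring
  have bχ : ∀ r ∈ Icc y (16 * y), 0 ≤ χ r ∧ χ r ≤ 57 * y ^ 2 := fun r hr => by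
    simp only [hχ]
    refine ⟨mul_nonneg (by linarith [hr.1]) (by linarith [hr.2]), ?_⟩
    nlinarith [sq_nonneg (r - 17 / 2 * y)]
  have ca : ∀ t, ContinuousOn (fun r => s.a t r) (Icc y (16 * y)) := fun t => (s.ca t).icc hy _
  have cb : ∀ t, ContinuousOn (fun r => s.b t r) (Icc y (16 * y)) := fun t => (s.cb t).icc hy _
  have cu : ∀ t, ContinuousOn (fun r => s.u t r) (Icc y (16 * y)) := fun t => (s.cu t).icc hy _
  have hD : 0 ≤ D := le_trans (ii_nonneg hyy fun r hr => by
    have := Ioi_of_Icc hy hr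
    positivity) (ha 0 ⟨le_rfl, hy.le⟩)
  have hin : ∀ t ∈ Icc 0 y, -(110000 * y ^ 3 * D) ≤ ∫ r in y..16 * y, At t r := fun t ht => by
    have cAt := (cA.slice t).icc hy (16 * y)
    have cBt := (cB.slice t).icc hy (16 * y)
    have ca := ca t
    have cu := cu t
    have := int_le_lin (A := fun r => -(At t r + Br t r)) (f := fun r => r ^ 5 * s.a t r ^ 2)
      (g := fun r => r ^ 5 * s.u t r ^ 2) hyy (50000 * y ^ 3) (60000 * y) con! con! con!
      fun r hr => by
        have hr0 := Ioi_of_Icc hy hr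
        have := level_density (b := s.b t r) hy hr0 (bχ r hr).1 (bχ r hr).2 (show |17 * y - 2 * r| ≤ 15 * y from abs_le.2 ⟨by linarith [hr.2], by linarith [hr.1]⟩)
          (show 0 ≤ 1 - t / y by rw [sub_nonneg, div_le_one hy]; exact ht.2)
          (show 1 - t / y ≤ 1 by linarith [div_nonneg ht.1 hy.le])
          ((abs_Vp hr0).trans (show 12 / r ^ 2 ≤ 12 / y ^ 2 by gcongr; exact hr.1)) (show m t r = _ from rfl)
        rw [← hsum t r hr] at this
        linarith
    rw [intervalIntegral.integral_neg, ii_add (cAt.iint hyy) (cBt.iint hyy), hBd t, add_zero] at this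
    have i1 := mul_le_l (ha t ht) (show 0 ≤ 50000 * y ^ 3 by positivity)
    have i2 := mul_le_l (hu t ht) (show 0 ≤ 60000 * y by positivity)
    linarith
  have hout : -(110000 * y ^ 4 * D) ≤ ∫ t in (0:ℝ)..y, ∫ r in y..16 * y, At t r := by
    have := int_mono hy.le (A := fun _ => -(110000 * y ^ 3 * D)) continuousOn_const (cA.int_cont hy hyy).continuousOn hin
    rw [ii_const] at this
    linarith
  rw [← cA.swap 0 y hy hyy, integral_congr (g := fun r => A y r - A 0 r) (fun r hr => by
    rw [uIcc_of_le hyy] at hr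
    exact hAd r (Ioi_of_Icc hy hr))] at hout
  have ca := ca y
  have cu := cu y
  have cb := cb 0
  have hA0 : ∀ r ∈ Icc y (16 * y), A 0 r = χ r ^ 2 * r ^ 5 * (s.b 0 r ^ 2 / 2) := fun r hr => by
    simp only [hA, h0 r (Ioi_of_Icc hy hr)]
    ring
  have hfin := int_le_lin (A := fun r => (A y r - A 0 r) + χ r ^ 2 * r ^ 5 * (s.b 0 r ^ 2 / 2)) (f := fun r => r ^ 5 * s.a y r ^ 2)
    (g := fun r => r ^ 5 * s.u y r ^ 2) hyy (1625 * y ^ 4) (1625 * y ^ 2) (by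
      refine ContinuousOn.congr (f := fun r => χ r ^ 2 * r ^ 5 * (-(s.u y r * s.a y r / y))) con! fun r hr => ?_
      rw [hA0 r hr, hA]
      field_simp
      ring) con! con! fun r hr => by
      have hr0 := Ioi_of_Icc hy hr
      obtain ⟨h1, h2⟩ := bχ r hr
      have hc : χ r ^ 2 ≤ 3250 * y ^ 4 := by
        calc _ ≤ (57 * y ^ 2) ^ 2 := by gcongr
          _ ≤ _ := by nlinarith [pow_pos hy 4]
      have i : -(s.u y r * s.a y r / y) ≤ (s.a y r ^ 2 + s.u y r ^ 2 / y ^ 2) / 2 := by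
        have : 0 ≤ (s.a y r + s.u y r / y) ^ 2 / 2 := pos!
        have e : (s.a y r + s.u y r / y) ^ 2 / 2 = (s.a y r ^ 2 + s.u y r ^ 2 / y ^ 2) / 2 + s.u y r * s.a y r / y := by
          field_simp
          ring
        linarith
      rw [hA0 r hr]
      calc _ = χ r ^ 2 * r ^ 5 * (-(s.u y r * s.a y r / y)) := by
            simp only [hA]
            field_simp
            ring
        _ ≤ χ r ^ 2 * r ^ 5 * ((s.a y r ^ 2 + s.u y r ^ 2 / y ^ 2) / 2) := by gcongr
        _ ≤ 3250 * y ^ 4 * r ^ 5 * ((s.a y r ^ 2 + s.u y r ^ 2 / y ^ 2) / 2) := by gcongr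
        _ = _ := by field_simp; ring
  have cAA : ContinuousOn (fun r => A y r - A 0 r) (Icc y (16 * y)) := by
    refine ContinuousOn.congr (f := fun r => χ r ^ 2 * r ^ 5 * (-(s.u y r * s.a y r / y)) - χ r ^ 2 * r ^ 5 * (s.b 0 r ^ 2 / 2)) con! fun r hr => ?_
    rw [hA0 r hr, hA]
    field_simp
    ring
  rw [ii_add (cAA.iint hyy) ((show ContinuousOn _ (Icc y (16 * y)) by fun_prop).iint hyy)] at hfin
  have i1 := mul_le_l (ha y ⟨hy.le, le_rfl⟩) (show 0 ≤ 1625 * y ^ 4 by positivity)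
  have i2 := mul_le_l (hu y ⟨hy.le, le_rfl⟩) (show 0 ≤ 1625 * y ^ 2 by positivity)
  have hW : ∫ r in y..16 * y, χ r ^ 2 * r ^ 5 * (s.b 0 r ^ 2 / 2) ≤ 113250 * y ^ 4 * D := by linarith
  have hlow : 98 * y ^ 4 * ∫ r in 2 * y..(8 * y), r ^ 5 * s.b 0 r ^ 2 ≤ ∫ r in y..16 * y, χ r ^ 2 * r ^ 5 * (s.b 0 r ^ 2 / 2) := by
    have hI : Icc (2 * y) (8 * y) ⊆ Icc y (16 * y) := Icc_subset_Icc lin! lin!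
    have h28 : 2 * y ≤ 8 * y := lin!
    rw [← ii_const_mul]
    refine (int_mono h28 (B := fun r => χ r ^ 2 * r ^ 5 * (s.b 0 r ^ 2 / 2)) ?_ ?_ fun r hr => ?_).trans (int_mono_set lin! h28 lin! con! fun r hr => ?_)
    · have := cb.mono hI
      fun_prop
    · have := cb.mono hI
      fun_prop
    · have hr0 := Ioi_of_Icc hy (hI hr)
      have h14 : 14 * y ^ 2 ≤ χ r := by
        simp only [hχ]
        nlinarith [mul_nonneg (sub_nonneg.2 hr.1) (sub_nonneg.2 hr.2)]
      calc _ = (14 * y ^ 2) ^ 2 * r ^ 5 * (s.b 0 r ^ 2 / 2) := by ring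
        _ ≤ _ := by gcongr
    · have := Ioi_of_Icc hy hr
      positivity
  have := hlow.trans hW
  have hy4 : 0 < y ^ 4 := pos!
  by_contra hcon
  push Not at hcon
  have := mul_lt_mul_of_pos_left hcon (show 0 < 98 * y ^ 4 by positivity)
  have := mul_nonneg hy4.le hD
  linarith

lemma wr_avg {s : Sol} {g g1 : ℝ → ℝ} {y G D : ℝ} (hg : HD g g1) (hg1 : ODE g g1) (hy : 0 < y) (hG : ∀ r ∈ Icc y (16 * y), |g r| ≤ G) (h0 : ∀ r, 0 < r → s.a 0 r = 0)
    (ha : ∫ r in y..16 * y, r ^ 5 * s.a y r ^ 2 ≤ D) {r : ℝ} (hr : r ∈ Icc y (16 * y)) :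
    |(∫ t in (0:ℝ)..y, wr g g1 s t r) - ∫ t in (0:ℝ)..y, wr g g1 s t y| ≤ 4096 * G * y ^ 3 * √D := by
  have hr0 := Ioi_of_Icc hy hr
  have hw := wr_grad hg hg1 s
  have cg : ContinuousOn g (Ioi 0) := fun r hr => (hg r hr).cwa
  have cgI : ContinuousOn g (Icc y r) := cg.icc hy _
  have cT : CP (Ioi 0) fun t r => r ^ 5 * g r * s.aT t r := (CP.ofR ((con! : ContinuousOn (fun r => r ^ 5 * g r) (Ioi 0)))).mul s.cT
  have e : (∫ t in (0:ℝ)..y, wr g g1 s t r) - ∫ t in (0:ℝ)..y, wr g g1 s t y = ∫ x in y..r, x ^ 5 * (g x * s.a y x) := by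
    rw [← ii_sub ((hw.cp.time hr0).intervalIntegrable _ _) ((hw.cp.time hy).intervalIntegrable _ _)]
    calc _ = ∫ t in (0:ℝ)..y, ∫ x in y..r, x ^ 5 * g x * s.aT t x := integral_congr fun t _ =>
          (ftc (f := wr g g1 s t) hr.1 (fun x hx => hw.dr t (Ioi_of_Icc hy hx)) ((cT.slice t).icc hy _)).symm
      _ = ∫ x in y..r, ∫ t in (0:ℝ)..y, x ^ 5 * g x * s.aT t x := (cT.swap 0 y hy hr.1).symm
      _ = _ := integral_congr fun x hx => by
          rw [uIcc_of_le hr.1] at hx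
          have hx0 := Ioi_of_Icc hy hx
          rw [ii_const_mul, s.ga.time_ftc s.cT 0 y hx0, h0 x hx0]
          ring
  have hG0 : 0 ≤ G := (abs_nonneg _).trans (hG r hr)
  have ca : ContinuousOn (fun x => s.a y x) (Icc y (16 * y)) := (s.ca y).icc hy _
  rw [e]
  refine (weighted_cs hy hr.1 cgI ((s.ca y).icc hy _) (fun x hx => hG x ⟨hx.1, hx.2.trans hr.2⟩) ((int_mono_set le_rfl hr.1 hr.2 con! fun x hx => ?_).trans ha)).trans ?_
  · have := Ioi_of_Icc hy hx
    positivity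
  · calc _ ≤ G * (16 * y) ^ 3 * √D := by
          gcongr
          exact hr.2
      _ = _ := by ring

lemma avg_abs {s : Sol} {y D : ℝ} (hy : 0 < y) (ha : ∀ t ∈ Icc 0 y, ∫ r in y..16 * y, r ^ 5 * s.a t r ^ 2 ≤ D) :
    ∫ r in y..16 * y, r ^ 5 * (∫ t in (0:ℝ)..y, |s.a t r|) ^ 2 ≤ y ^ 2 * D := by
  have hyy : y ≤ 16 * y := lin!
  have c1 : CP (Ioi 0) fun t r => |s.a t r| := ContinuousOn.abs s.ga.cp
  have c2 : CP (Ioi 0) fun t r => y * (r ^ 5 * s.a t r ^ 2) := by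
    have := (CP.ofR (J := Ioi 0) (k := fun r => y * r ^ 5) con!).mul (s.ga.cp.mul s.ga.cp)
    refine ContinuousOn.congr this fun z hz => ?_
    ring
  have ci := (c1.int_cont_t 0 y hy).mono (Icc_subset_Ici_self : Icc y (16 * y) ⊆ _)
  calc _ ≤ ∫ r in y..16 * y, ∫ t in (0:ℝ)..y, y * (r ^ 5 * s.a t r ^ 2) := by
        refine int_mono hyy con! ((c2.int_cont_t 0 y hy).mono Icc_subset_Ici_self) fun r hr => ?_
        have hr0 := Ioi_of_Icc hy hr
        have := cs (f := fun _ => (1 : ℝ)) (g := fun t => |s.a t r|) hy.le continuousOn_const (c1.time hr0).continuousOn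
        simp only [one_mul, one_pow, sq_abs, ii_const, mul_one, sub_zero] at this
        rw [ii_const_mul, ii_const_mul]
        calc _ ≤ r ^ 5 * (y * ∫ t in (0:ℝ)..y, s.a t r ^ 2) := mul_le_l this pos!
          _ = _ := by ring
    _ = ∫ t in (0:ℝ)..y, ∫ r in y..16 * y, y * (r ^ 5 * s.a t r ^ 2) := c2.swap 0 y hy hyy
    _ ≤ ∫ t in (0:ℝ)..y, y * D := by
        refine int_mono hy.le (c2.int_cont hy hyy).continuousOn continuousOn_const fun t ht => ?_
        rw [ii_const_mul]
        exact mul_le_l (ha t ht) hy.le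
    _ = _ := by
        rw [ii_const]
        ring

/-- A solution whose time derivative is small near `{|x| ∼ y}` for times up to `y` is, there, close to a stationary one. -/
lemma level_coef {g g1 h h1 : ℝ → ℝ} (hg : HD g g1) (hg1 : ODE g g1) (hh : HD h h1) (hh1 : ODE h h1) (hw : ∀ r, 0 < r → r ^ 5 * (g r * h1 r - g1 r * h r) = 1) (K : ℝ) :
    ∃ C, 0 ≤ C ∧ ∀ (s : Sol) (y D G H : ℝ), 0 < y → (∀ r ∈ Icc y (16 * y), |g r| ≤ G) →
      (∀ r ∈ Icc y (16 * y), |h r| ≤ H) → y ^ 4 * (G * H) ≤ K → (∀ r, 0 < r → s.a 0 r = 0) →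
      (∀ t ∈ Icc 0 y, ∫ r in y..16 * y, r ^ 5 * s.a t r ^ 2 ≤ D) →
      ∃ k l, ∫ r in 2 * y..(8 * y), r ^ 5 * (s.b 0 r - k * g1 r - l * h1 r) ^ 2 ≤ C * D ∧
        ∫ r in 2 * y..(8 * y), r ^ 5 * (s.u 0 r - k * g r - l * h r) ^ 2 ≤ C * (y ^ 2 * D) := by
  set C1 : ℝ := 2 * (8192 * K) ^ 2 * 16 ^ 6 + 2 with hC1
  refine ⟨1200 * C1, pos!, fun s y D G H hy hG hH hK h0 ha => ?_⟩
  have hyy : y ≤ 16 * y := lin!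
  have hmem : y ∈ Icc y (16 * y) := ⟨le_rfl, hyy⟩
  have hD : 0 ≤ D := le_trans (ii_nonneg hyy fun r hr => by
    have := Ioi_of_Icc hy hr
    positivity) (ha 0 ⟨le_rfl, hy.le⟩)
  have hG0 : 0 ≤ G := (abs_nonneg _).trans (hG y hmem)
  have hH0 : 0 ≤ H := (abs_nonneg _).trans (hH y hmem)
  obtain ⟨l, hl⟩ : ∃ l, l = (∫ t in (0:ℝ)..y, wr g g1 s t y) / y := ⟨_, rfl⟩
  obtain ⟨k, hk⟩ : ∃ k, k = -(∫ t in (0:ℝ)..y, wr h h1 s t y) / y := ⟨_, rfl⟩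
  set z := Sol.lin 1 (Sol.lin 1 s (-k) (Sol.static g g1 hg hg1)) (-l) (Sol.static h h1 hh hh1) with hz
  have zu : ∀ t r, z.u t r = s.u t r - k * g r - l * h r := fun t r => by simp only [hz, Sol.lin, Sol.static]; ring
  have za : ∀ t r, z.a t r = s.a t r := fun t r => by simp only [hz, Sol.lin, Sol.static]; ring
  have zb : ∀ t r, z.b t r = s.b t r - k * g1 r - l * h1 r := fun t r => by simp only [hz, Sol.lin, Sol.static]; ring
  have hU : ∀ r ∈ Icc y (16 * y), |∫ t in (0:ℝ)..y, z.u t r| ≤ 8192 * K / y * √D := fun r hr => by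
    have hr0 := Ioi_of_Icc hy hr
    have w1 := (wr_grad hg hg1 s).cp.time hr0
    have w2 := (wr_grad hh hh1 s).cp.time hr0
    have e : ∫ t in (0:ℝ)..y, z.u t r = h r * ((∫ t in (0:ℝ)..y, wr g g1 s t r) - ∫ t in (0:ℝ)..y, wr g g1 s t y) -
        g r * ((∫ t in (0:ℝ)..y, wr h h1 s t r) - ∫ t in (0:ℝ)..y, wr h h1 s t y) := by
      calc _ = ∫ t in (0:ℝ)..y, (h r * wr g g1 s t r - g r * wr h h1 s t r - (k * g r + l * h r)) :=
            integral_congr fun t _ => by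
              simp only [zu, wr]
              linear_combination (-s.u t r) * hw r hr0
        _ = _ := by
            rw [ii_sub ((con! : Continuous _).intervalIntegrable _ _) (by simp),
              ii_sub ((con! : Continuous _).intervalIntegrable _ _) ((con! : Continuous _).intervalIntegrable _ _),
              ii_const_mul, ii_const_mul, ii_const, hk, hl]
            field_simp
            ring
    rw [e]
    have i1 := wr_avg hg hg1 hy hG h0 (ha y ⟨hy.le, le_rfl⟩) hr
    have i2 := wr_avg hh hh1 hy hH h0 (ha y ⟨hy.le, le_rfl⟩) hr
    refine (abs_sub _ _).trans ?_
    rw [abs_mul, abs_mul]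
    calc _ ≤ H * (4096 * G * y ^ 3 * √D) + G * (4096 * H * y ^ 3 * √D) := by
          have := hH r hr
          have := hG r hr
          gcongr
      _ = 8192 * (y ^ 4 * (G * H)) / y * √D := by field_simp; ring
      _ ≤ _ := by gcongr
  have hz1 : ∀ t ∈ Icc 0 y, ∀ r ∈ Icc y (16 * y), |z.u t r| ≤ |8192 * K / y ^ 2 * √D| + |(∫ t in (0:ℝ)..y, |s.a t r|)| := fun t ht r hr => by
    have hr0 := Ioi_of_Icc hy hr
    have cu := z.gu.cp.time hr0
    have ca : Continuous fun t => |s.a t r| := (s.ga.cp.time hr0).abs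
    have hd : ∀ τ ∈ Icc 0 y, z.u t r - z.u τ r ≤ (∫ t in (0:ℝ)..y, |s.a t r|) ∧ -(z.u t r - z.u τ r) ≤ (∫ t in (0:ℝ)..y, |s.a t r|) := fun τ hτ => by
      refine abs_le'.1 ?_
      rw [← z.gu.time_ftc z.ga.cp τ t hr0]
      refine (intervalIntegral.norm_integral_le_integral_norm_uIoc (f := fun t => z.a t r) (μ := volume)).trans ?_
      simp only [za, Real.norm_eq_abs]
      rw [integral_of_le hy.le]
      refine setIntegral_mono_set (intervalIntegrable_iff_integrableOn_Ioc_of_le hy.le |>.1 (ca.intervalIntegrable _ _)) (ae_of_all _ fun _ => abs_nonneg _)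
        (Ioc_subset_Ioc (le_min hτ.1 ht.1) (max_le hτ.2 ht.2)).eventuallyLE
    set F := ∫ t in (0:ℝ)..y, |s.a t r| with hF
    have j1 := int_mono hy.le (A := fun τ => z.u t r - z.u τ r) (B := fun _ => F) con! continuousOn_const fun τ hτ => (hd τ hτ).1
    have j2 := int_mono hy.le (A := fun τ => -(z.u t r - z.u τ r)) (B := fun _ => F) con! continuousOn_const fun τ hτ => (hd τ hτ).2
    rw [intervalIntegral.integral_neg] at j2
    rw [ii_sub (by simp) (cu.intervalIntegrable _ _), intervalIntegral.integral_const, ii_const, smul_eq_mul, sub_zero] at j1 j2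
    obtain ⟨u1, u2⟩ := abs_le.1 (hU r hr)
    have k1 : y * z.u t r ≤ y * (8192 * K / y ^ 2 * √D + F) := by
      have : y * (8192 * K / y ^ 2 * √D + F) = 8192 * K / y * √D + y * F := by field_simp
      linarith
    have k2 : y * -(z.u t r) ≤ y * (8192 * K / y ^ 2 * √D + F) := by
      have : y * (8192 * K / y ^ 2 * √D + F) = 8192 * K / y * √D + y * F := by field_simp
      linarith
    refine (abs_le'.2 ⟨le_of_mul_le_mul_left k1 hy, le_of_mul_le_mul_left k2 hy⟩).trans ?_
    exact add_le_add (le_abs_self _) (le_abs_self _)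
  have ca := (CP.int_cont_t (f := fun t r => |s.a t r|) (ContinuousOn.abs s.ga.cp) 0 y hy).mono (Icc_subset_Ici_self : Icc y (16 * y) ⊆ _)
  have hu : ∀ t ∈ Icc 0 y, ∫ r in y..16 * y, r ^ 5 * z.u t r ^ 2 ≤ y ^ 2 * (C1 * D) := fun t ht => by
    have cu := (z.cu t).icc hy (16 * y)
    refine (int_le_lin hyy (A := fun r => r ^ 5 * z.u t r ^ 2) (f := fun r => (16 * y) ^ 5 * (8192 * K / y ^ 2 * √D) ^ 2)
      (g := fun r => r ^ 5 * (∫ t in (0:ℝ)..y, |s.a t r|) ^ 2) 2 2 con! continuousOn_const con! fun r hr => ?_).trans ?_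
    · have hr0 := Ioi_of_Icc hy hr
      have i := pow_le_l (abs_nonneg _) (hz1 t ht r hr) 2
      rw [sq_abs] at i
      calc _ ≤ r ^ 5 * (2 * (8192 * K / y ^ 2 * √D) ^ 2 + 2 * (∫ t in (0:ℝ)..y, |s.a t r|) ^ 2) := by
            refine mul_le_l (i.trans ?_) pos!
            rw [← sq_abs (8192 * K / y ^ 2 * √D), ← sq_abs (∫ t in (0:ℝ)..y, |s.a t r|)]
            exact add_sq_le.trans_eq (by ring)
        _ ≤ _ := by
            have := pow_le_l hr0.le hr.2 5
            have := mul_le_r this (show 0 ≤ 2 * (8192 * K / y ^ 2 * √D) ^ 2 by positivity)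
            linarith
    · have i := avg_abs hy ha
      rw [ii_const]
      have e : (16 * y - y) * ((16 * y) ^ 5 * (8192 * K / y ^ 2 * √D) ^ 2) = 15 * 16 ^ 5 * (8192 * K) ^ 2 * y ^ 2 * D := by
        rw [mul_pow _ (√D), Real.sq_sqrt hD]
        field_simp
        ring
      rw [e, hC1]
      have : 0 ≤ (8192 * K) ^ 2 * y ^ 2 * D := pos!
      linarith
  have hC1' : 1 ≤ C1 := by rw [hC1]; nlinarith [sq_nonneg (8192 * K)]
  have hC1D : D ≤ C1 * D := le_mul_of_one_le_left hD hC1'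
  refine ⟨k, l, ?_, ?_⟩
  · have := level_energy (s := z) (D := C1 * D) hy (fun r hr => by rw [za]; exact h0 r hr) (fun t ht => by simp only [za]; exact (ha t ht).trans hC1D) hu
    simp only [zb] at this
    linarith
  · have cu := (z.cu 0).icc hy (16 * y)
    have := (int_mono_set (a := y) (b := 2 * y) (c := 8 * y) (d := 16 * y) (f := fun r => r ^ 5 * z.u 0 r ^ 2) lin! lin! lin! con! fun r hr => by
      have := Ioi_of_Icc hy hr
      positivity).trans (hu 0 ⟨le_rfl, hy.le⟩)
    simp only [zu] at this
    have : 0 ≤ y ^ 2 * (C1 * D) := pos!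
    linarith

lemma extend_bound {f : ℝ → ℝ} (hf : ContinuousOn f (Ioi 0)) {C : ℝ} (h : ∀ r, 0 < r → r ≤ 1 → |f r| ≤ C) (X : ℝ) : ∃ C, 0 ≤ C ∧ ∀ r, 0 < r → r ≤ X → |f r| ≤ C := by
  obtain ⟨B, hB0, hB⟩ := exists_bound (hf.icc one_pos X)
  refine ⟨max B C, hB0.trans (le_max_left _ _), fun r h0 h1 => ?_⟩
  rcases le_total r 1 with h2 | h2
  · exact (h r h0 h2).trans (le_max_right _ _)
  · exact (hB r ⟨h2, h1⟩).trans (le_max_left _ _)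

lemma cont_of_deriv {f f1 : ℝ → ℝ} (h : HD f f1) : ContinuousOn f (Ioi 0) := fun r hr => (h r hr).cwa

lemma cPhS : ContinuousOn PhS (Ioi 0) := cont_of_deriv fun _ h => dPhS h
lemma cPhS1 : ContinuousOn PhS1 (Ioi 0) := cont_of_deriv fun _ h => dPhS1 h
lemma cThS : ContinuousOn ThS (Ioi 0) := cont_of_deriv fun _ h => dThS h
lemma cThS1 : ContinuousOn ThS1 (Ioi 0) := cont_of_deriv fun _ h => dThS1 h

lemma bounds_in (X : ℝ) : ∃ C, 1 ≤ C ∧ ∀ r, 0 < r → r ≤ X → r ^ 4 * |Gam r| ≤ C ∧ r ^ 5 * |Gam1 r| ≤ C ∧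
    |PhS r + Iout 0 * Gam r| ≤ C ∧ |PhS1 r + Iout 0 * Gam1 r| ≤ C ∧ r ^ 2 * |ThS r| ≤ C ∧ r ^ 3 * |ThS1 r| ≤ C := by
  obtain ⟨A, -, hA⟩ := Gam_bound_in
  obtain ⟨B, -, hB⟩ := PhS_bound_in
  obtain ⟨D, -, hD⟩ := ThS_bound
  have ab : ∀ {r x : ℝ} (n : ℕ), 0 < r → |r ^ n * x| = r ^ n * |x| := fun n hr => by rw [abs_mul, abs_of_pos (pow_pos hr n)]
  have := cGam
  have := cGam1
  have := cPhS
  have := cPhS1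
  have := cThS
  have := cThS1
  obtain ⟨C1, -, h1⟩ := extend_bound (f := fun r => r ^ 4 * Gam r) con! (fun r h0 h => by rw [ab 4 h0]; exact (hA r h0 h).1) X
  obtain ⟨C2, -, h2⟩ := extend_bound (f := fun r => r ^ 5 * Gam1 r) con! (fun r h0 h => by rw [ab 5 h0]; exact (hA r h0 h).2) X
  obtain ⟨C3, -, h3⟩ := extend_bound (f := fun r => PhS r + Iout 0 * Gam r) con! (fun r h0 h => (hB r h0 h).1) X
  obtain ⟨C4, -, h4⟩ := extend_bound (f := fun r => PhS1 r + Iout 0 * Gam1 r) con! (fun r h0 h => (hB r h0 h).2) X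
  obtain ⟨C5, -, h5⟩ := extend_bound (f := fun r => r ^ 2 * ThS r) con! (fun r h0 h => by rw [ab 2 h0]; exact (hD r h0 h).1) X
  obtain ⟨C6, -, h6⟩ := extend_bound (f := fun r => r ^ 3 * ThS1 r) con! (fun r h0 h => by rw [ab 3 h0]; exact (hD r h0 h).2) X
  refine ⟨max 1 (max (max C1 C2) (max (max C3 C4) (max C5 C6))), le_max_left _ _, fun r h0 hr => ?_⟩
  have g1 := h1 r h0 hr
  have g2 := h2 r h0 hr
  have g5 := h5 r h0 hr
  have g6 := h6 r h0 hr
  rw [ab _ h0] at g1 g2 g5 g6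
  refine ⟨?_, ?_, ?_, ?_, ?_, ?_⟩ <;> simp only [le_max_iff]
  · exact Or.inr (Or.inl (Or.inl g1))
  · exact Or.inr (Or.inl (Or.inr g2))
  · exact Or.inr (Or.inr (Or.inl (Or.inl (h3 r h0 hr))))
  · exact Or.inr (Or.inr (Or.inl (Or.inr (h4 r h0 hr))))
  · exact Or.inr (Or.inr (Or.inr (Or.inl g5)))
  · exact Or.inr (Or.inr (Or.inr (Or.inr g6)))

/-- Size of the two stationary solutions and their derivatives on `[y, 16y]`. -/
def Wt (K y G H : ℝ) : Prop := y ^ 4 * (G * H) ≤ K ^ 2 ∧ ∀ r ∈ Icc y (16 * y), |phi r| ≤ G ∧ y * |phi1 r| ≤ G ∧ |Gam r| ≤ H ∧ y * |Gam1 r| ≤ H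

lemma wt : ∃ K, 1 ≤ K ∧ (∀ y, R1 ≤ y → Wt K y (K / y ^ 4) K) ∧ ∀ y, 0 < y → y ≤ R1 → Wt K y K (K / y ^ 4) := by
  obtain ⟨A, hA0, hA⟩ := Gam_bound_out
  obtain ⟨B, hB1, hB⟩ := bounds_in (16 * R1)
  have hR := R1_ge
  refine ⟨8 + A + B + 16 * R1 ^ 2, by nlinarith, fun y hy => ?_, fun y h0 hy => ?_⟩
  · have hy0 : 0 < y := lin!
    have hy1 : 1 ≤ y := lin!
    refine ⟨le_of_eq (by field_simp), fun r hr => ?_⟩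
    have hr0 := Ioi_of_Icc hy0 hr
    have h4 := pow_le_l hy0.le hr.1 4
    have h5 := pow_le_l hy0.le hr.1 5
    have h3 := pow_le_l hy0.le hr.1 3
    obtain ⟨g1, g2⟩ := hA r (hy1.trans hr.1)
    refine ⟨?_, ?_, by nlinarith, ?_⟩
    · rw [le_div_iff₀ pos!]
      nlinarith [mul_le_r h4 (abs_nonneg (phi r)), phi_bound hr0]
    · rw [le_div_iff₀ pos!]
      nlinarith [mul_le_r h5 (abs_nonneg (phi1 r)), phi1_bound hr0]
    · have h13 : y ≤ y ^ 3 := le_self_pow₀ hy1 (by norm_num)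
      nlinarith [mul_le_r (h13.trans h3) (abs_nonneg (Gam1 r))]
  · refine ⟨le_of_eq (by field_simp), fun r hr => ?_⟩
    have hr0 := Ioi_of_Icc h0 hr
    have h4 := pow_le_l h0.le hr.1 4
    have h5 := pow_le_l h0.le hr.1 5
    obtain ⟨g1, g2, -⟩ := hB r hr0 (by linarith [hr.2])
    refine ⟨by nlinarith [phi_small (r := r)], ?_, ?_, ?_⟩
    · have : y * |phi1 r| ≤ R1 * (16 * R1) := mul_le_mul hy ((phi1_small hr0).trans (by linarith [hr.2])) (abs_nonneg _) lin!
      nlinarith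
    · rw [le_div_iff₀ pos!]
      nlinarith [mul_le_r h4 (abs_nonneg (Gam r))]
    · rw [le_div_iff₀ pos!]
      nlinarith [mul_le_r h5 (abs_nonneg (Gam1 r))]

/-- The solution `P + t²g/2`, where `ΔP - VP = g`. -/
def Sol.growing (g g1 P P1 : ℝ → ℝ) (hg : HD g g1) (hg1 : ODE g g1) (hP : HD P P1) (hP1 : ∀ r, 0 < r → HasDerivAt P1 (g r - 5 / r * P1 r + Vp r * P r) r) : Sol where
  u t r := P r + t * t / 2 * g r
  a t r := t * g r
  b t r := P1 r + t * t / 2 * g1 r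
  aT _ r := g r
  aR t r := t * g1 r
  bR t r := (g r - 5 / r * P1 r + Vp r * P r) + t * t / 2 * (-5 / r * g1 r + Vp r * g r)
  gu := ((HasGrad.ofR hP).add ((((HasGrad.time.mul HasGrad.time).smul (1 / 2)).mul (HasGrad.ofR hg)))).congr_fun isOpen_Ioi
    (fun t r _ => by ring) |>.congr (fun t r _ => by ring) (fun t r _ => by ring)
  ga := (HasGrad.time.mul (HasGrad.ofR hg)).congr (fun t r _ => by ring) (fun t r _ => by ring)
  gb := ((HasGrad.ofR hP1).add ((((HasGrad.time.mul HasGrad.time).smul (1 / 2)).mul (HasGrad.ofR hg1)))).congr_fun isOpen_Ioi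
    (fun t r _ => by ring) |>.congr (fun t r _ => by ring) (fun t r _ => by ring)
  cT := CP.ofR (cont_of_deriv hg)
  cR := HasGrad.time.cp.mul (CP.ofR (cont_of_deriv hg1))
  cB := by
    have cr : ContinuousOn (fun r : ℝ => r⁻¹) (Ioi 0) := continuousOn_id.inv₀ fun r hr => ne_of_gt hr
    have := cont_of_deriv hg
    have := cont_of_deriv hg1
    have := cont_of_deriv hP
    have := cont_of_deriv hP1
    have := cont_Vp
    have h1 : CP (Ioi 0) fun t _ => t * t / 2 := by unfold CP; fun_prop
    have h2 := (CP.ofR (J := Ioi 0) (k := fun r => g r - 5 * (r⁻¹ * P1 r) + Vp r * P r) con!).add (h1.mul (CP.ofR (k := fun r => -5 * (r⁻¹ * g1 r) + Vp r * g r) con!))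
    refine ContinuousOn.congr h2 fun z _ => ?_
    ring
  pde t r hr := by ring

/-- The even solution `PhS + t²phi/2`. -/
def solPh : Sol := Sol.growing phi phi1 PhS PhS1 (fun r _ => dphi r) (fun _ h => dphi1 h) (fun _ h => dPhS h) fun _ h => dPhS1 h
/-- The even solution `ThS + t²Gam/2`. -/
def solTh : Sol := Sol.growing Gam Gam1 ThS ThS1 (fun _ h => dGam h) (fun _ h => dGam1 h) (fun _ h => dThS h) fun _ h => dThS1 h

/-- Solutions even in time. -/
structure Evn (s : Sol) : Prop where
  eu : ∀ t r, 0 < r → s.u (-t) r = s.u t r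
  ea : ∀ t r, 0 < r → s.a (-t) r = -s.a t r
  eb : ∀ t r, 0 < r → s.b (-t) r = s.b t r

lemma Evn.a0 {s : Sol} (h : Evn s) {r : ℝ} (hr : 0 < r) : s.a 0 r = 0 := by
  have := h.ea 0 r hr
  rw [neg_zero] at this
  linarith

lemma EB.shift {s : Sol} {ρ t M c d : ℝ} (hc : c * c = 1) (h : EB s ρ (c * t + d) M) : EB (s.shift c d hc) ρ t M := by
  intro Y hY
  refine le_trans (le_of_eq (integral_congr fun r _ => ?_)) (h Y hY)
  simp only [Sol.shift]
  linear_combination r ^ 5 * s.a (c * t + d) r ^ 2 * hc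

lemma FE.shift {s : Sol} {c d : ℝ} (hc : c * c = 1) (h : FE s) : FE (s.shift c d hc) := by
  intro ρ hρ T
  obtain ⟨M, hM⟩ := h ρ hρ (T + |d|)
  refine ⟨M, fun t ht => EB.shift hc (hM _ ?_)⟩
  refine (abs_add_le _ _).trans ?_
  rw [abs_mul, show |c| = 1 by nlinarith [abs_mul_abs_self c, abs_nonneg c], one_mul]
  linarith

lemma even_difference : ∃ C, 0 ≤ C ∧ ∀ s : Sol, Evn s → FE s → ∀ E, 0 < E → (∀ ρ, 0 ≤ ρ → Late s ρ E) →
    ∃ B : ℝ → ℝ → ℝ, ∀ y h, 0 < y → h ∈ Icc 0 y → (∀ Y, max y R1 ≤ Y → ∫ r in (max y X0)..Y, r ^ 5 * (s.a h r - B h (max y R1) * phi r) ^ 2 ≤ C * E) ∧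
      (y ≤ X0 → ∃ γ, |γ| ≤ C * √E ∧ ∫ r in y..16 * X0, r ^ 5 * (s.a h r - B h R1 * phi r - γ * Gam r) ^ 2 ≤ C * E) := by
  obtain ⟨C, hC0, hC⟩ := odd_main
  refine ⟨C, hC0, fun s hs hF E hE hL => ?_⟩
  have h1 : (1 : ℝ) * 1 = 1 := one_mul 1
  set w : ℝ → Sol := fun h => Sol.lin (1 / 2) (s.shift 1 h h1) (-1 / 2) (s.shift 1 (-h) h1) with hw
  have wa : ∀ h r, 0 < r → (w h).a 0 r = s.a h r := fun h r hr => by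
    simp only [hw, Sol.lin, Sol.shift, mul_zero, zero_add, hs.ea h r hr]
    ring
  have key := fun h => hC (w h) (fun r hr => by
    constructor
    · simp only [hw, Sol.lin, Sol.shift, mul_zero, zero_add, hs.eu h r hr]
      ring
    · simp only [hw, Sol.lin, Sol.shift, mul_zero, zero_add, hs.eb h r hr]
      ring) ((hF.shift h1).lin (hF.shift h1) _ _)
  choose B hB using key
  refine ⟨B, fun y h hy hh => ?_⟩
  have hl : ∀ d, |d| ≤ y → Late (s.shift 1 d h1) y E := fun d hd => by
    obtain ⟨d1, d2⟩ := abs_le.1 hd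
    obtain ⟨T, hT⟩ := hL (y - d) lin!
    refine ⟨T - d, fun t ht => EB.shift h1 ?_⟩
    have := hT (1 * t + d) lin!
    rwa [show y - d + (1 * t + d) = y + t by ring] at this
  have hd : |h| ≤ y := by rw [abs_of_nonneg hh.1]; exact hh.2
  have := (hl h hd).lin hy (hl (-h) (by rwa [abs_neg])) (1 / 2) (-1 / 2)
  rw [show 2 * (1 / 2) ^ 2 * E + 2 * (-1 / 2) ^ 2 * E = E by ring] at this
  obtain ⟨i1, i2⟩ := hB h y E hy hE this
  refine ⟨fun Y hY => le_trans (le_of_eq (integral_congr fun r hr => ?_)) (i1 Y hY), fun hyX => ?_⟩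
  · have hX := X0_pos
    have hXR : max y X0 ≤ Y := (max_le_max_left y (by linarith [X0_lt, R1_ge])).trans hY
    rw [uIcc_of_le hXR] at hr
    simp only [wa h r (lt_of_lt_of_le hy ((le_max_left _ _).trans hr.1))]
  · obtain ⟨γ, g1, g2⟩ := i2 hyX
    refine ⟨γ, g1, le_trans (le_of_eq (integral_congr fun r hr => ?_)) g2⟩
    rw [uIcc_of_le (by linarith [X0_pos])] at hr
    simp only [wa h r (Ioi_of_Icc hy hr)]

lemma int_add_smul_le {f g : ℝ → ℝ} {y G θ D D' : ℝ} (hy : 0 < y) (hf : ContinuousOn f (Icc y (16 * y)))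
    (hg : ContinuousOn g (Icc y (16 * y))) (hG : ∀ r ∈ Icc y (16 * y), |g r| ≤ G)
    (hD : ∫ r in y..16 * y, r ^ 5 * f r ^ 2 ≤ D) (hθ : y ^ 6 * (θ * G) ^ 2 ≤ D') :
    ∫ r in y..16 * y, r ^ 5 * (f r + θ * g r) ^ 2 ≤ 2 * D + 2 * 16 ^ 6 * D' := by
  have hyy : y ≤ 16 * y := lin!
  have h1 : ∀ r ∈ Icc y (16 * y), r ^ 5 * (f r + θ * g r) ^ 2 ≤ 2 * (r ^ 5 * f r ^ 2) + 2 * ((16 * y) ^ 5 * (θ * G) ^ 2) := by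
    intro r hr
    have hr0 := Ioi_of_Icc hy hr
    have a1 : (θ * g r) ^ 2 ≤ (θ * G) ^ 2 := by
      rw [mul_pow, mul_pow]
      exact mul_le_l (sq_le_sq' (abs_le.1 (hG r hr)).1 (abs_le.1 (hG r hr)).2) (sq_nonneg _)
    have a2 : r ^ 5 ≤ (16 * y) ^ 5 := pow_le_l hr0.le hr.2 5
    have a3 : r ^ 5 * (θ * g r) ^ 2 ≤ (16 * y) ^ 5 * (θ * G) ^ 2 := mul_le_mul a2 a1 (sq_nonneg _) pos!
    have a4 : 0 ≤ r ^ 5 * (f r - θ * g r) ^ 2 := pos!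
    nlinarith
  have := int_le_lin hyy 2 2 con! con! (f := fun r => r ^ 5 * f r ^ 2) (g := fun _ => (16 * y) ^ 5 * (θ * G) ^ 2) con! h1
  rw [ii_const] at this
  nlinarith [mul_nonneg (pow_nonneg hy.le 6) (sq_nonneg (θ * G))]

/-- On dyadic shells, a velocity close to multiples of `g` is close to a multiple linear in time. -/
lemma linear_level {g g1 : ℝ → ℝ} {c0 : ℝ} (hc0 : 0 < c0) (hg : HD g g1) (hg1 : ODE g g1) {s : Sol} {y K D : ℝ} {β : ℝ → ℝ} (hy : 0 < y)
    (hl : ∀ r ∈ Icc y (2 * y), c0 ≤ y ^ 4 * g r) (hG : ∀ r ∈ Icc y (16 * y), |g r| ≤ K / y ^ 4)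
    (h0 : ∀ r, 0 < r → s.a 0 r = 0) (h : ∀ t ∈ Icc 0 y, ∫ r in y..16 * y, r ^ 5 * (s.a t r - β t * g r) ^ 2 ≤ D) :
    ∀ t ∈ Icc 0 y, ∫ r in y..16 * y, r ^ 5 * (s.a t r - t * (β y / y) * g r) ^ 2 ≤ (2 + 2 * 16 ^ 6 * (13920 / c0 * K) ^ 2) * D := by
  intro t ht
  have cg : ContinuousOn g (Icc y (16 * y)) := (cont_of_deriv hg).icc hy _
  have ca := fun t => (s.ca t).icc hy (16 * y)
  have hD : 0 ≤ D := le_trans (ii_nonneg lin! fun r hr => by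
    have := Ioi_of_Icc hy hr
    positivity) (h 0 ⟨le_rfl, hy.le⟩)
  have h1 := near_linear hy hc0 hg hg1 hl h0 hy le_rfl (fun t ht => (int_mono_set le_rfl lin! lin! (by have := ca t; fun_prop) fun r hr => by
      have := Ioi_of_Icc hy hr
      positivity).trans (h t ht)) ht
  have h2 : y ^ 6 * ((β t - t / y * β y) * (K / y ^ 4)) ^ 2 ≤ (13920 / c0 * K) ^ 2 * D := by
    have : (β t - t / y * β y) ^ 2 ≤ (13920 / c0 * y * √D) ^ 2 := sq_le_sq' (abs_le.1 h1).1 (abs_le.1 h1).2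
    rw [mul_pow _ √D, Real.sq_sqrt hD] at this
    calc _ = (β t - t / y * β y) ^ 2 * (K ^ 2 / y ^ 2) := by field_simp
      _ ≤ ((13920 / c0 * y) ^ 2 * D) * (K ^ 2 / y ^ 2) := mul_le_r this pos!
      _ = _ := by field_simp
  have h3 := int_add_smul_le hy (by have := ca t; fun_prop) cg hG (h t ht) h2
  refine le_trans (le_of_eq (integral_congr fun r hr => ?_)) (h3.trans (le_of_eq (by ring)))
  ring

/-- The velocity near radius `y` is close to `t (α φ + δ Γ)` for `t ∈ [0,y]`. -/
def Lev (s : Sol) (D y α δ : ℝ) : Prop := ∀ h ∈ Icc 0 y, ∫ r in y..16 * y, r ^ 5 * (s.a h r - h * α * phi r - h * δ * Gam r) ^ 2 ≤ D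

lemma phi_lower : ∃ c0 : ℝ, 0 < c0 ∧ (∀ y, R1 ≤ y → ∀ r ∈ Icc y (2 * y), c0 ≤ y ^ 4 * phi r) ∧ ∀ y, 0 < y → y ≤ 8 * X0 → ∀ r ∈ Icc y (2 * y), c0 ≤ y ^ 4 * Gam r := by
  obtain ⟨M, Mi, hR, hX, -, -, ⟨R, hRR, P⟩, J, hJ, Q⟩ := scales
  have hM := P.hM
  have hMi := Q.hM
  have key : ∀ m g y r : ℝ, 1 ≤ m → m ≤ max M Mi → 0 < g → 0 < y → r ∈ Icc y (2 * y) → 1 ≤ m * (r ^ 4 * g) → 1 / (16 * max M Mi) ≤ y ^ 4 * g := by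
    intro m g y r hm hmm hg hy hr h
    have : r ^ 4 ≤ (2 * y) ^ 4 := pow_le_l (hy.le.trans hr.1) hr.2 4
    have h2 : r ^ 4 * g ≤ (2 * y) ^ 4 * g := mul_le_r this hg.le
    rw [div_le_iff₀ pos!]
    have h3 : m * (r ^ 4 * g) ≤ max M Mi * ((2 * y) ^ 4 * g) := mul_le_mul hmm h2 (by
      have := hy.trans_le hr.1
      positivity) lin!
    nlinarith
  have hMM := le_max_left M Mi
  refine ⟨1 / (16 * max M Mi), pos!, fun y hy r hr => ?_, fun y h0 hy r hr => ?_⟩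
  · have hrR : r ∈ Ioi R := lt_of_lt_of_le hRR (hy.trans hr.1)
    exact key M _ y r hM hMM (P.g0 r hrR) lin! hr (P.gl r hrR)
  · have hrJ : r ∈ J := hJ ⟨h0.trans_le hr.1, hr.2.trans lin!⟩
    exact key Mi _ y r hMi (le_max_right _ _) (Q.g0 r hrJ) h0 hr (Q.gl r hrJ)

lemma even_levels_aux : ∃ C, 1 ≤ C ∧ ∀ s : Sol, Evn s → FE s → ∀ E, 0 < E → (∀ ρ, 0 ≤ ρ → Late s ρ E) →
    ∃ α δ : ℝ → ℝ, (∀ y, 0 < y → Lev s (C * E) y (α y) (δ y)) ∧ (∀ y, y ≤ R1 → α y = α R1) ∧ (∀ y, X0 < y → δ y = 0) ∧ ∀ y, 0 < y → y ≤ X0 → |δ y| ≤ C / y * √E := by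
  obtain ⟨C, hC0, hC⟩ := even_difference
  obtain ⟨c0, hc0, hl1, hl2⟩ := phi_lower
  obtain ⟨K, hK1, hw1, hw2⟩ := wt
  have hX := X0_pos
  have hX1 := X0_lt
  have hR := R1_ge
  set A : ℝ := 2 + 2 * 16 ^ 6 * (13920 / c0 * K) ^ 2 with hA
  have hA0 : 1 ≤ A := by
    have : 0 ≤ 2 * 16 ^ 6 * (13920 / c0 * K) ^ 2 := pos!
    linarith
  set F : ℝ := 2 * C + 2 * 16 ^ 6 * ((R1 ^ 3 * (13920 / c0 * R1) * K) ^ 2 * C) with hF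
  have hF0 : 0 ≤ F := pos!
  have hAC : 0 ≤ A * C := pos!
  have hAF : F ≤ A * F := le_mul_of_one_le_left hF0 hA0
  refine ⟨A * C + A * F + C + 1, lin!, fun s hs hF' E hE hL => ?_⟩
  obtain ⟨B, hB⟩ := hC s hs hF' E hE hL
  have h0 : ∀ r, 0 < r → s.a 0 r = 0 := fun r hr => hs.a0 hr
  have ca := fun {y : ℝ} (hy : 0 < y) t => (s.ca t).icc hy (16 * y)
  have cp := fun {y : ℝ} => (cphi.continuousOn : ContinuousOn phi (Icc y (16 * y)))
  have cG := fun {y : ℝ} (hy : 0 < y) => cGam.icc hy (16 * y)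
  have out : ∀ y, R1 ≤ y → ∀ t ∈ Icc 0 y, ∫ r in y..16 * y, r ^ 5 * (s.a t r - B t y * phi r) ^ 2 ≤ C * E := by
    intro y hy t ht
    have := (hB y t lin! ht).1 (16 * y) (by rw [max_eq_left hy]; linarith)
    rwa [max_eq_left hy, max_eq_left lin!] at this
  have hγ : ∀ y h, ∃ γ, 0 < y → h ∈ Icc 0 y → y ≤ X0 → |γ| ≤ C * √E ∧ ∫ r in y..16 * X0, r ^ 5 * (s.a h r - B h R1 * phi r - γ * Gam r) ^ 2 ≤ C * E := by
    intro y h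
    by_cases hc : 0 < y ∧ h ∈ Icc 0 y ∧ y ≤ X0
    · obtain ⟨γ, hg⟩ := (hB y h hc.1 hc.2.1).2 hc.2.2
      exact ⟨γ, fun _ _ _ => hg⟩
    · exact ⟨0, fun a b c => absurd ⟨a, b, c⟩ hc⟩
  choose γ hγ using hγ
  set a0 := B R1 R1 / R1 with ha0
  have hB1 : ∀ h ∈ Icc 0 R1, |h * a0 - B h R1| ≤ 13920 / c0 * R1 * √(C * E) := by
    intro h hh
    have := near_linear lin! hc0 (fun r _ => dphi r) (fun _ h => dphi1 h) (hl1 R1 le_rfl) h0 lin! le_rfl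
      (β := fun h => B h R1) (fun t ht => (int_mono_set le_rfl lin! lin!
      (by have := ca (lin! : 0 < R1) t; have := cp (y := R1); fun_prop) fun r hr => by
        have := Ioi_of_Icc (lin! : 0 < R1) hr
        positivity).trans (out R1 le_rfl t ht)) hh
    rw [abs_sub_comm] at this
    rwa [show h * a0 = h / R1 * B R1 R1 by rw [ha0]; ring]
  have low : ∀ y h f, 0 < y → y ≤ R1 → h ∈ Icc 0 y → ContinuousOn f (Icc y (16 * y)) → ∫ r in y..16 * y, r ^ 5 * (f r - B h R1 * phi r) ^ 2 ≤ C * E →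
      ∫ r in y..16 * y, r ^ 5 * (f r - h * a0 * phi r) ^ 2 ≤ F * E := by
    intro y h f hy hyR hh hf hi
    have h1 := hB1 h ⟨hh.1, hh.2.trans hyR⟩
    have h2 : y ^ 6 * ((B h R1 - h * a0) * K) ^ 2 ≤ (R1 ^ 3 * (13920 / c0 * R1) * K) ^ 2 * C * E := by
      have : (h * a0 - B h R1) ^ 2 ≤ (13920 / c0 * R1 * √(C * E)) ^ 2 := sq_le_sq' (abs_le.1 h1).1 (abs_le.1 h1).2
      rw [mul_pow _ √(C * E), Real.sq_sqrt pos!] at this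
      calc _ = y ^ 6 * (K ^ 2 * (h * a0 - B h R1) ^ 2) := by ring
        _ ≤ R1 ^ 6 * (K ^ 2 * ((13920 / c0 * R1) ^ 2 * (C * E))) := by gcongr
        _ = _ := by ring
    have h3 := int_add_smul_le hy (f := fun r => f r - B h R1 * phi r) (by have := cp (y := y); fun_prop) cp (fun r hr => ((hw2 y hy hyR).2 r hr).1) hi h2
    refine le_trans (le_of_eq (integral_congr fun r hr => ?_)) (h3.trans (le_of_eq (by rw [hF]; ring)))
    ring
  have e1 : ∀ x, x ≤ A * C + A * F + C + 1 → x * E ≤ (A * C + A * F + C + 1) * E := fun x hx => mul_le_r hx hE.le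
  refine ⟨fun y => if R1 ≤ y then B y y / y else a0, fun y => if y ≤ X0 then γ y y / y else 0, fun y hy h hh => ?_, fun y hy => ?_, fun y hy => ?_, fun y hy hyX => ?_⟩
  · by_cases hyR : R1 ≤ y
    · simp only [if_pos hyR, if_neg (lin! : ¬ y ≤ X0), mul_zero, zero_mul, sub_zero]
      have := linear_level hc0 (fun r _ => dphi r) (fun _ h => dphi1 h) hy (hl1 y hyR) (fun r hr => ((hw1 y hyR).2 r hr).1) h0 (β := fun t => B t y) (out y hyR) h hh
      exact this.trans ((le_of_eq (mul_assoc _ _ _).symm).trans (e1 _ lin!))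
    have hyR' := (not_le.1 hyR).le
    have hhR : max y R1 = R1 := max_eq_right hyR'
    by_cases hyX : y ≤ X0
    · simp only [if_neg hyR, if_pos hyX]
      have st : ∀ t ∈ Icc 0 y, ∫ r in y..16 * y, r ^ 5 * ((Sol.lin 1 s (-a0) solPh).a t r - γ y t * Gam r) ^ 2 ≤ F * E := by
        intro t ht
        have c1 : ContinuousOn (fun r => s.a t r - γ y t * Gam r) (Icc y (16 * X0)) := by
          have := (s.ca t).icc hy (16 * X0)
          have := cGam.icc hy (16 * X0)
          fun_prop
        have c2 : ContinuousOn phi (Icc y (16 * X0)) := cphi.continuousOn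
        have := low y t (fun r => s.a t r - γ y t * Gam r) hy hyR' ht (by
            have := ca hy t
            have := cG hy
            fun_prop)
          ((int_mono_set le_rfl lin! lin! con! (fun r hr => by
            have := Ioi_of_Icc hy hr
            positivity)).trans (le_trans (le_of_eq (integral_congr fun r hr => by ring)) (hγ y t hy ht hyX).2))
        refine le_trans (le_of_eq (integral_congr fun r hr => ?_)) this
        simp only [Sol.lin, solPh, Sol.growing]
        ring
      have := linear_level hc0 (fun _ h => dGam h) (fun _ h => dGam1 h) hy (hl2 y hy lin!) (fun r hr => ((hw2 y hy hyR').2 r hr).2.2.1) (fun r hr => by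
          simp only [Sol.lin, solPh, Sol.growing, h0 r hr]
          ring) st h hh
      refine le_trans (le_of_eq (integral_congr fun r hr => ?_)) (this.trans ((le_of_eq (mul_assoc _ _ _).symm).trans (e1 _ lin!)))
      simp only [Sol.lin, solPh, Sol.growing]
      ring
    · simp only [if_neg hyR, if_neg hyX, mul_zero, zero_mul, sub_zero]
      have := (hB y h hy hh).1 (16 * R1) (by rw [hhR]; linarith)
      rw [hhR, max_eq_left (not_le.1 hyX).le] at this
      have c1 := (s.ca h).icc hy (16 * R1)
      have c2 : ContinuousOn phi (Icc y (16 * R1)) := cphi.continuousOn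
      refine (low y h (s.a h) hy hyR' hh (ca hy h) ((int_mono_set le_rfl lin! lin! con! (fun r hr => by
          have := Ioi_of_Icc hy hr
          positivity)).trans this)).trans (e1 _ lin!)
  · rcases hy.eq_or_lt with rfl | hy
    · rfl
    · simp only [if_neg (not_le.2 hy), if_pos le_rfl]
      exact ha0
  · simp only [if_neg (not_le.2 hy)]
  · simp only [if_pos hyX]
    have := (hγ y y hy ⟨hy.le, le_rfl⟩ hyX).1
    rw [abs_div, abs_of_pos hy, div_le_iff₀ hy]
    calc _ ≤ C * √E := this
      _ ≤ (A * C + A * F + C + 1) * √E := mul_le_r lin! (Real.sqrt_nonneg _)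
      _ = _ := by field_simp

lemma even_levels : ∃ C, 1 ≤ C ∧ ∀ s : Sol, Evn s → FE s → ∀ E, 0 < E → (∀ ρ, 0 ≤ ρ → Late s ρ E) →
    ∃ α δ : ℝ → ℝ, (∀ y, 0 < y → Lev s (C * E) y (α y) (δ y)) ∧ (∀ y, y ≤ R1 → α y = α R1) ∧ (∀ y, X0 < y → δ y = 0) ∧ (∀ y, 0 < y → y ≤ X0 → |δ y| ≤ C / y * √E) ∧
      (∀ y, R1 ≤ y → |α (2 * y) - α y| ≤ C * √E) ∧ (∀ y, 0 < y → |δ (2 * y) - δ y| ≤ C * √E) := by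
  obtain ⟨C, hC1, hC⟩ := even_levels_aux
  obtain ⟨c0, hc0, hl1, hl2⟩ := phi_lower
  have hX := X0_pos
  have hX1 := X0_lt
  have hR := R1_ge
  have n1 : 0 ≤ 2 * C / X0 := pos!
  have n2 : 0 ≤ 2 / c0 * √(4 * C) := pos!
  refine ⟨C + 2 * C / X0 + 2 / c0 * √(4 * C), lin!, fun s hs hF E hE hL => ?_⟩
  obtain ⟨α, δ, i1, i2, i3, i4⟩ := hC s hs hF E hE hL
  have hs0 := Real.sqrt_nonneg E
  have up : ∀ x, x ≤ C + 2 * C / X0 + 2 / c0 * √(4 * C) → x * √E ≤ (C + 2 * C / X0 + 2 / c0 * √(4 * C)) * √E := fun x hx => mul_le_r hx hs0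
  have cmp : ∀ y, 0 < y → ∫ r in 2 * y..(16 * y), r ^ 5 * (y * (α (2 * y) - α y) * phi r + y * (δ (2 * y) - δ y) * Gam r) ^ 2 ≤ 4 * C * E := by
    intro y hy
    have h1 := i1 y hy y ⟨hy.le, le_rfl⟩
    have h2 := i1 (2 * y) lin! y ⟨hy.le, lin!⟩
    have ca := (s.ca y).mono (Icc_pos (b := 16 * (2 * y)) hy)
    have cG := cGam.mono (Icc_pos (b := 16 * (2 * y)) hy)
    have cp : ContinuousOn phi (Icc y (16 * (2 * y))) := cphi.continuousOn
    have cc : ∀ x z : ℝ, ContinuousOn (fun r => r ^ 5 * (s.a y r - y * x * phi r - y * z * Gam r) ^ 2) (Icc y (16 * (2 * y))) := fun x z => con!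
    have sub1 : Icc (2 * y) (16 * y) ⊆ Icc y (16 * (2 * y)) := Icc_subset_Icc lin! lin!
    have pos : ∀ x z : ℝ, ∀ r ∈ Icc y (16 * (2 * y)), 0 ≤ r ^ 5 * (s.a y r - y * x * phi r - y * z * Gam r) ^ 2 := fun x z r hr => by
      have := Ioi_of_Icc hy hr
      positivity
    have h3 := (int_mono_set (a := y) (b := 2 * y) (c := 16 * y) lin! lin! le_rfl ((cc (α y) (δ y)).mono (Icc_subset_Icc_right lin!))
      (fun r hr => pos _ _ r ⟨hr.1, hr.2.trans lin!⟩)).trans h1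
    have h4 := (int_mono_set (a := 2 * y) (c := 16 * y) le_rfl lin! lin! ((cc (α (2 * y)) (δ (2 * y))).mono
      (Icc_subset_Icc_left lin!)) (fun r hr => pos _ _ r ⟨by linarith [hr.1], hr.2⟩)).trans h2
    have := int_le_lin (lin! : 2 * y ≤ 16 * y) 2 2 (ContinuousOn.mono con! sub1) ((cc (α y) (δ y)).mono sub1) ((cc (α (2 * y)) (δ (2 * y))).mono sub1)
      (A := fun r => r ^ 5 * (y * (α (2 * y) - α y) * phi r + y * (δ (2 * y) - δ y) * Gam r) ^ 2) (fun r hr => by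
        have hr0 := Ioi_of_Icc hy (sub1 hr)
        have : 0 ≤ r ^ 5 * ((s.a y r - y * α y * phi r - y * δ y * Gam r) + (s.a y r - y * α (2 * y) * phi r - y * δ (2 * y) * Gam r)) ^ 2 := pos!
        nlinarith)
    linarith
  have fin : ∀ y g x, 0 < y → ContinuousOn g (Icc (2 * y) (16 * y)) → (∀ r ∈ Icc (2 * y) (2 * (2 * y)), c0 ≤ (2 * y) ^ 4 * g r) →
      ∫ r in 2 * y..(16 * y), r ^ 5 * (y * x * g r) ^ 2 ≤ 4 * C * E → |x| ≤ 2 / c0 * √(4 * C) * √E := by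
    intro y g x hy cg hg h
    have := coef_le lin! hc0 lin! cg hg h
    rw [abs_mul, abs_of_pos hy, Real.sqrt_mul pos!] at this
    refine le_of_mul_le_mul_left (this.trans (le_of_eq ?_)) hy
    ring
  refine ⟨α, δ, fun y hy h hh => (i1 y hy h hh).trans (mul_le_r lin! hE.le), i2, i3, fun y hy hyX => (i4 y hy hyX).trans ?_, fun y hy => ?_, fun y hy => ?_⟩
  · rw [div_mul_eq_mul_div, div_mul_eq_mul_div]
    exact div_le_div_of_nonneg_right (up _ lin!) hy.le
  · have hy0 : 0 < y := lin!
    refine (fin y phi _ hy0 cphi.continuousOn (hl1 (2 * y) lin!) ?_).trans (up _ lin!)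
    have := cmp y hy0
    simp only [i3 y lin!, i3 (2 * y) lin!, sub_zero, mul_zero, zero_mul, add_zero] at this
    exact this
  · by_cases h1 : X0 < y
    · rw [i3 y h1, i3 (2 * y) lin!, sub_zero, abs_zero]
      positivity
    rw [not_lt] at h1
    by_cases h2 : X0 < 2 * y
    · rw [i3 _ h2, zero_sub, abs_neg]
      refine (i4 y hy h1).trans ((mul_le_r ?_ hs0).trans (up (2 * C / X0) lin!))
      rw [div_le_div_iff₀ hy hX]
      nlinarith
    · refine (fin y Gam _ hy (cGam.mono (Icc_pos lin!)) (hl2 (2 * y) lin! lin!) ?_).trans (up _ lin!)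
      have := cmp y hy
      rw [i2 y lin!, i2 (2 * y) lin!] at this
      simpa only [sub_self, mul_zero, zero_mul, zero_add] using this

/-- The static profile approximating even data near radius `y`. -/
def pro (α δ k l r : ℝ) : ℝ := α * PhS r + δ * ThS r + k * phi r + l * Gam r
/-- Its radial derivative. -/
def pro1 (α δ k l r : ℝ) : ℝ := α * PhS1 r + δ * ThS1 r + k * phi1 r + l * Gam1 r

lemma even_coefs : ∃ C, 1 ≤ C ∧ ∀ s : Sol, Evn s → FE s → ∀ E, 0 < E → (∀ ρ, 0 ≤ ρ → Late s ρ E) →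
    ∃ α δ k l : ℝ → ℝ, (∀ y, y ≤ R1 → α y = α R1) ∧ (∀ y, X0 < y → δ y = 0) ∧ (∀ y, 0 < y → y ≤ X0 → |δ y| ≤ C / y * √E) ∧
      (∀ y, R1 ≤ y → |α (2 * y) - α y| ≤ C * √E) ∧ (∀ y, 0 < y → |δ (2 * y) - δ y| ≤ C * √E) ∧
      ∀ y, 0 < y → ∫ r in 2 * y..(8 * y), r ^ 5 * (s.b 0 r - pro1 (α y) (δ y) (k y) (l y) r) ^ 2 ≤ C * E ∧
        ∫ r in 2 * y..(8 * y), r ^ 5 * (s.u 0 r - pro (α y) (δ y) (k y) (l y) r) ^ 2 ≤ C * (y ^ 2 * E) := by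
  obtain ⟨C, hC1, hC⟩ := even_levels
  obtain ⟨K, hK1, hw1, hw2⟩ := wt
  obtain ⟨A, hA0, hA⟩ := level_coef (fun r _ => dphi r) (fun _ h => dphi1 h) (fun _ h => dGam h) (fun _ h => dGam1 h) (fun _ h => wronsk h) (K ^ 2)
  have hAC : 0 ≤ A * C := pos!
  refine ⟨C + A * C, lin!, fun s hs hF E hE hL => ?_⟩
  obtain ⟨α, δ, i1, i2, i3, i4, i5, i6⟩ := hC s hs hF E hE hL
  have hs0 := Real.sqrt_nonneg E
  have key : ∀ y, ∃ k l, 0 < y → ∫ r in 2 * y..(8 * y), r ^ 5 * (s.b 0 r - pro1 (α y) (δ y) k l r) ^ 2 ≤ (C + A * C) * E ∧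
        ∫ r in 2 * y..(8 * y), r ^ 5 * (s.u 0 r - pro (α y) (δ y) k l r) ^ 2 ≤ (C + A * C) * (y ^ 2 * E) := by
    intro y
    by_cases hy : 0 < y
    swap
    · exact ⟨0, 0, fun h => absurd h hy⟩
    obtain ⟨G, H, hw⟩ : ∃ G H, Wt K y G H := by
      rcases le_total R1 y with h | h
      · exact ⟨_, _, hw1 y h⟩
      · exact ⟨_, _, hw2 y hy h⟩
    obtain ⟨k, l, h1, h2⟩ := hA (Sol.lin 1 (Sol.lin 1 s (-α y) solPh) (-δ y) solTh) y (C * E) G H hy (fun r hr => (hw.2 r hr).1) (fun r hr => (hw.2 r hr).2.2.1) hw.1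
      (fun r hr => by
        simp only [Sol.lin, solPh, solTh, Sol.growing, hs.a0 hr]
        ring)
      (fun t ht => le_trans (le_of_eq (integral_congr fun r _ => by
        simp only [Sol.lin, solPh, solTh, Sol.growing]
        ring)) (i1 y hy t ht))
    refine ⟨k, l, fun _ => ⟨?_, ?_⟩⟩
    · refine le_trans (le_of_eq (integral_congr fun r _ => ?_)) (h1.trans ?_)
      · simp only [Sol.lin, solPh, solTh, Sol.growing, pro1]
        ring
      · nlinarith
    · refine le_trans (le_of_eq (integral_congr fun r _ => ?_)) (h2.trans ?_)
      · simp only [Sol.lin, solPh, solTh, Sol.growing, pro]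
        ring
      · have : 0 ≤ C * (y ^ 2 * E) := pos!
        nlinarith
  choose k l hkl using key
  refine ⟨α, δ, k, l, i2, i3, fun y hy hyX => (i4 y hy hyX).trans ?_, fun y hy => (i5 y hy).trans ?_, fun y hy => (i6 y hy).trans ?_, fun y hy => hkl y hy⟩
  · gcongr
    linarith
  all_goals exact mul_le_r lin! hs0

lemma coef_of_wronsk {p q D D1 A A1 z : ℝ} {f f1 e e1 : ℝ → ℝ} (hp : 0 < p) (hpq : p ≤ q) (hf : ContinuousOn f (Icc p q))
    (hf1 : ContinuousOn f1 (Icc p q)) (he : ContinuousOn e (Icc p q)) (he1 : ContinuousOn e1 (Icc p q))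
    (hA : ∀ r ∈ Icc p q, |f r| ≤ A) (hA1 : ∀ r ∈ Icc p q, |f1 r| ≤ A1)
    (hD : ∫ r in p..q, r ^ 5 * e r ^ 2 ≤ D) (hD1 : ∫ r in p..q, r ^ 5 * e1 r ^ 2 ≤ D1)
    (hz : ∀ r ∈ Icc p q, r ^ 5 * (f r * e1 r - f1 r * e r) = z) :
    (q - p) * |z| ≤ A * q ^ 3 * √D1 + A1 * q ^ 3 * √D := by
  have h1 := weighted_cs hp hpq hf he1 hA hD1
  have h2 := weighted_cs hp hpq hf1 he hA1 hD
  have h3 : (q - p) * z = (∫ r in p..q, r ^ 5 * (f r * e1 r)) - ∫ r in p..q, r ^ 5 * (f1 r * e r) := by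
    rw [← ii_sub (ContinuousOn.iint hpq con!) (ContinuousOn.iint hpq con!), ← smul_eq_mul, ← intervalIntegral.integral_const]
    refine ii_congr hpq fun r hr => ?_
    simp only [← hz r hr]
    ring
  rw [← abs_of_nonneg (lin! : 0 ≤ q - p), ← abs_mul, h3]
  exact (abs_sub _ _).trans (add_le_add h1 h2)

lemma coef_step {y K G H E x A C D a b : ℝ} {P P1 : ℝ → ℝ} (hy : 0 < y) (hE : 0 < E) (hW : Wt K y G H) (cP : ContinuousOn P (Ioi 0)) (cP1 : ContinuousOn P1 (Ioi 0))
    (hP : ∀ r ∈ Icc (4 * y) (8 * y), r ^ 2 * |P r| ≤ A ∧ r ^ 3 * |P1 r| ≤ A) (hx : |x| ≤ C * √E)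
    (h : ∫ r in 4 * y..(8 * y), r ^ 5 * (x * P r + a * phi r + b * Gam r) ^ 2 ≤ D * (y ^ 2 * E))
    (h1 : ∫ r in 4 * y..(8 * y), r ^ 5 * (x * P1 r + a * phi1 r + b * Gam1 r) ^ 2 ≤ D * E) :
    |b| ≤ 256 * √(2 * D + 64 * C ^ 2 * A ^ 2) * (y ^ 2 * G) * √E ∧ |a| ≤ 256 * √(2 * D + 64 * C ^ 2 * A ^ 2) * (y ^ 2 * H) * √E := by
  have hp : 0 < 4 * y := lin!
  have hpq : 4 * y ≤ 8 * y := lin!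
  have cp : ContinuousOn phi (Icc (4 * y) (8 * y)) := cphi.continuousOn
  have cp1 : ContinuousOn phi1 (Icc (4 * y) (8 * y)) := cphi1.continuousOn
  have cG := cGam.icc hp (8 * y)
  have cG1 := cGam1.icc hp (8 * y)
  have c1 := cP.icc hp (8 * y)
  have c2 := cP1.icc hp (8 * y)
  have hx2 : x ^ 2 ≤ C ^ 2 * E := by
    have := sq_le_sq' (abs_le.1 hx).1 (abs_le.1 hx).2
    rwa [mul_pow, Real.sq_sqrt hE.le] at this
  set D' := 2 * D + 64 * C ^ 2 * A ^ 2 with hD'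
  have i0 : ∫ r in 4 * y..(8 * y), r ^ 5 * (a * phi r + b * Gam r) ^ 2 ≤ D' * (y ^ 2 * E) := by
    have := int_le_lin hpq 2 2 (A := fun r => r ^ 5 * (a * phi r + b * Gam r) ^ 2) con! (f := fun r => r ^ 5 * (x * P r + a * phi r + b * Gam r) ^ 2) con!
      (g := fun _ => C ^ 2 * E * A ^ 2 * (8 * y)) con! (fun r hr => by
        have hr0 := Ioi_of_Icc hp hr
        have e1 : (r ^ 2 * P r) ^ 2 ≤ A ^ 2 := by
          rw [← sq_abs, abs_mul, abs_of_pos (pos! : 0 < r ^ 2)]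
          exact pow_le_l pos! (hP r hr).1 2
        have e2 : x ^ 2 * (r ^ 2 * P r) ^ 2 * r ≤ C ^ 2 * E * A ^ 2 * (8 * y) := mul_le_mul (mul_le_mul hx2 e1 (sq_nonneg _) pos!) hr.2 hr0.le pos!
        have : 0 ≤ r ^ 5 * (2 * x * P r + a * phi r + b * Gam r) ^ 2 := pos!
        nlinarith)
    rw [ii_const] at this
    rw [hD']
    nlinarith
  have i1 : ∫ r in 4 * y..(8 * y), r ^ 5 * (a * phi1 r + b * Gam1 r) ^ 2 ≤ D' * E := by
    have := int_le_lin hpq 2 2 (A := fun r => r ^ 5 * (a * phi1 r + b * Gam1 r) ^ 2) con! (f := fun r => r ^ 5 * (x * P1 r + a * phi1 r + b * Gam1 r) ^ 2) con!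
      (g := fun _ => C ^ 2 * E * A ^ 2 / (4 * y)) con! (fun r hr => by
        have hr0 := Ioi_of_Icc hp hr
        have e1 : (r ^ 3 * P1 r) ^ 2 ≤ A ^ 2 := by
          rw [← sq_abs, abs_mul, abs_of_pos (pos! : 0 < r ^ 3)]
          exact pow_le_l pos! (hP r hr).2 2
        have e2 : x ^ 2 * (r ^ 3 * P1 r) ^ 2 / r ≤ C ^ 2 * E * A ^ 2 / (4 * y) := div_le_div₀ pos! (mul_le_mul hx2 e1 (sq_nonneg _) pos!) pos! hr.1
        rw [show x ^ 2 * (r ^ 3 * P1 r) ^ 2 / r = r ^ 5 * (x * P1 r) ^ 2 by field_simp] at e2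
        have : 0 ≤ r ^ 5 * (2 * x * P1 r + a * phi1 r + b * Gam1 r) ^ 2 := pos!
        nlinarith)
    rw [ii_const, show (8 * y - 4 * y) * (C ^ 2 * E * A ^ 2 / (4 * y)) = C ^ 2 * E * A ^ 2 by field_simp; ring] at this
    have : 0 ≤ C ^ 2 * E * A ^ 2 := pos!
    rw [hD']
    nlinarith
  have hin : ∀ r ∈ Icc (4 * y) (8 * y), r ∈ Icc y (16 * y) := fun r hr => ⟨by linarith [hr.1], by linarith [hr.2]⟩
  have hD0 : 0 ≤ D' := by
    have : 0 ≤ D' * E := le_trans (ii_nonneg hpq fun r hr => by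
      have := Ioi_of_Icc hp hr
      positivity) i1
    exact nonneg_of_mul_nonneg_left this hE
  have r1 : √(D' * (y ^ 2 * E)) = √D' * (y * √E) := by rw [Real.sqrt_mul hD0, Real.sqrt_mul (sq_nonneg _), Real.sqrt_sq hy.le]
  have r2 : √(D' * E) = √D' * √E := Real.sqrt_mul hD0 _
  have div1 : ∀ g : ℝ, ∀ r ∈ Icc (4 * y) (8 * y), ∀ f, y * |f| ≤ g → |f| ≤ g / y := fun g r _ f hf => by
    rw [le_div_iff₀ hy]
    linarith
  constructor
  · have := coef_of_wronsk hp hpq cp cp1 con! con! (fun r hr => (hW.2 r (hin r hr)).1)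
      (fun r hr => div1 G r hr _ (hW.2 r (hin r hr)).2.1) i0 i1 (z := b) (fun r hr => by linear_combination b * wronsk (Ioi_of_Icc hp hr))
    rw [r1, r2] at this
    refine le_of_mul_le_mul_left (this.trans (le_of_eq ?_)) (lin! : 0 < 8 * y - 4 * y)
    field_simp
    ring
  · have := coef_of_wronsk hp hpq cG cG1 con! con! (fun r hr => (hW.2 r (hin r hr)).2.2.1)
      (fun r hr => div1 H r hr _ (hW.2 r (hin r hr)).2.2.2) i0 i1 (z := -a) (fun r hr => by linear_combination -a * wronsk (Ioi_of_Icc hp hr))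
    rw [r1, r2, abs_neg] at this
    refine le_of_mul_le_mul_left (this.trans (le_of_eq ?_)) (lin! : 0 < 8 * y - 4 * y)
    field_simp
    ring

/-- The approximation of even data by static profiles on dyadic shells, with constant `C` and energy `E`. -/
structure Shells (s : Sol) (C E : ℝ) (α δ k l : ℝ → ℝ) : Prop where
  hC : 1 ≤ C
  hE : 0 < E
  αc : ∀ y, y ≤ R1 → α y = α R1
  δ0 : ∀ y, X0 < y → δ y = 0
  δb : ∀ y, 0 < y → y ≤ X0 → |δ y| ≤ C / y * √E
  αd : ∀ y, R1 ≤ y → |α (2 * y) - α y| ≤ C * √E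
  δd : ∀ y, 0 < y → |δ (2 * y) - δ y| ≤ C * √E
  eb : ∀ y, 0 < y → ∫ r in 2 * y..(8 * y), r ^ 5 * (s.b 0 r - pro1 (α y) (δ y) (k y) (l y) r) ^ 2 ≤ C * E
  eu : ∀ y, 0 < y → ∫ r in 2 * y..(8 * y), r ^ 5 * (s.u 0 r - pro (α y) (δ y) (k y) (l y) r) ^ 2 ≤ C * (y ^ 2 * E)
  lo : ∀ y, R1 ≤ y → |l (2 * y) - l y| ≤ C / y ^ 2 * √E
  ko : ∀ y, R1 ≤ y → |k (2 * y) - k y| ≤ C * y ^ 2 * √E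
  li : ∀ y, 0 < y → 2 * y ≤ R1 → |l (2 * y) - l y| ≤ C * y ^ 2 * √E
  ki : ∀ y, 0 < y → 2 * y ≤ R1 → |k (2 * y) - k y| ≤ C / y ^ 2 * √E

lemma cpro (α δ k l : ℝ) {p q : ℝ} (hp : 0 < p) : ContinuousOn (pro α δ k l) (Icc p q) := by
  have := cphi.continuousOn (s := Icc p q)
  have := cGam.icc hp q
  have := cPhS.icc hp q
  have := cThS.icc hp q
  unfold pro
  fun_prop

lemma cpro1 (α δ k l : ℝ) {p q : ℝ} (hp : 0 < p) : ContinuousOn (pro1 α δ k l) (Icc p q) := by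
  have := cphi1.continuousOn (s := Icc p q)
  have := cGam1.icc hp q
  have := cPhS1.icc hp q
  have := cThS1.icc hp q
  unfold pro1
  fun_prop

lemma overlap {f g h : ℝ → ℝ} {y D D' : ℝ} (hy : 0 < y) (hf : ContinuousOn f (Ioi 0))
    (hg : ∀ p q, 0 < p → ContinuousOn g (Icc p q)) (hh : ∀ p q, 0 < p → ContinuousOn h (Icc p q))
    (h1 : ∫ r in 2 * y..(8 * y), r ^ 5 * (f r - g r) ^ 2 ≤ D)
    (h2 : ∫ r in (2 * (2 * y))..(8 * (2 * y)), r ^ 5 * (f r - h r) ^ 2 ≤ D') :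
    ∫ r in 4 * y..(8 * y), r ^ 5 * (h r - g r) ^ 2 ≤ 2 * D + 2 * D' := by
  have c1 := hf.mono (Icc_pos (b := 16 * y) (lin! : 0 < 2 * y))
  have c2 := hg (2 * y) (16 * y) lin!
  have c3 := hh (2 * y) (16 * y) lin!
  have s1 : Icc (2 * y) (8 * y) ⊆ Icc (2 * y) (16 * y) := Icc_subset_Icc_right lin!
  have s2 : Icc (2 * (2 * y)) (8 * (2 * y)) ⊆ Icc (2 * y) (16 * y) := Icc_subset_Icc lin! lin!
  have s3 : Icc (4 * y) (8 * y) ⊆ Icc (2 * y) (16 * y) := Icc_subset_Icc lin! lin!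
  have k1 : ContinuousOn (fun r => r ^ 5 * (f r - g r) ^ 2) (Icc (2 * y) (16 * y)) := con!
  have k2 : ContinuousOn (fun r => r ^ 5 * (f r - h r) ^ 2) (Icc (2 * y) (16 * y)) := con!
  have k3 : ContinuousOn (fun r => r ^ 5 * (h r - g r) ^ 2) (Icc (2 * y) (16 * y)) := con!
  have p : ∀ r ∈ Icc (2 * y) (16 * y), 0 < r := fun r hr => by linarith [hr.1]
  have j1 := le_trans (int_mono_set (lin! : 2 * y ≤ 4 * y) lin! le_rfl (k1.mono s1) fun r hr => by
    have := p r (s1 hr)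
    positivity) h1
  have j2 := le_trans (int_mono_set (b := 4 * y) (c := 8 * y) lin! lin! lin! (k2.mono s2) fun r hr => by
      have := p r (s2 hr)
      positivity) h2
  have := int_le_lin (lin! : 4 * y ≤ 8 * y) 2 2 (k3.mono s3) (k1.mono s3) (k2.mono s3) fun r hr => by
    have := p r (s3 hr)
    have : 0 ≤ r ^ 5 * ((f r - g r) + (f r - h r)) ^ 2 := pos!
    nlinarith
  linarith

lemma even_shells : ∃ C, 1 ≤ C ∧ ∀ s : Sol, Evn s → FE s → ∀ E, 0 < E → (∀ ρ, 0 ≤ ρ → Late s ρ E) → ∃ α δ k l : ℝ → ℝ, Shells s C E α δ k l := by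
  obtain ⟨C, hC1, hC⟩ := even_coefs
  obtain ⟨K, hK1, hw1, hw2⟩ := wt
  obtain ⟨A, hA0, hA⟩ := PhS_bound
  obtain ⟨B, hB1, hB⟩ := bounds_in (8 * R1)
  have hR := R1_ge
  set N : ℝ := 256 * √(2 * (10 * C) + 64 * C ^ 2 * (A + B) ^ 2) * K with hN
  have hN0 : 0 ≤ N := pos!
  refine ⟨C + N, lin!, fun s hs hF E hE hL => ?_⟩
  obtain ⟨α, δ, k, l, i1, i2, i3, i4, i5, i6⟩ := hC s hs hF E hE hL
  have hs0 := Real.sqrt_nonneg E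
  have h1 : ∀ y, 0 < y → ∫ r in 4 * y..(8 * y), r ^ 5 * (pro1 (α (2 * y)) (δ (2 * y)) (k (2 * y)) (l (2 * y)) r -
      pro1 (α y) (δ y) (k y) (l y) r) ^ 2 ≤ 10 * C * E := fun y hy => by
    have := overlap hy (s.cb 0) (fun p q hp => cpro1 _ _ _ _ hp) (fun p q hp => cpro1 _ _ _ _ hp) (i6 y hy).1 (i6 (2 * y) lin!).1
    have : 0 ≤ C * E := pos!
    linarith
  have h2 : ∀ y, 0 < y → ∫ r in 4 * y..(8 * y), r ^ 5 * (pro (α (2 * y)) (δ (2 * y)) (k (2 * y)) (l (2 * y)) r -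
      pro (α y) (δ y) (k y) (l y) r) ^ 2 ≤ 10 * C * (y ^ 2 * E) := fun y hy =>
    (overlap hy (s.cu 0) (fun p q hp => cpro _ _ _ _ hp) (fun p q hp => cpro _ _ _ _ hp) (i6 y hy).2 (i6 (2 * y) lin!).2).trans (le_of_eq (by ring))
  have out : ∀ y, R1 ≤ y → |l (2 * y) - l y| ≤ N / y ^ 2 * √E ∧ |k (2 * y) - k y| ≤ N * y ^ 2 * √E := by
    intro y hyR
    have hX := X0_lt
    have hy : 0 < y := lin!
    have := coef_step hy hE (hw1 y hyR) cPhS cPhS1 (A := A + B) (D := 10 * C) (fun r hr => by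
      obtain ⟨a1, a2⟩ := hA r (by linarith [hr.1])
      exact ⟨lin!, lin!⟩) (i4 y hyR) (a := k (2 * y) - k y) (b := l (2 * y) - l y)
      (le_trans (le_of_eq (integral_congr fun r _ => by
        simp only [pro, i2 y lin!, i2 (2 * y) lin!]
        ring)) (h2 y hy))
      (le_trans (le_of_eq (integral_congr fun r _ => by
        simp only [pro1, i2 y lin!, i2 (2 * y) lin!]
        ring)) (h1 y hy))
    refine ⟨this.1.trans (le_of_eq ?_), this.2.trans (le_of_eq ?_)⟩
    · rw [hN]; field_simp
    · rw [hN]; ring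
  have inn : ∀ y, 0 < y → 2 * y ≤ R1 → |l (2 * y) - l y| ≤ N * y ^ 2 * √E ∧ |k (2 * y) - k y| ≤ N / y ^ 2 * √E := by
    intro y hy hyR
    have := coef_step hy hE (hw2 y hy lin!) cThS cThS1 (A := A + B) (D := 10 * C) (fun r hr => by
      obtain ⟨-, -, -, -, a1, a2⟩ := hB r (by linarith [hr.1]) (by linarith [hr.2])
      exact ⟨lin!, lin!⟩) (i5 y hy) (a := k (2 * y) - k y) (b := l (2 * y) - l y)
      (le_trans (le_of_eq (integral_congr fun r _ => by
        simp only [pro, i1 y lin!, i1 (2 * y) lin!]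
        ring)) (h2 y hy))
      (le_trans (le_of_eq (integral_congr fun r _ => by
        simp only [pro1, i1 y lin!, i1 (2 * y) lin!]
        ring)) (h1 y hy))
    refine ⟨this.1.trans (le_of_eq ?_), this.2.trans (le_of_eq ?_)⟩
    · rw [hN]; ring
    · rw [hN]; field_simp
  have le1 : ∀ x t : ℝ, x ≤ C + N → 0 ≤ t → x * t ≤ (C + N) * t := fun x t hx ht => mul_le_r hx ht
  refine ⟨α, δ, k, l, ⟨lin!, hE, i1, i2, fun y hy hyX => (i3 y hy hyX).trans ?_, fun y hy => (i4 y hy).trans ?_,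
    fun y hy => (i5 y hy).trans ?_, fun y hy => (i6 y hy).1.trans ?_, fun y hy => (i6 y hy).2.trans ?_,
    fun y hy => (out y hy).1.trans ?_, fun y hy => (out y hy).2.trans ?_,
    fun y hy hyR => (inn y hy hyR).1.trans ?_, fun y hy hyR => (inn y hy hyR).2.trans ?_⟩⟩
  · gcongr
    linarith
  · exact le1 _ _ lin! hs0
  · exact le1 _ _ lin! hs0
  · exact le1 _ _ lin! hE.le
  · exact le1 _ _ lin! pos!
  all_goals gcongr; linarith

lemma Lq_mass {p : ℝ} (hp : 5 ≤ p) : p ^ 6 ≤ ∫ r in p..2 * p, r ^ 5 * Lq p r := by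
  have hp0 : 0 < p := lin!
  have h := bump_ibp hp0 (f := fun _ => 1) (f1 := fun _ => 0) (F := fun r => -Vp r) (fun r _ => hasDerivAt_const r 1)
    (fun r _ => (hasDerivAt_const r (0 : ℝ)).congr_deriv (by ring)) (by have := cont_Vp; fun_prop)
  have h2 : ∫ r in p..2 * p, r ^ 5 * Lq p r = ∫ r in p..2 * p, r ^ 5 * (Lq p r * 1) := integral_congr fun r _ => by ring
  rw [h2, ← h]
  have c1 := czet p
  have c2 := cont_Vp
  have h3 := int_mono (lin! : p ≤ 2 * p) (A := fun r => 30 / p ^ 4 * (r ^ 5 * zet p r)) (B := fun r => r ^ 5 * (zet p r * -Vp r)) con! con! (fun r hr => by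
      have hr0 := Ioi_of_Icc hp0 hr
      have : 30 / p ^ 4 ≤ -Vp r := by
        rw [Vp, neg_div, neg_neg, div_le_div_iff₀ pos! pos!]
        have h5 : 24 + r ^ 2 ≤ 5 * p ^ 2 := by nlinarith [hr.1, hr.2]
        nlinarith [pow_le_l pos! h5 2, pow_pos hp0 4]
      have hz : 0 ≤ r ^ 5 * zet p r := by rw [zet]; positivity
      nlinarith)
  rw [ii_const_mul] at h3
  have h4 := mul_le_l (zet_int hp0) (pos! : 0 ≤ 30 / p ^ 4)
  refine le_trans (le_of_eq ?_) (h4.trans h3)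
  field_simp

lemma lim_small {s : Sol} {E c : ℝ} (hE : 0 < E) (hL : Late s 1 E) (hc : ∀ t, Tendsto (s.u t) atTop (𝓝 c)) : |c| ≤ 512 * √E := by
  obtain ⟨T0, hT0⟩ := hL
  obtain ⟨T, hT, hT2⟩ : ∃ T, T0 ≤ T ∧ 2 ≤ T := ⟨max T0 2, le_max_left _ _, le_max_right _ _⟩
  obtain ⟨p, hp⟩ : ∃ p, p = 4 * T := ⟨_, rfl⟩
  have hp0 : 0 < p := lin!
  have hpp : p ≤ 2 * p := lin!
  have cL := cLq (p := p) (q := 2 * p) hp0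
  have cu := fun t => (s.cu t).icc hp0 (2 * p)
  have eb : ∀ t ∈ Icc T (2 * T), EB s (1 + t) t E := fun t ht => hT0 t (hT.trans ht.1)
  have hm : ∀ t ∈ Icc T (2 * T), |mom s p t| ≤ 8 * p ^ 7 * √E := fun t ht => by
    have := weighted_cs hp0 hpp (czet p).continuousOn ((s.ca t).icc hp0 _) (fun r hr => zet_bound hp0 hr)
      (((eb t ht).sub (by linarith [ht.1]) (by linarith [ht.2])).a_le hp0 hpp)
    exact this.trans (le_of_eq (by ring))
  set I := ∫ r in p..2 * p, r ^ 5 * Lq p r with hI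
  have hI0 : p ^ 6 ≤ I := Lq_mass lin!
  have hF : ∀ t ∈ Icc T (2 * T), |(∫ r in p..2 * p, r ^ 5 * (Lq p r * s.u t r)) - c * I| ≤ 448 * p ^ 6 * √E := by
    intro t ht
    have e1 : (∫ r in p..2 * p, r ^ 5 * (Lq p r * s.u t r)) - c * I = ∫ r in p..2 * p, r ^ 5 * (Lq p r * (s.u t r - c)) := by
      rw [hI, ← ii_const_mul, ← ii_sub (ContinuousOn.iint hpp (by have := cu t; fun_prop)) (ContinuousOn.iint hpp con!)]
      exact integral_congr fun r _ => by ring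
    rw [e1]
    have := norm_integral_le_of_norm_le_const (a := p) (b := 2 * p)
      (f := fun r => r ^ 5 * (Lq p r * (s.u t r - c))) (C := (2 * p) ^ 5 * (28 * p ^ 2 * (√E / (2 * p ^ 2)))) (fun r hr => by
        rw [uIoc_of_le hpp] at hr
        have hr' : r ∈ Icc p (2 * p) := ⟨hr.1.le, hr.2⟩
        have hr0 := Ioi_of_Icc hp0 hr'
        have u1 := u_bound (eb t ht) (by linarith [ht.1]) (hc t) (x := r) (by linarith [ht.2, hr.1])
        have u2 : (s.u t r - c) ^ 2 ≤ (√E / (2 * p ^ 2)) ^ 2 := by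
          rw [div_pow, Real.sq_sqrt hE.le]
          refine u1.trans (div_le_div_of_nonneg_left hE.le pos! ?_)
          have := pow_le_l hp0.le hr'.1 4
          nlinarith
        have u3 := abs_le_of_sq_le_sq u2 pos!
        rw [Real.norm_eq_abs, abs_mul, abs_mul, abs_of_pos (pos! : 0 < r ^ 5)]
        exact mul_le_mul (pow_le_l hr0.le hr.2 5) (mul_le_mul (Lq_bound hp0 hr') u3 (abs_nonneg _) pos!) pos! pos!)
    rw [Real.norm_eq_abs] at this
    refine this.trans (le_of_eq ?_)
    rw [show 2 * p - p = p by ring, abs_of_pos hp0]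
    field_simp
    ring
  have hTT : T ≤ 2 * T := lin!
  have cF : Continuous fun t => ∫ r in p..2 * p, r ^ 5 * (Lq p r * s.u t r) := by
    have : CP (Ioi 0) fun t r => r ^ 5 * (Lq p r * s.u t r) := (CP.ofR (k := fun r => r ^ 5) con!).mul ((CP.ofR (cLq' p)).mul s.gu.cp)
    exact this.int_cont hp0 hpp
  have e2 : mom s p (2 * T) - mom s p T - T * (c * I) = ∫ t in T..2 * T, ((∫ r in p..2 * p, r ^ 5 * (Lq p r * s.u t r)) - c * I) := by
    rw [mom_diff hp0, ii_sub (cF.intervalIntegrable _ _) (intervalIntegrable_const), ii_const]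
    ring
  have e3 := norm_integral_le_of_norm_le_const (a := T) (b := 2 * T)
    (f := fun t => (∫ r in p..2 * p, r ^ 5 * (Lq p r * s.u t r)) - c * I) (C := 448 * p ^ 6 * √E) (fun t ht => by
      rw [uIoc_of_le hTT] at ht
      exact hF t ⟨ht.1.le, ht.2⟩)
  rw [← e2, Real.norm_eq_abs, show 2 * T - T = T by ring, abs_of_pos (lin! : 0 < T)] at e3
  have m1 := abs_le.1 (hm T ⟨le_rfl, hTT⟩)
  have m2 := abs_le.1 (hm (2 * T) ⟨hTT, le_rfl⟩)
  have e4 : |T * (c * I)| ≤ 512 * (T * p ^ 6) * √E := by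
    have h7 : 8 * p ^ 7 * √E = 32 * (T * p ^ 6) * √E := by rw [hp]; ring
    rw [h7] at m1 m2
    have := abs_le.1 e3
    rw [abs_le]
    constructor <;> nlinarith
  rw [abs_mul, abs_mul, abs_of_pos (lin! : 0 < T), abs_of_nonneg ((pos! : 0 ≤ p ^ 6).trans hI0)] at e4
  have e5 : T * (|c| * p ^ 6) ≤ T * (|c| * I) := by gcongr
  have : 0 < T * p ^ 6 := pos!
  refine le_of_mul_le_mul_left ?_ this
  nlinarith

lemma Gam_lim : Tendsto Gam atTop (𝓝 (1 / 4)) := by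
  have h0 : Tendsto (fun r : ℝ => phi r * Lg r) atTop (𝓝 0) := by
    refine squeeze_zero_norm' (a := fun r => 24 / r) ?_ (tendsto_const_nhds.div_atTop tendsto_id)
    filter_upwards [eventually_ge_atTop 1] with r hr
    have hr0 : 0 < r := lin!
    have p := phi_bound hr0
    have hL := Lg_abs hr
    rw [norm_mul, Real.norm_eq_abs, Real.norm_eq_abs, le_div_iff₀ hr0]
    have : r ^ 2 ≤ r ^ 4 := pow_le_pow_right₀ hr (by norm_num)
    have h1 := mul_le_mul hL p pos! pos!
    have : |phi r| * |Lg r| * r ≤ |phi r| * |Lg r| * r ^ 3 := mul_le_l (le_self_pow₀ hr (by norm_num)) pos!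
    have h2 : |phi r| * |Lg r| * r ^ 3 * r ≤ 24 * r := by nlinarith
    exact this.trans (le_of_mul_le_mul_right h2 hr0)
  have h1 := ((cont_inv_num.tendsto 0).comp tendsto_inv_atTop_zero).add (h0.const_mul 8640)
  refine Tendsto.congr' ?_ (h1.trans (le_of_eq (by norm_num)))
  filter_upwards [eventually_gt_atTop 0] with r hr
  have h := quad_ne r
  simp only [Gam, phi, Function.comp]
  generalize Lg r = l
  field_simp

lemma geom_up {f : ℕ → ℝ} {A : ℝ} (h : ∀ n, |f (n + 1) - f n| ≤ A * 4 ^ n) (n : ℕ) : |f n - f 0| ≤ A * 4 ^ n := by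
  have hA : 0 ≤ A := by simpa using (abs_nonneg _).trans (h 0)
  induction n with
  | zero => simpa
  | succ n ih =>
    have := abs_add_le (f (n + 1) - f n) (f n - f 0)
    rw [sub_add_sub_cancel] at this
    have hp : 0 ≤ A * 4 ^ n := pos!
    rw [pow_succ]
    linarith [h n]

lemma lin_up {f : ℕ → ℝ} {A : ℝ} (h : ∀ n, |f (n + 1) - f n| ≤ A) (n : ℕ) : |f n - f 0| ≤ n * A := by
  induction n with
  | zero => simp
  | succ n ih =>
    have := abs_add_le (f (n + 1) - f n) (f n - f 0)
    rw [sub_add_sub_cancel] at this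
    push_cast
    linarith [h n]

lemma geom_down {f : ℕ → ℝ} {A L : ℝ} (h : ∀ n, |f (n + 1) - f n| ≤ A / 4 ^ n) (hL : Tendsto f atTop (𝓝 L)) (n : ℕ) : |f n - L| ≤ 2 * A / 4 ^ n := by
  have hA : 0 ≤ A := by simpa using (abs_nonneg _).trans (h 0)
  have key : ∀ m, |f n - f (n + m)| ≤ 2 * A / 4 ^ n - 2 * A / 4 ^ (n + m) := by
    intro m
    induction m with
    | zero => simp
    | succ m ih =>
      have := abs_add_le (f n - f (n + m)) (f (n + m) - f (n + m + 1))
      rw [sub_add_sub_cancel] at this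
      have h1 := h (n + m)
      rw [abs_sub_comm] at h1
      have h2 : 2 * A / 4 ^ (n + m + 1) = 2 * (A / 4 ^ (n + m)) / 4 := by rw [pow_succ]; field_simp
      have h3 : 2 * A / 4 ^ (n + m) = 2 * (A / 4 ^ (n + m)) := by ring
      have : 0 ≤ A / 4 ^ (n + m) := pos!
      rw [← add_assoc, h2]
      linarith
  have hl : Tendsto (fun m => |f n - f (n + m)|) atTop (𝓝 |f n - L|) :=
    ((tendsto_const_nhds.sub ((tendsto_add_atTop_iff_nat n).2 hL |>.congr fun m => by rw [add_comm])).abs)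
  refine le_of_tendsto hl (Eventually.of_forall fun m => (key m).trans ?_)
  have : 0 ≤ 2 * A / 4 ^ (n + m) := pos!
  linarith

lemma exists_pt {f : ℝ → ℝ} {y D : ℝ} (hy : 0 < y) (hf : ContinuousOn f (Icc (2 * y) (8 * y))) (hD : 0 < D)
    (h : ∫ r in 2 * y..(8 * y), r ^ 5 * f r ^ 2 ≤ D) : ∃ r ∈ Icc (2 * y) (8 * y), f r ^ 2 ≤ D / (100 * y ^ 6) := by
  by_contra hc
  push Not at hc
  have := int_mono (lin! : 2 * y ≤ 8 * y) (A := fun _ => (2 * y) ^ 5 * (D / (100 * y ^ 6))) (B := fun r => r ^ 5 * f r ^ 2) con! con! (fun r hr => by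
      have h1 : (2 * y) ^ 5 ≤ r ^ 5 := pow_le_l pos! hr.1 5
      exact mul_le_mul h1 (hc r hr).le pos! ((pos! : 0 ≤ (2 * y) ^ 5).trans h1))
  rw [ii_const, show (8 * y - 2 * y) * ((2 * y) ^ 5 * (D / (100 * y ^ 6))) = 192 / 100 * D by field_simp; ring] at this
  linarith

lemma poly_div_four (P Q : ℝ) : Tendsto (fun n : ℕ => (P + Q * n) / 4 ^ n) atTop (𝓝 0) := by
  have h1 := (tendsto_pow_atTop_nhds_zero_of_lt_one (r := (1 / 4 : ℝ)) (by norm_num) (by norm_num)).const_mul P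
  have h2 := (tendsto_self_mul_const_pow_of_lt_one (r := (1 / 4 : ℝ)) (by norm_num) (by norm_num)).const_mul Q
  have := h1.add h2
  rw [mul_zero, mul_zero, add_zero] at this
  refine this.congr fun n => ?_
  rw [one_div, inv_pow]
  field_simp

variable {s : Sol} {C E : ℝ} {α δ k l : ℝ → ℝ}

lemma Shells.out (h : Shells s C E α δ k l) (n : ℕ) : |α (R1 * 2 ^ n) - α R1| ≤ n * (C * √E) ∧ |k (R1 * 2 ^ n) - k R1| ≤ C * R1 ^ 2 * √E * 4 ^ n ∧
    |l (R1 * 2 ^ (n + 1)) - l (R1 * 2 ^ n)| ≤ C / R1 ^ 2 * √E / 4 ^ n := by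
  have hR := R1_ge
  have hy : ∀ n : ℕ, R1 ≤ R1 * 2 ^ n := fun n => le_mul_of_one_le_right lin! (one_le_pow₀ (by norm_num))
  have h2 : ∀ n : ℕ, R1 * 2 ^ (n + 1) = 2 * (R1 * 2 ^ n) := fun n => by rw [pow_succ]; ring
  have h4 : ∀ n : ℕ, ((2 : ℝ) ^ n) ^ 2 = 4 ^ n := fun n => by rw [← pow_mul, mul_comm, pow_mul]; norm_num
  have e1 := lin_up (f := fun n => α (R1 * 2 ^ n)) (A := C * √E) (fun n => by simp only [h2]; exact h.αd _ (hy n)) n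
  have e2 := geom_up (f := fun n => k (R1 * 2 ^ n)) (A := C * R1 ^ 2 * √E) (fun n => by
    simp only [h2]; refine (h.ko _ (hy n)).trans (le_of_eq ?_); rw [mul_pow, h4]; ring) n
  simp only [pow_zero, mul_one] at e1 e2
  refine ⟨e1, e2, ?_⟩
  rw [h2]
  refine (h.lo _ (hy n)).trans (le_of_eq ?_)
  rw [mul_pow, h4]
  field_simp

lemma Shells.inn (h : Shells s C E α δ k l) (n : ℕ) : |δ (R1 / 2 ^ n)| ≤ n * (C * √E) ∧ |k (R1 / 2 ^ n) - k R1| ≤ 4 * C / R1 ^ 2 * √E * 4 ^ n ∧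
    |l (R1 / 2 ^ (n + 1)) - l (R1 / 2 ^ n)| ≤ C * R1 ^ 2 / 4 * √E / 4 ^ n := by
  have hR := R1_ge
  have hX := X0_lt
  have hy0 : ∀ n : ℕ, 0 < R1 / 2 ^ n := fun n => pos!
  have hy : ∀ n : ℕ, R1 / 2 ^ n ≤ R1 := fun n => div_le_self lin! (one_le_pow₀ (by norm_num))
  have h2 : ∀ n : ℕ, R1 / 2 ^ n = 2 * (R1 / 2 ^ (n + 1)) := fun n => by rw [pow_succ]; field_simp
  have h4 : ∀ n : ℕ, ((2 : ℝ) ^ n) ^ 2 = 4 ^ n := fun n => by rw [← pow_mul, mul_comm, pow_mul]; norm_num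
  have e1 := lin_up (f := fun n => δ (R1 / 2 ^ n)) (A := C * √E) (fun n => by rw [h2 n, abs_sub_comm]; exact h.δd _ (hy0 _)) n
  have e2 := geom_up (f := fun n => k (R1 / 2 ^ n)) (A := 4 * C / R1 ^ 2 * √E) (fun n => by
    have := h.ki _ (hy0 (n + 1)) ((h2 n).symm.trans_le (hy n))
    rw [← h2 n, abs_sub_comm] at this
    refine this.trans (le_of_eq ?_); rw [div_pow, h4, pow_succ]; field_simp; ring) n
  simp only [pow_zero, div_one, h.δ0 R1 lin!, sub_zero] at e1 e2
  refine ⟨e1, e2, ?_⟩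
  have := h.li _ (hy0 (n + 1)) ((h2 n).symm.trans_le (hy n))
  rw [← h2 n, abs_sub_comm] at this
  refine this.trans (le_of_eq ?_)
  rw [div_pow, h4, pow_succ]; field_simp; ring

variable {s : Sol} {C E c : ℝ} {α δ k l : ℝ → ℝ}

lemma Shells.pt (h : Shells s C E α δ k l) {y : ℝ} (hy : 0 < y) : ∃ r ∈ Icc (2 * y) (8 * y), y ^ 2 * |s.u 0 r - pro (α y) (δ y) (k y) (l y) r| ≤ C * √E := by
  have hC := h.hC
  have hE := h.hE
  obtain ⟨r, hr, e⟩ := exists_pt (f := fun r => s.u 0 r - pro (α y) (δ y) (k y) (l y) r) hy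
    (((s.cu 0).mono (Icc_pos (b := 8 * y) (lin! : 0 < 2 * y))).sub (cpro _ _ _ _ lin!))
    (D := C * (y ^ 2 * E)) pos! (h.eu y hy)
  refine ⟨r, hr, (abs_le_of_sq_le_sq' ?_ pos!).2⟩
  rw [mul_pow, mul_pow, sq_sqrt hE.le, sq_abs]
  have := mul_le_l e (pos! : 0 ≤ (y ^ 2) ^ 2)
  rw [show (y ^ 2) ^ 2 * (C * (y ^ 2 * E) / (100 * y ^ 6)) = C * E / 100 by field_simp] at this
  nlinarith [mul_le_r hC (pos! : 0 ≤ C * E)]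

lemma Shells.lim_out (h : Shells s C E α δ k l) (hc : Tendsto (s.u 0) atTop (𝓝 c)) : Tendsto (fun n : ℕ => l (R1 * 2 ^ n)) atTop (𝓝 (4 * c)) := by
  have hR := R1_ge
  have hX := X0_lt
  have hC := h.hC
  obtain ⟨A, hA0, hA⟩ := PhS_bound
  have hp : ∀ n : ℕ, (1 : ℝ) ≤ 2 ^ n := fun n => one_le_pow₀ (by norm_num)
  have hy : ∀ n : ℕ, R1 ≤ R1 * 2 ^ n := fun n => le_mul_of_one_le_right lin! (hp n)
  choose r hr e using fun n : ℕ => h.pt (by linarith [hy n] : 0 < R1 * 2 ^ n)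
  have hrt : Tendsto r atTop atTop := by
    refine tendsto_atTop_mono (fun n => ?_) (tendsto_pow_atTop_atTop_of_one_lt (one_lt_two : (1 : ℝ) < 2))
    nlinarith [(hr n).1, hp n, mul_le_r hR (by linarith [hp n] : (0 : ℝ) ≤ 2 ^ n)]
  have hz : Tendsto (fun n : ℕ => l (R1 * 2 ^ n) * Gam (r n) - s.u 0 (r n)) atTop (𝓝 0) := by
    refine squeeze_zero_norm (fun n => ?_) (poly_div_four (C * √E + A * |α R1| + |k R1| + C * R1 ^ 2 * √E) (A * (C * √E)))
    obtain ⟨o1, o2, -⟩ := h.out n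
    have hy0 : 0 < R1 * 2 ^ n := by linarith [hy n]
    have h4 : ((2 : ℝ) ^ n) ^ 2 = 4 ^ n := by rw [← pow_mul, mul_comm, pow_mul]; norm_num
    have h41 : (1 : ℝ) ≤ 4 ^ n := one_le_pow₀ (by norm_num)
    have hy2 : 4 ^ n ≤ (R1 * 2 ^ n) ^ 2 := by rw [mul_pow, h4]; exact le_mul_of_one_le_left lin! (by nlinarith)
    have hr1 : 1 ≤ r n := by linarith [(hr n).1, hy n]
    have hr2 : 4 ^ n ≤ r n ^ 2 := hy2.trans (pow_le_l hy0.le (by linarith [(hr n).1]) 2)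
    have b1 := (mul_le_r hy2 (abs_nonneg _)).trans (e n)
    have b2 := (mul_le_r hr2 (abs_nonneg (PhS (r n)))).trans (hA _ hr1).1
    have b3 := (mul_le_r (mul_le_mul hr2 hr2 pos! pos!) (abs_nonneg (phi (r n)))).trans_eq (by ring) |>.trans (phi_bound lin!)
    rw [norm_eq_abs, le_div_iff₀ pos!, show l (R1 * 2 ^ n) * Gam (r n) - s.u 0 (r n) =
      -(s.u 0 (r n) - pro (α (R1 * 2 ^ n)) (δ (R1 * 2 ^ n)) (k (R1 * 2 ^ n)) (l (R1 * 2 ^ n)) (r n)) - (α (R1 * 2 ^ n) * PhS (r n) + k (R1 * 2 ^ n) * phi (r n)) by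
      rw [pro, h.δ0 _ (by linarith [hy n])]; ring]
    have t1 := abs_sub (-(s.u 0 (r n) - pro (α (R1 * 2 ^ n)) (δ (R1 * 2 ^ n)) (k (R1 * 2 ^ n)) (l (R1 * 2 ^ n)) (r n)))
      (α (R1 * 2 ^ n) * PhS (r n) + k (R1 * 2 ^ n) * phi (r n))
    rw [abs_neg] at t1
    have t2 := abs_add_le (α (R1 * 2 ^ n) * PhS (r n)) (k (R1 * 2 ^ n) * phi (r n))
    rw [abs_mul, abs_mul] at t2
    have a1 : |α (R1 * 2 ^ n)| ≤ |α R1| + n * (C * √E) := by linarith [abs_sub_abs_le_abs_sub (α (R1 * 2 ^ n)) (α R1)]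
    have a2 : |k (R1 * 2 ^ n)| ≤ (|k R1| + C * R1 ^ 2 * √E) * 4 ^ n := by nlinarith [abs_sub_abs_le_abs_sub (k (R1 * 2 ^ n)) (k R1), mul_le_l h41 (abs_nonneg (k R1))]
    have c1 := mul_le_mul a1 b2 pos! pos!
    have c2 := mul_le_mul a2 le_rfl (pos! : 0 ≤ |phi (r n)| * 4 ^ n) pos!
    have c3 := mul_le_l b3 (pos! : 0 ≤ |k R1| + C * R1 ^ 2 * √E)
    have c4 := mul_le_r (t1.trans (add_le_add_right t2 _)) (pos! : (0 : ℝ) ≤ 4 ^ n)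
    refine c4.trans ?_
    linarith
  have hG : Tendsto (fun n => Gam (r n)) atTop (𝓝 (1 / 4)) := Gam_lim.comp hrt
  have := ((hz.add (hc.comp hrt)).div hG (by norm_num))
  rw [show (0 + c) / (1 / 4) = 4 * c by ring] at this
  refine this.congr' ?_
  filter_upwards [hG.eventually_ne (by norm_num : (1 / 4 : ℝ) ≠ 0)] with n hn
  simp only [Pi.div_apply, Function.comp_apply]
  field_simp
  ring

lemma Shells.gap_in (h : Shells s C E α δ k l) {B : ℝ} (hB : ∀ r, 0 < r → r ≤ 1 → |s.u 0 r| ≤ B) : Tendsto (fun n : ℕ => l (R1 / 2 ^ n)) atTop (𝓝 (α R1 * Iout 0)) := by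
  have hR := R1_ge
  have hX := X0_lt
  have hX0 := X0_pos
  have hC := h.hC
  obtain ⟨A, hA0, hA⟩ := bounds_in 1
  obtain ⟨c0, hc0, -, hG⟩ := phi_lower
  have hB0 : 0 ≤ B := (abs_nonneg _).trans (hB 1 one_pos le_rfl)
  choose r hr e using fun n : ℕ => h.pt (pos! : 0 < R1 / 2 ^ n)
  have hrt : Tendsto (fun n : ℕ => R1 / 2 ^ n) atTop (𝓝 0) := tendsto_const_nhds.div_atTop (tendsto_pow_atTop_atTop_of_one_lt one_lt_two)
  refine tendsto_iff_norm_sub_tendsto_zero.2 (squeeze_zero' (Eventually.of_forall fun n => norm_nonneg _) ?_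
    (poly_div_four (4096 * R1 ^ 4 * (B + C * √E + A * |α R1| + |k R1| + 4 * C / R1 ^ 2 * √E) / c0) (4096 * R1 ^ 4 * (A * (C * √E)) / c0)))
  filter_upwards [hrt.eventually (gt_mem_nhds hX0)] with n hn
  obtain ⟨o1, o2, -⟩ := h.inn n
  obtain ⟨z, hz⟩ : ∃ z, z = R1 / 2 ^ n := ⟨_, rfl⟩
  have hz2 : z ^ 2 * 4 ^ n = R1 ^ 2 := by rw [hz, div_pow, show (4 : ℝ) ^ n = (2 ^ n) ^ 2 by rw [← pow_mul, mul_comm, pow_mul]; norm_num]; field_simp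
  have hz0 : 0 < z := by rw [hz]; positivity
  have hr := hr n
  have e := e n
  rw [← hz] at o1 o2 hr e hn ⊢
  generalize r n = x at hr e
  have hx : 0 < x := by linarith [hr.1]
  have hx1 : x ≤ 1 := by linarith [hr.2]
  obtain ⟨-, -, h1, -, h2, -⟩ := hA x hx hx1
  have h3 := hG x hx (by linarith [hr.2]) x ⟨le_rfl, lin!⟩
  rw [norm_eq_abs, le_div_iff₀ pos!]
  have hα : α z = α R1 := h.αc z lin!
  obtain ⟨v, hv⟩ : ∃ v, v = s.u 0 x - pro (α z) (δ z) (k z) (l z) x := ⟨_, rfl⟩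
  rw [← hv] at e
  have hid : (l z - α R1 * Iout 0) * Gam x = (s.u 0 x - v) - ((α R1 * (PhS x + Iout 0 * Gam x) + δ z * ThS x) + k z * phi x) := by rw [hv, pro, hα]; ring
  have t0 : |l z - α R1 * Iout 0| * Gam x ≤ B + |v| + (|α R1| * A + |δ z| * |ThS x| + |k z|) := by
    rw [← abs_of_nonneg (a := Gam x) (by nlinarith [pow_pos hx 4]), ← abs_mul, hid]
    refine (abs_sub _ _).trans (add_le_add ((abs_sub _ _).trans (add_le_add (hB x hx hx1) le_rfl))
      ((abs_add_le _ _).trans (add_le_add ((abs_add_le _ _).trans ?_) ?_))) <;> simp only [abs_mul]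
    · gcongr
    · exact mul_le_of_le_one_right (abs_nonneg _) phi_small
  have hw : (0 : ℝ) < 4 ^ n := pos!
  generalize (4 : ℝ) ^ n = w at *
  have hx2 : w * x ^ 2 ≤ 64 * R1 ^ 2 := by
    rw [← hz2]
    nlinarith [pow_le_l hx.le hr.2 2]
  have hzz : z ^ 2 ≤ R1 ^ 2 := pow_le_l hz0.le lin! 2
  have hR2 : 1 ≤ R1 ^ 2 := by nlinarith
  have f0 : w * x ^ 4 ≤ 4096 * R1 ^ 2 * z ^ 2 := by
    have := mul_le_mul hx2 (pow_le_l hx.le hr.2 2) pos! pos!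
    linarith
  have f1 : w * x ^ 4 ≤ 4096 * R1 ^ 4 := f0.trans (by linarith [mul_le_l hzz (pos! : 0 ≤ 4096 * R1 ^ 2)])
  have hR4 : 64 * R1 ^ 2 ≤ 4096 * R1 ^ 4 := by nlinarith
  have g1 : w * x ^ 4 * |v| ≤ 4096 * R1 ^ 4 * (C * √E) := by
    have i1 := mul_le_r f0 (abs_nonneg v)
    have i2 := mul_le_l e (pos! : 0 ≤ 4096 * R1 ^ 2)
    have i3 := mul_le_r hR2 (pos! : 0 ≤ 4096 * R1 ^ 2 * (C * √E))
    linarith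
  have g2 : w * x ^ 4 * (|δ z| * |ThS x|) ≤ 4096 * R1 ^ 4 * (A * (C * √E)) * n := by
    have i1 := mul_le_mul hx2 h2 pos! pos!
    have i2 := mul_le_mul i1 o1 (abs_nonneg _) pos!
    have i3 := mul_le_r hR4 (pos! : 0 ≤ A * (n * (C * √E)))
    linarith
  have g3 : w * x ^ 4 * |k z| ≤ 4096 * R1 ^ 4 * (|k R1| + 4 * C / R1 ^ 2 * √E) := by
    have i0 : |k z| ≤ |k R1| + 4 * C / R1 ^ 2 * √E * w := by linarith [abs_sub_abs_le_abs_sub (k z) (k R1)]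
    have i1 := mul_le_mul f0 i0 (abs_nonneg _) pos!
    refine i1.trans ?_
    have i2 : 4096 * R1 ^ 2 * z ^ 2 * (4 * C / R1 ^ 2 * √E * w) = 4096 * R1 ^ 4 * (4 * C / R1 ^ 2 * √E) := by rw [show R1 ^ 4 = R1 ^ 2 * R1 ^ 2 by ring, ← hz2]; ring
    have i3 : 4096 * R1 ^ 2 * z ^ 2 * |k R1| ≤ 4096 * R1 ^ 2 * R1 ^ 2 * |k R1| := by gcongr
    linarith
  have j := mul_le_l t0 (pos! : 0 ≤ w * x ^ 4)
  have j2 := mul_le_r f1 (pos! : 0 ≤ B + |α R1| * A)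
  have j3 := mul_le_l h3 (pos! : 0 ≤ |l z - α R1 * Iout 0| * w)
  rw [show (4096 * R1 ^ 4 * (B + C * √E + A * |α R1| + |k R1| + 4 * C / R1 ^ 2 * √E) / c0 +
    4096 * R1 ^ 4 * (A * (C * √E)) / c0 * n) = (4096 * R1 ^ 4 * (B + C * √E + A * |α R1| + |k R1| + 4 * C / R1 ^ 2 * √E) +
    4096 * R1 ^ 4 * (A * (C * √E)) * n) / c0 by ring, le_div_iff₀ hc0]
  linarith

lemma Iout_zero_pos : 0 < Iout 0 := by
  unfold Iout
  norm_num

lemma Shells.coefs (h : Shells s C E α δ k l) {B : ℝ} (hB : ∀ r, 0 < r → r ≤ 1 → |s.u 0 r| ≤ B) (hc : Tendsto (s.u 0) atTop (𝓝 c)) (hc' : |c| ≤ 512 * √E) :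
    |α R1| ≤ (2 * C + 2048 + C * R1 ^ 2 / 2) / Iout 0 * √E ∧ (∀ n : ℕ, |l (R1 * 2 ^ n)| ≤ (2 * C + 2048) * √E) ∧
    ∀ n : ℕ, |l (R1 / 2 ^ n) - α R1 * Iout 0| ≤ C * R1 ^ 2 / 2 * √E / 4 ^ n := by
  have hI := Iout_zero_pos
  have hC := h.hC
  have hR := R1_ge
  have h2 : ∀ n : ℕ, |l (R1 * 2 ^ n)| ≤ (2 * C + 2048) * √E := fun n => by
    have := geom_down (fun n => (h.out n).2.2) (h.lim_out hc) n
    have h4 : (1 : ℝ) ≤ 4 ^ n := one_le_pow₀ (by norm_num)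
    have h5 : 2 * (C / R1 ^ 2 * √E) / 4 ^ n ≤ 2 * (C * √E) := by
      refine (div_le_self pos! h4).trans ?_
      gcongr
      exact div_le_self lin! (by nlinarith)
    have h6 : |4 * c| = 4 * |c| := by rw [abs_mul]; norm_num
    linarith [abs_sub_abs_le_abs_sub (l (R1 * 2 ^ n)) (4 * c)]
  have h3 : ∀ n : ℕ, |l (R1 / 2 ^ n) - α R1 * Iout 0| ≤ C * R1 ^ 2 / 2 * √E / 4 ^ n := fun n => (geom_down (fun n => (h.inn n).2.2) (h.gap_in hB) n).trans_eq (by ring)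
  refine ⟨?_, h2, h3⟩
  have e1 := h2 0
  have e2 := h3 0
  rw [pow_zero, mul_one] at e1
  simp only [pow_zero, div_one] at e2
  rw [abs_sub_comm] at e2
  rw [div_mul_eq_mul_div, le_div_iff₀ hI, ← abs_of_pos hI, ← abs_mul]
  linarith [abs_sub_abs_le_abs_sub (α R1 * Iout 0) (l R1)]

lemma shell_add {f g : ℝ → ℝ} {y D M : ℝ} (hy : 0 < y) (hf : ContinuousOn f (Icc (2 * y) (8 * y)))
    (hg : ContinuousOn g (Icc (2 * y) (8 * y))) (h : ∫ r in 2 * y..(8 * y), r ^ 5 * f r ^ 2 ≤ D)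
    (hM : ∀ r ∈ Icc (2 * y) (8 * y), r ^ 3 * |g r| ≤ M) :
    ∫ r in 2 * y..(8 * y), r ^ 5 * (f r + g r) ^ 2 ≤ 2 * D + 6 * M ^ 2 := by
  have := int_le_lin (lin! : 2 * y ≤ 8 * y) 2 1 (A := fun r => r ^ 5 * (f r + g r) ^ 2)
    (f := fun r => r ^ 5 * f r ^ 2) (g := fun _ => M ^ 2 / y) con! con! con! (fun r hr => by
      have hr0 : 0 < r := by linarith [hr.1]
      have h1 := pow_le_l pos! (hM r hr) 2
      rw [mul_pow, sq_abs] at h1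
      have h2 : r ^ 5 * g r ^ 2 ≤ M ^ 2 / (2 * y) := by
        rw [le_div_iff₀ pos!]
        refine le_trans ?_ h1
        have := mul_le_l hr.1 (pos! : 0 ≤ r ^ 5 * g r ^ 2)
        linarith
      have h3 : M ^ 2 / y = 2 * (M ^ 2 / (2 * y)) := by field_simp
      have h5 : 0 ≤ r ^ 5 * (f r - g r) ^ 2 := pos!
      simp only [h3]
      linarith)
  rw [ii_const, show (8 * y - 2 * y) * (M ^ 2 / y) = 6 * M ^ 2 by field_simp; ring] at this
  linarith

lemma shells_final (C : ℝ) : ∃ K, 0 ≤ K ∧ ∀ (s : Sol) (E c B : ℝ) (α δ k l : ℝ → ℝ), Shells s C E α δ k l →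
    (∀ r, 0 < r → r ≤ 1 → |s.u 0 r| ≤ B) → Tendsto (s.u 0) atTop (𝓝 c) → |c| ≤ 512 * √E → ∀ n : ℕ,
    ∀ y, (y = R1 * 2 ^ n ∨ y = R1 / 2 ^ n) →
    ∫ r in 2 * y..(8 * y), r ^ 5 * (s.b 0 r - k R1 * phi1 r) ^ 2 ≤ K * (1 + n) ^ 2 * E := by
  have hR := R1_ge
  have hX := X0_lt
  by_cases hC : 1 ≤ C
  swap
  · exact ⟨0, le_rfl, fun s E c B α δ k l h => absurd h.hC hC⟩
  obtain ⟨A, hA0, hA⟩ := PhS_bound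
  obtain ⟨G, hG0, hG⟩ := Gam_bound_out
  obtain ⟨I, hI0, hI⟩ := bounds_in (8 * R1)
  obtain ⟨K0, hK0⟩ : ∃ K0, K0 = (2 * C + 2048 + C * R1 ^ 2 / 2) / Iout 0 := ⟨_, rfl⟩
  have hK00 : 0 ≤ K0 := by rw [hK0]; have := Iout_zero_pos; positivity
  obtain ⟨N, hN⟩ : ∃ N, N = K0 * A + C * A + 2 * C + (2 * C + 2048) * G + (K0 * (512 * R1 ^ 3 * I) + C * I + 16384 * C * R1 ^ 2 + C * I) := ⟨_, rfl⟩
  refine ⟨2 * C + 6 * N ^ 2, pos!, fun s E c B α δ k l h hB hc hc' n y hy => ?_⟩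
  obtain ⟨a0, l0, l1⟩ := h.coefs hB hc hc'
  rw [← hK0] at a0
  have hE := h.hE
  have hy0 : 0 < y := by rcases hy with rfl | rfl <;> positivity
  have hq := sqrt_nonneg E
  have key : ∀ r ∈ Icc (2 * y) (8 * y), r ^ 3 * |pro1 (α y) (δ y) (k y) (l y) r - k R1 * phi1 r| ≤ N * (1 + n) * √E := by
    intro r hr
    have hr0 : 0 < r := by linarith [hr.1]
    have p1 := phi1_bound hr0
    obtain ⟨p, hp⟩ : ∃ p, p = (1 + n) * √E := ⟨_, rfl⟩
    have hqp : √E ≤ p := by rw [hp]; nlinarith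
    have hnp : n * (C * √E) ≤ C * p := by rw [hp]; nlinarith
    have hp0 : 0 ≤ p := hq.trans hqp
    have ha : |α R1| ≤ K0 * p := a0.trans (by gcongr)
    have h4 : ((2 : ℝ) ^ n) ^ 2 = 4 ^ n := by rw [← pow_mul, mul_comm, pow_mul]; norm_num
    rw [mul_assoc, ← hp, ← abs_of_pos (pow_pos hr0 3), ← abs_mul]
    have hr2 : 4 * y ^ 2 ≤ r ^ 2 := by nlinarith [pow_le_l lin! hr.1 2]
    rcases hy with rfl | rfl
    · obtain ⟨o1, o2, -⟩ := h.out n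
      have hyR : R1 ≤ R1 * 2 ^ n := le_mul_of_one_le_right lin! (one_le_pow₀ (by norm_num))
      have hr1 : 1 ≤ r := by linarith [hr.1]
      rw [show r ^ 3 * (pro1 (α (R1 * 2 ^ n)) (δ (R1 * 2 ^ n)) (k (R1 * 2 ^ n)) (l (R1 * 2 ^ n)) r - k R1 * phi1 r) =
        α (R1 * 2 ^ n) * (r ^ 3 * PhS1 r) + (k (R1 * 2 ^ n) - k R1) * (r ^ 3 * phi1 r) + l (R1 * 2 ^ n) * (r ^ 3 * Gam1 r) by
        rw [pro1, h.δ0 _ lin!]; ring]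
      refine (abs_add_le _ _).trans ((add_le_add_left (abs_add_le _ _) _).trans ?_)
      simp only [abs_mul, abs_of_pos (pow_pos hr0 3)]
      have t1 := mul_le_mul (by linarith [abs_sub_abs_le_abs_sub (α (R1 * 2 ^ n)) (α R1)] : |α (R1 * 2 ^ n)| ≤ (K0 + C) * p) (hA r hr1).2 pos! pos!
      have t3 := mul_le_mul ((l0 n).trans (mul_le_l hqp pos!)) (hG r hr1).2 pos! pos!
      have t2 : |k (R1 * 2 ^ n) - k R1| * (r ^ 3 * |phi1 r|) ≤ 2 * C * p := by
        rw [mul_assoc (C * _), mul_comm √E, ← mul_assoc, mul_assoc C, ← h4, ← mul_pow] at o2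
        have i1 := mul_le_r hr2 (pos! : 0 ≤ r ^ 3 * |phi1 r|)
        have i2 := mul_le_r o2 (pos! : 0 ≤ r ^ 3 * |phi1 r|)
        have i3 : (R1 * 2 ^ n) ^ 2 * (r ^ 3 * |phi1 r|) ≤ 2 := lin!
        have i4 := mul_le_l i3 (pos! : 0 ≤ C * √E)
        have i5 := mul_le_l hqp (pos! : 0 ≤ 2 * C)
        linarith
      have : 0 ≤ (K0 * (512 * R1 ^ 3 * I) + C * I + 16384 * C * R1 ^ 2 + C * I) * p := pos!
      rw [hN]
      linarith
    · obtain ⟨o1, o2, -⟩ := h.inn n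
      have hyR : R1 / 2 ^ n ≤ R1 := div_le_self lin! (one_le_pow₀ (by norm_num))
      have hr1 : r ≤ 8 * R1 := by linarith [hr.2]
      obtain ⟨-, g1, -, g2, -, g3⟩ := hI r hr0 hr1
      have hz : 4 ^ n * (R1 / 2 ^ n) ^ 2 = R1 ^ 2 := by rw [div_pow, h4]; field_simp
      rw [show r ^ 3 * (pro1 (α (R1 / 2 ^ n)) (δ (R1 / 2 ^ n)) (k (R1 / 2 ^ n)) (l (R1 / 2 ^ n)) r - k R1 * phi1 r) =
        α R1 * (r ^ 3 * (PhS1 r + Iout 0 * Gam1 r)) + δ (R1 / 2 ^ n) * (r ^ 3 * ThS1 r) + (k (R1 / 2 ^ n) - k R1) * (r ^ 3 * phi1 r)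
          + (l (R1 / 2 ^ n) - α R1 * Iout 0) * (r ^ 3 * Gam1 r) by
        rw [pro1, h.αc _ hyR]; ring]
      refine (abs_add_le _ _).trans ((add_le_add_left ((abs_add_le _ _).trans (add_le_add_left (abs_add_le _ _) _)) _).trans ?_)
      simp only [abs_mul, abs_of_pos (pow_pos hr0 3)]
      have t1 := mul_le_mul ha (mul_le_mul (pow_le_l hr0.le hr1 3) g2 (abs_nonneg _) pos!) pos! pos!
      have t2 := mul_le_mul (o1.trans hnp) g3 pos! pos!
      have hl := l1 n
      rw [← hz] at o2
      generalize R1 / 2 ^ n = y at *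
      have hw : (0 : ℝ) < 4 ^ n := pos!
      generalize (4 : ℝ) ^ n = w at *
      have t3 : |k y - k R1| * (r ^ 3 * |phi1 r|) ≤ 16384 * C * R1 ^ 2 * p := by
        have i1 : r ^ 3 * |phi1 r| ≤ 64 * y ^ 2 * (64 * R1 ^ 2) := by
          refine (mul_le_l (phi1_small hr0) pos!).trans ?_
          have := mul_le_mul (pow_le_l hr0.le hr.2 2) (pow_le_l hr0.le hr1 2) pos! pos!
          linarith
        refine (mul_le_mul o2 i1 pos! pos!).trans ?_
        rw [show 4 * C / (w * y ^ 2) * √E * w * (64 * y ^ 2 * (64 * R1 ^ 2)) = 16384 * C * R1 ^ 2 * √E by field_simp; ring]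
        gcongr
      have t4 : |l y - α R1 * Iout 0| * (r ^ 3 * |Gam1 r|) ≤ C * I * p := by
        rw [show C * R1 ^ 2 / 2 * √E / w = C / 2 * √E * y ^ 2 by rw [← hz]; field_simp] at hl
        have i1 := mul_le_mul hl le_rfl (pos! : 0 ≤ r ^ 3 * |Gam1 r|) pos!
        have i2 := mul_le_r hr2 (pos! : 0 ≤ r ^ 3 * |Gam1 r|)
        have i3 : y ^ 2 * (r ^ 3 * |Gam1 r|) ≤ 2 * I := lin!
        have i4 := mul_le_l i3 (pos! : 0 ≤ C / 2 * √E)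
        have i5 := mul_le_l hqp (pos! : 0 ≤ C * I)
        linarith
      have : 0 ≤ (K0 * A + C * A + 2 * C + (2 * C + 2048) * G) * p := pos!
      rw [hN]
      linarith
  have := shell_add hy0 (f := fun r => s.b 0 r - pro1 (α y) (δ y) (k y) (l y) r) (g := fun r => pro1 (α y) (δ y) (k y) (l y) r - k R1 * phi1 r)
    (((s.cb 0).mono (Icc_pos (b := 8 * y) (lin! : 0 < 2 * y))).sub (cpro1 _ _ _ _ lin!))
    ((cpro1 _ _ _ _ lin!).sub (continuousOn_const.mul cphi1.continuousOn)) (h.eb y hy0) key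
  simp only [sub_add_sub_cancel] at this
  refine this.trans ?_
  rw [mul_pow, mul_pow, sq_sqrt hE.le]
  have : 1 ≤ (1 + (n : ℝ)) ^ 2 := one_le_pow₀ (by linarith [n.cast_nonneg (α := ℝ)])
  nlinarith [mul_le_l this (pos! : 0 ≤ C * E)]

lemma odd_final : ∃ K, 0 ≤ K ∧ ∀ s : Sol, (∀ r, 0 < r → s.u 0 r = 0 ∧ s.b 0 r = 0) → FE s → ∀ B : ℝ,
    (∀ r, 0 < r → r ≤ 1 → |s.a 0 r| ≤ B) → ∀ E, 0 < E → (∀ ρ, 0 < ρ → Late s ρ E) →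
    ∃ b : ℝ, ∀ x Y, 0 < x → x ≤ Y → ∫ r in x..Y, r ^ 5 * (s.a 0 r - b * phi r) ^ 2 ≤ K * E := by
  obtain ⟨C, hC0, hC⟩ := odd_main
  obtain ⟨c0, hc0, -, hG⟩ := phi_lower
  obtain ⟨I, hI0, hI⟩ := Iin_bound
  have hR := R1_ge
  have hX := X0_lt
  have hX0 := X0_pos
  refine ⟨C + 2 * C + 4 * I * C / c0 ^ 2 + 1, pos!, fun s h0 hF B hB E hE hL => ?_⟩
  obtain ⟨β, hβ⟩ := hC s h0 hF
  obtain ⟨f, hf⟩ : ∃ f : ℝ → ℝ, f = fun r => s.a 0 r - β R1 * phi r := ⟨_, rfl⟩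
  have cf : ContinuousOn f (Ioi 0) := by rw [hf]; exact (s.ca 0).sub (continuousOn_const.mul cphi.continuousOn)
  have cF : ∀ {p q : ℝ}, 0 < p → ContinuousOn (fun r => r ^ 5 * f r ^ 2) (Icc p q) := fun {p q} hp => by
    have := cf.icc hp q
    fun_prop
  have cG : ∀ {p q : ℝ}, 0 < p → ContinuousOn (fun r => r ^ 5 * Gam r ^ 2) (Icc p q) := fun {p q} hp => by
    have := cGam.icc hp q
    fun_prop
  have nF : ∀ {p q : ℝ}, 0 < p → ∀ r ∈ Icc p q, 0 ≤ r ^ 5 * f r ^ 2 := fun hp r hr => by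
    have : 0 < r := hp.trans_le hr.1
    positivity
  obtain ⟨D, hD⟩ : ∃ D, D = (B + |β R1|) ^ 2 := ⟨_, rfl⟩
  have hfB : ∀ r, 0 < r → r ≤ 1 → f r ^ 2 ≤ D := fun r h1 h2 => by
    rw [hD, hf, sq_le_sq, abs_of_nonneg (a := B + _) (by linarith [abs_nonneg (β R1), (abs_nonneg _).trans (hB r h1 h2)])]
    refine (abs_sub _ _).trans (add_le_add (hB r h1 h2) ?_)
    rw [abs_mul]
    exact mul_le_of_le_one_right (abs_nonneg _) phi_small
  have key : ∀ ρ, 0 < ρ → ρ ≤ X0 → ∫ r in ρ..16 * X0, r ^ 5 * f r ^ 2 ≤ (2 * C + 4 * I * C / c0 ^ 2) * E + 128 * I * D / c0 ^ 2 * ρ := by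
    intro ρ hρ hρX
    obtain ⟨γ, -, hγ⟩ := (hβ ρ E hρ hE (hL ρ hρ)).2 hρX
    have ch : ∀ q, ContinuousOn (fun r => r ^ 5 * (s.a 0 r - β R1 * phi r - γ * Gam r) ^ 2) (Icc ρ q) := fun q => by
      have h1 := (s.ca 0).icc hρ q
      have h2 := cGam.icc hρ q
      have h3 := cphi.continuousOn (s := Icc ρ q)
      fun_prop
    have nh : ∀ q, ∀ r ∈ Icc ρ q, 0 ≤ r ^ 5 * (s.a 0 r - β R1 * phi r - γ * Gam r) ^ 2 := fun q r hr => by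
      have : 0 < r := hρ.trans_le hr.1
      positivity
    have e1 := int_le_lin (lin! : ρ ≤ 16 * X0) 2 (2 * γ ^ 2) (cF hρ) (ch _) (cG hρ) (fun r hr => by
      have : 0 < r := hρ.trans_le hr.1
      have : 0 ≤ r ^ 5 * (s.a 0 r - β R1 * phi r - γ * Gam r - γ * Gam r) ^ 2 := pos!
      simp only [hf]
      linarith)
    have e2 : ∫ r in ρ..2 * ρ, r ^ 5 * (s.a 0 r - β R1 * phi r - γ * Gam r) ^ 2 ≤ C * E := (int_mono_set le_rfl lin! lin! (ch _) (nh _)).trans hγ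
    have e3 := int_le_lin (lin! : ρ ≤ 2 * ρ) 2 1 (A := fun _ => γ ^ 2 * (c0 ^ 2 / ρ ^ 3)) con! (ch _) (g := fun _ => 2 * ((2 * ρ) ^ 5 * D)) con! (fun r hr => by
      have hr0 : 0 < r := hρ.trans_le hr.1
      have h1 := hG ρ hρ lin! r hr
      have h2 := pow_le_l hρ.le hr.1 5
      have h3 : c0 ^ 2 / ρ ^ 3 ≤ r ^ 5 * Gam r ^ 2 := by
        rw [div_le_iff₀ pos!]
        have := mul_le_mul h2 (pow_le_l hc0.le h1 2) pos! pos!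
        refine le_of_mul_le_mul_left (this.trans_eq ?_) (pow_pos hρ 5)
        ring
      have h4 := mul_le_mul (pow_le_l hr0.le hr.2 5) (hfB r hr0 (by linarith [hr.2])) (sq_nonneg _) pos!
      have h5 := mul_le_l h3 (sq_nonneg γ)
      have h6 : 0 ≤ r ^ 5 * (s.a 0 r - β R1 * phi r - γ * Gam r + (s.a 0 r - β R1 * phi r)) ^ 2 := pos!
      simp only [hf] at h4
      linarith)
    rw [intervalIntegral.integral_const, ii_const, smul_eq_mul, show (2 * ρ - ρ) * (γ ^ 2 * (c0 ^ 2 / ρ ^ 3)) = γ ^ 2 / ρ ^ 2 * c0 ^ 2 by field_simp; ring] at e3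
    have e4 : ∫ r in ρ..16 * X0, r ^ 5 * Gam r ^ 2 ≤ I / ρ ^ 2 := ((int_mono_set le_rfl lin! hX.le (cG hρ) (fun r hr => by
        have : 0 < r := hρ.trans_le hr.1
        positivity)).trans (le_abs_self _)).trans (hI ρ hρ lin!)
    have e5 : γ ^ 2 / ρ ^ 2 ≤ (2 * (C * E) + 64 * ρ * D) / c0 ^ 2 := by
      rw [le_div_iff₀ pos!]
      have : ρ ^ 6 * D ≤ ρ * D := mul_le_r (pow_le_of_le_one hρ.le lin! (by norm_num)) (by rw [hD]; positivity)
      linarith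
    have e6 := mul_le_l e4 (pos! : 0 ≤ 2 * γ ^ 2)
    have e7 := mul_le_l e5 (pos! : 0 ≤ 2 * I)
    have e8 : 2 * γ ^ 2 * (I / ρ ^ 2) = 2 * I * (γ ^ 2 / ρ ^ 2) := by ring
    have e9 : 2 * I * ((2 * (C * E) + 64 * ρ * D) / c0 ^ 2) = 4 * I * C / c0 ^ 2 * E + 128 * I * D / c0 ^ 2 * ρ := by ring
    linarith
  refine ⟨β R1, fun x Y hx hxY => ?_⟩
  obtain ⟨ρ, hρ, hρ1, hρ2⟩ : ∃ ρ, 0 < ρ ∧ ρ ≤ min x X0 ∧ 128 * I * D / c0 ^ 2 * ρ ≤ E := by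
    have hT : 0 ≤ 128 * I * D / c0 ^ 2 := by rw [hD]; positivity
    generalize 128 * I * D / c0 ^ 2 = T at hT
    refine ⟨min (min x X0) (E / (T + 1)), pos!, min_le_left _ _, ?_⟩
    refine (mul_le_l (min_le_right _ _) hT).trans ?_
    rw [mul_div_assoc', div_le_iff₀ pos!]
    nlinarith
  have hρx := hρ1.trans (min_le_left _ _)
  have hρX := hρ1.trans (min_le_right _ _)
  have k1 := key ρ hρ hρX
  have k2 := (hβ ρ E hρ hE (hL ρ hρ)).1 (max Y R1) (by rw [max_eq_right lin!]; exact le_max_right _ _)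
  rw [max_eq_right (lin! : ρ ≤ R1), max_eq_right hρX] at k2
  have k3 := int_mono_set hρx hxY (le_max_left Y R1) (cF (q := max Y R1) hρ) (nF hρ)
  have hm := le_max_right Y R1
  rw [← int_sub hρX lin! (cF hρ)] at k3
  have k4 := int_mono_set le_rfl hρX (lin! : X0 ≤ 16 * X0) (cF hρ) (nF hρ)
  simp only [hf] at k1 k2 k3 k4
  linarith

lemma dyadic {R : ℝ} (hR : 0 < R) : ∃ (n : ℕ) (y : ℝ), (y = R1 * 2 ^ n ∨ y = R1 / 2 ^ n) ∧ 2 * y ≤ R ∧ R ≤ 4 * y ∧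
    1 + (n : ℝ) ≤ (4 + 2 * Real.log (2 * R1)) * (1 + |Real.log R|) := by
  have h1 := R1_ge
  have hl : 0 ≤ Real.log (2 * R1) := Real.log_nonneg lin!
  have hp : ∀ (n : ℕ) (x : ℝ), 2 ^ n ≤ x → (n : ℝ) ≤ 2 * Real.log x := fun n x h => by
    have := Real.log_le_log pos! h
    rw [Real.log_pow] at this
    nlinarith [Real.log_two_gt_d9, n.cast_nonneg (α := ℝ)]
  rcases le_total (2 * R1) R with h | h
  · obtain ⟨n, h3, h4⟩ := exists_nat_pow_near ((one_le_div lin!).2 h) one_lt_two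
    have h5 := hp n _ h3
    rw [Real.log_div hR.ne' lin!] at h5
    rw [le_div_iff₀ lin!] at h3
    rw [div_lt_iff₀ lin!, pow_succ] at h4
    exact ⟨n, _, Or.inl rfl, lin!, lin!, by nlinarith [le_abs_self (Real.log R), mul_nonneg hl (abs_nonneg (Real.log R))]⟩
  · obtain ⟨n, h3, h4⟩ := exists_nat_pow_near ((one_le_div hR).2 h) one_lt_two
    have h5 := hp n _ h3
    rw [Real.log_div lin! hR.ne'] at h5
    rw [le_div_iff₀ hR] at h3
    rw [div_lt_iff₀ hR, pow_succ] at h4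
    refine ⟨n + 1, _, Or.inr rfl, ?_, ?_, ?_⟩
    · rw [mul_div_assoc', div_le_iff₀ pos!, pow_succ]; linarith
    · rw [mul_div_assoc', le_div_iff₀ pos!, pow_succ]; linarith
    · push_cast
      nlinarith [neg_abs_le (Real.log R), mul_nonneg hl (abs_nonneg (Real.log R))]

theorem radial_main : ∃ K, 0 ≤ K ∧ ∀ s : Sol, FE s → ∀ B : ℝ, (∀ r, 0 < r → r ≤ 1 → |s.u 0 r| ≤ B ∧ |s.a 0 r| ≤ B) → ∀ E, 0 < E →
    (∀ ρ, 0 ≤ ρ → Late s ρ E ∧ Late (s.shift (-1) 0 (by norm_num)) ρ E) → ∃ b κ : ℝ,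
    (∀ x Y, 0 < x → x ≤ Y → ∫ r in x..Y, r ^ 5 * (s.a 0 r - b * phi r) ^ 2 ≤ K * E) ∧
    ∀ R, 0 < R → ∫ r in R..2 * R, r ^ 5 * (s.b 0 r - κ * phi1 r) ^ 2 ≤ K * (1 + Real.log R ^ 2) * E := by
  obtain ⟨K, hK0, hK⟩ := odd_final
  obtain ⟨C, hC1, hC⟩ := even_shells
  obtain ⟨G, hG0, hG⟩ := shells_final C
  obtain ⟨T, hT⟩ : ∃ T, T = 4 + 2 * Real.log (2 * R1) := ⟨_, rfl⟩
  refine ⟨K + 2 * G * T ^ 2, pos!, fun s hF B hB E hE hL => ?_⟩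
  obtain ⟨s', hs⟩ : ∃ s', s' = s.shift (-1) 0 (by norm_num) := ⟨_, rfl⟩
  rw [← hs] at hL
  have hF' : FE s' := hs ▸ hF.shift (by norm_num)
  have v : ∀ t r, s'.u t r = s.u (-t) r ∧ s'.a t r = -s.a (-t) r ∧ s'.b t r = s.b (-t) r := fun t r => by subst hs; simp [Sol.shift]
  have hl : ∀ (y : ℝ), y ^ 2 = 1 / 4 → ∀ ρ, 0 ≤ ρ → Late (Sol.lin (1 / 2) s y s') ρ E := fun y hy ρ hρ => by
    obtain ⟨T1, h1⟩ := (hL ρ hρ).1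
    obtain ⟨T2, h2⟩ := (hL ρ hρ).2
    refine ⟨max (max T1 T2) 1, fun t ht => ?_⟩
    have := EB.lin (by linarith [le_max_right (max T1 T2) 1]) (h1 t ((le_max_left _ _).trans ((le_max_left _ _).trans ht)))
      (h2 t ((le_max_right _ _).trans ((le_max_left _ _).trans ht))) (1 / 2) y
    rw [hy] at this
    convert this using 1
    ring
  obtain ⟨b, hb⟩ := hK (Sol.lin (1 / 2) s (-1 / 2) s') (fun r hr => by constructor <;> simp [Sol.lin, v] <;> ring) (hF.lin hF' _ _) B (fun r h h1 => by
      have : (Sol.lin (1 / 2) s (-1 / 2) s').a 0 r = s.a 0 r := by simp [Sol.lin, v]; ring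
      rw [this]; exact (hB r h h1).2) E hE (fun ρ h => hl _ (by norm_num) ρ h.le)
  have hFe := hF.lin hF' (1 / 2) (1 / 2)
  have hle := hl (1 / 2) (by norm_num)
  obtain ⟨α, δ, k, l, S⟩ := hC (Sol.lin (1 / 2) s (1 / 2) s')
    ⟨fun t r _ => by simp [Sol.lin, v, add_comm], fun t r _ => by simp [Sol.lin, v], fun t r _ => by simp [Sol.lin, v, add_comm]⟩
    hFe E hE hle
  obtain ⟨c, hc⟩ := hFe.lim_u
  have hS := hG _ E c B α δ k l S (fun r h h1 => by
    have : (Sol.lin (1 / 2) s (1 / 2) s').u 0 r = s.u 0 r := by simp [Sol.lin, v]; ring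
    rw [this]; exact (hB r h h1).1) (hc 0) (lim_small hE (hle 1 zero_le_one) hc)
  have hbb : (Sol.lin (1 / 2) s (1 / 2) s').b 0 = s.b 0 := by ext r; simp [Sol.lin, v]; ring
  have haa : (Sol.lin (1 / 2) s (-1 / 2) s').a 0 = s.a 0 := by ext r; simp [Sol.lin, v]; ring
  rw [haa] at hb
  rw [hbb] at hS
  refine ⟨b, k R1, fun x Y hx hxY => (hb x Y hx hxY).trans ?_, fun R hR => ?_⟩
  · gcongr; exact le_add_of_nonneg_right pos!
  · obtain ⟨n, y, hy, h1, h2, h3⟩ := dyadic hR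
    have hy0 : 0 < y := lin!
    rw [← hT] at h3
    have c1 := (s.cb 0).mono (Icc_pos (b := 8 * y) (lin! : 0 < 2 * y))
    refine (int_mono_set h1 lin! (lin! : 2 * R ≤ 8 * y) (by
      have := cphi1.continuousOn (s := Icc (2 * y) (8 * y))
      fun_prop) (fun r hr => by
      have : 0 < r := by linarith [hr.1]
      positivity)).trans ((hS n y hy).trans ?_)
    have h5 := pow_le_l pos! h3 2
    have h6 : (1 + |Real.log R|) ^ 2 ≤ 2 * (1 + Real.log R ^ 2) := by rw [← sq_abs (Real.log R)]; nlinarith [sq_nonneg (1 - |Real.log R|)]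
    have h7 := mul_le_l h6 (sq_nonneg T)
    refine mul_le_r ?_ hE.le
    linarith [mul_le_l (h5.trans_eq (mul_pow _ _ _) |>.trans h7) hG0, mul_nonneg hK0 (pos! : 0 ≤ 1 + Real.log R ^ 2)]

lemma energy_growth (s : Sol) {ρ T Y : ℝ} (hρ : 0 < ρ) (hT : 0 ≤ T) (hY : ρ + T + 1 ≤ Y) :
    ∫ r in ρ..Y - T - 1, r ^ 5 * (s.a T r ^ 2 + s.b T r ^ 2) ≤ exp ((1152 + 1 / ρ ^ 4) * T) *
      ((∫ r in ρ..Y, r ^ 5 * (s.a 0 r ^ 2 + s.b 0 r ^ 2) + s.u 0 r ^ 2 / r ^ 3) + ∫ t in (0:ℝ)..T, |2 * ρ ^ 5 * (s.a t ρ * s.b t ρ)|) := by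
  obtain ⟨C, hC⟩ : ∃ C, C = 1152 + 1 / ρ ^ 4 := ⟨_, rfl⟩
  obtain ⟨θ, hθ⟩ : ∃ θ : ℝ → ℝ, θ = Real.smoothTransition := ⟨_, rfl⟩
  obtain ⟨θ', hθ'⟩ : ∃ θ' : ℝ → ℝ, θ' = deriv θ := ⟨_, rfl⟩
  have cd : ContDiff ℝ 1 θ := hθ ▸ Real.smoothTransition.contDiff
  have dθ : ∀ x, HasDerivAt θ (θ' x) x := fun x => by rw [hθ']; exact (cd.differentiable (by norm_num) x).hasDerivAt
  have θ0 : ∀ x, 0 ≤ θ x ∧ θ x ≤ 1 := fun x => by rw [hθ]; exact ⟨Real.smoothTransition.nonneg x, Real.smoothTransition.le_one x⟩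
  have θ'0 : ∀ x, 0 ≤ θ' x := fun x => by rw [hθ', hθ]; exact Real.smoothTransition.monotone.deriv_nonneg
  have cθ : Continuous θ := cd.continuous
  have cθ' : Continuous θ' := hθ' ▸ cd.continuous_deriv le_rfl
  rw [← hC]
  obtain ⟨P, hP⟩ : ∃ P : ℝ → ℝ → ℝ, P = fun t r => exp (-(C * t)) * θ (Y - r - t) * (r ^ 5 * (s.a t r ^ 2 + s.b t r ^ 2) + s.u t r ^ 2 / r ^ 3) := ⟨_, rfl⟩
  obtain ⟨Pt, hPt⟩ : ∃ P : ℝ → ℝ → ℝ, P = fun t r => exp (-(C * t)) * ((-C * θ (Y - r - t) - θ' (Y - r - t)) *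
    (r ^ 5 * (s.a t r ^ 2 + s.b t r ^ 2) + s.u t r ^ 2 / r ^ 3) + θ (Y - r - t) *
    (r ^ 5 * (2 * s.a t r * s.aT t r + 2 * s.b t r * s.aR t r) + 2 * s.u t r * s.a t r / r ^ 3)) := ⟨_, rfl⟩
  obtain ⟨Q, hQ⟩ : ∃ P : ℝ → ℝ → ℝ, P = fun t r => exp (-(C * t)) * (θ (Y - r - t) * (2 * r ^ 5 * (s.a t r * s.b t r))) := ⟨_, rfl⟩
  obtain ⟨Qr, hQr⟩ : ∃ P : ℝ → ℝ → ℝ, P = fun t r => exp (-(C * t)) * (-θ' (Y - r - t) *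
    (2 * r ^ 5 * (s.a t r * s.b t r)) + θ (Y - r - t) * (10 * r ^ 4 * (s.a t r * s.b t r) +
    2 * r ^ 5 * (s.aR t r * s.b t r + s.a t r * s.bR t r))) := ⟨_, rfl⟩
  have dP : ∀ t r, 0 < r → HasDerivAt (fun t => P t r) (Pt t r) t := fun t r hr => by
    rw [hP, hPt]
    refine (((((hasDerivAt_id t).const_mul C).neg.exp).fun_mul ((dθ (Y - r - t)).comp t ((hasDerivAt_id t).const_sub (Y - r)))).fun_mul
      ((((s.ga.dt t hr).fun_pow 2).fun_add ((s.gb.dt t hr).fun_pow 2)).const_mul (r ^ 5) |>.fun_add (((s.gu.dt t hr).fun_pow 2).div_const (r ^ 3)))).congr_deriv ?_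
    simp
    ring
  have dQ : ∀ t r, 0 < r → HasDerivAt (Q t) (Qr t r) r := fun t r hr => by
    rw [hQ, hQr]
    refine ((((dθ (Y - r - t)).comp r (((hasDerivAt_id r).const_sub Y).sub_const t)).fun_mul
      ((((hasDerivAt_id r).fun_pow 5).const_mul 2).fun_mul ((s.ga.dr t hr).fun_mul (s.gb.dr t hr)))).const_mul _).congr_deriv ?_
    simp only [Nat.cast_ofNat, id, Function.comp_apply]
    ring
  have ca : CP (Ioi 0) s.a := s.ga.cp
  have cb : CP (Ioi 0) s.b := s.gb.cp
  have cu : CP (Ioi 0) s.u := s.gu.cp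
  have cT := s.cT
  have cR := s.cR
  have cB := s.cB
  have cPt : CP (Ioi 0) Pt := by
    rw [hPt]
    unfold CP at *
    have : ∀ z ∈ (univ ×ˢ Ioi 0 : Set (ℝ × ℝ)), z.2 ^ 3 ≠ 0 := fun z hz => pow_ne_zero _ hz.2.ne'
    fun_prop (disch := assumption)
  have cQr : CP (Ioi 0) Qr := by
    rw [hQr]
    unfold CP at *
    fun_prop
  have le : ∀ t r, ρ ≤ r → Pt t r ≤ Qr t r := fun t r hr => by
    have hr0 : 0 < r := hρ.trans_le hr
    rw [hPt, hQr]
    simp only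
    rw [s.pde t r hr0]
    refine mul_le_l ?_ (exp_pos _).le
    have h1 : |Vp r| * r ^ 4 ≤ 1152 := by
      rw [Vp, abs_div, abs_neg, abs_of_pos (by norm_num : (0 : ℝ) < 1152), abs_of_nonneg pos!, div_mul_eq_mul_div, div_le_iff₀ pos!]
      nlinarith [sq_nonneg r]
    have h2 : |-(Vp r) * r ^ 4 + 1 / r ^ 4| ≤ C := by
      rw [hC]
      refine (abs_add_le _ _).trans (add_le_add ?_ ?_)
      · rwa [abs_mul, abs_neg, abs_of_pos (pow_pos hr0 4)]
      · rw [abs_of_pos pos!]; gcongr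
    have h3 : |2 * (s.u t r * s.a t r) * r| ≤ r ^ 5 * (s.a t r ^ 2 + s.b t r ^ 2) + s.u t r ^ 2 / r ^ 3 := by
      have : r ^ 5 * s.a t r ^ 2 + s.u t r ^ 2 / r ^ 3 - |2 * (s.u t r * s.a t r) * r| = r ^ 5 * (|s.a t r| - |s.u t r| / r ^ 4) ^ 2 := by
        rw [abs_mul, abs_mul, abs_mul, abs_of_pos hr0, ← sq_abs (s.a t r), ← sq_abs (s.u t r), abs_two]; field_simp; ring
      have : 0 ≤ r ^ 5 * (|s.a t r| - |s.u t r| / r ^ 4) ^ 2 := pos!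
      have : 0 ≤ r ^ 5 * s.b t r ^ 2 := pos!
      linarith
    have h4 := (le_abs_self _).trans ((abs_mul _ _).le.trans (mul_le_mul h2 h3 (abs_nonneg _) ((abs_nonneg _).trans h2)))
    have h5 : (-(Vp r) * r ^ 4 + 1 / r ^ 4) * (2 * (s.u t r * s.a t r) * r) = r ^ 5 * (2 * s.a t r * (-(Vp r * s.u t r))) + 2 * s.u t r * s.a t r / r ^ 3 := by field_simp
    have h6 : r ^ 5 * (2 * s.a t r * (5 / r * s.b t r)) = 10 * r ^ 4 * (s.a t r * s.b t r) := by field_simp; ring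
    have h7 : 0 ≤ θ' (Y - r - t) * (r ^ 5 * (s.a t r - s.b t r) ^ 2 + s.u t r ^ 2 / r ^ 3) := mul_nonneg (θ'0 _) pos!
    have h8 := mul_le_l (h5 ▸ h4) (θ0 (Y - r - t)).1
    rw [← h6]
    linarith
  have hρY : ρ ≤ Y := lin!
  have e1 : ∫ r in ρ..Y, (P T r - P 0 r) ≤ ∫ r in ρ..Y, ∫ t in (0:ℝ)..T, Qr t r := by
    rw [← integral_congr (f := fun r => ∫ t in (0:ℝ)..T, Pt t r) fun r hr => by
      rw [uIcc_of_le hρY] at hr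
      exact integral_eq_sub_of_hasDerivAt (fun t _ => dP t r (hρ.trans_le hr.1)) ((cPt.time (hρ.trans_le hr.1)).intervalIntegrable _ _)]
    refine int_mono hρY ((cPt.int_cont_t 0 T hρ).mono fun _ h => h.1) ((cQr.int_cont_t 0 T hρ).mono fun _ h => h.1)
      fun r hr => int_mono hT (cPt.time (hρ.trans_le hr.1)).continuousOn (cQr.time (hρ.trans_le hr.1)).continuousOn fun t _ => le t r hr.1
  have cab := (ca.time hρ).mul (cb.time hρ)
  have e2 : ∫ r in ρ..Y, ∫ t in (0:ℝ)..T, Qr t r ≤ ∫ t in (0:ℝ)..T, |2 * ρ ^ 5 * (s.a t ρ * s.b t ρ)| := by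
    rw [cQr.swap 0 T hρ hρY]
    refine int_mono hT (cQr.int_cont hρ hρY).continuousOn (continuous_const.mul cab).abs.continuousOn fun t ht => ?_
    rw [integral_eq_sub_of_hasDerivAt (f := Q t) (fun r hr => dQ t r (by rw [uIcc_of_le hρY] at hr; exact hρ.trans_le hr.1)) ((cQr.slice t).icc hρ Y |>.iint hρY), hQ]
    simp only [hθ]
    rw [Real.smoothTransition.zero_of_nonpos (by linarith [ht.1]), zero_mul, mul_zero, zero_sub, ← hθ]
    refine (neg_le_abs _).trans ?_
    rw [← mul_assoc, abs_mul, abs_of_nonneg (mul_nonneg (exp_pos _).le (θ0 _).1)]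
    have hC0 : 0 ≤ C * t := mul_nonneg (by rw [hC]; positivity) ht.1
    exact mul_le_of_le_one_left (abs_nonneg _) (mul_le_one₀ (exp_le_one_iff.2 lin!) (θ0 _).1 (θ0 _).2)
  have cs : ∀ t, ContinuousOn (fun r => r ^ 5 * (s.a t r ^ 2 + s.b t r ^ 2) + s.u t r ^ 2 / r ^ 3) (Icc ρ Y) := fun t => by
    have h1 := (ca.slice t).icc hρ Y
    have h2 := (cb.slice t).icc hρ Y
    have h3 := (cu.slice t).icc hρ Y
    have : ∀ z ∈ Icc ρ Y, z ^ 3 ≠ 0 := fun z hz => pow_ne_zero _ (hρ.trans_le hz.1).ne'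
    fun_prop (disch := assumption)
  have cp : ∀ t, ContinuousOn (P t) (Icc ρ Y) := fun t => by
    have := cs t
    rw [hP]
    fun_prop
  have np : ∀ t r, 0 < r → 0 ≤ r ^ 5 * (s.a t r ^ 2 + s.b t r ^ 2) + s.u t r ^ 2 / r ^ 3 := fun t r hr => pos!
  have e3 : ∫ r in ρ..Y, P 0 r ≤ ∫ r in ρ..Y, r ^ 5 * (s.a 0 r ^ 2 + s.b 0 r ^ 2) + s.u 0 r ^ 2 / r ^ 3 := int_mono hρY (cp 0) (cs 0) fun r hr => by
      rw [hP]
      simp only [mul_zero, neg_zero, Real.exp_zero, one_mul]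
      exact mul_le_of_le_one_left (np 0 r (hρ.trans_le hr.1)) (θ0 _).2
  have e4 := int_mono_set le_rfl (lin! : ρ ≤ Y - T - 1) lin! (cp T) fun r hr => by
    rw [hP]
    exact mul_nonneg (mul_nonneg (exp_pos _).le (θ0 _).1) (np T r (hρ.trans_le hr.1))
  have hsub : Icc ρ (Y - T - 1) ⊆ Icc ρ Y := Icc_subset_Icc_right lin!
  have e5 := int_le_mul (lin! : ρ ≤ Y - T - 1) (exp (C * T)) (A := fun r => r ^ 5 * (s.a T r ^ 2 + s.b T r ^ 2)) (by
    have h1 := (ca.slice T).icc hρ (Y - T - 1)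
    have h2 := (cb.slice T).icc hρ (Y - T - 1)
    fun_prop) ((cp T).mono hsub) (fun r hr => by
    have hr0 : 0 < r := hρ.trans_le hr.1
    rw [hP, hθ]
    simp only
    rw [Real.smoothTransition.one_of_one_le (by linarith [hr.2]), mul_one, ← mul_assoc, ← Real.exp_add, add_neg_cancel, Real.exp_zero, one_mul]
    exact le_add_of_nonneg_right pos!)
  rw [ii_sub ((cp T).iint hρY) ((cp 0).iint hρY)] at e1
  refine e5.trans (mul_le_l ?_ (exp_pos _).le)
  linarith

lemma fe_pos {s : Sol} {ρ M : ℝ} (hρ : 0 < ρ) (h : EB s ρ 0 M) (T : ℝ) : ∃ M', ∀ t, 0 ≤ t → t ≤ T → EB s ρ t M' := by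
  have hM := h.nonneg
  refine ⟨exp ((1152 + 1 / ρ ^ 4) * T) * ((1 * M + (2 * s.u 0 ρ ^ 2 + M / (2 * ρ ^ 4)) * (1 / (2 * ρ ^ 2))) +
    ∫ t in (0:ℝ)..T, |2 * ρ ^ 5 * (s.a t ρ * s.b t ρ)|), fun t h0 hT Y hY => ?_⟩
  have g := energy_growth s hρ h0 (Y := Y + t + 1) lin!
  rw [show Y + t + 1 - t - 1 = Y by ring] at g
  have hY' : ρ ≤ Y + t + 1 := lin!
  have ne : ∀ z ∈ Icc ρ (Y + t + 1), z ^ 3 ≠ 0 := fun z hz => pow_ne_zero _ (hρ.trans_le hz.1).ne'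
  have c1 := s.ce (Y := Y + t + 1) 0 hρ
  have c2 : ContinuousOn (fun r : ℝ => 1 / r ^ 3) (Icc ρ (Y + t + 1)) := by fun_prop (disch := assumption)
  have c3 := (s.cu 0).icc hρ (Y + t + 1)
  have i := int_le_lin hY' 1 (2 * s.u 0 ρ ^ 2 + M / (2 * ρ ^ 4)) (A := fun r => r ^ 5 * (s.a 0 r ^ 2 + s.b 0 r ^ 2) + s.u 0 r ^ 2 / r ^ 3)
    (by fun_prop (disch := assumption)) c1 c2 fun r hr => by
      have hr0 : 0 < r := hρ.trans_le hr.1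
      have := diff_sq_le h hρ le_rfl hr.1
      rw [one_mul, mul_one_div]
      gcongr
      have e : M / (2 * ρ ^ 4) = 2 * (M / (4 * ρ ^ 4)) := by field_simp; norm_num
      rw [e]
      nlinarith [sq_nonneg (s.u 0 r - 2 * s.u 0 ρ)]
  have j := ftc hY' (f := fun r => -(1 / (2 * r ^ 2))) (fun r hr => by
    have := (hρ.trans_le hr.1).ne'
    refine ((((hasDerivAt_id r).fun_pow 2).const_mul 2).fun_inv pos!).neg.congr_deriv ?_ |>.congr_of_eventuallyEq (.of_forall fun x => by simp)
    simp only [id]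
    field_simp
    norm_num) c2
  have j0 : 0 ≤ 1 / (2 * (Y + t + 1) ^ 2) := pos!
  have ab := (CP.time s.ga.cp hρ).mul (CP.time s.gb.cp hρ)
  have k := int_mono_set le_rfl h0 hT ((continuous_const.mul ab).abs.continuousOn (s := Icc 0 T)) fun r _ => abs_nonneg (2 * ρ ^ 5 * (s.a r ρ * s.b r ρ))
  refine g.trans (mul_le_mul (exp_le_exp.2 (by gcongr)) (add_le_add (i.trans (add_le_add ?_ ?_)) k) ?_ (exp_pos _).le)
  · exact mul_le_l (h _ hY') zero_le_one
  · exact mul_le_l (by rw [j]; linarith) pos!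
  · refine add_nonneg (ii_nonneg hY' fun r hr => ?_) (ii_nonneg h0 fun _ _ => abs_nonneg _)
    have hr0 : 0 < r := hρ.trans_le hr.1
    positivity

lemma fe_of_zero {s : Sol} (h : ∀ ρ, 0 < ρ → ∃ M, EB s ρ 0 M) : FE s := fun ρ hρ T => by
  obtain ⟨M, hM⟩ := h ρ hρ
  obtain ⟨A, hA⟩ := fe_pos hρ hM T
  obtain ⟨B, hB⟩ := fe_pos hρ (s := s.shift (-1) 0 (by norm_num)) (EB.shift _ (by simpa using hM)) T
  refine ⟨max A B, fun t ht => ?_⟩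
  rcases le_total 0 t with h0 | h0
  · exact (hA t h0 ((le_abs_self t).trans ht)).mono (le_max_left _ _)
  · intro Y hY
    have := hB (-t) lin! ((neg_le_abs t).trans ht) Y hY
    simp only [Sol.shift, neg_mul, one_mul, neg_neg, add_zero, neg_sq] at this
    exact this.trans (le_max_right _ _)

/-- The radial part of the `L²(ℝ⁶)` inner product. -/
def IP (f g : ℝ → ℝ) : ℝ := ∫ r in Ioi 0, r ^ 5 * (f r * g r)

/-- Continuous functions with finite `IP f f`. -/
def L2 (f : ℝ → ℝ) : Prop := ContinuousOn f (Ioi 0) ∧ IntegrableOn (fun r => r ^ 5 * (f r * f r)) (Ioi 0)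

section
variable {f g k : ℝ → ℝ}

lemma L2.mul (hf : L2 f) (hg : L2 g) : IntegrableOn (fun r => r ^ 5 * (f r * g r)) (Ioi 0) := by
  have h1 := hf.1
  have h2 := hg.1
  refine (hf.2.add hg.2).mono' (ContinuousOn.aestronglyMeasurable con! measurableSet_Ioi) (ae_restrict_of_forall_mem measurableSet_Ioi fun r hr => ?_)
  have : (0 : ℝ) < r ^ 5 := pow_pos hr 5
  rw [norm_mul, Real.norm_of_nonneg this.le, Pi.add_apply, ← mul_add]
  refine mul_le_l (abs_le.2 ⟨?_, ?_⟩) this.le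
  · nlinarith [sq_nonneg (f r + g r), mul_self_nonneg (f r), mul_self_nonneg (g r)]
  · nlinarith [sq_nonneg (f r - g r), mul_self_nonneg (f r), mul_self_nonneg (g r)]

lemma IP_comm (f g : ℝ → ℝ) : IP f g = IP g f := by
  unfold IP
  simp_rw [mul_comm (f _)]

lemma IP_sub (hf : L2 f) (hg : L2 g) (hk : L2 k) (c : ℝ) : IP (fun r => f r - c * g r) k = IP f k - c * IP g k := by
  unfold IP
  rw [← integral_const_mul, ← integral_sub (hf.mul hk) ((hg.mul hk).const_mul c)]
  exact integral_congr_ae (.of_forall fun r => by ring)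

lemma L2.sub (hf : L2 f) (hg : L2 g) (c : ℝ) : L2 fun r => f r - c * g r :=
  ⟨hf.1.sub (hg.1.const_mul c), (((hf.2.sub ((hf.mul hg).const_mul (2 * c))).add (hg.2.const_mul (c ^ 2))).congr
    (.of_forall fun r => by simp only [Pi.add_apply, Pi.sub_apply]; ring))⟩

lemma IP_min (hf : L2 f) (hg : L2 g) (h : 0 < IP g g) (c : ℝ) :
    IP (fun r => f r - IP f g / IP g g * g r) (fun r => f r - IP f g / IP g g * g r) ≤ IP (fun r => f r - c * g r) (fun r => f r - c * g r) := by
  have e : ∀ c, IP (fun r => f r - c * g r) (fun r => f r - c * g r) = IP f f - 2 * c * IP f g + c ^ 2 * IP g g := fun c => by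
    rw [IP_sub hf hg (hf.sub hg c), IP_comm f, IP_comm g, IP_sub hf hg hf, IP_sub hf hg hg, IP_comm g f]
    ring
  rw [e, e, ← sub_nonneg]
  have : IP f f - 2 * c * IP f g + c ^ 2 * IP g g - (IP f f - 2 * (IP f g / IP g g) * IP f g + (IP f g / IP g g) ^ 2 * IP g g) =
    (c * IP g g - IP f g) ^ 2 / IP g g := by field_simp; ring
  rw [this]
  positivity

lemma IP_lim (hf : L2 f) (hg : L2 g) : Tendsto (fun n : ℕ => ∫ r in (1 / 2 ^ n : ℝ)..2 ^ n, r ^ 5 * (f r * g r)) atTop (𝓝 (IP f g)) := by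
  have h2 : ∀ n : ℕ, (1 / 2 ^ n : ℝ) ≤ 2 ^ n := fun n => (div_le_one₀ pos!).2 (one_le_pow₀ one_le_two) |>.trans (one_le_pow₀ one_le_two)
  have h3 := tendsto_pow_atTop_atTop_of_one_lt (one_lt_two (α := ℝ))
  have h : AECover (volume.restrict (Ioi (0 : ℝ))) atTop fun n : ℕ => Ioc (1 / 2 ^ n : ℝ) (2 ^ n) := ⟨ae_restrict_of_forall_mem measurableSet_Ioi fun r hr => by
      filter_upwards [h3.eventually_ge_atTop r, h3.eventually_gt_atTop (1 / r)] with n h4 h5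
      exact ⟨(one_div_lt pos! hr).2 h5, h4⟩, fun n => measurableSet_Ioc⟩
  refine (h.integral_tendsto_of_countably_generated (hf.mul hg)).congr fun n => ?_
  rw [integral_of_le (h2 n), Measure.restrict_restrict measurableSet_Ioc,
    inter_eq_left.2 (show Ioc (1 / 2 ^ n : ℝ) (2 ^ n) ⊆ Ioi 0 from fun r hr => (pos! : (0 : ℝ) < 1 / 2 ^ n).trans hr.1)]

lemma L2.of_decay (hf : ContinuousOn f (Ici 0)) (h : ∀ r, 1 ≤ r → |f r| ≤ 8 / r ^ 4) : L2 f := by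
  refine ⟨hf.mono Ioi_subset_Ici_self, ?_⟩
  rw [← Ioc_union_Ioi_eq_Ioi zero_le_one]
  have c : ContinuousOn (fun r => r ^ 5 * (f r * f r)) (Ici 0) := con!
  refine IntegrableOn.union (((c.mono Icc_subset_Ici_self).integrableOn_Icc).mono_set Ioc_subset_Icc_self)
    (((integrableOn_Ioi_rpow_of_lt (by norm_num : (-3 : ℝ) < -1) one_pos).const_mul 64).mono'
      ((c.mono fun r hr => mem_Ici.2 (zero_le_one.trans (mem_Ioi.1 hr).le)).aestronglyMeasurable measurableSet_Ioi)
      (ae_restrict_of_forall_mem measurableSet_Ioi fun r hr => ?_))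
  have r0 : 0 < r := one_pos.trans hr
  rw [Real.norm_of_nonneg (mul_nonneg pos! (mul_self_nonneg _)), ← abs_mul_abs_self, Real.rpow_neg r0.le, Real.rpow_ofNat]
  have := mul_self_le_mul_self (abs_nonneg _) (h r hr.le)
  calc _ ≤ r ^ 5 * (8 / r ^ 4 * (8 / r ^ 4)) := by gcongr
    _ = _ := by field_simp; norm_num

lemma shells_sum {A : ℝ} (hc : ContinuousOn f (Ioi 0)) (h1 : ∀ R, 0 < R → R ≤ 1 → |∫ r in R..2 * R, f r| ≤ A * R)
    (h2 : ∀ R, 1 ≤ R → |∫ r in R..2 * R, f r| ≤ A / R) (n : ℕ) :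
    |∫ r in (1 / 2 ^ n : ℝ)..2 ^ n, f r| ≤ 4 * A * (1 - 1 / 2 ^ n) := by
  induction n with
  | zero => simp
  | succ n ih =>
    have p : (1 : ℝ) ≤ 2 ^ n := one_le_pow₀ one_le_two
    have p0 : (0 : ℝ) < 2 ^ n := pos!
    have ii : ∀ a b : ℝ, 0 < a → 0 < b → IntervalIntegrable f volume a b := fun a b ha hb => (hc.mono fun x hx => (lt_min ha hb).trans_le hx.1).intervalIntegrable
    have k1 := h1 (1 / 2 ^ (n + 1)) pos! ((div_le_one₀ pos!).2 (one_le_pow₀ one_le_two))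
    rw [show (2 : ℝ) * (1 / 2 ^ (n + 1)) = 1 / 2 ^ n by field_simp; ring] at k1
    have k2 := h2 _ p
    rw [← pow_succ'] at k2
    rw [← integral_add_adjacent_intervals (ii _ _ pos! pos! : IntervalIntegrable f volume _ (1 / 2 ^ n)) (ii _ _ pos! pos!), ← integral_add_adjacent_intervals
      (ii (1 / 2 ^ n) (2 ^ n) pos! p0) (ii _ _ pos! pos!)]
    have A0 : 0 ≤ A / 2 ^ n := (abs_nonneg _).trans k2
    refine (abs_add_le _ _).trans ((add_le_add k1 ((abs_add_le _ _).trans (add_le_add ih k2))).trans ?_)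
    have : A * (1 / 2 ^ (n + 1)) = A / 2 ^ n / 2 := by field_simp; ring
    have e : 4 * A * (1 - 1 / 2 ^ (n + 1)) = 4 * A * (1 - 1 / 2 ^ n) + 2 * (A / 2 ^ n) := by field_simp; ring
    linarith

lemma log_sq_le {R : ℝ} (hR : 1 ≤ R) : Real.log R ^ 2 ≤ 4 * R := by
  have h := Real.log_le_sub_one_of_pos (Real.sqrt_pos.2 lin!)
  rw [Real.log_sqrt lin!] at h
  have := Real.sq_sqrt (lin! : 0 ≤ R)
  nlinarith [Real.log_nonneg hR, Real.sqrt_nonneg R]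

lemma IP_phi1_le {K : ℝ} (hf : L2 f) (hp : L2 phi1) (hK : 0 ≤ K)
    (h : ∀ R, 0 < R → ∫ r in R..2 * R, r ^ 5 * f r ^ 2 ≤ K * (1 + Real.log R ^ 2)) : IP f phi1 ^ 2 ≤ 16 * (640 * K) := by
  have c := hf.1
  have key : ∀ R, 0 < R → ∀ D, (∀ r ∈ Icc R (2 * R), r ^ 4 * phi1 r ^ 2 ≤ D) →
      (∫ r in R..2 * R, r ^ 5 * (f r * phi1 r)) ^ 2 ≤ 2 * R * (K * (1 + Real.log R ^ 2)) * (D * R) := fun R hR D hD => by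
    have hR2 : R ≤ 2 * R := lin!
    have c1 := c.icc hR (2 * R)
    have c2 := cphi1
    have := cs (f := fun r => r ^ 3 * f r) (g := fun r => r ^ 2 * phi1 r) hR2 con! con!
    rw [integral_congr fun r _ => (by ring : r ^ 5 * (f r * phi1 r) = r ^ 3 * f r * (r ^ 2 * phi1 r))]
    refine this.trans (mul_le_mul ((int_le_mul hR2 (2 * R) (f := fun r => r ^ 5 * f r ^ 2) con! con! fun r hr => ?_).trans
      (mul_le_l (h R hR) pos!)) ((int_mono hR2 con! continuousOn_const (B := fun _ => D) fun r hr => ?_).trans ?_)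
      (ii_nonneg hR2 fun _ _ => pos!) pos!)
    · have : 0 ≤ r ^ 5 * f r ^ 2 := mul_nonneg (pow_nonneg (hR.le.trans hr.1) 5) (sq_nonneg _)
      nlinarith [hr.2]
    · exact (by ring : (r ^ 2 * phi1 r) ^ 2 = r ^ 4 * phi1 r ^ 2).trans_le (hD r hr)
    · rw [ii_const]; linarith
  have sq : ∀ X, 0 ≤ X → ∀ y, y ^ 2 ≤ 640 * K * X ^ 2 → |y| ≤ √(640 * K) * X := fun X hX y hy => by
    refine abs_le_of_sq_le_sq (hy.trans_eq ?_) pos!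
    rw [mul_pow, Real.sq_sqrt pos!]
  have b := le_of_tendsto' (IP_lim hf hp).abs fun n => (shells_sum (A := √(640 * K)) (f := fun r => r ^ 5 * (f r * phi1 r))
    (ContinuousOn.mul con! (c.mul hp.1)) (fun R hR h1 => ?_) (fun R h1 => ?_) n).trans
    (mul_le_of_le_one_right pos! (sub_le_self 1 pos!))
  · rw [← sq_abs]
    refine (pow_le_l (abs_nonneg _) b 2).trans_eq ?_
    rw [mul_pow, Real.sq_sqrt pos!]
    norm_num
  · refine sq R hR.le _ ((key R hR (64 * R ^ 6) fun r hr => ?_).trans ?_)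
    · have := hR.trans_le hr.1
      rw [← sq_abs]
      calc _ ≤ r ^ 4 * r ^ 2 := by gcongr; exact phi1_small this
        _ = r ^ 6 := by ring
        _ ≤ (2 * R) ^ 6 := pow_le_l this.le hr.2 6
        _ = _ := by ring
    · have := log_sq_le (one_le_one_div hR h1)
      rw [Real.log_div one_ne_zero hR.ne', Real.log_one, zero_sub, neg_sq] at this
      have : R * (1 + Real.log R ^ 2) ≤ 5 := by
        have := mul_le_l this hR.le
        have e : R * (4 * (1 / R)) = 4 := by field_simp
        linarith
      calc _ = 128 * K * R ^ 7 * (R * (1 + Real.log R ^ 2)) := by ring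
        _ ≤ 128 * K * R ^ 2 * 5 := by gcongr 128 * K * ?_ * ?_; exact pow_le_pow_of_le_one hR.le h1 (by norm_num)
        _ = _ := by ring
  · have hR : 0 < R := lin!
    rw [div_eq_mul_one_div]
    refine sq (1 / R) pos! _ ((key R hR (64 / R ^ 6) fun r hr => ?_).trans ?_)
    · have h0 := hR.trans_le hr.1
      rw [← sq_abs, le_div_iff₀ pos!]
      calc _ ≤ r ^ 4 * |phi1 r| ^ 2 * r ^ 6 := by gcongr; exact hr.1
        _ = (r ^ 5 * |phi1 r|) ^ 2 := by ring
        _ ≤ 8 ^ 2 := by gcongr; exact phi1_bound h0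
        _ = 64 := by norm_num
    · have : 1 + Real.log R ^ 2 ≤ 5 * R := by linarith [log_sq_le h1]
      calc _ ≤ 2 * R * (K * (5 * R)) * (64 / R ^ 6 * R) := by gcongr
        _ = 640 * K * (1 / R ^ 3) := by field_simp; ring
        _ ≤ 640 * K * (1 / R) ^ 2 := by rw [div_pow, one_pow]; gcongr 640 * K * (1 / ?_); exact pow_le_pow_right₀ h1 (by norm_num)

end

lemma IP_interval {f : ℝ → ℝ} (hf : L2 f) {x Y : ℝ} (hx : 0 < x) (hY : x ≤ Y) : ∫ r in x..Y, r ^ 5 * f r ^ 2 ≤ IP f f := by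
  simp_rw [sq]
  rw [integral_of_le hY]
  exact setIntegral_mono_set hf.2 (ae_restrict_of_forall_mem measurableSet_Ioi fun r hr =>
    mul_nonneg (pow_pos hr 5).le (mul_self_nonneg _)) (.of_forall fun r hr => hx.trans hr.1)

lemma IP_pos {f : ℝ → ℝ} (hf : L2 f) (h : ∀ r ∈ Ioo (1 : ℝ) 2, f r ≠ 0) : 0 < IP f f := by
  have := hf.1.icc one_pos 2
  refine (intervalIntegral.intervalIntegral_pos_of_pos_on (ContinuousOn.iint one_le_two con!) (fun r hr => ?_) one_lt_two).trans_le (IP_interval hf one_pos one_le_two)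
  have := h r hr
  have : 0 < r := one_pos.trans hr.1
  positivity

lemma le_mul_of_forall_add {x c E : ℝ} (h : ∀ e, 0 < e → x ≤ c * (E + e)) : x ≤ c * E := by
  have : Tendsto (fun e => c * (E + e)) (𝓝[>] 0) (𝓝 (c * (E + 0))) := (con! : Continuous fun e => c * (E + e)).continuousAt.mono_left nhdsWithin_le_nhds
  rw [add_zero] at this
  exact ge_of_tendsto this (eventually_mem_nhdsWithin.mono h)

lemma L2_phi : L2 phi := L2.of_decay cphi.continuousOn fun r hr => by
  have hr0 : 0 < r := lin!
  rw [le_div_iff₀ pos!]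
  linarith [phi_bound hr0]

lemma L2_phi1 : L2 phi1 := L2.of_decay cphi1.continuousOn fun r hr => by
  have hr0 : 0 < r := lin!
  rw [le_div_iff₀ pos!, mul_comm]
  exact (mul_le_r (pow_le_pow_right₀ hr (by norm_num)) (abs_nonneg _)).trans (phi1_bound hr0)

lemma IP_phi_pos : 0 < IP phi phi := IP_pos L2_phi fun r hr => by
  have := hr.1
  exact div_ne_zero (by nlinarith [hr.2]) pos!

lemma IP_phi1_pos : 0 < IP phi1 phi1 := IP_pos L2_phi1 fun r hr => by
  have := hr.1
  exact div_ne_zero (mul_ne_zero lin! (by nlinarith [hr.2])) pos!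

lemma fe_of_L2 {s : Sol} (ha : L2 (s.a 0)) (hb : L2 (s.b 0)) : FE s := fe_of_zero fun ρ hρ => ⟨1 * IP (s.a 0) (s.a 0) + 1 * IP (s.b 0) (s.b 0), fun Y hY => by
    have h1 := (s.ca 0).icc hρ Y
    have h2 := (s.cb 0).icc hρ Y
    refine (int_le_lin hY 1 1 (f := fun r => r ^ 5 * s.a 0 r ^ 2) (g := fun r => r ^ 5 * s.b 0 r ^ 2) con! con!
      con! fun r _ => lin!).trans (by gcongr <;> exact IP_interval ‹_› hρ hY)⟩

/-- The component of `f` orthogonal to `g`. -/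
def proj (f g : ℝ → ℝ) (r : ℝ) : ℝ := f r - IP f g / IP g g * g r

theorem radial_proj : ∃ K, 0 ≤ K ∧ ∀ s : Sol, L2 (s.a 0) → L2 (s.b 0) → ∀ B : ℝ, (∀ r, 0 < r → r ≤ 1 → |s.u 0 r| ≤ B ∧ |s.a 0 r| ≤ B) → ∀ E, 0 ≤ E →
    (∀ e, 0 < e → ∀ ρ, 0 ≤ ρ → Late s ρ (E + e) ∧ Late (s.shift (-1) 0 (by norm_num)) ρ (E + e)) →
    IP (proj (s.a 0) phi) (proj (s.a 0) phi) ≤ K * E ∧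
    ∀ R, 0 < R → ∫ r in R..2 * R, r ^ 5 * proj (s.b 0) phi1 r ^ 2 ≤ K * (1 + Real.log R ^ 2) * E := by
  obtain ⟨K, hK0, hK⟩ := radial_main
  have pp := IP_phi_pos
  have qq := IP_phi1_pos
  have hq : 0 ≤ 20480 * K / IP phi1 phi1 := pos!
  refine ⟨2 * K + 20480 * K / IP phi1 phi1, pos!, fun s ha hb B hB E hE hL => ?_⟩
  refine ⟨le_mul_of_forall_add fun e he => ?_, fun R hR => le_mul_of_forall_add fun e he => ?_⟩ <;>
  obtain ⟨b, κ, h1, h2⟩ := hK s (fe_of_L2 ha hb) B hB (E + e) lin! (hL e he)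
  · refine (IP_min ha L2_phi pp b).trans (le_of_tendsto' (IP_lim (ha.sub L2_phi b) (ha.sub L2_phi b)) fun n => ?_)
    simp_rw [← sq]
    refine (h1 _ _ pos! ((div_le_one₀ pos!).2 (one_le_pow₀ one_le_two) |>.trans (one_le_pow₀ one_le_two))).trans ?_
    gcongr
    linarith
  · have hh := hb.sub L2_phi1 κ
    have hi := IP_phi1_le hh L2_phi1 (K := K * (E + e)) pos! fun R hR => (h2 R hR).trans_eq (by ring)
    rw [IP_sub hb L2_phi1 L2_phi1] at hi
    have hR2 : R ≤ 2 * R := lin!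
    have c1 := hb.1.icc hR (2 * R)
    have c2 := cphi1
    obtain ⟨ν, hν⟩ : ∃ ν, ν = IP (s.b 0) phi1 / IP phi1 phi1 := ⟨_, rfl⟩
    have e1 : IP (s.b 0) phi1 = ν * IP phi1 phi1 := by rw [hν]; field_simp
    unfold proj
    rw [← hν]
    rw [e1] at hi
    have hμ : 2 * (ν - κ) ^ 2 * IP phi1 phi1 ≤ 20480 * K / IP phi1 phi1 * (E + e) := by
      rw [div_mul_eq_mul_div, le_div_iff₀ qq]
      linarith
    have i := int_le_lin hR2 2 (2 * (ν - κ) ^ 2) (A := fun r => r ^ 5 * (s.b 0 r - ν * phi1 r) ^ 2)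
      (f := fun r => r ^ 5 * (s.b 0 r - κ * phi1 r) ^ 2) (g := fun r => r ^ 5 * phi1 r ^ 2) con! con! con!
      fun r hr => by
        have : 0 ≤ r ^ 5 * (s.b 0 r - κ * phi1 r + (ν - κ) * phi1 r) ^ 2 := mul_nonneg (pow_nonneg (hR.le.trans hr.1) 5) (sq_nonneg _)
        linarith
    have j := mul_le_l (IP_interval L2_phi1 hR hR2) (pos! : 0 ≤ 2 * (ν - κ) ^ 2)
    have k : 0 ≤ 20480 * K / IP phi1 phi1 * (E + e) * Real.log R ^ 2 := pos!
    linarith [h2 R hR]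

lemma hasGrad_of_contDiff {H : ℝ × ℝ → ℝ} (hH : ContDiff ℝ 1 H) (J : Set ℝ) :
    HasGrad J (fun t r => H (t, r)) (fun t r => fderiv ℝ H (t, r) (1, 0)) fun t r => fderiv ℝ H (t, r) (0, 1) := fun t r _ =>
  (hH.differentiable one_ne_zero (t, r)).hasFDerivAt.congr_fderiv (by ext <;> simp)

lemma hasFDerivAt_radial {f : ℝ → ℝ} {f' : ℝ} {x : E6} (hx : x ≠ 0) (h : HasDerivAt f f' ‖x‖) : HasFDerivAt (fun y : E6 => f ‖y‖) ((f' / ‖x‖) • innerSL ℝ x) x := by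
  have h1 : HasFDerivAt (fun y : E6 => ‖y‖) ((1 / ‖x‖) • innerSL ℝ x) x := by
    have := (hasStrictFDerivAt_norm_sq x).hasFDerivAt.sqrt (pow_ne_zero 2 (norm_ne_zero_iff.2 hx))
    simp only [Real.sqrt_sq (norm_nonneg _)] at this
    refine this.congr_fderiv ?_
    rw [← Nat.cast_smul_eq_nsmul ℝ, smul_smul]
    congr 1
    field_simp
    norm_num
  refine (h.comp_hasFDerivAt x h1).congr_fderiv ?_
  rw [smul_smul, mul_one_div]

lemma lap_radial {f : E6 → ℝ} {g g1 : ℝ → ℝ} {g2 : ℝ} {x : E6} (hx : x ≠ 0) (hf : ∀ y, f y = g ‖y‖)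
    (h : HD g g1) (h' : HasDerivAt g1 g2 ‖x‖) : lap6 f x = g2 + 5 / ‖x‖ * g1 ‖x‖ := by
  have hn := norm_ne_zero_iff.2 hx
  have e : ∀ i : Fin 6, fderiv ℝ (fun y => fderiv ℝ f y (EuclideanSpace.single i 1)) x (EuclideanSpace.single i 1) =
      (g2 * ‖x‖ - g1 ‖x‖) / ‖x‖ ^ 3 * x i ^ 2 + g1 ‖x‖ / ‖x‖ := fun i => by
    have h1 : (fun y => fderiv ℝ f y (EuclideanSpace.single i 1)) =ᶠ[𝓝 x] fun y => g1 ‖y‖ / ‖y‖ * EuclideanSpace.proj (𝕜 := ℝ) i y := by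
      filter_upwards [isOpen_ne.mem_nhds hx] with y hy
      rw [funext hf, (hasFDerivAt_radial hy (h _ (norm_pos_iff.2 hy))).fderiv]
      simp [EuclideanSpace.inner_single_right]
    rw [h1.fderiv_eq, ((hasFDerivAt_radial hx (h'.fun_div (hasDerivAt_id' _) hn)).fun_mul (EuclideanSpace.proj (𝕜 := ℝ) i).hasFDerivAt).fderiv]
    simp [EuclideanSpace.inner_single_right]
    field_simp
    ring
  rw [lap6, Finset.sum_congr rfl fun i _ => e i, Finset.sum_add_distrib, ← Finset.mul_sum, ← EuclideanSpace.real_norm_sq_eq]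
  simp
  field_simp
  ring

lemma exists_sol {u : ℝ → E6 → ℝ} (hu : IsRadSol u) : ∃ s : Sol, (∀ t x, u t x = s.u t ‖x‖) ∧ (∀ t x, dtu u t x = s.a t ‖x‖) ∧
    Continuous (s.u 0) ∧ Continuous (s.a 0) := by
  obtain ⟨h1, h2, h3, -⟩ := hu
  obtain ⟨G, hG⟩ : ∃ G : ℝ × ℝ → ℝ, G = fun z => u z.1 (z.2 • EuclideanSpace.single 0 1) := ⟨_, rfl⟩
  have cG : ContDiff ℝ 2 G := hG ▸ h1.comp (contDiff_fst.prodMk (contDiff_snd.smul contDiff_const))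
  have uG : ∀ t x, u t x = G (t, ‖x‖) := fun t x => by
    rw [hG]
    exact h2 _ _ _ (by simp [norm_smul])
  have cD : ∀ v, ContDiff ℝ 1 fun z => fderiv ℝ G z v := fun v => (cG.fderiv_right (m := 1) (by norm_num)).clm_apply contDiff_const
  have cDD : ∀ v w, Continuous fun z => fderiv ℝ (fun z => fderiv ℝ G z v) z w := fun v w => ((cD v).continuous_fderiv one_ne_zero).clm_apply continuous_const
  have g0 := hasGrad_of_contDiff (cG.of_le one_le_two)
  have g1 := fun v => hasGrad_of_contDiff (cD v)
  have sym : ∀ z, fderiv ℝ (fun z => fderiv ℝ G z (0, 1)) z (1, 0) = fderiv ℝ (fun z => fderiv ℝ G z (1, 0)) z (0, 1) := fun z => by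
    have d : DifferentiableAt ℝ (fderiv ℝ G) z := (cG.fderiv_right (m := 1) (by norm_num)).differentiable one_ne_zero z
    rw [fderiv_clm_apply d (differentiableAt_const _), fderiv_clm_apply d (differentiableAt_const _)]
    simpa using (cG.contDiffAt.isSymmSndFDerivAt (by simp)) (1, 0) (0, 1)
  have ha : ∀ t x, dtu u t x = fderiv ℝ G (t, ‖x‖) (1, 0) := fun t x => by
    simp only [dtu, uG]
    exact ((g0 univ).dt t (mem_univ _)).deriv
  refine ⟨⟨fun t r => G (t, r), fun t r => fderiv ℝ G (t, r) (1, 0), fun t r => fderiv ℝ G (t, r) (0, 1),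
    fun t r => fderiv ℝ (fun z => fderiv ℝ G z (1, 0)) (t, r) (1, 0), fun t r => fderiv ℝ (fun z => fderiv ℝ G z (1, 0)) (t, r) (0, 1),
    fun t r => fderiv ℝ (fun z => fderiv ℝ G z (0, 1)) (t, r) (0, 1), g0 _, g1 _ _, (g1 _ _).congr (fun _ _ _ => (sym _).symm) fun _ _ _ => rfl, (cDD _ _).continuousOn,
    (cDD _ _).continuousOn, (cDD _ _).continuousOn, fun t r hr => ?_⟩, uG, ha, cG.continuous.comp con!, (cD _).continuous.comp con!⟩
  have hx : ‖r • (EuclideanSpace.single 0 1 : E6)‖ = r := by simp [norm_smul, abs_of_pos hr]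
  have := h3 t (r • EuclideanSpace.single 0 1)
  rw [lap_radial (norm_pos_iff.1 (hx.symm ▸ hr)) (uG t) (fun r _ => (g0 univ).dr t (mem_univ r)) ((g1 _ univ).dr t (mem_univ _)), uG, hx, dttu,
    funext fun s => ha s _, hx, ((g1 _ univ).dt t (mem_univ r)).deriv, V6, W6, hx] at this
  have e : -2 * ((1 + r ^ 2 / 24) ^ 2)⁻¹ = Vp r := by rw [Vp]; field_simp; ring
  rw [e] at this
  linarith

lemma EB.integrableOn {s : Sol} {ρ t M : ℝ} (h : EB s ρ t M) (hρ : 0 < ρ) : IntegrableOn (fun r => r ^ 5 * (s.a t r ^ 2 + s.b t r ^ 2)) (Ioi ρ) := by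
  refine integrableOn_Ioi_of_intervalIntegral_norm_bounded M ρ (b := id) (l := atTop)
    (fun Y => ((s.ce (Y := Y) t hρ).integrableOn_Icc).mono_set Ioc_subset_Icc_self) tendsto_id ?_
  filter_upwards [eventually_ge_atTop ρ] with Y hY
  refine le_trans (integral_congr fun r hr => ?_).le (h Y hY)
  rw [id, uIcc_of_le hY] at hr
  exact Real.norm_of_nonneg (mul_nonneg (pow_nonneg (hρ.le.trans hr.1) 5) pos!)

lemma FE.late {s : Sol} (hF : FE s) {L E ρ : ℝ} (h : Tendsto (fun t => ∫ r in Ioi t, r ^ 5 * (s.a t r ^ 2 + s.b t r ^ 2)) atTop (𝓝 L))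
    (hL : L < E) (hρ : 0 ≤ ρ) : Late s ρ E := by
  obtain ⟨T, hT⟩ := eventually_atTop.1 (h.eventually_lt_const hL)
  refine ⟨max T 1, fun t ht Y hY => ?_⟩
  have ht1 : 0 < t := one_pos.trans_le ((le_max_right _ _).trans ht)
  obtain ⟨M, hM⟩ := hF t ht1 |t|
  rw [integral_of_le hY]
  refine (setIntegral_mono_set ((hM t le_rfl).integrableOn ht1) (ae_restrict_of_forall_mem measurableSet_Ioi fun r hr => ?_)
    (.of_forall fun r hr => ?_)).trans (hT t ((le_max_left _ _).trans ht)).le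
  · exact mul_nonneg (pow_nonneg (ht1.trans hr).le 5) pos!
  · exact (le_add_of_nonneg_left hρ).trans_lt (mem_Ioc.1 hr).1

/-- The area of the unit sphere of `ℝ⁶`. -/
def A6 : ℝ := 6 * volume.real (Metric.ball (0 : E6) 1)

lemma A6_pos : 0 < A6 := mul_pos (by norm_num) (ENNReal.toReal_pos (Metric.measure_ball_pos volume _ one_pos).ne' measure_ball_lt_top.ne)

lemma ae_ne_zero : ∀ᵐ x : E6, x ≠ 0 := compl_mem_ae_iff.2 (measure_singleton (0 : E6))

lemma polar_on {F : E6 → ℝ} {f : ℝ → ℝ} {S : Set ℝ} (hS : MeasurableSet S) (h : ∀ x ≠ 0, F x = f ‖x‖) :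
    ∫ x in {x | ‖x‖ ∈ S}, F x = A6 * ∫ r in Ioi 0 ∩ S, r ^ 5 * f r := by
  change ∫ x in (fun x : E6 => ‖x‖) ⁻¹' S, F x = _
  rw [← integral_indicator (hS.preimage measurable_norm), integral_congr_ae (g := fun x => S.indicator f ‖x‖),
    integral_fun_norm_addHaar volume, ← setIntegral_indicator hS]
  · simp only [finrank_euclideanSpace_fin, nsmul_eq_mul, smul_eq_mul, ← mul_assoc, Nat.cast_ofNat, A6]
    congr 1
    refine integral_congr_ae (.of_forall fun r => ?_)
    by_cases hr : r ∈ S <;> simp [hr]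
  · filter_upwards [ae_ne_zero] with x hx
    by_cases hr : ‖x‖ ∈ S <;> simp [hr, h x hx]

lemma polar {F : E6 → ℝ} {f : ℝ → ℝ} (h : ∀ x ≠ 0, F x = f ‖x‖) : ∫ x, F x = A6 * ∫ r in Ioi 0, r ^ 5 * f r := by simpa using polar_on MeasurableSet.univ h

lemma grad_radial {f : E6 → ℝ} {g : ℝ → ℝ} {g' : ℝ} {x : E6} (hx : x ≠ 0) (hf : ∀ y, f y = g ‖y‖) (h : HasDerivAt g g' ‖x‖) : gradient f x = (g' / ‖x‖) • x := by
  rw [funext hf]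
  refine (hasGradientAt_iff_hasFDerivAt.2 ((hasFDerivAt_radial hx h).congr_fderiv ?_)).gradient
  ext y
  simp

lemma norm_div_smul {x : E6} (hx : x ≠ 0) (c : ℝ) : ‖(c / ‖x‖) • x‖ ^ 2 = c ^ 2 := by
  have := norm_ne_zero_iff.2 hx
  rw [norm_smul, norm_div, norm_norm, div_mul_cancel₀ _ this, Real.norm_eq_abs, sq_abs]

lemma LW_eq (x : E6) : LW6 x = -1152 * phi ‖x‖ := by
  rcases eq_or_ne x 0 with rfl | hx
  · simp [LW6, W6, phi]; norm_num
  · have h := hasFDerivAt_radial hx (((((hasDerivAt_id' ‖x‖).fun_pow 2).div_const 24).const_add 1).fun_pow 2 |>.fun_inv pos!)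
    have := norm_ne_zero_iff.2 hx
    rw [LW6, W6, show W6 = fun y => ((1 + ‖y‖ ^ 2 / 24) ^ 2)⁻¹ from rfl, h.fderiv, phi]
    simp
    field_simp
    ring

end Chan

open Chan

/-- Channels of energy around the ground state in six dimensions. -/
theorem stmt0 :
    ∃ C : ℝ, 0 < C ∧
      ∀ (u : ℝ → E6 → ℝ) (Ep Em : ℝ), IsRadSol u →
        Tendsto (fun t => ∫ x in {x : E6 | |t| < ‖x‖}, eDensity u t x) atTop (𝓝 Ep) →
        Tendsto (fun t => ∫ x in {x : E6 | |t| < ‖x‖}, eDensity u t x) atBot (𝓝 Em) →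
        ENNReal.ofReal (Real.sqrt (∫ x, PiL2perp (dtu u 0) x ^ 2)) +
            Zm3 (fun x => ‖gradient (PiH1perp (u 0)) x‖) ≤
          ENNReal.ofReal (C * Real.sqrt (Ep + Em)) := by
  obtain ⟨K, hK0, hK⟩ := radial_proj
  refine ⟨2 * √K + 1, pos!, fun u Ep Em hu hp hm => ?_⟩
  obtain ⟨s, su, sa, cu, ca⟩ := exists_sol hu
  have hA := A6_pos
  have hn : ∀ {x : E6}, x ≠ 0 → 0 < ‖x‖ := norm_pos_iff.2
  have gu : ∀ t (x : E6), x ≠ 0 → gradient (u t) x = (s.b t ‖x‖ / ‖x‖) • x := fun t x hx => grad_radial hx (su t) (s.gu.dr t (hn hx))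
  have ed : ∀ t (x : E6), x ≠ 0 → eDensity u t x = s.a t ‖x‖ ^ 2 + s.b t ‖x‖ ^ 2 := fun t x hx => by rw [eDensity, sa, gu t x hx, norm_div_smul hx]
  have fin : IntegrableOn (fun r => r ^ 5 * (s.a 0 r ^ 2 + s.b 0 r ^ 2)) (Ioi 0) := by
    have := (integrable_fun_norm_addHaar (volume : Measure E6) (f := fun r => s.a 0 r ^ 2 + s.b 0 r ^ 2)).1 (hu.2.2.2.congr (ae_ne_zero.mono (ed 0)))
    simpa using this
  have L2of : ∀ f, ContinuousOn f (Ioi 0) → (∀ r, f r * f r ≤ s.a 0 r ^ 2 + s.b 0 r ^ 2) → L2 f := fun f hf h =>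
    ⟨hf, fin.mono' (ContinuousOn.aestronglyMeasurable con! measurableSet_Ioi) (ae_restrict_of_forall_mem measurableSet_Ioi fun r hr => by
      have : (0 : ℝ) < r ^ 5 := pow_pos hr 5
      rw [Real.norm_of_nonneg (mul_nonneg this.le (mul_self_nonneg _))]
      exact mul_le_l (h r) this.le)⟩
  have la : L2 (s.a 0) := L2of _ (s.ca 0) fun r => by linarith [sq_nonneg (s.b 0 r)]
  have lb : L2 (s.b 0) := L2of _ (s.cb 0) fun r => by linarith [sq_nonneg (s.a 0 r)]
  have hF := fe_of_L2 la lb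
  have en : ∀ t, (∫ x in {x : E6 | |t| < ‖x‖}, eDensity u t x) / A6 = ∫ r in Ioi |t|, r ^ 5 * (s.a t r ^ 2 + s.b t r ^ 2) := fun t => by
    rw [show {x : E6 | |t| < ‖x‖} = {x | ‖x‖ ∈ Ioi |t|} from rfl, polar_on (f := fun r => s.a t r ^ 2 + s.b t r ^ 2) measurableSet_Ioi (ed t), mul_div_cancel_left₀ _ hA.ne',
      inter_eq_right.2 (Ioi_subset_Ioi (abs_nonneg t))]
  have pos : ∀ t, 0 ≤ ∫ x in {x : E6 | |t| < ‖x‖}, eDensity u t x := fun t => integral_nonneg fun x => by unfold eDensity; positivity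
  have Ep0 := ge_of_tendsto' hp pos
  have Em0 := ge_of_tendsto' hm pos
  have E0 : 0 ≤ Ep + Em := lin!
  obtain ⟨B, -, hB⟩ := exists_bound (a := 0) (b := 1) cu.continuousOn
  obtain ⟨B', -, hB'⟩ := exists_bound (a := 0) (b := 1) ca.continuousOn
  obtain ⟨k1, k2⟩ := hK s la lb (max B B') (fun r h0 h1 => ⟨(hB r ⟨h0.le, h1⟩).trans (le_max_left _ _), (hB' r ⟨h0.le, h1⟩).trans (le_max_right _ _)⟩)
    ((Ep + Em) / A6) pos! fun e he ρ hρ => by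
      rw [add_div]
      have := div_nonneg Ep0 hA.le
      have := div_nonneg Em0 hA.le
      constructor
      · refine hF.late ((hp.div_const A6).congr' ?_) lin! hρ
        filter_upwards [eventually_ge_atTop 0] with t ht
        rw [en, abs_of_nonneg ht]
      · refine (hF.shift _).late (((hm.div_const A6).comp tendsto_neg_atTop_atBot).congr' ?_) lin! hρ
        filter_upwards [eventually_ge_atTop 0] with t ht
        simp [en, abs_of_nonneg ht, Sol.shift]
  have aux : ∀ f g : ℝ → ℝ, ∫ r in Ioi 0, r ^ 5 * (-1152 * (f r * g r)) = -1152 * IP f g := fun f g => by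
    rw [IP, ← integral_const_mul]
    exact integral_congr_ae (.of_forall fun r => by ring)
  have aux2 : ∀ f : ℝ → ℝ, ∫ r in Ioi 0, r ^ 5 * (-1152 * f r) ^ 2 = 1152 ^ 2 * IP f f := fun f => by
    rw [IP, ← integral_const_mul]
    exact integral_congr_ae (.of_forall fun r => by ring)
  have gw : ∀ x : E6, x ≠ 0 → gradient LW6 x = (-1152 * phi1 ‖x‖ / ‖x‖) • x := fun x hx => grad_radial hx LW_eq ((dphi _).const_mul _)
  have PL : ∀ x ≠ 0, PiL2perp (dtu u 0) x ^ 2 = proj (s.a 0) phi ‖x‖ * proj (s.a 0) phi ‖x‖ := fun x _ => by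
    rw [PiL2perp, polar (F := fun y => dtu u 0 y * LW6 y) (f := fun r => -1152 * (s.a 0 r * phi r)) fun y _ => by rw [sa, LW_eq]; ring,
      polar (F := fun y => LW6 y ^ 2) (f := fun r => (-1152 * phi r) ^ 2) fun y _ => by rw [LW_eq], aux, aux2, sa, LW_eq, proj]
    have := IP_phi_pos
    field_simp
  have PH : ∀ x ≠ 0, ‖gradient (PiH1perp (u 0)) x‖ ^ 2 = proj (s.b 0) phi1 ‖x‖ ^ 2 := fun x hx => by
    have c : (∫ y, ⟪gradient (u 0) y, gradient LW6 y⟫) / (∫ y, ‖gradient LW6 y‖ ^ 2) = -(IP (s.b 0) phi1 / IP phi1 phi1) / 1152 := by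
      rw [polar (F := fun y => ⟪gradient (u 0) y, gradient LW6 y⟫) (f := fun r => -1152 * (s.b 0 r * phi1 r)) fun y hy => by
          rw [gu 0 y hy, gw y hy, real_inner_smul_left, real_inner_smul_right, real_inner_self_eq_norm_sq]
          have := (hn hy).ne'
          field_simp,
        polar (F := fun y => ‖gradient LW6 y‖ ^ 2) (f := fun r => (-1152 * phi1 r) ^ 2) fun y hy => by rw [gw y hy, norm_div_smul hy], aux, aux2]
      have := IP_phi1_pos
      field_simp
    rw [grad_radial hx (g := fun r => s.u 0 r - -(IP (s.b 0) phi1 / IP phi1 phi1) / 1152 * (-1152 * phi r)) (fun y => by rw [PiH1perp, c, su, LW_eq])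
      ((s.gu.dr 0 (hn hx)).sub (((dphi _).const_mul _).const_mul _)), norm_div_smul hx, proj]
    ring
  have m : ∀ x, x ≤ √K * √(Ep + Em) → ENNReal.ofReal x ≤ ENNReal.ofReal (√K * √(Ep + Em)) := fun x => ENNReal.ofReal_le_ofReal
  calc _ ≤ ENNReal.ofReal (√K * √(Ep + Em)) + ENNReal.ofReal (√K * √(Ep + Em)) := add_le_add (m _ ?_) (iSup_le fun ⟨R, hR⟩ => m _ ?_)
    _ ≤ _ := by
      rw [← ENNReal.ofReal_add pos! pos!]
      exact ENNReal.ofReal_le_ofReal (by linarith [Real.sqrt_nonneg (Ep + Em)])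
  · rw [← Real.sqrt_mul hK0, polar (F := fun x => PiL2perp (dtu u 0) x ^ 2) (f := fun r => proj (s.a 0) phi r * proj (s.a 0) phi r) PL]
    refine Real.sqrt_le_sqrt ((mul_le_l k1 hA.le).trans_eq ?_)
    field_simp
  · have hR2 : R ≤ 2 * R := lin!
    rw [← Real.sqrt_mul hK0, inv_mul_le_iff₀ pos!, ← Real.sqrt_mul pos!,
      show ann R = {x : E6 | ‖x‖ ∈ Ioo R (2 * R)} from rfl, polar_on (f := fun r => proj (s.b 0) phi1 r ^ 2) measurableSet_Ioo PH,
      inter_eq_right.2 (show Ioo R (2 * R) ⊆ Ioi 0 from fun r hr => hR.trans hr.1), ← integral_Ioc_eq_integral_Ioo, ← intervalIntegral.integral_of_le hR2]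
    refine Real.sqrt_le_sqrt ((mul_le_l (k2 R hR) hA.le).trans_eq ?_)
    field_simp

end
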